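/- For every ε > 0 there is a constant K(ε) with the following property. Let F be a normalized holomorphic Hecke eigenform of even weight k ≥ 12 for SL(2, ℤ) with normalized Hecke eigenvalues λ. Let M ≥ 1 and let m₁, m₂ be distinct squarefree nonzero integers of the same sign with M ≤ |m₁|, |m₂| ≤ 2M. Let f be a nonzero integer such that m₁, m₂, f are not all negative. Set d = gcd(m₁, m₂), m₁ = d m₃, m₂ = d m₄, and let D be the largest divisor of m₁ − m₂ all of whose prime factors divide d. Let X, Z ≥ 1 and let g : ℝ → ℂ be smooth, supported in [X, 2X], with |g^{(ν)}| ≤ K_ν (X/Z)^{−ν} for all ν ∈ ℕ₀; suppose there is a real Ξ with MX/(100Z) ≤ Ξ ≤ 100(MX + |f|) such that g(n) = 0 unless both m₁n + f and m₂n + f lie in [Ξ, 2Ξ]. Then | Σ_{n ∈ ℕ} λ(m₁n + f) λ(m₂n + f) g(n) | ≤ K(ε) (|f| X M Z k)^{ε} k^{23/2} ( k + Z(1 + |f|/(MX)) )^{8} ( (MX + |f|)^{1/2} M^{1/2} D d^{−1/2} + (MX + |f|)^{3/4} D^{1/4} gcd(f, D m₃ m₄)^{1/4} M^{−1/4} ).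 -/

import Mathlib

/-- Normalized Hecke eigenvalues: `λ(n) = a(n) n^{−(k−1)/2}` for `n ≥ 1`, `λ(m) = 0` for
`m ≤ 0`. -/
noncomputable def heckeLambda (k : ℕ) (a : ℕ → ℂ) (m : ℤ) : ℂ :=
  if 0 < m then a m.toNat * ((m.toNat : ℝ) ^ (-(((k : ℝ) - 1) / 2)) : ℝ) else 0

/-- `a : ℕ → ℂ` is the sequence of Fourier coefficients of a normalized holomorphic Hecke
eigenform of even weight `k ≥ 12` for `SL(2, ℤ)`. -/
def IsNormalizedHeckeEigenform (k : ℕ) (a : ℕ → ℂ) : Prop :=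
  Even k ∧ 12 ≤ k ∧
  (∃ F : CuspForm (CongruenceSubgroup.Gamma 1) k, F ≠ 0 ∧
    ∀ z : UpperHalfPlane, F z = ∑' n : ℕ,
      a (n + 1) * Complex.exp (2 * Real.pi * Complex.I * (n + 1) * (z : ℂ))) ∧
  a 1 = 1 ∧
  ∀ m n : ℕ, 1 ≤ m → 1 ≤ n →
    a m * a n = ∑ d ∈ (Nat.gcd m n).divisors, (d : ℂ) ^ (k - 1) * a (m * n / d ^ 2)

open Finset (prod_const sum_sub_distrib sum_boole sum_bij' card_range mem_insert_of_mem prod_insert sum_le_card_nsmul mem_image mem_product sum_bij)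
open Equiv (sum_comp mulLeft₀ mulRight coe_mulRight)
open AddChar (sum_eq_zero_of_ne_one map_add_eq_mul norm_apply mulShift map_neg_eq_conj sum_mulShift)
open Fintype (sum_prod_type' card_prod)
open Real (sqrt_pos sqrt_nonneg mul_rpow exp_nat_mul sqrt_le_left rpow_add continuous_cosh rpow_nonneg fourier_real_eq_integral_exp_smul le_sqrt_of_sq_le)
open Nat (lt_two_pow_self pow_le_pow_left mem_divisors cast_sub one_le_iff_ne_zero prime_iff_prime_int div_add_mod cast_le isCoprime_iff_coprime coprime_of_squarefree_mul coprime_iff_gcd_eq_one le_mul_of_pos_left pos_of_dvd_of_pos gcd_le_left lcm_ne_zero card_eq_fintype_card totient_pos divisor_le exists_coprime' gcd_mul_right primeFactors_mono)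
open ZMod (castHom coe_int_isUnit_iff_isCoprime)
open Set (mem_prod indicator_nonneg)
open Int (natCast_dvd_natCast natCast_dvd toNat_natCast isUnit_iff fract_nonneg fract_lt_one natAbs_dvd sign_eq_neg_one_of_neg sign_eq_one_of_pos one_le_abs gcd_pos_of_ne_zero_left squarefree_natAbs)
open ENNReal (ofReal ofReal_lt_top measurable_ofReal ofReal_le_ofReal ofReal_le_ofReal_iff ofReal_natCast toReal_ofReal)
open UpperHalfPlane (ofComplex_apply_of_im_pos ofComplex_apply_of_im_nonpos continuous_im continuous_re specialLinearGroup_apply continuous_coe)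
open Complex (measurable_im measurableEquivRealProd continuous_ofReal re_add_im exp_eq_one_iff continuous_conj conj_ofReal continuous_exp ofReal_zero)
open ModularGroup (isClosed_fd im_smul_eq_div_normSq)
open Complex (exp norm_intCast exp_add normSq_eq_norm_sq norm_real norm_exp normSq_apply norm_exp_ofReal_mul_I dist_eq ofReal_mul)
open Real (pi sqrt sq_sqrt sqrt_sq sqrt_mul log sqrt_le_sqrt mul_self_sqrt rpow_natCast rpow_mul rpow_le_rpow add_one_le_exp rpow_one rpow_neg_one rpow_neg volume_Icc norm_of_nonneg sqrt_eq_rpow pi_gt_three pi_pos norm_eq_abs fourierInv_eq_fourier_neg pi_lt_d2)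
open Finset (sum_eq_single mul_sum card_univ sum_eq_zero sum_congr mem_filter mem_univ card_le_card univ sum_const sum_add_distrib sum_comm sum_le_sum sum_mul sum_mul_sum sum_filter range mem_range Icc single_le_sum sum_image sum_le_sum_of_subset_of_nonneg mem_Icc sum_nonneg)
open Nat (exists_eq_add_of_le cast_nonneg prod_primeFactors_of_squarefree prime_of_mem_primeFactors dvd_of_mem_primeFactors gcd_pos_of_pos_left pos_of_mem_divisors gcd_mul_left_dvd_mul_gcd le_of_dvd dvd_of_mem_divisors cast_mul cast_natAbs squarefree_mul_iff abs_cast)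
open ZMod (stdAddChar stdAddChar_coe chineseRemainder intCast_surjective cast_intCast intCast_zmod_eq_zero_iff_dvd isPrimitive_stdAddChar inv_coe_unit natCast_zmod_val)
open Set (Ioi indicator_of_mem indicator_of_notMem Ico Ico_subset_Icc_self)
open UpperHalfPlane (ofComplex coe_re coe_im denom_ne_zero modular_T_zpow_smul coe_vadd cosh_dist vadd_re)
open CongruenceSubgroup (Gamma0 Gamma0_mem)
open Matrix (det_fin_two)
open Int (fract cast_natCast isCoprime_iff_gcd_eq_one natAbs_natCast mul_ediv_cancel_left eq_ofNat_of_zero_le natAbs_mul gcd_def natCast_natAbs cast_abs)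
open ArithmeticFunction (moebius)
open MeasureTheory
local notation "SL2Z" => Matrix.SpecialLinearGroup (Fin 2) ℤ
local notation "ℍℍ" => UpperHalfPlane
local notation "bpos" => (by positivity)
local notation "blin" => (by linarith)
local notation "bnum" => (by norm_num)
local notation "bomg" => (by omega)
local notation:max "PN" c:max ν:max m:max => (c * ν * (m + 1) : ℕ)
local notation "τI" => 2 * pi * Complex.I

open Polynomial in
theorem stp_coeff_digit {F : Type*} [Field F] (T : F[X][X]) (Q : ℕ)
    (hT : ∀ i, (T.coeff i).degree < Q) (n j : ℕ) (hj : j < Q) :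
    (T.eval (X ^ Q)).coeff (n * Q + j) = (T.coeff n).coeff j := by
  rw [eval_eq_sum_range' (n := max (T.natDegree + 1) (n + 1)) (by simp), finsetSum_coeff]
  rw [sum_eq_single n]
  · rw [← pow_mul, coeff_mul_X_pow', if_pos (by rw [mul_comm]; omega)]
    congr 1; rw [mul_comm]; omega
  · intro i _ hi
    rw [← pow_mul, coeff_mul_X_pow']
    split_ifs with h
    · apply coeff_eq_zero_of_degree_lt
      refine (hT i).trans_le ?_
      have : i < n := by
        rcases lt_or_gt_of_ne hi with h1 | h1
        · exact h1
        · nlinarith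
      have : Q ≤ n * Q + j - Q * i := by
        apply Nat.le_sub_of_add_le; nlinarith
      exact_mod_cast this
    · rfl
  · intro h; exact absurd (mem_range.2 bomg) h
open Polynomial in
theorem stp_inj {F : Type*} [Field F] (T : F[X][X]) (Q : ℕ)
    (hT : ∀ i, (T.coeff i).degree < Q) (h0 : T.eval (X ^ Q) = 0) : T = 0 := by
  ext n j
  by_cases hj : j < Q
  · rw [← stp_coeff_digit T Q hT n j hj, h0]; simp
  · rw [coeff_eq_zero_of_degree_lt ((hT n).trans_le (by exact_mod_cast not_lt.1 hj))]; simp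
open Polynomial in
theorem stp_not_sq {F : Type*} [Field F] (f s r : F[X]) (c : F) (hc : c ≠ 0) (hf : Squarefree f)
    (hd : 0 < f.natDegree) (hr : r ≠ 0) (h : s ^ 2 = f * C c * r ^ 2) : False := by
  have hf0 : f ≠ 0 := by rintro rfl; simp at hd
  obtain ⟨π, hπ, hdv⟩ := exists_irreducible_of_natDegree_pos hd
  have hp : Prime π := hπ.prime
  have hs : s ≠ 0 := by
    rintro rfl
    have : f * C c * r ^ 2 ≠ 0 := by simp [hf0, hc, hr]
    exact this (by rw [← h]; simp)
  have h1 : emultiplicity π f = 1 := by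
    refine le_antisymm ?_ ?_
    · rcases (squarefree_iff_emultiplicity_le_one f).1 hf π with h | h
      · exact h
      · exact absurd h hπ.not_isUnit
    · have h := le_emultiplicity_of_pow_dvd (a := π) (b := f) (k := 1) (by rw [pow_one]; exact hdv)
      simpa only [Nat.cast_one] using h
  have h2 : emultiplicity π (C c : F[X]) = 0 := by
    rw [emultiplicity_eq_zero]
    intro h; exact hπ.not_isUnit (isUnit_of_dvd_unit h (isUnit_C.2 hc.isUnit))
  have h3 := congrArg (emultiplicity π) h
  rw [emultiplicity_pow hp, emultiplicity_mul hp, emultiplicity_mul hp, emultiplicity_pow hp, h1, h2] at h3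
  have fs : FiniteMultiplicity π s := FiniteMultiplicity.of_not_isUnit hπ.not_isUnit hs
  have fr : FiniteMultiplicity π r := FiniteMultiplicity.of_not_isUnit hπ.not_isUnit hr
  rw [fs.emultiplicity_eq_multiplicity, fr.emultiplicity_eq_multiplicity] at h3
  have : 2 * multiplicity π s = 1 + 0 + 2 * multiplicity π r := by exact_mod_cast h3
  omega
open Polynomial in
noncomputable def stpδ {F : Type*} [Field F] (Q b : ℕ) (g : F[X]) (s r : Fin b → F[X]) : F[X] :=
  ∑ i, (s i) ^ Q * X ^ (i : ℕ) + g * ∑ i, (r i) ^ Q * X ^ (i : ℕ)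
open Polynomial in
theorem stp_exists {F : Type*} [Field F] [Finite F] (p e : ℕ) [Fact p.Prime] [CharP F p] (b A A' N : ℕ)
    (g : F[X]) (hg : g.natDegree + A' * p ^ e + b ≤ N) (hA : A * p ^ e + b ≤ N)
    (hN : N < (A + A' + 2) * b) :
    ∃ s r : Fin b → F[X], (∀ i, (s i).natDegree ≤ A) ∧ (∀ i, (r i).natDegree ≤ A') ∧
      ¬ (s = 0 ∧ r = 0) ∧ stpδ (p ^ e) b g s r = 0 := by
  classical
  have : Fintype F := Fintype.ofFinite F
  let T := (Fin b → degreeLT F (A + 1)) × (Fin b → degreeLT F (A' + 1))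
  have hfin : ∀ n, Finite (degreeLT F n) := fun n => Finite.of_equiv _ (degreeLTEquiv F n).toEquiv.symm
  have hcard : ∀ n, Nat.card (degreeLT F n) = Nat.card F ^ n := fun n => by
    rw [Nat.card_congr (degreeLTEquiv F n).toEquiv]; simp
  have hdl : ∀ {n} (x : degreeLT F (n+1)), (x : F[X]).natDegree ≤ n := fun {n} x => by
    have := mem_degreeLT.1 x.2
    rw [natDegree_le_iff_coeff_eq_zero]
    intro m hm
    exact (degree_lt_iff_coeff_zero _ _).1 this m bomg
  have hmem : ∀ t : T, stpδ (p ^ e) b g (fun i => t.1 i) (fun i => t.2 i) ∈ degreeLT F N := by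
    intro t
    have hterm : ∀ (n : ℕ) (x : degreeLT F (n+1)) (i : Fin b), n * p ^ e + b ≤ n * p ^ e + b →
       ((x : F[X]) ^ (p ^ e) * X ^ (i : ℕ)).natDegree ≤ n * p ^ e + (b - 1) := by
      intro n x i _
      refine natDegree_mul_le.trans ?_
      have h1 : ((x : F[X]) ^ (p ^ e)).natDegree ≤ p ^ e * n :=
        natDegree_pow_le.trans (Nat.mul_le_mul_left _ (hdl x))
      have h2 : (X ^ (i : ℕ) : F[X]).natDegree ≤ b - 1 := by
        rw [natDegree_X_pow]; have := i.2; omega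
      rw [mul_comm n]; omega
    rcases Nat.eq_zero_or_pos b with rfl | hb
    · simp [stpδ]
    rw [mem_degreeLT]
    unfold stpδ
    refine lt_of_le_of_lt (degree_add_le _ _) (max_lt ?_ ?_)
    · refine lt_of_le_of_lt (degree_sum_le _ _) ?_
      rw [Finset.sup_lt_iff (WithBot.bot_lt_coe _)]
      intro i _
      refine lt_of_le_of_lt (degree_le_of_natDegree_le (hterm A (t.1 i) i le_rfl)) ?_
      exact_mod_cast bomg
    · rw [mul_sum]
      refine lt_of_le_of_lt (degree_sum_le _ _) ?_
      rw [Finset.sup_lt_iff (WithBot.bot_lt_coe _)]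
      intro i _
      refine lt_of_le_of_lt (degree_le_of_natDegree_le
        (natDegree_mul_le.trans (Nat.add_le_add_left (hterm A' (t.2 i) i le_rfl) _))) ?_
      exact_mod_cast bomg
  let φ : T → degreeLT F N := fun t => ⟨_, hmem t⟩
  have hlt : Nat.card (degreeLT F N) < Nat.card T := by
    have : Nat.card T = Nat.card F ^ ((A + A' + 2) * b) := by
      simp only [T, Nat.card_prod, Nat.card_pi, hcard, prod_const, card_univ, Fintype.card_fin]
      rw [← pow_mul, ← pow_mul, ← pow_add]; congr 1; ring
    rw [this, hcard]
    exact Nat.pow_lt_pow_right Finite.one_lt_card hN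
  obtain ⟨t, t', hne, heq⟩ : ∃ t t', t ≠ t' ∧ φ t = φ t' := by
    by_contra hcon
    push Not at hcon
    have hinj : Function.Injective φ := fun x y h => by
      by_contra hxy; exact hcon x y hxy h
    exact absurd (Nat.card_le_card_of_injective φ hinj) (not_le.2 hlt)
  refine ⟨fun i => t.1 i - t'.1 i, fun i => t.2 i - t'.2 i, ?_, ?_, ?_, ?_⟩
  · intro i; exact (natDegree_sub_le _ _).trans (max_le (hdl _) (hdl _))
  · intro i; exact (natDegree_sub_le _ _).trans (max_le (hdl _) (hdl _))
  · rintro ⟨h1, h2⟩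
    apply hne
    refine Prod.ext ?_ ?_
    · funext i; exact Subtype.ext (sub_eq_zero.1 (congrFun h1 i))
    · funext i; exact Subtype.ext (sub_eq_zero.1 (congrFun h2 i))
  · have h := congrArg (fun x : degreeLT F N => (x : F[X])) heq
    simp only [φ] at h
    rw [← sub_eq_zero] at h
    rw [← h]
    unfold stpδ
    simp only [sub_pow_char_pow, sub_mul, sum_sub_distrib]
    ring
open Polynomial in
def stpcd {F : Type*} [Field F] (d : ℕ) (T : F[X][X]) : Prop := ∀ i, (T.coeff i).natDegree ≤ d
open Polynomial in
theorem stpcd_mul {F : Type*} [Field F] {a b : ℕ} {T U : F[X][X]} (hT : stpcd a T) (hU : stpcd b U) :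
    stpcd (a + b) (T * U) := by
  intro i
  rw [coeff_mul]
  refine natDegree_sum_le_of_forall_le _ _ (fun x _ => ?_)
  exact natDegree_mul_le.trans (Nat.add_le_add (hT _) (hU _))
open Polynomial in
theorem stp_main {F : Type*} [Field F] [Fintype F] (p e : ℕ) [Fact p.Prime] [CharP F p]
    (hodd : p ≠ 2) (Q : ℕ) (hQ : Q = p ^ e) (hF : Fintype.card F = Q ^ 2) (hQp : p * (p + 2) < Q)
    (f : F[X]) (hd : f.natDegree = 2 * p) (hsf : Squarefree f) [DecidablePred fun u : F => IsSquare (f.eval u)] :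
    2 * (univ.filter (fun u : F => IsSquare (f.eval u))).card ≤ Q ^ 2 + 3 * p * Q := by
  classical
  have hp : p.Prime := Fact.out
  have hpo : Odd p := hp.odd_of_ne_two hodd
  have hQo : Odd Q := hQ ▸ hpo.pow
  obtain ⟨A, hA⟩ := hQo
  obtain ⟨p', hp'⟩ := hpo
  set b := (Q + p) / 2 with hb
  have hb2 : 2 * b = Q + p := by omega
  have hpQ : p < Q := by nlinarith
  have hAp : p ≤ A := by nlinarith [hp.two_le]
  have hQ1 : (Q + 1) / 2 = A + 1 := by omega
  obtain ⟨s, r, hs, hr, hne, hδ⟩ := stp_exists (F := F) p e b A (A - p) (A * Q + p + b)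
    (f ^ (A + 1)) (by
      rw [← hQ]
      have h1 : (f ^ (A + 1)).natDegree ≤ (A + 1) * (2 * p) := hd ▸ natDegree_pow_le
      obtain ⟨a, rfl⟩ := exists_eq_add_of_le hAp
      have : p + a - p = a := by omega
      rw [this]
      subst hA
      nlinarith) (by rw [← hQ]; omega) (by
      obtain ⟨a, rfl⟩ := exists_eq_add_of_le hAp
      have : p + a - p = a := by omega
      rw [this]
      nlinarith)
  have hp0 : 0 < p := hp.pos
  have hQ0 : 0 < Q := by omega
  set St : F[X][X] := ∑ i : Fin b, monomial (i : ℕ) (s i) with hSt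
  set Rt : F[X][X] := ∑ i : Fin b, monomial (i : ℕ) (r i) with hRt
  have coefmon : ∀ (t : Fin b → F[X]) (n : ℕ), (∑ i : Fin b, monomial (i : ℕ) (t i) : F[X][X]).coeff n =
      if h : n < b then t ⟨n, h⟩ else 0 := by
    intro t n
    rw [finsetSum_coeff]
    split_ifs with h
    · rw [sum_eq_single ⟨n, h⟩]
      · simp
      · intro i _ hi
        rw [coeff_monomial, if_neg]
        intro h'; exact hi (Fin.ext h')
      · simp
    · apply sum_eq_zero
      intro i _
      rw [coeff_monomial, if_neg]; have := i.2; omega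
  have hSd : stpcd A St := by
    intro n; rw [hSt, coefmon]; split_ifs
    · exact hs _
    · simp
  have hRd : stpcd (A - p) Rt := by
    intro n; rw [hRt, coefmon]; split_ifs
    · exact hr _
    · simp
  set P : F[X] := St.eval (X ^ Q) + f ^ (A + 1) * Rt.eval (X ^ Q) with hP
  have hevmon : ∀ (t : Fin b → F[X]), (∑ i : Fin b, monomial (i : ℕ) (t i) : F[X][X]).eval (X ^ Q) =
     ∑ i, t i * X ^ (Q * (i : ℕ)) := by
    intro t
    rw [eval_finsetSum]
    refine sum_congr rfl fun i _ => ?_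
    rw [eval_monomial, ← pow_mul]
  have hPne : P ≠ 0 := by
    intro hP0
    set fσ : F[X] := f.map (iterateFrobenius F p e) with hfσ
    have hfQ : (fσ.map C).eval (X ^ Q) = f ^ Q := by
      rw [hQ, ← map_iterateFrobenius_expand f e (p := p), Polynomial.map_expand, ← hfσ,
        expand_eq_comp_X_pow, comp, eval_map]
    have hT : St * St - C f * fσ.map C * (Rt * Rt) = 0 := by
      apply stp_inj _ Q
      · intro i
        rw [degree_lt_iff_coeff_zero]
        intro m hm
        apply coeff_eq_zero_of_natDegree_lt
        have h1 := stpcd_mul hSd hSd i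
        have h2 : stpcd (2 * p + 0 + ((A - p) + (A - p))) (C f * fσ.map C * (Rt * Rt)) := by
          refine stpcd_mul (stpcd_mul ?_ ?_) (stpcd_mul hRd hRd)
          · intro n; rw [coeff_C]; split_ifs
            · exact hd.le
            · simp
          · intro n; rw [coeff_map]; simp
        rw [coeff_sub]
        have := natDegree_sub_le_of_le h1 (h2 i)
        refine lt_of_le_of_lt this ?_
        rw [max_lt_iff]; omega
      · simp only [eval_sub, eval_mul, eval_C, hfQ]
        have h1 : St.eval (X ^ Q) = - (f ^ (A + 1) * Rt.eval (X ^ Q)) := eq_neg_of_add_eq_zero_left hP0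
        rw [h1, hA]; ring
    have hlc := congrArg leadingCoeff (sub_eq_zero.1 hT)
    rw [leadingCoeff_mul, leadingCoeff_mul, leadingCoeff_mul, leadingCoeff_mul, leadingCoeff_C,
      leadingCoeff_map_of_injective (C_injective), hfσ,
      leadingCoeff_map_of_injective (RingHom.injective _)] at hlc
    by_cases hR0 : Rt = 0
    · have hS0 : St = 0 := by
        have := sub_eq_zero.1 hT
        rw [hR0] at this
        simpa using this
      apply hne
      constructor
      · funext i
        have := coefmon s i
        rw [← hSt, hS0, dif_pos i.2] at this
        simpa using this.symm
      · funext i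
        have := coefmon r i
        rw [← hRt, hR0, dif_pos i.2] at this
        simpa using this.symm
    · refine stp_not_sq f St.leadingCoeff Rt.leadingCoeff _ ?_ hsf bomg
        (leadingCoeff_ne_zero.2 hR0) (by rw [pow_two, pow_two]; exact hlc)
      rw [Ne, map_eq_zero, leadingCoeff_eq_zero]
      rintro rfl; simp at hd; omega
  have hroot : ∀ u : F, IsSquare (f.eval u) → P.eval u = 0 := by
    rintro u ⟨g, hg⟩
    have huq : u ^ (Q * Q) = u := by
      rw [← pow_two, ← hF]; exact FiniteField.pow_card u
    have hgq : g ^ (Q * Q) = g := by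
      rw [← pow_two, ← hF]; exact FiniteField.pow_card g
    have h1 : P.eval u = ∑ i, (s i).eval u * u ^ (Q * (i : ℕ)) + f.eval u ^ (A + 1) *
        ∑ i, (r i).eval u * u ^ (Q * (i : ℕ)) := by
      rw [hP, hSt, hRt, hevmon, hevmon]
      simp [eval_finsetSum]
    have h2 : (stpδ Q b (f ^ (A + 1)) s r).eval u = ∑ i, (s i).eval u ^ Q * u ^ (i : ℕ) + f.eval u ^ (A + 1) *
        ∑ i, (r i).eval u ^ Q * u ^ (i : ℕ) := by
      unfold stpδ
      simp [eval_finsetSum]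
    have h3 : ∀ t : Fin b → F, (∑ i, t i * u ^ (Q * (i : ℕ))) ^ Q = ∑ i, t i ^ Q * u ^ (i : ℕ) := by
      intro t
      rw [hQ, sum_pow_char_pow, ← hQ]
      refine sum_congr rfl fun i _ => ?_
      rw [mul_pow, ← pow_mul, show Q * (i : ℕ) * Q = (Q * Q) * i by ring, pow_mul, huq]
    have h4 : (f.eval u ^ (A + 1)) ^ Q = f.eval u ^ (A + 1) := by
      have : f.eval u ^ (A + 1) = g ^ (Q + 1) := by
        rw [hg, ← pow_two, ← pow_mul, show 2 * (A + 1) = Q + 1 by omega]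
      rw [this, ← pow_mul, show (Q + 1) * Q = Q * Q + Q by ring, pow_add, hgq]; ring
    have h5 : (P.eval u) ^ Q = (stpδ Q b (f ^ (A + 1)) s r).eval u := by
      rw [h1, h2, hQ, add_pow_char_pow, mul_pow, ← hQ, h3, h3, h4]
    rw [hQ, hδ, ← hQ, eval_zero] at h5
    exact (pow_eq_zero_iff hQ0.ne').1 h5
  have hdeg : 2 * P.natDegree ≤ Q ^ 2 + 3 * p * Q := by
    have hd1 : ∀ (t : Fin b → F[X]) (n : ℕ), (∀ i, (t i).natDegree ≤ n) →
        (∑ i, t i * X ^ (Q * (i : ℕ))).natDegree ≤ n + Q * (b - 1) := by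
      intro t n ht
      refine natDegree_sum_le_of_forall_le _ _ (fun i _ => ?_)
      refine natDegree_mul_le.trans (Nat.add_le_add (ht i) ?_)
      rw [natDegree_X_pow]; exact Nat.mul_le_mul_left _ (by have := i.2; omega)
    have h1 : P.natDegree ≤ (A + 1) * (2 * p) + (A - p) + Q * (b - 1) := by
      rw [hP, hSt, hRt, hevmon, hevmon]
      refine natDegree_add_le_of_degree_le ((hd1 s A hs).trans ?_) ?_
      · have : A ≤ (A + 1) * (2 * p) := by nlinarith
        omega
      · refine natDegree_mul_le.trans ?_
        rw [add_assoc]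
        exact Nat.add_le_add (hd ▸ natDegree_pow_le) (hd1 r _ hr)
    obtain ⟨a, rfl⟩ := exists_eq_add_of_le hAp
    have h2 : p + a - p = a := by omega
    rw [h2] at h1
    obtain ⟨b', hb'⟩ : ∃ b', b = b' + 1 := ⟨b - 1, by omega⟩
    have h3 : b - 1 = b' := by omega
    rw [h3] at h1
    have h4 : 2 * b' + 2 = Q + p := by omega
    have h5 : 2 * (Q * b') + 2 * Q = Q ^ 2 + p * Q := by nlinarith
    have h6 : 2 * ((p + a + 1) * (2 * p)) = 2 * p * Q + 2 * p := by rw [hA]; ring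
    nlinarith
  refine le_trans (Nat.mul_le_mul_left 2 ?_) hdeg
  have hsub : univ.filter (fun u : F => IsSquare (f.eval u)) ⊆ P.roots.toFinset := by
    intro u hu
    simp only [mem_filter, mem_univ, true_and] at hu
    simp [hPne, hroot u hu]
  exact (card_le_card hsub).trans ((Multiset.toFinset_card_le _).trans (card_roots' _))
theorem wl_sum_sq {F : Type*} [Field F] [Fintype F] [DecidableEq F] (hF : ringChar F ≠ 2) (G : F → ℂ) :
    ∑ b : F, G (b ^ 2) = ∑ w : F, (1 + (quadraticChar F w : ℂ)) * G w := by
  rw [← Finset.sum_fiberwise_of_maps_to (s := univ) (t := univ) (g := fun b : F => b ^ 2)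
    (fun _ _ => mem_univ _)]
  refine sum_congr rfl fun w _ => ?_
  rw [sum_congr rfl (g := fun _ => G w) (fun x hx => by rw [(mem_filter.1 hx).2])]
  rw [sum_const, nsmul_eq_mul]
  congr 1
  have := quadraticChar_card_sqrts hF w
  rw [Set.toFinset_ofPred] at this
  have h2 := congrArg (fun z : ℤ => (z : ℂ)) this
  push_cast at h2
  rw [h2]; ring
theorem wl_sum_sq2 {F : Type*} [Field F] [Fintype F] [DecidableEq F] (hF : ringChar F ≠ 2) (G : F → ℂ)
    (ν : F) (hν : quadraticChar F ν = -1) :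
    ∑ b : F, G (b ^ 2) + ∑ b : F, G (ν * b ^ 2) = 2 * ∑ w, G w := by
  have hν0 : ν ≠ 0 := by rintro rfl; simp at hν
  rw [wl_sum_sq hF G, wl_sum_sq hF (fun w => G (ν * w))]
  have : ∑ w : F, (1 + (quadraticChar F w : ℂ)) * G (ν * w) =
      ∑ w : F, (1 - (quadraticChar F w : ℂ)) * G w := by
    rw [← sum_comp (mulLeft₀ ν hν0) (fun w : F => (1 - (quadraticChar F w : ℂ)) * G w)]
    refine sum_congr rfl fun w _ => ?_
    simp only [mulLeft₀, Units.mulLeft_apply, Units.val_mk0, map_mul, hν]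
    push_cast; ring
  rw [this, ← sum_add_distrib, mul_sum]
  exact sum_congr rfl fun w _ => by ring
noncomputable def wlS {F : Type*} [Field F] [Fintype F] (Ψ : AddChar F ℂ) : ℂ :=
  by classical exact ∑ x : F, if x = 0 then 0 else Ψ (x + x⁻¹)
theorem wl_S_eq {F : Type*} [Field F] [Fintype F] [DecidableEq F] (hF : ringChar F ≠ 2) (Ψ : AddChar F ℂ) :
    wlS Ψ = ∑ v : F, (1 + (quadraticChar F (v ^ 2 - 4) : ℂ)) * Ψ v := by
  unfold wlS
  have h2 : (2 : F) ≠ 0 := Ring.two_ne_zero hF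
  have hsplit : ∀ x : F, (if x = 0 then 0 else Ψ (x + x⁻¹)) =
      ∑ v : F, if x ^ 2 - v * x + 1 = 0 then Ψ v else 0 := by
    intro x
    split_ifs with hx
    · subst hx; simp
    · rw [sum_eq_single (x + x⁻¹)]
      · rw [if_pos]; field_simp; ring
      · intro v _ hv
        rw [if_neg]
        intro h; apply hv
        field_simp
        linear_combination -h
      · simp
  have hconv : (∑ x : F, if x = 0 then 0 else Ψ (x + x⁻¹)) =
      ∑ v : F, (1 + (quadraticChar F (v ^ 2 - 4) : ℂ)) * Ψ v := by
    rw [sum_congr rfl fun x _ => hsplit x, sum_comm]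
    refine sum_congr rfl fun v _ => ?_
    have e : ∑ x : F, (if x ^ 2 - v * x + 1 = 0 then Ψ v else 0) =
        ∑ y : F, (if y ^ 2 = v ^ 2 - 4 then Ψ v else 0) := by
      rw [← sum_comp ((mulLeft₀ (2 : F) h2).trans (Equiv.subRight v))
        (fun y : F => if y ^ 2 = v ^ 2 - 4 then Ψ v else 0)]
      refine sum_congr rfl fun x _ => ?_
      have : (x ^ 2 - v * x + 1 = 0) ↔ ((2 * x - v) ^ 2 = v ^ 2 - 4) := by
        have h4 : (4 : F) ≠ 0 := by
          have : (4 : F) = 2 * 2 := by norm_num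
          rw [this]; exact mul_ne_zero h2 h2
        constructor
        · intro h; linear_combination 4 * h
        · intro h
          apply mul_left_cancel₀ h4
          linear_combination h
      simp [this]
    rw [e, wl_sum_sq hF (fun w => if w = v ^ 2 - 4 then Ψ v else 0)]
    simp
  convert hconv
theorem wl_charsum {F : Type*} [Field F] [Fintype F] [DecidableEq F] (p e : ℕ) [Fact p.Prime] [CharP F p]
    (hodd : p ≠ 2) (Q : ℕ) (hQ : Q = p ^ e) (hF : Fintype.card F = Q ^ 2) (hQp : p * (p + 2) < Q)
    (f : Polynomial F) (hd : f.natDegree = 2 * p) (hsf : Squarefree f) :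
    |∑ u : F, quadraticChar F (f.eval u)| ≤ 3 * p * Q := by
  have hF2 : ringChar F ≠ 2 := by rw [ringChar.eq F p]; exact hodd
  obtain ⟨ν, hν⟩ := quadraticChar_exists_neg_one hF2
  have hν0 : ν ≠ 0 := by rintro rfl; simp at hν
  have h1 := stp_main p e hodd Q hQ hF hQp f hd hsf
  have h2 := stp_main p e hodd Q hQ hF hQp (Polynomial.C ν * f)
    (by rw [Polynomial.natDegree_C_mul hν0, hd]) (by
      have hu : IsUnit (Polynomial.C ν) := Polynomial.isUnit_C.2 hν0.isUnit
      exact (associated_unit_mul_left f _ hu).squarefree_iff.2 hsf)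
  have e1 : ∀ u : F, (quadraticChar F (f.eval u)) ≤
     2 * (if IsSquare (f.eval u) then 1 else 0) - 1 := by
    intro u
    split_ifs with h
    · by_cases h0 : f.eval u = 0
      · rw [h0]; simp
      · rw [(quadraticChar_one_iff_isSquare h0).2 h]; norm_num
    · rw [quadraticChar_neg_one_iff_not_isSquare.2 h]; norm_num
  have e2 : ∀ u : F, -(quadraticChar F (f.eval u)) ≤
     2 * (if IsSquare ((Polynomial.C ν * f).eval u) then 1 else 0) - 1 := by
    intro u
    have : -(quadraticChar F (f.eval u)) = quadraticChar F ((Polynomial.C ν * f).eval u) := by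
      rw [Polynomial.eval_mul, Polynomial.eval_C, map_mul, hν]; ring
    rw [this]
    generalize (Polynomial.C ν * f).eval u = w
    split_ifs with h
    · by_cases h0 : w = 0
      · rw [h0]; simp
      · rw [(quadraticChar_one_iff_isSquare h0).2 h]; norm_num
    · rw [quadraticChar_neg_one_iff_not_isSquare.2 h]; norm_num
  have s1 := sum_le_sum (s := univ) fun u _ => e1 u
  have s2 := sum_le_sum (s := univ) fun u _ => e2 u
  rw [sum_sub_distrib, ← mul_sum, sum_boole, sum_const, card_univ, hF] at s1 s2
  rw [Finset.sum_neg_distrib] at s2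
  zify at h1 h2
  rw [abs_le]
  simp only [nsmul_eq_mul, mul_one] at s1 s2
  push_cast at s1 s2
  constructor <;> linarith
open Polynomial in
theorem wl_bound1 {F : Type*} [Field F] [Fintype F] (p e : ℕ) [Fact p.Prime] [CharP F p]
    (hodd : p ≠ 2) (Q : ℕ) (hQ : Q = p ^ e) (hF : Fintype.card F = Q ^ 2) (hQp : p * (p + 2) < Q)
    (Ψ : AddChar F ℂ) (hΨ : Ψ ≠ 1) (hinv : ∀ u, Ψ (u ^ p) = Ψ u) :
    ‖wlS Ψ‖ ≤ 3 * p * Q := by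
  classical
  have hp : p.Prime := Fact.out
  have hF2 : ringChar F ≠ 2 := by rw [ringChar.eq F p]; exact hodd
  have h2 : (2 : F) ≠ 0 := Ring.two_ne_zero hF2
  have h4 : (4 : F) ≠ 0 := by
    have : (4 : F) = 2 * 2 := by norm_num
    rw [this]; exact mul_ne_zero h2 h2
  set χ := fun v : F => (quadraticChar F (v ^ 2 - 4) : ℂ) with hχ
  have hS : wlS Ψ = ∑ v, χ v * Ψ v := by
    rw [wl_S_eq hF2]
    simp only [add_mul, one_mul, sum_add_distrib]
    rw [sum_eq_zero_of_ne_one hΨ, zero_add]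
  have hsh : ∀ u : F, wlS Ψ = ∑ v, χ (v + (u ^ p - u)) * Ψ v := by
    intro u
    rw [hS, ← sum_comp (Equiv.addRight (u ^ p - u))]
    refine sum_congr rfl fun v _ => ?_
    have : Ψ (u ^ p - u) = 1 := by
      rw [sub_eq_add_neg, map_add_eq_mul, hinv, ← map_add_eq_mul, add_neg_cancel,
        AddChar.map_zero_eq_one]
    simp only [Equiv.coe_addRight]
    rw [map_add_eq_mul Ψ v, this, mul_one]
  have hq : (Fintype.card F : ℂ) * wlS Ψ = ∑ v, (∑ u : F, χ (v + (u ^ p - u))) * Ψ v := by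
    calc (Fintype.card F : ℂ) * wlS Ψ = ∑ u : F, wlS Ψ := by simp
      _ = ∑ u : F, ∑ v, χ (v + (u ^ p - u)) * Ψ v := sum_congr rfl fun u _ => hsh u
      _ = _ := by rw [sum_comm]; exact sum_congr rfl fun v _ => by rw [sum_mul]
  have hb : ∀ v : F, ‖∑ u : F, χ (v + (u ^ p - u))‖ ≤ 3 * p * Q := by
    intro v
    set g : F[X] := X ^ p - X + C v with hg
    have hp1 : 1 < p := hp.one_lt
    have hgd : g.natDegree = p := by
      rw [hg, show (X ^ p - X + C v : F[X]) = X ^ p - (X - C v) by ring, natDegree_sub_eq_left_of_natDegree_lt] <;>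
        simp [hp1]
    set f : F[X] := g ^ 2 - C 4 with hf
    have hfd : f.natDegree = 2 * p := by
      rw [hf, natDegree_sub_C, natDegree_pow, hgd]
    have hder : derivative f = - 2 * g := by
      rw [hf, hg]
      simp [derivative_pow]
      exact Or.inl (map_ofNat C 2)
    have hsep : f.Separable := by
      refine ⟨C (-(4 : F)⁻¹), C (-(8 : F)⁻¹) * g, ?_⟩
      rw [hder, hf]
      have h8 : (8 : F) ≠ 0 := by
        have : (8 : F) = 4 * 2 := by norm_num
        rw [this]; exact mul_ne_zero h4 h2
      have c1 : C (-(4 : F)⁻¹) * (C 4 : F[X]) = -1 := by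
        rw [← C_mul]; rw [show -(4 : F)⁻¹ * 4 = -1 by field_simp]; simp
      have c2 : C (-(8 : F)⁻¹) * (2 : F[X]) = C (-(4 : F)⁻¹) := by
        rw [show (2 : F[X]) = C 2 from (map_ofNat C 2).symm, ← C_mul]; congr 1; field_simp; norm_num
      linear_combination -c1 - g ^ 2 * c2
    have hb := wl_charsum p e hodd Q hQ hF hQp f hfd hsep.squarefree
    have : (∑ u : F, χ (v + (u ^ p - u))) = ((∑ u : F, quadraticChar F (f.eval u) : ℤ) : ℂ) := by
      push_cast
      refine sum_congr rfl fun u _ => ?_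
      simp only [hχ, hf, hg]
      congr 2
      simp
      ring
    rw [this, norm_intCast]
    exact_mod_cast hb
  have hcard : 0 < (Fintype.card F : ℝ) := by exact_mod_cast Fintype.card_pos
  have hn : ‖(Fintype.card F : ℂ) * wlS Ψ‖ ≤ Fintype.card F * (3 * p * Q) := by
    rw [hq]
    refine (norm_sum_le _ _).trans ?_
    calc _ ≤ ∑ v : F, (3 * p * Q : ℝ) := sum_le_sum fun v _ => by
            rw [norm_mul, norm_apply, mul_one]; exact hb v
      _ = _ := by simp
  rw [norm_mul, Complex.norm_natCast] at hn
  exact le_of_mul_le_mul_left hn hcard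
theorem wl_double_sum {F : Type*} [Field F] [Fintype F] [DecidableEq F] (hF : ringChar F ≠ 2)
    (Ψ : AddChar F ℂ) (hΨ : Ψ ≠ 1) (ν : F) (hν : quadraticChar F ν = -1) :
    wlS Ψ ^ 2 + ∑ x : F × F, (if x = 0 then 0 else
      Ψ (2 * x.1 + 2 * x.1 * (x.1 ^ 2 - ν * x.2 ^ 2)⁻¹)) = 2 * Fintype.card F := by
  classical
  have h2 : (2 : F) ≠ 0 := Ring.two_ne_zero hF
  let G : F → F → ℂ := fun a w => if w = a ^ 2 then 0 else Ψ (2 * a + 2 * a * (a ^ 2 - w)⁻¹)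
  have hnsq : ∀ a b : F, ν * b ^ 2 = a ^ 2 → a = 0 ∧ b = 0 := by
    intro a b h
    have hν0 : ν ≠ 0 := by rintro rfl; simp at hν
    by_cases hb : b = 0
    · subst hb; simpa using h.symm
    · exfalso
      rw [quadraticChar_neg_one_iff_not_isSquare] at hν
      apply hν
      refine ⟨a / b, ?_⟩
      field_simp
      linear_combination h
  have e1 : (∑ x : F × F, (if x = 0 then 0 else
      Ψ (2 * x.1 + 2 * x.1 * (x.1 ^ 2 - ν * x.2 ^ 2)⁻¹))) = ∑ a, ∑ b, G a (ν * b ^ 2) := by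
    rw [Fintype.sum_prod_type]
    refine sum_congr rfl fun a _ => sum_congr rfl fun b _ => ?_
    simp only [G]
    refine if_congr ?_ rfl rfl
    constructor
    · intro h; rw [Prod.ext_iff] at h; simp at h; simp [h]
    · intro h; obtain ⟨rfl, rfl⟩ := hnsq a b h; rfl
  have e2 : wlS Ψ ^ 2 = ∑ a, ∑ b, G a (b ^ 2) := by
    have : wlS Ψ = ∑ x : F, (if x = 0 then 0 else Ψ (x + x⁻¹)) := by
      unfold wlS; convert rfl
    rw [this, pow_two, sum_mul_sum, ← sum_prod_type', ← sum_prod_type']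
    let φ : F × F ≃ F × F :=
      { toFun := fun x => (x.1 + x.2, x.1 - x.2)
        invFun := fun x => ((x.1 + x.2) / 2, (x.1 - x.2) / 2)
        left_inv := fun x => by ext <;> simp <;> field_simp <;> ring
        right_inv := fun x => by ext <;> simp <;> field_simp <;> ring }
    rw [← sum_comp φ]
    refine sum_congr rfl fun x _ => ?_
    obtain ⟨a, b⟩ := x
    simp only [φ, Equiv.coe_fn_mk, G]
    by_cases h1 : a + b = 0
    · rw [if_pos h1, if_pos (show b ^ 2 = a ^ 2 by linear_combination -(a - b) * h1), zero_mul]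
    by_cases h3 : a - b = 0
    · rw [if_pos h3, if_pos (show b ^ 2 = a ^ 2 by linear_combination -(a + b) * h3), mul_zero]
    have hne : a ^ 2 - b ^ 2 ≠ 0 := by
      rw [show a ^ 2 - b ^ 2 = (a + b) * (a - b) by ring]; exact mul_ne_zero h1 h3
    rw [if_neg h1, if_neg h3, if_neg (fun h => hne (by rw [h]; ring)), ← map_add_eq_mul]
    congr 1
    rw [show a ^ 2 - b ^ 2 = (a + b) * (a - b) by ring]
    field_simp
    ring
  rw [e1, e2, ← sum_add_distrib]
  have e3 : ∀ a, ∑ b, G a (b ^ 2) + ∑ b, G a (ν * b ^ 2) = 2 * ∑ n : F, if n = 0 then 0 else Ψ (a * (2 + 2 * n⁻¹)) := by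
    intro a
    rw [wl_sum_sq2 hF (G a) ν hν, ← sum_comp (Equiv.subLeft (a ^ 2))]
    congr 1
    refine sum_congr rfl fun n _ => ?_
    simp only [G, Equiv.subLeft_apply, sub_sub_cancel, sub_eq_self]
    refine if_congr Iff.rfl rfl ?_
    congr 1; ring
  rw [sum_congr rfl fun a _ => e3 a, ← mul_sum, sum_comm]
  congr 1
  rw [sum_eq_single (-1)]
  · rw [sum_congr rfl (g := fun _ => (1 : ℂ))]
    · simp
    · intro a _
      have : a * (2 + 2 * (-1 : F)⁻¹) = 0 := by rw [inv_neg, inv_one]; ring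
      rw [this]; simp
  · intro n _ hn
    by_cases h0 : n = 0
    · simp [h0]
    simp only [if_neg h0]
    have hne : (2 + 2 * n⁻¹) ≠ 0 := by
      intro h
      apply hn
      field_simp at h
      have : n + 1 = 0 := by simpa [h2] using h
      exact eq_neg_of_add_eq_zero_left this
    exact (sum_comp (Equiv.mulRight₀ _ hne) Ψ).trans (sum_eq_zero_of_ne_one hΨ)
  · simp
def wlBig (p q : ℕ) (c : ℝ) : Prop :=
  ∃ (F : Type) (_ : Field F) (_ : Fintype F) (_ : CharP F p) (Ψ : AddChar F ℂ), Ψ ≠ 1 ∧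
    (∀ u, Ψ (u ^ p) = Ψ u) ∧ Fintype.card F = q ∧ c * sqrt q ≤ ‖wlS Ψ‖
theorem wl_step (p q : ℕ) [Fact p.Prime] (hodd : p ≠ 2) (η : ℝ) (hη : 0 ≤ η) (h : wlBig p q (2 + η)) :
    wlBig p (q ^ 2) (2 + 4 * η) := by
  classical
  obtain ⟨F, _, _, _, Ψ, h1, hinv, hq, hb⟩ := h
  have hF2 : ringChar F ≠ 2 := by rw [ringChar.eq F p]; exact hodd
  have h2 : (2 : F) ≠ 0 := Ring.two_ne_zero hF2
  obtain ⟨ν, hν⟩ := quadraticChar_exists_neg_one hF2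
  have : Fact (∀ r : F, r ^ 2 ≠ ν + 0 * r) := ⟨fun r h => by
    rw [quadraticChar_neg_one_iff_not_isSquare] at hν
    exact hν ⟨r, by linear_combination -h⟩⟩
  let : Fintype (QuadraticAlgebra F ν 0) := Fintype.ofEquiv (F × F) (QuadraticAlgebra.equivProd ν 0).symm
  have : CharP (QuadraticAlgebra F ν 0) p := charP_of_injective_algebraMap (algebraMap F (QuadraticAlgebra F ν 0)).injective p
  let Ψ' : AddChar (QuadraticAlgebra F ν 0) ℂ :=
    { toFun := fun z => Ψ (2 * z.re)
      map_zero_eq_one' := by simp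
      map_add_eq_mul' := fun x y => by
        rw [← map_add_eq_mul, QuadraticAlgebra.re_add, mul_add] }
  have hΨ' : ∀ z : (QuadraticAlgebra F ν 0), Ψ' z = Ψ (2 * z.re) := fun _ => rfl
  refine ⟨(QuadraticAlgebra F ν 0), inferInstance, inferInstance, inferInstance, Ψ', ?_, ?_, ?_, ?_⟩
  · intro h
    apply h1
    ext x
    have := DFunLike.congr_fun h (⟨x / 2, 0⟩ : (QuadraticAlgebra F ν 0))
    rw [hΨ'] at this
    simp only [mul_div_cancel₀ x h2] at this
    simpa [mul_div_cancel₀ x h2] using this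
  · intro u
    have : (2 * (u ^ p).re) = (2 * u.re) ^ p := by
      apply (algebraMap F (QuadraticAlgebra F ν 0)).injective
      have t : ∀ z : (QuadraticAlgebra F ν 0), algebraMap F (QuadraticAlgebra F ν 0) (2 * z.re) = z + star z := by
        intro z
        rw [← QuadraticAlgebra.algebraMap_trace_eq_add_star, QuadraticAlgebra.trace_def]; simp
      rw [map_pow, t, t, add_pow_char, star_pow]
    rw [hΨ', hΨ', this, hinv]
  · rw [Fintype.card_congr (QuadraticAlgebra.equivProd ν 0), card_prod, hq, pow_two]
  · have hd := wl_double_sum hF2 Ψ h1 ν hν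
    have hS : wlS Ψ' = ∑ x : F × F, (if x = 0 then 0 else
      Ψ (2 * x.1 + 2 * x.1 * (x.1 ^ 2 - ν * x.2 ^ 2)⁻¹)) := by
      have : wlS Ψ' = ∑ x : (QuadraticAlgebra F ν 0), (if x = 0 then 0 else Ψ' (x + x⁻¹)) := by
        unfold wlS; convert rfl
      rw [this, ← sum_comp (QuadraticAlgebra.equivProd ν 0).symm]
      refine sum_congr rfl fun x _ => ?_
      refine if_congr ?_ rfl ?_
      · constructor
        · intro h; simpa [QuadraticAlgebra.ext_iff, Prod.ext_iff] using h
        · intro h; subst h; rfl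
      · rw [hΨ']
        congr 1
        simp [QuadraticAlgebra.inv_def, QuadraticAlgebra.norm_def]
        ring
    rw [← hS, hq] at hd
    have hS' : wlS Ψ' = 2 * q - wlS Ψ ^ 2 := by linear_combination hd
    have hn : ‖wlS Ψ‖ ^ 2 - 2 * q ≤ ‖wlS Ψ'‖ := by
      rw [hS', norm_sub_rev]
      have := norm_sub_norm_le (wlS Ψ ^ 2) (2 * q : ℂ)
      simpa [norm_pow] using this
    refine le_trans ?_ hn
    have hsq : (sqrt q) ^ 2 = q := sq_sqrt (cast_nonneg q)
    have : ((2 + η) * sqrt q) ^ 2 ≤ ‖wlS Ψ‖ ^ 2 := pow_le_pow_left₀ bpos hb 2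
    rw [mul_pow, hsq] at this
    have e : sqrt ((q ^ 2 : ℕ) : ℝ) = q := by push_cast; exact sqrt_sq (cast_nonneg q)
    rw [e]
    have hq0 : (0 : ℝ) ≤ q := cast_nonneg q
    nlinarith [mul_nonneg (mul_self_nonneg η) hq0]
theorem wl_prime (p : ℕ) [Fact p.Prime] (hodd : p ≠ 2) (Ψ : AddChar (ZMod p) ℂ) (hΨ : Ψ ≠ 1) :
    ‖wlS Ψ‖ ≤ 2 * sqrt p := by
  have hp : p.Prime := Fact.out
  by_contra hcon
  push Not at hcon
  have hsp : 0 < sqrt p := sqrt_pos.2 (by exact_mod_cast hp.pos)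
  set η := ‖wlS Ψ‖ / sqrt p - 2 with hη
  have hη0 : 0 < η := by rw [hη, sub_pos, lt_div_iff₀ hsp]; exact hcon
  have h0 : wlBig p p (2 + η) := by
    refine ⟨ZMod p, inferInstance, inferInstance, inferInstance, Ψ, hΨ, fun u => by rw [ZMod.pow_card],
      ZMod.card p, ?_⟩
    rw [hη, add_sub_cancel, div_mul_cancel₀ _ hsp.ne']
  have hr : ∀ r : ℕ, wlBig p (p ^ (2 ^ r)) (2 + 4 ^ r * η) := by
    intro r
    induction r with
    | zero => simpa using h0
    | succ r ih =>
      have := wl_step p _ hodd _ bpos ih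
      rw [← pow_mul, ← pow_succ, ← mul_assoc, ← pow_succ'] at this
      exact this
  obtain ⟨n, hn⟩ := exists_nat_gt (3 * p / η)
  set r := n + p * (p + 2) + 1 with hrdef
  obtain ⟨F, _, _, _, Φ, hΦ, hinv, hcard, hbig⟩ := hr r
  have h2r : ∀ m : ℕ, m < 2 ^ m := fun m => lt_two_pow_self
  set Q := p ^ (2 ^ (n + p * (p + 2))) with hQ
  have hQ2 : p ^ (2 ^ r) = Q ^ 2 := by rw [hQ, ← pow_mul, hrdef, pow_succ]
  have hQp : p * (p + 2) < Q := by
    calc p * (p + 2) ≤ n + p * (p + 2) := by omega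
      _ < 2 ^ (n + p * (p + 2)) := h2r _
      _ < 2 ^ (2 ^ (n + p * (p + 2))) := h2r _
      _ ≤ Q := pow_le_pow_left hp.two_le _
  have hbd := wl_bound1 p _ hodd Q hQ (hcard.trans hQ2) hQp Φ hΦ hinv
  rw [hQ2] at hbig
  have e : sqrt ((Q ^ 2 : ℕ) : ℝ) = Q := by push_cast; exact sqrt_sq (cast_nonneg Q)
  rw [e] at hbig
  have hQ0 : (0 : ℝ) < Q := by
    have : 0 < Q := by omega
    exact_mod_cast this
  have h3 : 2 + 4 ^ r * η ≤ 3 * p := le_of_mul_le_mul_right (hbig.trans hbd) hQ0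
  have h4 : (n : ℝ) ≤ 4 ^ r := by
    have : n ≤ 4 ^ r := by
      calc n ≤ r := by omega
        _ ≤ 2 ^ r := (h2r r).le
        _ ≤ 4 ^ r := pow_le_pow_left bnum _
    exact_mod_cast this
  have h5 : 3 * p < n * η := by rwa [div_lt_iff₀ hη0] at hn
  nlinarith
noncomputable def klT (c d : ℕ) [NeZero c] (u : ℤ) : ℂ :=
  ∑ a : (ZMod c)ˣ, if ((a : ZMod c).cast : ZMod d) ^ 2 = 1 then
    stdAddChar ((u : ZMod c) * ((a : ZMod c) + ((a⁻¹ : (ZMod c)ˣ) : ZMod c))) else 0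
theorem kl_char_split (m n : ℕ) [NeZero m] [NeZero n] (w1 w2 : ℤ) (hw : w1 * n + w2 * m = 1) (t : ℤ) :
    (stdAddChar (N := m * n) (t : ZMod (m * n))) =
      stdAddChar (N := m) ((w1 * t : ℤ) : ZMod m) * stdAddChar (N := n) ((w2 * t : ℤ) : ZMod n) := by
  rw [stdAddChar_coe, stdAddChar_coe, stdAddChar_coe, ← exp_add]
  congr 1
  have hm : (m : ℂ) ≠ 0 := by exact_mod_cast NeZero.ne m
  have hn : (n : ℂ) ≠ 0 := by exact_mod_cast NeZero.ne n
  have hw' : (w1 : ℂ) * n + w2 * m = 1 := by exact_mod_cast hw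
  push_cast
  field_simp
  linear_combination -(t:ℂ) * hw'
theorem kl_mul (p n d : ℕ) [NeZero p] [NeZero n] (hd : d ∣ n) (hc : p.Coprime n)
    (w1 w2 : ℤ) (hw : w1 * n + w2 * p = 1) (u : ℤ) :
    klT (p * n) d u = klT p 1 (w1 * u) * klT n d (w2 * u) := by
  unfold klT
  rw [sum_mul_sum, ← sum_prod_type']
  let φ : (ZMod (p * n))ˣ ≃ (ZMod p)ˣ × (ZMod n)ˣ :=
    ((Units.mapEquiv (chineseRemainder hc).toMulEquiv).trans MulEquiv.prodUnits).toEquiv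
  rw [← sum_comp φ]
  refine sum_congr rfl fun a _ => ?_
  have h1 : ∀ a : (ZMod (p * n))ˣ, ((φ a).1 : ZMod p) = castHom (dvd_mul_right p n) (ZMod p) (a : ZMod (p * n)) := by
    intro a
    change ((chineseRemainder hc) (a : ZMod (p * n))).1 = _
    obtain ⟨t, ht⟩ := intCast_surjective (a : ZMod (p * n))
    rw [← ht]; simp
  have h2 : ∀ a : (ZMod (p * n))ˣ, ((φ a).2 : ZMod n) = castHom (dvd_mul_left n p) (ZMod n) (a : ZMod (p * n)) := by
    intro a
    change ((chineseRemainder hc) (a : ZMod (p * n))).2 = _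
    obtain ⟨t, ht⟩ := intCast_surjective (a : ZMod (p * n))
    rw [← ht]; simp
  have i1 : (φ a).1⁻¹ = (φ a⁻¹).1 := rfl
  have i2 : (φ a).2⁻¹ = (φ a⁻¹).2 := rfl
  rw [i1, i2, h1, h1, h2, h2]
  have hs : ∀ x y : ZMod 1, x = y := fun x y => Subsingleton.elim _ _
  rw [if_pos (hs _ _)]
  obtain ⟨t, ht⟩ := intCast_surjective (a : ZMod (p * n))
  obtain ⟨t', ht'⟩ := intCast_surjective ((a⁻¹ : (ZMod (p * n))ˣ) : ZMod (p * n))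
  rw [← ht, ← ht', map_intCast, map_intCast, map_intCast, map_intCast]
  rw [cast_intCast (hd.trans (dvd_mul_left n p)), cast_intCast hd, mul_ite, mul_zero]
  refine if_congr Iff.rfl ?_ rfl
  have := kl_char_split p n w1 w2 hw (u * (t + t'))
  push_cast at this ⊢
  rw [this]
  congr 2 <;> ring
theorem kl_prime (p : ℕ) [Fact p.Prime] (hodd : p ≠ 2) (u : ℤ) (hu : ¬ (p : ℤ) ∣ u) :
    ‖klT p 1 u‖ ≤ 2 * sqrt p := by
  have hu0 : (u : ZMod p) ≠ 0 := by rwa [Ne, intCast_zmod_eq_zero_iff_dvd]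
  have hne : mulShift (stdAddChar (N := p)) (u : ZMod p) ≠ 1 :=
    isPrimitive_stdAddChar p hu0
  have := wl_prime p hodd _ hne
  convert this using 2
  unfold klT wlS
  classical
  have hs : ∀ x y : ZMod 1, x = y := fun x y => Subsingleton.elim _ _
  simp only [if_pos (hs _ _)]
  have e1 : (∑ x : ZMod p, if x = 0 then (0 : ℂ) else (mulShift (stdAddChar (N := p)) (u : ZMod p)) (x + x⁻¹)) =
     ∑ x ∈ univ.filter (fun x : ZMod p => x ≠ 0), (mulShift (stdAddChar (N := p)) (u : ZMod p)) (x + x⁻¹) := by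
    rw [sum_filter]
    refine sum_congr rfl fun x _ => ?_
    by_cases h : x = 0 <;> simp [h]
  have e2 : ∑ a : (ZMod p)ˣ, stdAddChar ((u : ZMod p) * ((a : ZMod p) + ((a⁻¹ : (ZMod p)ˣ) : ZMod p))) =
      ∑ x ∈ univ.filter (fun x : ZMod p => x ≠ 0), (mulShift (stdAddChar (N := p)) (u : ZMod p)) (x + x⁻¹) := by
    refine sum_bij' (fun a _ => (a : ZMod p)) (fun x hx => Units.mk0 x (mem_filter.1 hx).2) ?_ ?_ ?_ ?_ ?_
    · intro a _; simp
    · intro a _; simp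
    · intro a _; ext; rfl
    · intro a _; rfl
    · intro a _; rw [AddChar.mulShift_apply, Units.val_inv_eq_inv_val]
  rw [e2, ← e1]
  refine sum_congr rfl fun x _ => ?_
  congr
theorem kl_trivial (c d : ℕ) [NeZero c] (hd : d ∣ c) (hsf : Squarefree d) (u : ℤ) :
    ‖klT c d u‖ ≤ (c / d : ℕ) * (d.divisors.card : ℝ) := by
  have hc0 : c ≠ 0 := NeZero.ne c
  have hd0 : d ≠ 0 := by rintro rfl; exact hc0 (Nat.eq_zero_of_zero_dvd hd)
  have : NeZero d := ⟨hd0⟩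
  unfold klT
  refine (norm_sum_le _ _).trans ?_
  have h1 : ∀ a : (ZMod c)ˣ, ‖(if ((a : ZMod c).cast : ZMod d) ^ 2 = 1 then
    stdAddChar ((u : ZMod c) * ((a : ZMod c) + ((a⁻¹ : (ZMod c)ˣ) : ZMod c))) else 0)‖ ≤
      if ((a : ZMod c).val : ZMod d) ^ 2 = 1 then (1 : ℝ) else 0 := by
    intro a
    rw [ZMod.natCast_val]
    split_ifs
    · rw [norm_apply]
    · simp
  refine (sum_le_sum fun a _ => h1 a).trans ?_
  rw [sum_boole]
  have h2 : (univ.filter (fun a : (ZMod c)ˣ => ((a : ZMod c).val : ZMod d) ^ 2 = 1)).card ≤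
      ((range (c / d)) ×ˢ d.divisors).card := by
    refine Finset.card_le_card_of_injOn (fun a => ((a : ZMod c).val / d, Nat.gcd ((a : ZMod c).val + (d - 1)) d)) ?_ ?_
    · intro a ha
      simp only [Finset.coe_product, mem_prod, Finset.mem_coe, mem_range, mem_divisors]
      refine ⟨?_, Nat.gcd_dvd_right _ _, hd0⟩
      rw [Nat.div_lt_iff_lt_mul (Nat.pos_of_ne_zero hd0), Nat.div_mul_cancel hd]
      exact ZMod.val_lt _
    · intro a ha b hb hab
      simp only [Prod.mk.injEq] at hab
      obtain ⟨hab1, hab2⟩ := hab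
      simp only [Finset.coe_filter, mem_univ, true_and, Set.mem_ofPred_eq] at ha hb
      apply Units.ext
      apply ZMod.val_injective
      set x := (a : ZMod c).val
      set y := (b : ZMod c).val
      have hmod : x ≡ y [MOD d] := by
        rw [Nat.modEq_iff_dvd]
        have key : ∀ x : ℕ, (x : ZMod d) ^ 2 = 1 → ∀ p : ℕ, p.Prime → p ∣ d →
            (((p : ℤ) ∣ (x : ℤ) - 1 ∧ p ∣ Nat.gcd (x + (d - 1)) d) ∨ ((p : ℤ) ∣ (x : ℤ) + 1 ∧ ((p : ℤ) ∣ (x : ℤ) - 1 → p ∣ Nat.gcd (x + (d - 1)) d) ∧ (p ∣ Nat.gcd (x + (d - 1)) d → (p : ℤ) ∣ (x : ℤ) - 1))) := by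
          intro x hx p hp hpd
          have hiff : ((p : ℤ) ∣ (x : ℤ) - 1) ↔ p ∣ Nat.gcd (x + (d - 1)) d := by
            rw [Nat.dvd_gcd_iff, and_iff_left hpd, ← natCast_dvd_natCast]
            have : ((x + (d - 1) : ℕ) : ℤ) = ((x : ℤ) - 1) + d := by
              have := Nat.pos_of_ne_zero hd0
              push_cast [cast_sub (one_le_iff_ne_zero.2 hd0)]; ring
            rw [this, dvd_add_left (natCast_dvd_natCast.2 hpd)]
          have h : (d : ℤ) ∣ (x : ℤ) ^ 2 - 1 := by
            rw [← intCast_zmod_eq_zero_iff_dvd]; push_cast; rw [hx]; ring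
          have h' : (p : ℤ) ∣ ((x : ℤ) - 1) * ((x : ℤ) + 1) := by
            rw [show ((x : ℤ) - 1) * ((x : ℤ) + 1) = (x : ℤ) ^ 2 - 1 by ring]
            exact (natCast_dvd_natCast.2 hpd).trans h
          rcases (prime_iff_prime_int.1 hp).dvd_or_dvd h' with h1 | h1
          · exact Or.inl ⟨h1, hiff.1 h1⟩
          · exact Or.inr ⟨h1, hiff.1, hiff.2⟩
        have hdd : ∀ p : ℕ, p.Prime → p ∣ d → (p : ℤ) ∣ (y : ℤ) - x := by
          intro p hp hpd
          rcases key x ha p hp hpd with ⟨h1, h2⟩ | ⟨h1, h2, h3⟩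
          · rcases key y hb p hp hpd with ⟨h4, h5⟩ | ⟨h4, h5, h6⟩
            · have := dvd_sub h4 h1; ring_nf at this ⊢; exact this
            · have h4 := h6 (hab2 ▸ h2)
              have := dvd_sub h4 h1; ring_nf at this ⊢; exact this
          · rcases key y hb p hp hpd with ⟨h4, h5⟩ | ⟨h4, h5, h6⟩
            · have h1 := h3 (hab2 ▸ h5)
              have := dvd_sub h4 h1; ring_nf at this ⊢; exact this
            · have := dvd_sub h4 h1; ring_nf at this ⊢; exact this
        rw [natCast_dvd]
        rw [← prod_primeFactors_of_squarefree hsf]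
        refine Finset.prod_primes_dvd _ (fun p hp => (prime_of_mem_primeFactors hp).prime) (fun p hp => ?_)
        exact natCast_dvd.1 (hdd p (prime_of_mem_primeFactors hp) (dvd_of_mem_primeFactors hp))
      have e1 := div_add_mod x d
      have e2 := div_add_mod y d
      have hm : x % d = y % d := hmod
      rw [hab1, hm] at e1
      exact e1.symm.trans e2
  have h3 : (((univ.filter (fun a : (ZMod c)ˣ => ((a : ZMod c).val : ZMod d) ^ 2 = 1)).card : ℕ) : ℝ) ≤ _ :=
    cast_le.2 h2
  rw [Finset.card_product, card_range] at h3
  exact_mod_cast h3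
theorem kl_ind (s : Finset ℕ) : ∀ (c b d : ℕ) [NeZero c] (u : ℤ), c = (∏ p ∈ s, p) * b → d ∣ b →
    Squarefree d → (∀ p ∈ s, p.Prime ∧ p ≠ 2 ∧ ¬ (p : ℤ) ∣ u ∧ p.Coprime b) →
    ‖klT c d u‖ ≤ ((∏ p ∈ s, p).divisors.card : ℝ) * sqrt ((∏ p ∈ s, p : ℕ) : ℝ) * ((b / d : ℕ) * (d.divisors.card : ℝ)) := by
  classical
  induction s using Finset.induction with
  | empty =>
    intro c b d _ u hc hd hsf _
    rw [Finset.prod_empty, one_mul] at hc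
    subst hc
    simpa using kl_trivial c d hd hsf u
  | insert p s hps ih =>
    intro c b d _ u hc hd hsf hp
    obtain ⟨pp, p2, pu, pb⟩ := hp p (Finset.mem_insert_self _ _)
    have : Fact p.Prime := ⟨pp⟩
    have hcop : p.Coprime (∏ p ∈ s, p) := by
      refine Nat.Coprime.prod_right fun q hq => ?_
      rw [Nat.coprime_primes pp (hp q (mem_insert_of_mem hq)).1]
      rintro rfl; exact hps hq
    rw [prod_insert hps, mul_assoc] at hc
    set n := (∏ p ∈ s, p) * b with hn
    have hc0 : c ≠ 0 := NeZero.ne c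
    have : NeZero n := ⟨by rintro h; rw [h] at hc; simp at hc; exact hc0 hc⟩
    have hpn : p.Coprime n := hcop.mul_right pb
    obtain ⟨w2, w1, hw⟩ := (isCoprime_iff_coprime.2 hpn)
    have hw' : w1 * n + w2 * p = 1 := by linarith
    subst hc
    rw [kl_mul p n d (hd.mul_left _) hpn w1 w2 hw' u, norm_mul]
    have hpi : Prime (p : ℤ) := prime_iff_prime_int.1 pp
    have b1 := kl_prime p p2 (w1 * u) (by
      intro h
      rcases hpi.dvd_or_dvd h with h | h
      · apply hpi.not_dvd_one
        rw [← hw']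
        exact dvd_add (h.mul_right _) (dvd_mul_left _ _)
      · exact pu h)
    have b2 := ih n b d (w2 * u) hn hd hsf (by
      intro q hq
      obtain ⟨qp, q2, qu, qb⟩ := hp q (mem_insert_of_mem hq)
      refine ⟨qp, q2, ?_, qb⟩
      have hqi : Prime (q : ℤ) := prime_iff_prime_int.1 qp
      intro h
      rcases hqi.dvd_or_dvd h with h | h
      · apply hqi.not_dvd_one
        rw [← hw']
        refine dvd_add (Dvd.dvd.mul_left ?_ _) (h.mul_right _)
        exact natCast_dvd_natCast.2 ((Finset.dvd_prod_of_mem _ hq).mul_right b)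
      · exact qu h)
    refine (mul_le_mul b1 b2 (norm_nonneg _) bpos).trans (le_of_eq ?_)
    rw [prod_insert hps, hcop.card_divisors_mul, pp.divisors, Finset.card_pair pp.one_lt.ne]
    push_cast
    rw [sqrt_mul bpos]
    ring
theorem kl_bound (c c1 b d : ℕ) [NeZero c] (u : ℤ) (hc : c = c1 * b) (hd : d ∣ b) (hsf : Squarefree d)
    (h1 : Squarefree c1) (h2 : c1.Coprime b) (h3 : c1.Coprime (2 * u.natAbs)) :
    ‖klT c d u‖ ≤ (c.divisors.card : ℝ) * (d.divisors.card : ℝ) / d * sqrt c1 * b := by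
  have hc0 : c ≠ 0 := NeZero.ne c
  have hb0 : b ≠ 0 := by rintro rfl; simp at hc; exact hc0 hc
  have hd0 : d ≠ 0 := by rintro rfl; exact hb0 (Nat.eq_zero_of_zero_dvd hd)
  have h := kl_ind c1.primeFactors c b d u (by rw [prod_primeFactors_of_squarefree h1]; exact hc) hd hsf (by
    intro p hp
    have pp := prime_of_mem_primeFactors hp
    have hpd := dvd_of_mem_primeFactors hp
    refine ⟨pp, ?_, ?_, h2.coprime_dvd_left hpd⟩
    · rintro rfl
      have := Nat.Coprime.coprime_dvd_left hpd h3
      simp at this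
      exact Nat.not_even_iff_odd.2 this (even_two_mul _)
    · intro h
      have hh : p ∣ 2 * u.natAbs := (natCast_dvd.1 h).mul_left 2
      have := Nat.Coprime.coprime_dvd_left hpd h3
      exact pp.one_lt.ne' (Nat.Coprime.eq_one_of_dvd this hh))
  rw [prod_primeFactors_of_squarefree h1] at h
  refine h.trans ?_
  rw [Nat.cast_div hd (by exact_mod_cast hd0)]
  have hle : (c1.divisors.card : ℝ) ≤ c.divisors.card := by
    exact_mod_cast card_le_card (Nat.divisors_subset_of_dvd hc0 ⟨b, hc⟩)
  calc _ ≤ (c.divisors.card : ℝ) * √(c1 : ℝ) * ((b : ℝ) / d * (d.divisors.card : ℝ)) := by gcongr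
    _ = _ := by ring
theorem kl_decomp (c N : ℕ) (hc : c ≠ 0) (hN : N ≠ 0) : ∃ c1 b1 x y : ℕ, 0 < x ∧ 0 < y ∧
    c = c1 * (b1 * x ^ 2 * y ^ 3) ∧ Squarefree c1 ∧ c1.Coprime (b1 * x ^ 2 * y ^ 3) ∧ c1.Coprime N ∧ b1 ∣ N := by
  obtain ⟨a0, b0, ha0, hb0, hab, hsq⟩ := Nat.sq_mul_squarefree_of_pos (Nat.pos_of_ne_zero hc)
  obtain ⟨s, hs⟩ := Nat.gcd_dvd_left a0 b0
  obtain ⟨x, hx⟩ := Nat.gcd_dvd_right a0 b0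
  set y := Nat.gcd a0 b0 with hy
  obtain ⟨c1, hc1⟩ := Nat.gcd_dvd_left s N
  set b1 := Nat.gcd s N with hb1
  have hys : y.Coprime s := coprime_of_squarefree_mul (hs ▸ hsq)
  have hss : Squarefree s := Squarefree.of_mul_right (hs ▸ hsq)
  have hbc : b1.Coprime c1 := coprime_of_squarefree_mul (hc1 ▸ hss)
  have hc1s : c1 ∣ s := ⟨b1, by rw [mul_comm]; exact hc1⟩
  have hxs : c1.Coprime x := by
    refine Nat.Coprime.coprime_dvd_left hc1s ?_
    apply Nat.Coprime.symm
    rw [coprime_iff_gcd_eq_one]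
    have h1 : Nat.gcd x s ∣ y := Nat.dvd_gcd
      ((Nat.gcd_dvd_right x s).trans ⟨y, by rw [mul_comm]; exact hs⟩)
      ((Nat.gcd_dvd_left x s).trans ⟨y, by rw [mul_comm]; exact hx⟩)
    exact Nat.Coprime.eq_one_of_dvd (hys.symm.coprime_dvd_left (Nat.gcd_dvd_right x s)) h1
  have hys1 : c1.Coprime y := (hys.coprime_dvd_right hc1s).symm
  refine ⟨c1, b1, x, y, ?_, ?_, ?_, Squarefree.of_mul_right (hc1 ▸ hss), ?_, ?_, Nat.gcd_dvd_right _ _⟩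
  · apply Nat.pos_of_ne_zero; rintro rfl; simp at hx; omega
  · exact gcd_pos_of_pos_left _ ha0
  · rw [← hab, hx, hs, hc1]; ring
  · exact (hbc.symm.mul_right (hxs.pow_right 2)).mul_right (hys1.pow_right 3)
  · rw [coprime_iff_gcd_eq_one]
    have h1 : Nat.gcd c1 N ∣ b1 := Nat.dvd_gcd ((Nat.gcd_dvd_left _ _).trans hc1s) (Nat.gcd_dvd_right _ _)
    exact Nat.Coprime.eq_one_of_dvd (hbc.symm.coprime_dvd_left (Nat.gcd_dvd_left _ _)) h1
theorem ks_gcdsum (q C : ℕ) (hq : q ≠ 0) :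
    ∑ x ∈ Icc 1 C, (Nat.gcd q x : ℝ) / x ≤ q.divisors.card * (1 + log C) := by
  have h1 : ∀ x ∈ Icc 1 C, (Nat.gcd q x : ℝ) / x ≤ ∑ g ∈ q.divisors, if g ∣ x then (g : ℝ) / x else 0 := by
    intro x hx
    have := single_le_sum (f := fun g : ℕ => if g ∣ x then (g : ℝ) / x else 0) (s := q.divisors)
      (fun g _ => by split_ifs <;> positivity) (mem_divisors.2 ⟨Nat.gcd_dvd_left q x, hq⟩)
    simpa [Nat.gcd_dvd_right] using this
  refine (sum_le_sum h1).trans ?_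
  rw [sum_comm, ← nsmul_eq_mul]
  refine sum_le_card_nsmul _ _ _ fun g hg => ?_
  have hg0 : 0 < g := pos_of_mem_divisors hg
  rw [← sum_filter]
  have h2 : ∑ x ∈ Finset.filter (fun x => g ∣ x) (Icc 1 C), (g : ℝ) / x ≤ ∑ m ∈ Icc 1 C, (m : ℝ)⁻¹ := by
    have h4 : ∑ x ∈ Finset.filter (fun x => g ∣ x) (Icc 1 C), (g : ℝ) / x =
        ∑ m ∈ (Finset.filter (fun x => g ∣ x) (Icc 1 C)).image (fun x => x / g), (m : ℝ)⁻¹ := by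
      rw [sum_image]
      · refine sum_congr rfl fun x hx => ?_
        obtain ⟨k, rfl⟩ := (mem_filter.1 hx).2
        have : (g : ℝ) ≠ 0 := by exact_mod_cast hg0.ne'
        rw [Nat.mul_div_cancel_left _ hg0]
        push_cast
        field_simp
      · intro x hx y hy hxy
        obtain ⟨k, rfl⟩ := (mem_filter.1 hx).2
        obtain ⟨k', rfl⟩ := (mem_filter.1 hy).2
        simp only [Nat.mul_div_cancel_left _ hg0] at hxy
        rw [hxy]
    rw [h4]
    refine sum_le_sum_of_subset_of_nonneg ?_ (fun _ _ _ => by positivity)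
    intro m hm
    obtain ⟨x, hx, rfl⟩ := mem_image.1 hm
    obtain ⟨hx1, k, rfl⟩ := mem_filter.1 hx
    rw [mem_Icc] at hx1 ⊢
    rw [Nat.mul_div_cancel_left _ hg0]
    refine ⟨Nat.pos_of_ne_zero (by rintro rfl; simp at hx1), (le_mul_of_pos_left k hg0).trans hx1.2⟩
  have h3 := harmonic_le_one_add_log C
  rw [harmonic_eq_sum_Icc] at h3
  push_cast at h3
  exact h2.trans h3
theorem ks_sqrtsum (n : ℕ) : ∑ m ∈ Icc 1 n, (1 : ℝ) / sqrt m ≤ 2 * sqrt n := by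
  induction n with
  | zero => simp
  | succ n ih =>
    rw [Finset.sum_Icc_succ_top bomg]
    have h1 : (1 : ℝ) / √((n + 1 : ℕ) : ℝ) ≤ 2 * √((n + 1 : ℕ) : ℝ) - 2 * √(n : ℝ) := by
      have hp : 0 < √((n + 1 : ℕ) : ℝ) := sqrt_pos.2 bpos
      rw [div_le_iff₀ hp]
      have e1 := sq_sqrt (show (0:ℝ) ≤ ((n + 1 : ℕ) : ℝ) by positivity)
      have e2 := sq_sqrt (show (0:ℝ) ≤ (n : ℝ) by positivity)
      push_cast at *
      nlinarith [sq_nonneg (√((n : ℝ) + 1) - √(n : ℝ))]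
    linarith
theorem ks_multsum (l C : ℕ) (hl : l ≠ 0) :
    ∑ c ∈ (Icc 1 C).filter (fun c => l ∣ c), (1 : ℝ) / sqrt c ≤ 2 * sqrt C / l := by
  have hl0 : 0 < l := Nat.pos_of_ne_zero hl
  have h2 : ∑ c ∈ (Icc 1 C).filter (fun c => l ∣ c), (1 : ℝ) / sqrt c =
      ∑ m ∈ Icc 1 (C / l), (1 / sqrt l) * ((1 : ℝ) / sqrt m) := by
    refine sum_bij' (fun c _ => c / l) (fun m _ => l * m) ?_ ?_ ?_ ?_ ?_
    · intro c hc
      simp only [mem_filter, mem_Icc] at hc ⊢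
      obtain ⟨⟨h1, h2⟩, k, rfl⟩ := hc
      rw [Nat.mul_div_cancel_left _ hl0, Nat.le_div_iff_mul_le hl0]
      refine ⟨Nat.pos_of_ne_zero (by rintro rfl; simp at h1), by rwa [mul_comm]⟩
    · intro m hm
      simp only [mem_filter, mem_Icc] at hm ⊢
      rw [Nat.le_div_iff_mul_le hl0] at hm
      exact ⟨⟨Nat.mul_pos hl0 hm.1, by rw [mul_comm]; exact hm.2⟩, dvd_mul_right _ _⟩
    · intro c hc
      exact Nat.mul_div_cancel' (mem_filter.1 hc).2
    · intro m hm
      exact Nat.mul_div_cancel_left _ hl0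
    · intro c hc
      obtain ⟨k, rfl⟩ := (mem_filter.1 hc).2
      rw [Nat.mul_div_cancel_left _ hl0]
      push_cast
      rw [sqrt_mul bpos]
      field_simp
  rw [h2, ← mul_sum]
  have h3 : √((C / l : ℕ) : ℝ) ≤ √(C : ℝ) / √(l : ℝ) := by
    rw [← Real.sqrt_div bpos]
    exact sqrt_le_sqrt Nat.cast_div_le
  have hlp : (0 : ℝ) < l := by exact_mod_cast hl0
  calc _ ≤ 1 / √(l : ℝ) * (2 * (√(C : ℝ) / √(l : ℝ))) := by
        gcongr; exact (ks_sqrtsum _).trans (by gcongr)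
    _ = 2 * √(C : ℝ) / (√(l : ℝ) * √(l : ℝ)) := by field_simp
    _ = _ := by rw [mul_self_sqrt hlp.le]
theorem gw_pow (x w n : ℕ) : Nat.gcd (x ^ n) w ∣ Nat.gcd x w ^ n := by
  induction n with
  | zero => simp
  | succ n ih =>
    rw [pow_succ, pow_succ]
    exact (gcd_mul_left_dvd_mul_gcd _ _ _).trans (mul_dvd_mul_right ih _)
theorem gw_sq (x w n : ℕ) (hw : Squarefree w) (hn : n ≠ 0) : Nat.gcd (x ^ n) w ∣ Nat.gcd x w := by
  refine Nat.dvd_gcd ?_ (Nat.gcd_dvd_right _ _)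
  exact (Squarefree.dvd_pow_iff_dvd (hw.squarefree_of_dvd (Nat.gcd_dvd_right _ _)) hn).1 (Nat.gcd_dvd_left _ _)
theorem ks_gcd_term (w μ b1 x y N : ℕ) (hwμ : w.Coprime μ) (hμ : Squarefree μ) (hw0 : w ≠ 0)
    (hb1 : b1 ∣ N) (hN : N ≠ 0) (hx : 0 < x) (hy : 0 < y) :
    (Nat.gcd (w * μ) (b1 * x ^ 2 * y ^ 3) : ℝ) / sqrt ((b1 * x ^ 2 * y ^ 3 : ℕ) : ℝ) ≤
      sqrt w * sqrt (Nat.gcd μ N) * ((Nat.gcd (w * μ) x : ℝ) / x) * ((Nat.gcd (w * μ) y : ℝ) / y) := by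
  have hb0 : 0 < b1 := pos_of_dvd_of_pos hb1 (Nat.pos_of_ne_zero hN)
  set b := b1 * x ^ 2 * y ^ 3 with hb
  have hbpos : 0 < b := by positivity
  have hμ0 : 0 < μ := Nat.pos_of_ne_zero hμ.ne_zero
  rw [Nat.gcd_comm, hwμ.gcd_mul, Nat.gcd_comm _ x, hwμ.gcd_mul, Nat.gcd_comm _ y, hwμ.gcd_mul]
  have hW : Nat.gcd b w ≤ Nat.gcd b1 w * (Nat.gcd x w ^ 2 * Nat.gcd y w ^ 3) := by
    apply le_of_dvd bpos
    rw [hb, mul_assoc]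
    refine (gcd_mul_left_dvd_mul_gcd _ _ _).trans (mul_dvd_mul_left _ ?_)
    refine (gcd_mul_left_dvd_mul_gcd _ _ _).trans (mul_dvd_mul ?_ ?_)
    · exact gw_pow x w 2
    · exact gw_pow y w 3
  have hM : Nat.gcd b μ ≤ Nat.gcd b1 μ * (Nat.gcd x μ * Nat.gcd y μ) := by
    apply le_of_dvd bpos
    rw [hb, mul_assoc]
    refine (gcd_mul_left_dvd_mul_gcd _ _ _).trans (mul_dvd_mul_left _ ?_)
    refine (gcd_mul_left_dvd_mul_gcd _ _ _).trans (mul_dvd_mul ?_ ?_)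
    · exact gw_sq x μ 2 hμ two_ne_zero
    · exact gw_sq y μ 3 hμ three_ne_zero
  have hB : Nat.gcd b1 w * Nat.gcd b1 μ ≤ b1 := by
    rw [← hwμ.gcd_mul]; exact gcd_le_left _ hb0
  have hM1 : Nat.gcd b1 μ ≤ Nat.gcd μ N := by
    apply le_of_dvd (gcd_pos_of_pos_left _ hμ0)
    exact Nat.dvd_gcd (Nat.gcd_dvd_right _ _) ((Nat.gcd_dvd_left _ _).trans hb1)
  have hWw : Nat.gcd b w ≤ w := Nat.gcd_le_right _ (Nat.pos_of_ne_zero hw0)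
  have hyw : Nat.gcd y w ≤ y := gcd_le_left _ hy
  have key : (Nat.gcd b w * Nat.gcd b μ) ^ 2 ≤
      w * Nat.gcd μ N * (Nat.gcd x w * Nat.gcd x μ) ^ 2 * (Nat.gcd y w * Nat.gcd y μ) ^ 2 * (b1 * y) := by
    calc (Nat.gcd b w * Nat.gcd b μ) ^ 2 = (Nat.gcd b w * Nat.gcd b w) * (Nat.gcd b μ * Nat.gcd b μ) := by ring
      _ ≤ (w * (Nat.gcd b1 w * (Nat.gcd x w ^ 2 * Nat.gcd y w ^ 3))) *
          ((Nat.gcd b1 μ * (Nat.gcd x μ * Nat.gcd y μ)) * (Nat.gcd b1 μ * (Nat.gcd x μ * Nat.gcd y μ))) := by gcongr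
      _ = w * Nat.gcd b1 μ * (Nat.gcd x w * Nat.gcd x μ) ^ 2 * (Nat.gcd y w * Nat.gcd y μ) ^ 2 *
          ((Nat.gcd b1 w * Nat.gcd b1 μ) * Nat.gcd y w) := by ring
      _ ≤ _ := by gcongr
  have key' : (((Nat.gcd b w * Nat.gcd b μ) ^ 2 : ℕ) : ℝ) ≤ _ := cast_le.2 key
  push_cast at key'
  have hx' : (0 : ℝ) < x := by exact_mod_cast hx
  have hy' : (0 : ℝ) < y := by exact_mod_cast hy
  rw [div_le_iff₀ (sqrt_pos.2 (by exact_mod_cast hbpos))]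
  apply le_of_sq_le_sq _ bpos
  simp only [mul_pow, div_pow]
  rw [sq_sqrt bpos, sq_sqrt bpos, sq_sqrt bpos]
  push_cast
  refine (le_of_eq (by ring)).trans (key'.trans (le_of_eq ?_))
  rw [hb]
  push_cast
  field_simp
noncomputable def klN (c d : ℕ) (u : ℤ) : ℝ := if h : c ≠ 0 then ‖@klT c d ⟨h⟩ u‖ else 0
theorem kl_sum (w μ d C : ℕ) (h : ℤ) (T : ℝ) (hwμ : w.Coprime μ) (hμ : Squarefree μ) (hw0 : w ≠ 0)
    (hd : Squarefree d) (hdw : d ∣ w) (hh : h ≠ 0) (hT : ∀ c ∈ Icc 1 C, (c.divisors.card : ℝ) ≤ T) :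
    ∑ c ∈ (Icc 1 C).filter (fun c => w * μ ∣ c), klN c d h / c ≤
      T * d.divisors.card / d * (2 * sqrt C / (w * μ : ℕ)) * (sqrt w * sqrt (Nat.gcd μ (2 * h.natAbs * d))) *
        (2 * h.natAbs * d).divisors.card * ((w * μ).divisors.card * (1 + log C)) ^ 2 := by
  classical
  rcases Nat.eq_zero_or_pos C with rfl | hC
  · simp
  have hT0 : 0 ≤ T := (cast_nonneg _).trans (hT 1 (by simp; omega))
  set N := 2 * h.natAbs * d with hN
  have hN0 : N ≠ 0 := by simp [hN, hh, hd.ne_zero]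
  set q := w * μ with hq
  have hq0 : q ≠ 0 := mul_ne_zero hw0 hμ.ne_zero
  have hd0 : (0:ℝ) < d := by exact_mod_cast Nat.pos_of_ne_zero hd.ne_zero
  set I := Icc 1 C with hI
  let B : ℕ → ℕ → ℕ → ℕ := fun b1 x y => b1 * x ^ 2 * y ^ 3
  have hterm : ∀ c ∈ I.filter (fun c => q ∣ c), klN c d h / c ≤
      T * d.divisors.card / d * ∑ b1 ∈ N.divisors, ∑ x ∈ I, ∑ y ∈ I,
        if B b1 x y ∣ c then sqrt (B b1 x y : ℕ) / sqrt c else 0 := by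
    intro c hc
    obtain ⟨hc1, hqc⟩ := mem_filter.1 hc
    have hcI := mem_Icc.1 hc1
    have hc0 : c ≠ 0 := by omega
    have : NeZero c := ⟨hc0⟩
    obtain ⟨c1, b1, x, y, hx, hy, hce, hsq, hcop, hcN, hbN⟩ := kl_decomp c N hc0 hN0
    have hBd : B b1 x y ∣ c := ⟨c1, by rw [mul_comm]; exact hce⟩
    have hB0 : 0 < B b1 x y := pos_of_dvd_of_pos hBd bomg
    have hxC : x ∈ I := by
      refine mem_Icc.2 ⟨hx, le_trans (le_of_dvd bomg (dvd_trans ?_ hBd)) hcI.2⟩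
      exact Dvd.dvd.mul_right (Dvd.dvd.mul_left (dvd_pow_self _ two_ne_zero) _) _
    have hyC : y ∈ I := by
      refine mem_Icc.2 ⟨hy, le_trans (le_of_dvd bomg (dvd_trans ?_ hBd)) hcI.2⟩
      exact Dvd.dvd.mul_left (dvd_pow_self _ three_ne_zero) _
    have hbm : b1 ∈ N.divisors := mem_divisors.2 ⟨hbN, hN0⟩
    have hdB : d ∣ B b1 x y := by
      have h1 : d ∣ c1 * B b1 x y := by
        change d ∣ c1 * (b1 * x ^ 2 * y ^ 3)
        rw [← hce]; exact ((hdw.mul_right μ).trans hqc)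
      exact Nat.Coprime.dvd_of_dvd_mul_left (Nat.Coprime.coprime_dvd_right (dvd_mul_left d _) hcN).symm h1
    have hb := kl_bound c c1 (B b1 x y) d h hce hdB hd hsq hcop (Nat.Coprime.coprime_dvd_right (dvd_mul_right _ d) hcN)
    have e1 : klN c d h = ‖klT c d h‖ := by unfold klN; rw [dif_pos hc0]
    rw [e1]
    have hc1p : 0 < c1 := Nat.pos_of_ne_zero hsq.ne_zero
    have hb' : ‖klT c d h‖ / c ≤ T * d.divisors.card / d * (sqrt (B b1 x y : ℕ) / sqrt c) := by
      have hc1r : (0:ℝ) < c1 := by exact_mod_cast hc1p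
      have hBr : (0:ℝ) < (B b1 x y : ℕ) := by exact_mod_cast hB0
      have hcr : (c : ℝ) = c1 * (B b1 x y : ℕ) := by exact_mod_cast hce
      have e2 : sqrt (B b1 x y : ℕ) / sqrt c = sqrt c1 * (B b1 x y : ℕ) / c := by
        rw [hcr, sqrt_mul hc1r.le]
        have := sqrt_pos.2 hc1r
        have := sqrt_pos.2 hBr
        have := mul_self_sqrt hc1r.le
        field_simp
        rw [sq, this]
      rw [e2, ← mul_div_assoc]
      gcongr
      refine hb.trans ?_
      rw [mul_assoc _ (sqrt _)]
      gcongr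
      exact hT c hc1
    refine hb'.trans (mul_le_mul_of_nonneg_left ?_ bpos)
    have hnn : ∀ b1 x y, 0 ≤ (if B b1 x y ∣ c then sqrt (B b1 x y : ℕ) / sqrt c else 0) := by
      intro b1 x y; split_ifs <;> positivity
    have s1 := single_le_sum (fun y _ => hnn b1 x y) hyC
    rw [if_pos hBd] at s1
    refine s1.trans ?_
    have s2 := single_le_sum (f := fun x => ∑ y ∈ I, if B b1 x y ∣ c then sqrt (B b1 x y : ℕ) / sqrt c else 0) (fun x _ => sum_nonneg fun y _ => hnn b1 x y) hxC
    refine s2.trans ?_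
    exact single_le_sum (f := fun b1 => ∑ x ∈ I, ∑ y ∈ I, if B b1 x y ∣ c then sqrt (B b1 x y : ℕ) / sqrt c else 0) (fun b1 _ => sum_nonneg fun x _ => sum_nonneg fun y _ => hnn b1 x y) hbm
  refine (sum_le_sum hterm).trans ?_
  rw [← mul_sum]
  have hsw : ∑ c ∈ I.filter (fun c => q ∣ c), ∑ b1 ∈ N.divisors, ∑ x ∈ I, ∑ y ∈ I,
        (if B b1 x y ∣ c then sqrt (B b1 x y : ℕ) / sqrt c else 0) =
      ∑ b1 ∈ N.divisors, ∑ x ∈ I, ∑ y ∈ I, ∑ c ∈ I.filter (fun c => q ∣ c),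
        (if B b1 x y ∣ c then sqrt (B b1 x y : ℕ) / sqrt c else 0) := by
    rw [sum_comm]
    refine sum_congr rfl fun b1 _ => ?_
    rw [sum_comm]
    refine sum_congr rfl fun x _ => ?_
    rw [sum_comm]
  rw [hsw]
  have hin : ∀ b1 ∈ N.divisors, ∀ x ∈ I, ∀ y ∈ I, ∑ c ∈ I.filter (fun c => q ∣ c),
        (if B b1 x y ∣ c then sqrt (B b1 x y : ℕ) / sqrt c else 0) ≤
      (2 * sqrt C / q) * ((sqrt w * sqrt (Nat.gcd μ N)) * (((Nat.gcd q x : ℝ) / x) * ((Nat.gcd q y : ℝ) / y))) := by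
    intro b1 hb1 x hx y hy
    have hb1' := dvd_of_mem_divisors hb1
    have hx0 := (mem_Icc.1 hx).1
    have hy0 := (mem_Icc.1 hy).1
    have hb0 : 0 < b1 := pos_of_mem_divisors hb1
    have hB0 : 0 < B b1 x y := by positivity
    have hg := ks_gcd_term w μ b1 x y N hwμ hμ hw0 hb1' hN0 hx0 hy0
    rw [← sum_filter, Finset.filter_filter]
    have e1 : I.filter (fun c => q ∣ c ∧ B b1 x y ∣ c) = I.filter (fun c => Nat.lcm q (B b1 x y) ∣ c) := by
      refine Finset.filter_congr fun c _ => ?_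
      rw [Nat.lcm_dvd_iff]
    rw [e1]
    have e2 : ∀ c : ℕ, sqrt (B b1 x y : ℕ) / sqrt c = sqrt (B b1 x y : ℕ) * (1 / sqrt c) := fun c => by ring
    simp_rw [e2]
    rw [← mul_sum]
    have hl := ks_multsum (Nat.lcm q (B b1 x y)) C (lcm_ne_zero hq0 hB0.ne')
    refine (mul_le_mul_of_nonneg_left hl (sqrt_nonneg _)).trans ?_
    refine le_trans (le_of_eq ?_) (mul_le_mul_of_nonneg_left (hg.trans (le_of_eq (by ring))) bpos)
    have hgl : ((Nat.gcd q (B b1 x y) : ℕ) : ℝ) * (Nat.lcm q (B b1 x y) : ℕ) = q * (B b1 x y : ℕ) := by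
      exact_mod_cast Nat.gcd_mul_lcm q (B b1 x y)
    have hlp : (0 : ℝ) < (Nat.lcm q (B b1 x y) : ℕ) := by exact_mod_cast Nat.pos_of_ne_zero (lcm_ne_zero hq0 hB0.ne')
    have hBr : (0:ℝ) < (B b1 x y : ℕ) := by exact_mod_cast hB0
    have hqr : (0:ℝ) < (q : ℕ) := by exact_mod_cast Nat.pos_of_ne_zero hq0
    have hs := mul_self_sqrt hBr.le
    have hsp := sqrt_pos.2 hBr
    change _ = 2 * √(C : ℝ) / (q : ℝ) * ((Nat.gcd q (B b1 x y) : ℝ) / √((B b1 x y : ℕ) : ℝ))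
    field_simp
    rw [sq, hs]
    linarith
  have hfin : ∑ b1 ∈ N.divisors, ∑ x ∈ I, ∑ y ∈ I, ∑ c ∈ I.filter (fun c => q ∣ c),
        (if B b1 x y ∣ c then sqrt (B b1 x y : ℕ) / sqrt c else 0) ≤
      N.divisors.card * ((2 * sqrt C / q) * ((sqrt w * sqrt (Nat.gcd μ N)) * (q.divisors.card * (1 + log C)) ^ 2)) := by
    rw [← nsmul_eq_mul]
    refine sum_le_card_nsmul _ _ _ fun b1 hb1 => ?_
    refine (sum_le_sum fun x hx => sum_le_sum fun y hy => hin b1 hb1 x hx y hy).trans ?_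
    simp_rw [← mul_sum]
    rw [← sum_mul]
    have hgs := ks_gcdsum q C hq0
    have hgs0 : 0 ≤ ∑ x ∈ I, (Nat.gcd q x : ℝ) / x := sum_nonneg fun _ _ => by positivity
    rw [sq]
    gcongr
  refine (mul_le_mul_of_nonneg_left hfin bpos).trans (le_of_eq ?_)
  ring
theorem dv_bound (ε : ℝ) (hε : 0 < ε) : ∃ K : ℝ, 1 ≤ K ∧ ∀ n : ℕ, n ≠ 0 → (n.divisors.card : ℝ) ≤ K * (n : ℝ) ^ ε := by
  obtain ⟨P, hP⟩ := exists_nat_gt ((2 : ℝ) ^ (1 / ε))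
  set A : ℝ := 1 + 1 / (ε * log 2) with hA
  have hl2 : 0 < log 2 := Real.log_pos one_lt_two
  have hA1 : 1 ≤ A := by rw [hA]; have : 0 ≤ 1 / (ε * log 2) := by positivity
                         linarith
  refine ⟨A ^ P, one_le_pow₀ hA1, fun n hn => ?_⟩
  have hn' : (n : ℝ) ^ ε = ∏ p ∈ n.primeFactors, ((p : ℝ) ^ (n.factorization p)) ^ ε := by
    rw [Real.finsetProd_rpow _ _ (fun _ _ => by positivity)]
    congr 1
    conv_lhs => rw [← Nat.prod_factorization_pow_eq_self hn]
    rw [Finsupp.prod, Nat.support_factorization]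
    push_cast; rfl
  have h1 : ∀ p ∈ n.primeFactors, ((n.factorization p + 1 : ℕ) : ℝ) ≤ (if p < P then A else 1) * ((p : ℝ) ^ (n.factorization p)) ^ ε := by
    intro p hp
    set v := n.factorization p
    have pp := prime_of_mem_primeFactors hp
    have hp2 : (2 : ℝ) ≤ p := by exact_mod_cast pp.two_le
    have hx : ((p : ℝ) ^ v) ^ ε = ((p : ℝ) ^ ε) ^ v := by
      rw [← rpow_natCast, ← rpow_mul bpos, mul_comm, rpow_mul bpos, rpow_natCast]
    rw [hx]
    split_ifs with h
    · have h2 : 1 + ε * log 2 ≤ (p : ℝ) ^ ε := by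
        have : (2:ℝ) ^ ε ≤ (p : ℝ) ^ ε := rpow_le_rpow bnum hp2 hε.le
        refine le_trans ?_ this
        rw [Real.rpow_def_of_pos bnum]
        have := add_one_le_exp (log 2 * ε)
        linarith
      have h3 : 1 + v * (ε * log 2) ≤ ((p : ℝ) ^ ε) ^ v :=
        (one_add_mul_le_pow (by nlinarith [mul_pos hε hl2]) v).trans (pow_le_pow_left₀ bpos h2 v)
      have h4 : ((v + 1 : ℕ) : ℝ) ≤ A * (1 + v * (ε * log 2)) := by
        have hpos : 0 < ε * log 2 := by positivity
        have : A * (1 + v * (ε * log 2)) = 1 + v * (ε * log 2) + 1 / (ε * log 2) + v := by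
          rw [hA]; field_simp; ring
        rw [this]; push_cast
        have : 0 ≤ 1 / (ε * log 2) := by positivity
        have : 0 ≤ v * (ε * log 2) := by positivity
        linarith
      exact h4.trans (mul_le_mul_of_nonneg_left h3 blin)
    · push Not at h
      have hpP : (2 : ℝ) ≤ (p : ℝ) ^ ε := by
        have : (2 : ℝ) ^ (1 / ε) ≤ p := hP.le.trans (by exact_mod_cast h)
        have := rpow_le_rpow bpos this hε.le
        rwa [← rpow_mul bnum, one_div_mul_cancel hε.ne', rpow_one] at this
      rw [one_mul]
      refine le_trans ?_ (pow_le_pow_left₀ bnum hpP v)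
      exact_mod_cast lt_two_pow_self
  rw [Nat.card_divisors hn]
  push_cast
  refine (Finset.prod_le_prod (fun _ _ => by positivity) (fun p hp => (le_of_eq (by push_cast; rfl)).trans (h1 p hp))).trans ?_
  rw [Finset.prod_mul_distrib, ← hn']
  gcongr
  rw [Finset.prod_ite, prod_const, Finset.prod_const_one, mul_one]
  refine pow_le_pow_right₀ hA1 ?_
  calc _ ≤ (range P).card := card_le_card (fun p hp => by
          rw [mem_range]; exact (mem_filter.1 hp).2)
    _ = P := card_range P
noncomputable def hyν : Measure ℝ := (volume.restrict (Ioi (0:ℝ))).withDensity (fun y => ofReal (1 / y ^ 2))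
noncomputable def hpt (p : ℝ × ℝ) : ℍℍ := ofComplex ⟨p.1, p.2⟩
theorem hpt_coe (x y : ℝ) (hy : 0 < y) : ((hpt (x, y) : ℍℍ) : ℂ) = ⟨x, y⟩ := by
  unfold hpt
  rw [ofComplex_apply_of_im_pos (by exact hy)]
theorem hpt_re (x y : ℝ) (hy : 0 < y) : (hpt (x, y)).re = x := by
  rw [← coe_re, hpt_coe x y hy]
theorem hpt_im (x y : ℝ) (hy : 0 < y) : (hpt (x, y)).im = y := by
  rw [← coe_im, hpt_coe x y hy]
theorem hpt_self (z : ℍℍ) : hpt (z.re, z.im) = z := by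
  apply UpperHalfPlane.ext
  rw [hpt_coe _ _ z.im_pos]
  rfl
theorem hpt_meas : Measurable hpt := by
  have h1 : Measurable (fun z : ℂ => ofComplex z) := by
    intro s hs
    obtain ⟨t, ht, rfl⟩ := hs
    have : (fun z : ℂ => ofComplex z) ⁻¹' (UpperHalfPlane.coe ⁻¹' t) =
      ({z : ℂ | 0 < z.im} ∩ t) ∪ ({z : ℂ | z.im ≤ 0} ∩ (fun z : ℂ => (ofComplex (0:ℂ) : ℂ)) ⁻¹' t) := by
      ext z
      by_cases h : 0 < z.im
      · simp [ofComplex_apply_of_im_pos h, h]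
      · have h' := not_lt.1 h
        simp [ofComplex_apply_of_im_nonpos h', h, h',
          ofComplex_apply_of_im_nonpos (show (0:ℂ).im ≤ 0 by simp)]
    have := this
    refine this ▸ ?_
    refine MeasurableSet.union (MeasurableSet.inter (measurableSet_lt measurable_const measurable_im) ht)
      (MeasurableSet.inter (measurableSet_le measurable_im measurable_const) (measurable_const ht))
  exact h1.comp measurableEquivRealProd.symm.measurable
theorem hy_volume : (volume : Measure ℍℍ) = ((volume : Measure ℝ).prod hyν).map hpt := by
  ext s hs
  rw [UpperHalfPlane.volume_eq_lintegral, Measure.map_apply hpt_meas hs]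
  have hS : MeasurableSet (UpperHalfPlane.coe '' s) := UpperHalfPlane.measurableEmbedding_coe.measurableSet_image.2 hs
  rw [← lintegral_indicator hS, ← (Complex.volume_preserving_equiv_real_prod.symm).lintegral_comp_emb
    measurableEquivRealProd.symm.measurableEmbedding]
  have hd : Measurable (fun y : ℝ => ofReal (1 / y ^ 2)) := by fun_prop
  have : SFinite hyν := by unfold hyν; infer_instance
  rw [Measure.prod_apply_symm (hpt_meas hs)]
  rw [Measure.volume_eq_prod, lintegral_prod_symm' _ ?_]
  swap
  · have : Measurable ((UpperHalfPlane.coe '' s).indicator (fun z : ℂ => (((1 / ‖z.im‖₊) ^ 2 : NNReal) : ENNReal))) := by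
      refine Measurable.indicator ?_ hS
      fun_prop
    exact this.comp measurableEquivRealProd.symm.measurable
  unfold hyν
  rw [lintegral_withDensity_eq_lintegral_mul_non_measurable₀]
  · rw [← lintegral_indicator measurableSet_Ioi]
    refine lintegral_congr fun y => ?_
    by_cases hy : 0 < y
    · rw [indicator_of_mem (by exact hy)]
      have : ∀ x : ℝ, (UpperHalfPlane.coe '' s).indicator (fun z : ℂ => (((1 / ‖z.im‖₊) ^ 2 : NNReal) : ENNReal)) (measurableEquivRealProd.symm (x, y)) =
        ofReal (1 / y ^ 2) * ((fun x => (x, y)) ⁻¹' (hpt ⁻¹' s)).indicator 1 x := by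
        intro x
        have e : measurableEquivRealProd.symm (x, y) = ((hpt (x, y) : ℍℍ) : ℂ) := by
          rw [hpt_coe x y hy]; rfl
        by_cases hx : hpt (x, y) ∈ s
        · rw [indicator_of_mem (by rw [e]; exact ⟨_, hx, rfl⟩), indicator_of_mem (by exact hx), e, hpt_coe x y hy]
          simp only [Pi.one_apply, mul_one]
          rw [ofReal, ENNReal.coe_inj]
          ext
          rw [Real.coe_toNNReal _ bpos]
          simp [abs_of_pos hy]
        · rw [indicator_of_notMem, indicator_of_notMem (by exact hx), mul_zero]
          rw [e]; rintro ⟨w, hw, hw2⟩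
          rw [UpperHalfPlane.ext hw2] at hw; exact hx hw
      simp_rw [this]
      rw [lintegral_const_mul, lintegral_indicator_one]
      · rfl
      · exact (measurable_prodMk_right : Measurable fun x : ℝ => (x, y)) (hpt_meas hs)
      · exact measurable_one.indicator ((measurable_prodMk_right : Measurable fun x : ℝ => (x, y)) (hpt_meas hs))
    · rw [indicator_of_notMem (by exact hy)]
      have : ∀ x : ℝ, (UpperHalfPlane.coe '' s).indicator (fun z : ℂ => (((1 / ‖z.im‖₊) ^ 2 : NNReal) : ENNReal)) (measurableEquivRealProd.symm (x, y)) = 0 := by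
        intro x
        rw [indicator_of_notMem]
        rintro ⟨w, hw, hw2⟩
        have := congrArg Complex.im hw2
        apply hy
        have h3 : w.im = y := this
        rw [← h3]; exact w.im_pos
      simp_rw [this]
      simp
  · exact hd.aemeasurable
  · filter_upwards with y using ofReal_lt_top
theorem unfoldU {Γ Y : Type*} [Group Γ] [Countable Γ] [MeasurableSpace Y] {μ : Measure Y} (act : Γ → Y → Y)
    (hmp : ∀ g, MeasurePreserving (act g) μ μ) (hinv : ∀ g y, act g⁻¹ (act g y) = y) (K : Y → ℝ)
    (hK0 : ∀ y, 0 ≤ K y) (hKm : Measurable K) (hK1 : ∀ y, HasSum (fun g => K (act g y)) 1) (φ : Y → ℂ)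
    (hφm : Measurable φ) (hφ : Integrable φ μ) :
    Integrable (fun y => (K y : ℂ) * ∑' g, φ (act g y)) μ ∧
      ∫ y, φ y ∂μ = ∫ y, (K y : ℂ) * ∑' g, φ (act g y) ∂μ := by
  have hKC : Measurable (fun y => (K y : ℂ)) := Complex.measurable_ofReal.comp hKm
  have hF0 : ∀ g, Measurable (fun u => (K (act g⁻¹ u) : ℂ) * φ u) := fun g =>
    (hKC.comp (hmp g⁻¹).measurable).mul hφm
  have hF : ∀ g, Measurable (fun u => (K u : ℂ) * φ (act g u)) := fun g =>
    hKC.mul (hφm.comp (hmp g).measurable)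
  have e1 : ∀ g, (fun u => (K u : ℂ) * φ (act g u)) = (fun u => (K (act g⁻¹ u) : ℂ) * φ u) ∘ act g := by
    intro g
    funext u
    simp [hinv]
  have hK1' : ∀ y, HasSum (fun g => K (act g⁻¹ y)) 1 := fun y => (Equiv.inv Γ).hasSum_iff.2 (hK1 y)
  have hs : ∑' g, ∫⁻ u, ‖(K u : ℂ) * φ (act g u)‖ₑ ∂μ = ∫⁻ u, ‖φ u‖ₑ ∂μ := by
    have : ∀ g, ∫⁻ u, ‖(K u : ℂ) * φ (act g u)‖ₑ ∂μ = ∫⁻ u, ‖(K (act g⁻¹ u) : ℂ) * φ u‖ₑ ∂μ := by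
      intro g
      rw [← (hmp g).lintegral_comp (hF0 g).enorm]
      simp [hinv]
    simp_rw [this]
    rw [← lintegral_tsum (fun g => (hF0 g).enorm.aemeasurable)]
    refine lintegral_congr fun u => ?_
    simp_rw [enorm_mul]
    rw [ENNReal.tsum_mul_right]
    have : ∀ g, ‖(K (act g⁻¹ u) : ℂ)‖ₑ = ofReal (K (act g⁻¹ u)) := by
      intro g
      rw [← ofReal_norm]
      simp [abs_of_nonneg (hK0 _)]
    simp_rw [this]
    rw [← ENNReal.ofReal_tsum_of_nonneg (fun g => hK0 _) (hK1' u).summable, (hK1' u).tsum_eq]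
    simp
  have hfin : ∑' g, ∫⁻ u, ‖(K u : ℂ) * φ (act g u)‖ₑ ∂μ ≠ ⊤ := by
    rw [hs]
    exact hφ.2.ne
  have e2 : (fun y => (K y : ℂ) * ∑' g, φ (act g y)) = fun y => ∑' g, (K y : ℂ) * φ (act g y) := by
    funext y
    rw [tsum_mul_left]
  rw [e2]
  constructor
  · refine ⟨(Measurable.tsum hF).aestronglyMeasurable, ?_⟩
    have : ∫⁻ u, ‖∑' g, (K u : ℂ) * φ (act g u)‖ₑ ∂μ ≤ ∫⁻ u, ‖φ u‖ₑ ∂μ := by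
      rw [← hs, ← lintegral_tsum (fun g => (hF g).enorm.aemeasurable)]
      exact lintegral_mono fun u => enorm_tsum_le_tsum_enorm
    exact lt_of_le_of_lt this hφ.2
  · rw [integral_tsum (fun g => (hF g).aestronglyMeasurable) hfin]
    have : ∀ g, ∫ u, (K u : ℂ) * φ (act g u) ∂μ = ∫ u, (K (act g⁻¹ u) : ℂ) * φ u ∂μ := by
      intro g
      have := integral_map (μ := μ) (φ := act g) (hmp g).measurable.aemeasurable
        (f := fun u => (K (act g⁻¹ u) : ℂ) * φ u) (hF0 g).aestronglyMeasurable
      rw [(hmp g).map_eq] at this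
      rw [this]
      simp [hinv]
    simp_rw [this]
    rw [← integral_tsum (fun g => (hF0 g).aestronglyMeasurable)]
    · refine integral_congr_ae (Filter.Eventually.of_forall fun u => ?_)
      simp only
      rw [tsum_mul_right, ← Complex.ofReal_tsum, (hK1' u).tsum_eq]
      simp
    · have : ∀ g, ∫⁻ u, ‖(K u : ℂ) * φ (act g u)‖ₑ ∂μ = ∫⁻ u, ‖(K (act g⁻¹ u) : ℂ) * φ u‖ₑ ∂μ := by
        intro g
        rw [← (hmp g).lintegral_comp (hF0 g).enorm]
        simp [hinv]
      simp_rw [← this]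
      exact hfin
instance sl2_countable : Countable (SL2Z) := by
  have : Countable (Matrix (Fin 2) (Fin 2) ℤ) := inferInstanceAs (Countable (Fin 2 → Fin 2 → ℤ))
  exact Subtype.countable
theorem sl2_mp (g : SL2Z) :
    MeasurePreserving (fun z : ℍℍ => g • z) volume volume :=
  measurePreserving_smul (g : GL (Fin 2) ℝ) (volume : Measure ℍℍ)
theorem hyν_Ioi (t : ℝ) (ht : 0 < t) : hyν (Ioi t) = ofReal (1 / t) := by
  unfold hyν
  rw [withDensity_apply _ measurableSet_Ioi, Measure.restrict_restrict measurableSet_Ioi]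
  have : Ioi t ∩ Ioi 0 = Ioi t := by
    ext x; simp; intro h; linarith
  rw [this, ← ofReal_integral_eq_lintegral_ofReal]
  · congr 1
    have h := integral_Ioi_rpow_of_lt (a := -2) bnum ht
    rw [show (1:ℝ) / t = -t ^ ((-2:ℝ) + 1) / (-2 + 1) by
      norm_num; rw [rpow_neg_one], ← h]
    refine setIntegral_congr_fun measurableSet_Ioi fun x hx => ?_
    have : 0 < x := lt_trans ht hx
    show 1 / x ^ 2 = x ^ (-2 : ℝ)
    rw [rpow_neg this.le]; norm_num
  · refine (integrableOn_Ioi_rpow_of_lt (a := -2) bnum ht).congr_fun (fun x hx => ?_) measurableSet_Ioi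
    have : 0 < x := lt_trans ht hx
    show x ^ (-2 : ℝ) = 1 / x ^ 2
    rw [rpow_neg this.le]; norm_num
  · exact Filter.Eventually.of_forall fun x => by positivity
theorem fd_vol : (volume : Measure ℍℍ) ModularGroup.fd ≤ 2 := by
  have hfd : MeasurableSet ModularGroup.fd := isClosed_fd.measurableSet
  have : SFinite hyν := by unfold hyν; infer_instance
  rw [hy_volume, Measure.map_apply hpt_meas hfd]
  have hn : ∀ᵐ p : ℝ × ℝ ∂(volume.prod hyν), 0 < p.2 := by
    have : ∀ᵐ y ∂hyν, 0 < y := by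
      unfold hyν
      refine withDensity_absolutelyContinuous _ _ ?_
      exact ae_restrict_mem measurableSet_Ioi
    exact Measure.quasiMeasurePreserving_snd.ae this
  have h3 : ((volume : Measure ℝ).prod hyν) (hpt ⁻¹' ModularGroup.fd) ≤ ((volume : Measure ℝ).prod hyν) (Set.Icc (-1/2:ℝ) (1/2) ×ˢ Ioi (1/2:ℝ)) := by
    refine measure_mono_ae ?_
    filter_upwards [hn] with p hp hpf
    have hpf : hpt p ∈ ModularGroup.fd := hpf
    have h1 := ModularGroup.three_le_four_mul_im_sq_of_mem_fd hpf
    have h2 := hpf.2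
    obtain ⟨x, y⟩ := p
    rw [hpt_im x y hp] at h1
    rw [hpt_re x y hp] at h2
    simp only at hp
    show (x, y) ∈ (Set.Icc (-1/2:ℝ) (1/2) ×ˢ Ioi (1/2:ℝ))
    simp only [mem_prod, Set.mem_Icc, Set.mem_Ioi]
    rw [abs_le] at h2
    exact ⟨⟨by linarith [h2.1], by linarith [h2.2]⟩, by nlinarith⟩
  refine h3.trans ?_
  rw [Measure.prod_prod, hyν_Ioi _ bnum, volume_Icc]
  norm_num
open ModularGroup in
theorem fd_fin (z : ℍℍ) : {g : SL2Z | g • z ∈ fd}.Finite := by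
  obtain ⟨g0, h0⟩ := exists_smul_mem_fd z
  have hfin : ({1, T, T⁻¹, S, T * S, T⁻¹ * S * T⁻¹, S * T⁻¹, S * T, T * S * T, T⁻¹ * S} :
    Set (SL2Z)).Finite := by simp
  refine ((hfin.union (hfin.image (fun g => -g))).image (· * g0)).subset ?_
  intro g hg
  have hg : g • z ∈ fd := hg
  refine ⟨g * g0⁻¹, ?_, by simp⟩
  have h2 : (g * g0⁻¹) • (g0 • z) ∈ fd := by
    rw [smul_smul]; simpa using hg
  have := cases_of_mem_fd_smul_mem_fd h0 h2
  generalize g * g0⁻¹ = x at this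
  simp only [Set.mem_union, Set.mem_image, Set.mem_insert_iff, Set.mem_singleton_iff]
  rcases this with h | h | h | h | h | h | h | h | h | h
  · rcases h with rfl | rfl
    · simp
    · right; exact ⟨1, by simp, rfl⟩
  all_goals
    rcases h.1 with rfl | rfl
    · simp
    · right; exact ⟨_, by simp, rfl⟩
noncomputable def fdN (z : ℍℍ) : ℝ :=
  ∑' g : SL2Z, Set.indicator ModularGroup.fd (fun _ => (1:ℝ)) (g • z)
theorem fdN_hasSum (z : ℍℍ) :
    HasSum (fun g : SL2Z => Set.indicator ModularGroup.fd (fun _ => (1:ℝ)) (g • z)) (fdN z) := by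
  refine Summable.hasSum (summable_of_ne_finset_zero (s := (fd_fin z).toFinset) ?_)
  intro g hg
  simp at hg
  simp [hg]
theorem fdN_one_le (z : ℍℍ) : 1 ≤ fdN z := by
  obtain ⟨g0, h0⟩ := ModularGroup.exists_smul_mem_fd z
  have := le_hasSum (fdN_hasSum z) g0 (fun g _ => indicator_nonneg (by simp) _)
  rwa [indicator_of_mem h0] at this
theorem fdN_smul (h : SL2Z) (z : ℍℍ) : fdN (h • z) = fdN z := by
  unfold fdN
  rw [← (mulRight h).tsum_eq (fun g : SL2Z => Set.indicator ModularGroup.fd (fun _ => (1:ℝ)) (g • z))]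
  refine tsum_congr fun g => ?_
  simp only [coe_mulRight, mul_smul]
theorem fdN_meas : Measurable fdN := by
  unfold fdN
  refine Measurable.tsum fun g => ?_
  exact (measurable_const.indicator isClosed_fd.measurableSet).comp (sl2_mp g).measurable
noncomputable def fdK (z : ℍℍ) : ℝ := Set.indicator ModularGroup.fd (fun _ => (1:ℝ)) z / fdN z
theorem fdK_meas : Measurable fdK :=
  (measurable_const.indicator isClosed_fd.measurableSet).div fdN_meas
theorem fdK_nonneg (z : ℍℍ) : 0 ≤ fdK z :=
  div_nonneg (indicator_nonneg (by simp) _) (by linarith [fdN_one_le z])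
theorem fdK_hasSum (z : ℍℍ) :
    HasSum (fun g : SL2Z => fdK (g • z)) 1 := by
  have h := (fdN_hasSum z).div_const (fdN z)
  rw [div_self (by linarith [fdN_one_le z])] at h
  simpa only [fdK, fdN_smul] using h
theorem fdK_lint : ∫⁻ z, ofReal (fdK z) ≤ 2 := by
  calc ∫⁻ z, ofReal (fdK z) ≤ ∫⁻ z, Set.indicator ModularGroup.fd (fun _ => (1:ENNReal)) z := by
        refine lintegral_mono fun z => ?_
        by_cases h : z ∈ ModularGroup.fd
        · simp [fdK, h]
          exact inv_le_one_of_one_le₀ (fdN_one_le z)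
        · simp [fdK, h]
    _ = volume ModularGroup.fd := by
        rw [lintegral_indicator isClosed_fd.measurableSet]; simp
    _ ≤ 2 := fd_vol
theorem kq_exists (Γ : Subgroup (SL2Z)) [Γ.FiniteIndex] :
    ∃ K : ℍℍ → ℝ, (∀ z, 0 ≤ K z) ∧ Measurable K ∧
      (∀ z, HasSum (fun γ : Γ => K (γ • z)) 1) ∧ ∫⁻ z, ofReal (K z) ≤ 2 * Γ.index := by
  classical
  have : Fintype (SL2Z ⧸ Γ) := Subgroup.fintypeQuotientOfFiniteIndex
  refine ⟨fun z => ∑ i : SL2Z ⧸ Γ, fdK (i.out • z), ?_, ?_, ?_, ?_⟩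
  · exact fun z => sum_nonneg fun i _ => fdK_nonneg _
  · exact Finset.measurable_sum _ fun i _ => fdK_meas.comp (sl2_mp i.out).measurable
  · intro z
    let e : Γ × (SL2Z ⧸ Γ) → SL2Z :=
      fun p => p.2.out * p.1
    have he : Function.Bijective e := by
      constructor
      · rintro ⟨γ, i⟩ ⟨γ', i'⟩ h
        have h : i.out * γ = i'.out * γ' := h
        have hi : i = i' := by
          rw [← Quotient.out_eq' i, ← Quotient.out_eq' i']; refine QuotientGroup.eq.2 ?_
          have : (i.out)⁻¹ * i'.out = γ * γ'⁻¹ := by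
            rw [inv_mul_eq_iff_eq_mul, ← mul_assoc, h]; simp
          rw [this]
          exact Γ.mul_mem γ.2 (Γ.inv_mem γ'.2)
        subst hi
        have := mul_left_cancel h
        ext1
        · exact Subtype.ext this
        · rfl
      · intro g
        have hm : ((g : SL2Z ⧸ Γ).out)⁻¹ * g ∈ Γ := by
          rw [← QuotientGroup.eq]
          exact Quotient.out_eq' _
        exact ⟨⟨⟨_, hm⟩, g⟩, by simp [e]⟩
    have h1 := (Equiv.ofBijective e he).hasSum_iff.2 (fdK_hasSum z)
    have h2 := h1.prod_fiberwise (g := fun γ => ∑ i : SL2Z ⧸ Γ, fdK (i.out • (γ • z)))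
      (fun γ => by
        have := hasSum_fintype (fun i : SL2Z ⧸ Γ => fdK (i.out • (γ • z)))
        convert this using 2 with i
        simp only [Function.comp, Equiv.ofBijective_apply, e]
        rw [mul_smul]; rfl)
    exact h2
  · have : ∀ z, ofReal (∑ i : SL2Z ⧸ Γ, fdK (i.out • z))
      = ∑ i : SL2Z ⧸ Γ, ofReal (fdK (i.out • z)) :=
      fun z => ENNReal.ofReal_sum_of_nonneg fun i _ => fdK_nonneg _
    simp_rw [this]
    have hm : Measurable (fun z => ofReal (fdK z)) := measurable_ofReal.comp fdK_meas
    rw [lintegral_finsetSum (μ := (volume : Measure ℍℍ)) univ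
      (f := fun (i : SL2Z ⧸ Γ) z => ofReal (fdK (i.out • z)))
      (fun i _ => hm.comp (sl2_mp i.out).measurable)]
    have : ∀ i : SL2Z ⧸ Γ, ∫⁻ z, ofReal (fdK (i.out • z)) = ∫⁻ z, ofReal (fdK z) :=
      fun i => (sl2_mp i.out).lintegral_comp hm
    simp_rw [this]
    rw [sum_const, Subgroup.index, card_eq_fintype_card, card_univ, nsmul_eq_mul, mul_comm]
    gcongr
    exact fdK_lint
theorem le_tau_phi (q : ℕ) (hq : q ≠ 0) : q ≤ q.divisors.card * q.totient := by
  calc q = ∑ d ∈ q.divisors, d.totient := (Nat.sum_totient q).symm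
    _ ≤ ∑ d ∈ q.divisors, q.totient := sum_le_sum fun d hd =>
        le_of_dvd (totient_pos.2 (Nat.pos_of_ne_zero hq)) (Nat.totient_dvd_of_dvd (dvd_of_mem_divisors hd))
    _ = _ := by simp
theorem gamma0_index (q : ℕ) (hq : q ≠ 0) :
    (Gamma0 q).index ≤ q * q.divisors.card := by
  classical
  have : NeZero q := ⟨hq⟩
  let Γ := Gamma0 q
  have : Fintype (SL2Z ⧸ Γ) := Subgroup.fintypeQuotientOfFiniteIndex
  have key : Γ.index * q.totient ≤ q * q := by
    let e : (SL2Z ⧸ Γ) × (ZMod q)ˣ → ZMod q × ZMod q := fun p =>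
      ((p.2 : ZMod q) * (p.1.out⁻¹ 1 0 : ℤ), (p.2 : ZMod q) * (p.1.out⁻¹ 1 1 : ℤ))
    have he : Function.Injective e := by
      rintro ⟨i, u⟩ ⟨i', u'⟩ h
      simp only [e, Prod.mk.injEq] at h
      obtain ⟨h1, h2⟩ := h
      have hi : i = i' := by
        rw [← Quotient.out_eq' i, ← Quotient.out_eq' i']
        refine QuotientGroup.eq.2 ?_
        rw [Gamma0_mem]
        have e1 : (i.out⁻¹ * i'.out) 1 0 = i.out⁻¹ 1 0 * i'.out⁻¹ 1 1 - i.out⁻¹ 1 1 * i'.out⁻¹ 1 0 := by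
          generalize i.out⁻¹ = A
          obtain ⟨B, hB⟩ : ∃ B, i'.out⁻¹ = B := ⟨_, rfl⟩
          have : i'.out = B⁻¹ := by rw [← hB]; simp
          rw [hB, this]
          show ((A * B⁻¹ : SL2Z) : Matrix (Fin 2) (Fin 2) ℤ) 1 0 =
            (A : Matrix (Fin 2) (Fin 2) ℤ) 1 0 * (B : Matrix (Fin 2) (Fin 2) ℤ) 1 1 - (A : Matrix (Fin 2) (Fin 2) ℤ) 1 1 * (B : Matrix (Fin 2) (Fin 2) ℤ) 1 0
          rw [Matrix.SpecialLinearGroup.coe_mul, Matrix.SpecialLinearGroup.coe_inv, Matrix.adjugate_fin_two]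
          simp [Matrix.mul_apply, Fin.sum_univ_two]
          ring
        have e2 : (u : ZMod q) * ((i.out⁻¹ * i'.out) 1 0 : ℤ) = 0 := by
          rw [e1]; push_cast
          have hu : IsUnit (u' : ZMod q) := u'.isUnit
          refine hu.mul_left_cancel ?_
          linear_combination (u' : ZMod q) * (i'.out⁻¹ 1 1 : ℤ) * h1 - (u' : ZMod q) * (i'.out⁻¹ 1 0 : ℤ) * h2
        exact (Units.mul_right_eq_zero u).1 e2
      subst hi
      have hdet : ((i.out⁻¹ 0 0 : ℤ) : ZMod q) * (i.out⁻¹ 1 1 : ℤ) - (i.out⁻¹ 0 1 : ℤ) * (i.out⁻¹ 1 0 : ℤ) = 1 := by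
        have := Matrix.SpecialLinearGroup.det_coe (i.out⁻¹)
        rw [det_fin_two] at this
        exact_mod_cast congrArg (Int.cast : ℤ → ZMod q) this
      have : u = u' := by
        ext
        linear_combination (-(u : ZMod q) + u') * hdet + ((i.out⁻¹ 0 0 : ℤ) : ZMod q) * h2 - ((i.out⁻¹ 0 1 : ℤ) : ZMod q) * h1
      rw [this]
    have := Fintype.card_le_of_injective e he
    rw [card_prod, card_prod, ZMod.card_units_eq_totient, ZMod.card] at this
    rwa [Subgroup.index, card_eq_fintype_card]
  have hφ := totient_pos.2 (Nat.pos_of_ne_zero hq)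
  refine Nat.le_of_mul_le_mul_right ?_ hφ
  refine key.trans ?_
  rw [mul_assoc]
  exact Nat.mul_le_mul_left _ (le_tau_phi q hq)
noncomputable def Ff (a : ℕ → ℂ) (z : ℍℍ) : ℂ :=
  ∑' n : ℕ, a (n + 1) * exp (τI * (n + 1) * (z : ℂ))
noncomputable def Fo (κ : ℕ) (a : ℕ → ℂ) (z : ℍℍ) : ℂ := (z.im : ℂ) ^ κ * Ff a z
theorem ff_slash (κ : ℕ) (a : ℕ → ℂ) (h : IsNormalizedHeckeEigenform (2 * κ) a)
    (γ : SL2Z) (z : ℍℍ) :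
    Ff a (γ • z) = (UpperHalfPlane.denom γ z) ^ (2 * κ) * Ff a z := by
  obtain ⟨_, _, ⟨F, _, hF⟩, _⟩ := h
  have hF' : ∀ z, F z = Ff a z := hF
  rw [← hF', ← hF']
  have := SlashInvariantForm.slash_action_eqn_SL'' F (CongruenceSubgroup.mem_Gamma_one γ) z
  exact_mod_cast this
theorem fo_slash (κ : ℕ) (a : ℕ → ℂ) (h : IsNormalizedHeckeEigenform (2 * κ) a)
    (γ : SL2Z) (z : ℍℍ) :
    Fo κ a (γ • z) = (UpperHalfPlane.denom γ z / ‖UpperHalfPlane.denom γ z‖) ^ (2 * κ) * Fo κ a z := by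
  unfold Fo
  rw [ff_slash κ a h γ z, im_smul_eq_div_normSq, normSq_eq_norm_sq]
  have := denom_ne_zero γ z
  have h2 : (‖UpperHalfPlane.denom γ z‖ : ℂ) ≠ 0 := by exact_mod_cast norm_ne_zero_iff.2 this
  push_cast
  rw [div_pow, div_pow, ← pow_mul]
  field_simp
theorem ff_cont (κ : ℕ) (a : ℕ → ℂ) (h : IsNormalizedHeckeEigenform (2 * κ) a) : Continuous (Ff a) := by
  obtain ⟨_, _, ⟨F, _, hF⟩, _⟩ := h
  have hF' : ⇑F = Ff a := funext hF
  rw [← hF']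
  exact (ModularFormClass.holo F).continuous
theorem fo_cont (κ : ℕ) (a : ℕ → ℂ) (h : IsNormalizedHeckeEigenform (2 * κ) a) : Continuous (Fo κ a) :=
  ((continuous_ofReal.comp continuous_im).pow _).mul (ff_cont κ a h)
theorem fo_bdd (κ : ℕ) (a : ℕ → ℂ) (h : IsNormalizedHeckeEigenform (2 * κ) a) :
    ∃ B, ∀ z, ‖Fo κ a z‖ ≤ B := by
  obtain ⟨_, _, ⟨F, _, hF⟩, _⟩ := h
  have hF' : ∀ z, F z = Ff a z := hF
  obtain ⟨C, hC⟩ := CuspFormClass.exists_bound (f := F)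
  refine ⟨C, fun z => ?_⟩
  have := hC z
  rw [hF'] at this
  unfold Fo
  rw [norm_mul, norm_pow, norm_real, norm_of_nonneg z.im_pos.le]
  have hz : z.im ^ (((2 * κ : ℕ) : ℤ) / 2 : ℝ) = z.im ^ κ := by
    rw [← rpow_natCast]; congr 1; push_cast; ring
  rw [hz, le_div_iff₀ (pow_pos z.im_pos _)] at this
  linarith
theorem ff_term_norm (a : ℕ → ℂ) (z : ℍℍ) (n : ℕ) :
    ‖a (n + 1) * exp (τI * (n + 1) * (z : ℂ))‖
      = ‖a (n + 1)‖ * Real.exp (-(2 * pi * (n + 1) * z.im)) := by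
  rw [norm_mul, norm_exp]
  congr 2
  simp [mul_assoc]
theorem ff_summable (κ : ℕ) (a : ℕ → ℂ) (h : IsNormalizedHeckeEigenform (2 * κ) a) (y : ℝ) (hy : 0 < y) :
    Summable (fun n : ℕ => ‖a (n + 1)‖ * Real.exp (-(2 * pi * (n + 1) * y))) := by
  have hne : ∃ z, Ff a z ≠ 0 := by
    obtain ⟨_, _, ⟨F, hF0, hF⟩, _⟩ := h
    by_contra! hcon
    apply hF0
    ext z
    rw [hF]
    exact hcon z
  obtain ⟨z0, hz0⟩ := hne
  obtain ⟨m, hm⟩ : ∃ m : ℕ, z0.im / (z0.re + m) ^ 2 ≤ y ∧ 0 < z0.re + m := by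
    obtain ⟨m, hm⟩ := exists_nat_gt (z0.im / y + 1 - z0.re)
    have h1 : 0 < z0.im / y := div_pos z0.im_pos hy
    have h2 : z0.im / y + 1 < z0.re + m := by linarith
    refine ⟨m, ?_, by linarith⟩
    rw [div_le_iff₀ (by nlinarith)]
    have : z0.im / y * y = z0.im := by field_simp
    nlinarith [mul_le_mul_of_nonneg_left (show z0.im / y ≤ (z0.re + m) ^ 2 by nlinarith) hy.le]
  let γ := ModularGroup.S * ModularGroup.T ^ m
  have hnz : Ff a (γ • z0) ≠ 0 := by
    rw [ff_slash κ a h]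
    exact mul_ne_zero (pow_ne_zero _ (denom_ne_zero _ _)) hz0
  have him : (γ • z0).im ≤ y := by
    refine le_trans ?_ hm.1
    have hT : (ModularGroup.T ^ m • z0) = (m : ℝ) +ᵥ z0 := by
      simpa using modular_T_zpow_smul z0 m
    rw [show γ • z0 = ModularGroup.S • (ModularGroup.T ^ m • z0) from mul_smul _ _ _, hT,
      UpperHalfPlane.modular_S_smul]
    rw [← coe_im, UpperHalfPlane.coe_mk]
    rw [Complex.inv_im]
    simp only [coe_vadd, normSq_apply, Complex.neg_im, Complex.neg_re, Complex.add_im, Complex.ofReal_im, Complex.add_re, Complex.ofReal_re, coe_re, coe_im, zero_add, neg_neg]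
    refine div_le_div_of_nonneg_left z0.im_pos.le (pow_pos hm.2 2) ?_
    nlinarith [sq_nonneg z0.im]
  have hs : Summable (fun n : ℕ => a (n + 1) * exp (τI * (n + 1) * ((γ • z0 : ℍℍ) : ℂ))) := by
    by_contra hcon
    exact hnz (tsum_eq_zero_of_not_summable hcon)
  have hs2 := hs.norm
  refine Summable.of_nonneg_of_le (fun n => by positivity) (fun n => ?_) hs2
  rw [ff_term_norm]
  gcongr
noncomputable def lam (κ : ℕ) (a : ℕ → ℂ) (n : ℕ) : ℂ := heckeLambda (2 * κ) a (n : ℤ)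
noncomputable def r0 (κ : ℕ) (s : ℝ) : ℝ := s ^ κ * Real.exp (-(2 * pi * s))
theorem lam_zero (κ : ℕ) (a : ℕ → ℂ) : lam κ a 0 = 0 := by simp [lam, heckeLambda]
theorem lam_eq (κ : ℕ) (a : ℕ → ℂ) (n : ℕ) (hn : 1 ≤ n) :
    lam κ a n = a n * ((n : ℝ) ^ (-((κ : ℝ) - 1 / 2)) : ℝ) := by
  unfold lam heckeLambda
  rw [if_pos (by exact_mod_cast hn)]
  simp only [toNat_natCast]
  congr 3
  push_cast; ring
theorem lam_hecke (κ : ℕ) (a : ℕ → ℂ) (h : IsNormalizedHeckeEigenform (2 * κ) a) (m n : ℕ) (hm : 1 ≤ m) (hn : 1 ≤ n) :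
    lam κ a m * lam κ a n = ∑ d ∈ (Nat.gcd m n).divisors, lam κ a (m * n / d ^ 2) := by
  have hk : 12 ≤ 2 * κ := h.2.1
  have hh := h.2.2.2.2 m n hm hn
  rw [lam_eq κ a m hm, lam_eq κ a n hn]
  have e1 : a m * ((m : ℝ) ^ (-((κ : ℝ) - 1 / 2)) : ℝ) * (a n * ((n : ℝ) ^ (-((κ : ℝ) - 1 / 2)) : ℝ))
    = (a m * a n) * (((m * n : ℝ) ^ (-((κ : ℝ) - 1 / 2)) : ℝ) : ℂ) := by
    rw [mul_rpow bpos bpos]; push_cast; ring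
  rw [e1, hh, sum_mul]
  refine sum_congr rfl fun d hd => ?_
  have hd' := dvd_of_mem_divisors hd
  have hd0 : 0 < d := pos_of_mem_divisors hd
  obtain ⟨u, hu⟩ := hd'.trans (Nat.gcd_dvd_left m n)
  obtain ⟨v, hv⟩ := hd'.trans (Nat.gcd_dvd_right m n)
  have hu0 : 1 ≤ u := by
    rcases Nat.eq_zero_or_pos u with h | h
    · simp [h] at hu; omega
    · exact h
  have hv0 : 1 ≤ v := by
    rcases Nat.eq_zero_or_pos v with h | h
    · simp [h] at hv; omega
    · exact h
  have e2 : m * n / d ^ 2 = u * v := by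
    rw [hu, hv, show d * u * (d * v) = u * v * d ^ 2 by ring]
    exact Nat.mul_div_cancel _ bpos
  rw [e2, lam_eq κ a _ (Nat.mul_pos hu0 hv0)]
  have e3 : ((m * n : ℝ) ^ (-((κ : ℝ) - 1 / 2)) : ℝ) = (d : ℝ) ^ (-(2 * (κ : ℝ) - 1)) * ((u * v : ℕ) : ℝ) ^ (-((κ : ℝ) - 1 / 2)) := by
    rw [hu, hv]; push_cast
    rw [show (d : ℝ) * u * (d * v) = d ^ (2:ℝ) * (u * v) by norm_num; ring,
      mul_rpow bpos bpos, ← rpow_mul bpos]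
    congr 2; ring
  have e4 : (d : ℝ) ^ (-(2 * (κ : ℝ) - 1)) = ((d : ℝ) ^ (2 * κ - 1))⁻¹ := by
    rw [rpow_neg bpos, ← rpow_natCast, cast_sub bomg]
    push_cast; rfl
  rw [e3, e4]
  push_cast
  have : (d : ℂ) ≠ 0 := by exact_mod_cast hd0.ne'
  field_simp
theorem fo_term (κ : ℕ) (a : ℕ → ℂ) (z : ℍℍ) (n : ℕ) :
    (z.im : ℂ) ^ κ * (a (n + 1) * exp (τI * (n + 1) * (z : ℂ))) =
     lam κ a (n + 1) * ((r0 κ ((n + 1) * z.im) / √(n + 1) : ℝ) : ℂ) * exp (τI * (n + 1) * z.re) := by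
  rw [lam_eq κ a _ bomg]
  have e1 : exp (τI * (n + 1) * (z : ℂ)) =
    (Real.exp (-(2 * pi * ((n + 1) * z.im))) : ℝ) * exp (τI * (n + 1) * z.re) := by
    rw [Complex.ofReal_exp, ← exp_add]
    congr 1
    have : (z : ℂ) = z.re + z.im * Complex.I := by
      rw [← coe_re, ← coe_im]; exact (re_add_im _).symm
    rw [this]
    push_cast
    linear_combination (2 * pi * (n + 1) * z.im) * Complex.I_sq
  rw [e1]
  have e2 : ((n + 1 : ℕ) : ℝ) ^ (-((κ : ℝ) - 1 / 2)) = √(n + 1) / (n + 1 : ℝ) ^ κ := by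
    rw [show -((κ : ℝ) - 1 / 2) = 1 / 2 - κ by ring, Real.rpow_sub bpos, rpow_natCast,
      ← sqrt_eq_rpow]
    push_cast; rfl
  rw [e2]
  unfold r0
  have h1 : (√((n : ℝ) + 1) : ℂ) ≠ 0 := by
    exact_mod_cast (sqrt_pos.2 bpos).ne'
  have h2 : ((n : ℂ) + 1) ≠ 0 := by exact_mod_cast Nat.succ_ne_zero n
  push_cast
  rw [mul_pow]
  field_simp
theorem fo_term_norm (κ : ℕ) (a : ℕ → ℂ) (y : ℝ) (hy : 0 < y) (n : ℕ) :
    ‖lam κ a (n + 1)‖ * (r0 κ ((n + 1) * y) / √(n + 1)) = y ^ κ * (‖a (n + 1)‖ * Real.exp (-(2 * pi * (n + 1) * y))) := by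
  have h := congrArg norm (fo_term κ a (hpt (0, y)) n)
  rw [norm_mul, ff_term_norm, hpt_im _ _ hy, hpt_re _ _ hy, norm_mul, norm_mul] at h
  have e1 : ‖exp (τI * (n + 1) * ((0:ℝ):ℂ))‖ = 1 := by simp
  have e2 : 0 ≤ r0 κ ((n + 1) * y) / √(n + 1) := by unfold r0; positivity
  rw [e1, norm_real, norm_of_nonneg e2, mul_one, norm_pow, norm_real, norm_of_nonneg hy.le] at h
  exact h.symm
theorem fo_summable (κ : ℕ) (a : ℕ → ℂ) (h : IsNormalizedHeckeEigenform (2 * κ) a) (y : ℝ) (hy : 0 < y) :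
    Summable (fun n : ℕ => ‖lam κ a (n + 1)‖ * (r0 κ ((n + 1) * y) / √(n + 1))) := by
  simp_rw [fo_term_norm κ a y hy]
  exact (ff_summable κ a h y hy).mul_left _
theorem fo_fourier (κ : ℕ) (a : ℕ → ℂ) (h : IsNormalizedHeckeEigenform (2 * κ) a) (z : ℍℍ) :
    HasSum (fun n : ℕ => lam κ a (n + 1) * ((r0 κ ((n + 1) * z.im) / √(n + 1) : ℝ) : ℂ) * exp (τI * (n + 1) * z.re)) (Fo κ a z) := by
  simp_rw [← fo_term]
  refine HasSum.mul_left _ ?_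
  refine Summable.hasSum ?_
  refine Summable.of_norm ?_
  simp_rw [ff_term_norm]
  exact ff_summable κ a h z.im z.im_pos
theorem e_int (N : ℤ) : ∫ x in Ico (0:ℝ) 1, exp (τI * N * x) = if N = 0 then 1 else 0 := by
  rw [integral_Ico_eq_integral_Ioc, ← intervalIntegral.integral_of_le zero_le_one]
  split_ifs with h
  · simp [h]
  · have hc : 2 * pi * Complex.I * N ≠ 0 := by
      simp [Complex.I_ne_zero, Real.pi_ne_zero, h]
    rw [integral_exp_mul_complex hc]
    have : exp (τI * N * (1:ℝ)) = 1 := by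
      rw [exp_eq_one_iff]
      exact ⟨N, by push_cast; ring⟩
    rw [this]; simp
theorem lam_le_sup (κ : ℕ) (a : ℕ → ℂ) (h : IsNormalizedHeckeEigenform (2 * κ) a) (B : ℝ)
    (hB : ∀ z, ‖Fo κ a z‖ ≤ B) (n : ℕ) (y : ℝ) (hy : 0 < y) :
    ‖lam κ a (n + 1)‖ * (r0 κ ((n + 1) * y) / √(n + 1)) ≤ B := by
  let c : ℕ → ℂ := fun n => lam κ a (n + 1) * ((r0 κ ((n + 1) * y) / √(n + 1) : ℝ) : ℂ)
  have hcn : ∀ n, ‖c n‖ = ‖lam κ a (n + 1)‖ * (r0 κ ((n + 1) * y) / √(n + 1)) := by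
    intro n
    have e2 : 0 ≤ r0 κ ((n + 1) * y) / √(n + 1) := by unfold r0; positivity
    simp only [c]
    rw [norm_mul, norm_real, norm_of_nonneg e2]
  have hcs : Summable (fun n => ‖c n‖) := by
    simp_rw [hcn]; exact fo_summable κ a h y hy
  let f : ℕ → ℝ → ℂ := fun m x => c m * exp (τI * ((m - n : ℤ) : ℂ) * x)
  have hfn : ∀ m x, ‖f m x‖ = ‖c m‖ := by
    intro m x
    simp only [f]
    rw [norm_mul, show 2 * pi * Complex.I * ((m - n : ℤ) : ℂ) * x = ((2 * pi * (m - n : ℤ) * x : ℝ) : ℂ) * Complex.I by push_cast; ring,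
      norm_exp_ofReal_mul_I, mul_one]
  have hfc : ∀ m, Continuous (f m) := by intro m; simp only [f]; fun_prop
  have hfI : ∀ m, Integrable (f m) (volume.restrict (Ico (0:ℝ) 1)) := by
    intro m
    exact ((hfc m).continuousOn.integrableOn_compact isCompact_Icc).mono_set Ico_subset_Icc_self
  have hsum := integral_tsum_of_summable_integral_norm (μ := volume.restrict (Ico (0:ℝ) 1)) hfI (by
    simp_rw [hfn]
    simpa using hcs)
  have hl : ∀ m, ∫ x in Ico (0:ℝ) 1, f m x = if m = n then c n else 0 := by
    intro m
    simp only [f]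
    rw [integral_const_mul, e_int]
    by_cases hm : m = n
    · simp [hm]
    · have : (m:ℤ) - n ≠ 0 := by omega
      simp [hm, this]
  simp_rw [hl] at hsum
  rw [tsum_ite_eq] at hsum
  rw [← hcn, hsum]
  calc _ ≤ B * (volume.restrict (Ico (0:ℝ) 1)).real Set.univ := by
        refine norm_integral_le_of_norm_le_const (Filter.Eventually.of_forall fun x => ?_)
        have h1 := (fo_fourier κ a h (hpt (x, y))).mul_right (exp (-(τI * (n + 1) * x)))
        rw [hpt_im _ _ hy, hpt_re _ _ hy] at h1
        have h2 : ∑' m, f m x = Fo κ a (hpt (x, y)) * exp (-(τI * (n + 1) * x)) := by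
          rw [← h1.tsum_eq]
          refine tsum_congr fun m => ?_
          simp only [f, c]
          rw [mul_assoc (lam κ a (m + 1) * _), ← exp_add]
          congr 2
          push_cast; ring
        rw [h2, norm_mul, show -(τI * (n + 1) * x) = ((-(2 * pi * (n + 1) * x) : ℝ) : ℂ) * Complex.I by push_cast; ring,
          norm_exp_ofReal_mul_I, mul_one]
        exact hB _
    _ = B := by simp
noncomputable def sk (κ : ℕ) : ℝ := κ / (2 * pi)
theorem r0_sk (κ : ℕ) : r0 κ (sk κ) = sk κ ^ κ * Real.exp (-κ) := by
  unfold r0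
  congr 2
  unfold sk
  field_simp
theorem r0_le_sk (m : ℕ) (hm : 1 ≤ m) (s : ℝ) (hs : 0 ≤ s) : r0 m s ≤ r0 m (sk m) := by
  rw [r0_sk]
  unfold r0
  have hm' : (0:ℝ) < m := by exact_mod_cast hm
  have hsk : 0 < sk m := by unfold sk; positivity
  have h1 : s / sk m ≤ Real.exp (s / sk m - 1) := by
    have := add_one_le_exp (s / sk m - 1); linarith
  have h2 : (s / sk m) ^ m ≤ Real.exp (2 * pi * s - m) := by
    calc (s / sk m) ^ m ≤ Real.exp (s / sk m - 1) ^ m := by gcongr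
      _ = _ := by
        rw [← exp_nat_mul]; congr 1; unfold sk; field_simp
  rw [div_pow, div_le_iff₀ bpos] at h2
  calc s ^ m * Real.exp (-(2 * pi * s)) ≤ (Real.exp (2 * pi * s - m) * sk m ^ m) * Real.exp (-(2 * pi * s)) := by gcongr
    _ = sk m ^ m * (Real.exp (2 * pi * s - m) * Real.exp (-(2 * pi * s))) := by ring
    _ = _ := by rw [← Real.exp_add]; congr 2; ring
theorem r0_sq (κ : ℕ) (hκ : 6 ≤ κ) (s : ℝ) (hs : 0 < s) : r0 κ s ≤ κ ^ 2 * r0 κ (sk κ) / s ^ 2 := by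
  rw [le_div_iff₀ bpos]
  have hκ' : (6:ℝ) ≤ κ := by exact_mod_cast hκ
  have hpi := pi_gt_three
  have h1 := r0_le_sk (κ + 2) bomg s hs.le
  have e1 : r0 κ s * s ^ 2 = r0 (κ + 2) s := by unfold r0; ring
  rw [e1]
  refine h1.trans ?_
  rw [r0_sk, r0_sk]
  have h2 : sk (κ + 2) = sk κ * (1 + 2 / κ) := by
    unfold sk; push_cast; field_simp
  have hsk : 0 < sk κ := by unfold sk; positivity
  have h3 : (1 + 2 / (κ:ℝ)) ^ κ ≤ Real.exp 2 := by
    calc (1 + 2 / (κ:ℝ)) ^ κ ≤ Real.exp (2 / κ) ^ κ := by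
          gcongr
          have := add_one_le_exp (2 / (κ:ℝ)); linarith
      _ = _ := by rw [← exp_nat_mul]; congr 1; field_simp
  have h4 : sk (κ + 2) ≤ κ := by
    unfold sk; push_cast
    rw [div_le_iff₀ bpos]
    nlinarith
  have h5 : 0 ≤ sk (κ + 2) := by unfold sk; positivity
  calc sk (κ + 2) ^ (κ + 2) * Real.exp (-((κ + 2 : ℕ) : ℝ))
      = sk (κ + 2) ^ 2 * (sk κ ^ κ * (1 + 2 / κ) ^ κ) * (Real.exp (-κ) * Real.exp (-2)) := by
        rw [pow_add, ← Real.exp_add]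
        nth_rw 1 [h2]
        rw [mul_pow]
        push_cast
        rw [show -((κ:ℝ) + 2) = -κ + -2 by ring]; ring
    _ ≤ κ ^ 2 * (sk κ ^ κ * Real.exp 2) * (Real.exp (-κ) * Real.exp (-2)) := by gcongr
    _ = κ ^ 2 * (sk κ ^ κ * Real.exp (-κ)) * (Real.exp 2 * Real.exp (-2)) := by ring
    _ = _ := by rw [← Real.exp_add]; simp
theorem inv_sq_div (n : ℕ) : ∑ d ∈ n.divisors, (1:ℝ) / (d:ℝ) ^ 2 ≤ 2 := by
  have h := sum_Ioo_inv_sq_le (α := ℝ) 0 (n + 1)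
  norm_num at h
  refine le_trans ?_ h
  simp_rw [one_div]
  refine sum_le_sum_of_subset_of_nonneg ?_ (fun _ _ _ => by positivity)
  intro d hd
  have h1 := pos_of_mem_divisors hd
  have h2 := divisor_le hd
  simp; omega
theorem lam_lin (κ : ℕ) (a : ℕ → ℂ) (h : IsNormalizedHeckeEigenform (2 * κ) a) (n : ℕ) (hn : 1 ≤ n) :
    ‖lam κ a n‖ ≤ 2 * n := by
  have hκ : 6 ≤ κ := by have := h.2.1; omega
  obtain ⟨B, hB⟩ := fo_bdd κ a h
  have hsk : 0 < sk κ := by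
    have : (6:ℝ) ≤ κ := by exact_mod_cast hκ
    unfold sk; have := pi_pos; positivity
  have hr : 0 < r0 κ (sk κ) := by unfold r0; positivity
  have hB0 : 0 ≤ B := (norm_nonneg _).trans (hB UpperHalfPlane.I)
  have h1 : ∀ n : ℕ, ‖lam κ a (n + 1)‖ / (n + 1) ≤ B / r0 κ (sk κ) := by
    intro n
    have h2 := lam_le_sup κ a h B hB n (sk κ / (n + 1)) bpos
    rw [show ((n:ℝ) + 1) * (sk κ / (n + 1)) = sk κ by field_simp] at h2
    rw [div_le_div_iff₀ bpos hr]
    have h3 : √((n:ℝ) + 1) ≤ n + 1 := by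
      rw [sqrt_le_left bpos]; nlinarith [(cast_nonneg n : (0:ℝ) ≤ n)]
    have h4 : 0 < √((n:ℝ) + 1) := sqrt_pos.2 bpos
    rw [← mul_div_assoc, div_le_iff₀ h4] at h2
    exact h2.trans (by gcongr)
  have hbdd : BddAbove (Set.range fun n : ℕ => ‖lam κ a (n + 1)‖ / (n + 1)) := ⟨_, by rintro _ ⟨n, rfl⟩; exact h1 n⟩
  set b := ⨆ n : ℕ, ‖lam κ a (n + 1)‖ / (n + 1) with hb
  have hle : ∀ n : ℕ, 1 ≤ n → ‖lam κ a n‖ ≤ b * n := by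
    intro n hn
    obtain ⟨m, rfl⟩ : ∃ m, n = m + 1 := ⟨n - 1, by omega⟩
    have := le_ciSup hbdd m
    rw [div_le_iff₀ bpos] at this
    push_cast; exact this
  have hb0 : 0 ≤ b := by
    have := (norm_nonneg _).trans (hle 1 le_rfl); simpa using this
  have hsq : ∀ n : ℕ, 1 ≤ n → ‖lam κ a n‖ ^ 2 ≤ 2 * b * n ^ 2 := by
    intro n hn
    have h2 := lam_hecke κ a h n n hn hn
    rw [Nat.gcd_self] at h2
    rw [sq, ← norm_mul, h2]
    calc ‖∑ d ∈ n.divisors, lam κ a (n * n / d ^ 2)‖ ≤ ∑ d ∈ n.divisors, b * n ^ 2 * (1 / (d:ℝ) ^ 2) := by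
          refine norm_sum_le_of_le _ fun d hd => ?_
          obtain ⟨u, hu⟩ := dvd_of_mem_divisors hd
          have hd0 := pos_of_mem_divisors hd
          have hu0 : 1 ≤ u := by
            rcases Nat.eq_zero_or_pos u with h | h
            · simp [h] at hu; omega
            · exact h
          have e : n * n / d ^ 2 = u * u := by
            rw [hu, show d * u * (d * u) = u * u * d ^ 2 by ring]
            exact Nat.mul_div_cancel _ bpos
          rw [e]
          have h7 := hle (u * u) (Nat.mul_pos hu0 hu0)
          refine h7.trans (le_of_eq ?_)
          rw [hu]; push_cast; field_simp
      _ = b * n ^ 2 * ∑ d ∈ n.divisors, (1 / (d:ℝ) ^ 2) := by rw [mul_sum]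
      _ ≤ b * n ^ 2 * 2 := by gcongr; exact inv_sq_div n
      _ = _ := by ring
  have hb2 : b ≤ √(2 * b) := by
    have hgoal : ∀ n : ℕ, ‖lam κ a (n + 1)‖ / (n + 1) ≤ √(2 * b) := by
     intro n
     rw [div_le_iff₀ bpos]
     have := hsq (n + 1) bomg
     refine (abs_le_of_sq_le_sq' ?_ (mul_nonneg (sqrt_nonneg _) bpos)).2
     rw [mul_pow, sq_sqrt bpos]
     push_cast at this; exact this
    exact ciSup_le hgoal
  have hb3 : b ≤ 2 := by
    rw [Real.le_sqrt hb0 bpos] at hb2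
    by_contra hc
    nlinarith
  exact (hle n hn).trans (by gcongr)
theorem fo_bound : ∃ C : ℝ, 1 ≤ C ∧ ∀ (κ : ℕ) (a : ℕ → ℂ), IsNormalizedHeckeEigenform (2 * κ) a →
    (∀ z, ‖Fo κ a z‖ ≤ C * κ ^ 2 * r0 κ (sk κ)) ∧ ∀ n : ℕ, 1 ≤ n → ‖lam κ a n‖ ≤ C * κ ^ 2 * √n := by
  have hsum : Summable (fun n : ℕ => (1:ℝ) / ((n + 1 : ℕ):ℝ) ^ (3/2:ℝ)) :=
    (summable_nat_add_iff 1).2 (Real.summable_one_div_nat_rpow.2 (by norm_num : (1:ℝ) < 3/2))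
  set S := ∑' n : ℕ, (1:ℝ) / ((n + 1 : ℕ):ℝ) ^ (3/2:ℝ) with hS
  have hS0 : 0 ≤ S := tsum_nonneg fun n => by positivity
  clear_value S
  refine ⟨8 * S + 1, by linarith, fun κ a h => ?_⟩
  have hκ : 6 ≤ κ := by have := h.2.1; omega
  have hκ' : (6:ℝ) ≤ κ := by exact_mod_cast hκ
  have hsk : 0 < sk κ := by
    unfold sk; have := pi_pos; positivity
  have hr : 0 < r0 κ (sk κ) := by unfold r0; positivity
  have hF : ∀ z, ‖Fo κ a z‖ ≤ (8 * S + 1) * κ ^ 2 * r0 κ (sk κ) := by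
    intro z
    obtain ⟨γ, hγ⟩ := ModularGroup.exists_one_half_le_im_smul z
    have e1 : ‖Fo κ a z‖ = ‖Fo κ a (γ • z)‖ := by
      rw [fo_slash κ a h, norm_mul, norm_pow, norm_div, norm_real, norm_norm,
        div_self (norm_ne_zero_iff.2 (denom_ne_zero γ z)), one_pow, one_mul]
    rw [e1]
    generalize γ • z = w at hγ
    rw [← (fo_fourier κ a h w).tsum_eq]
    have hb : ∀ n : ℕ, ‖lam κ a (n + 1) * ((r0 κ ((n + 1) * w.im) / √(n + 1) : ℝ) : ℂ) * exp (τI * (n + 1) * w.re)‖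
        ≤ 8 * κ ^ 2 * r0 κ (sk κ) * (1 / ((n + 1 : ℕ):ℝ) ^ (3/2:ℝ)) := by
      intro n
      have e2 : 0 ≤ r0 κ ((n + 1) * w.im) / √(n + 1) := by unfold r0; have := w.im_pos; positivity
      rw [norm_mul, norm_mul, show 2 * pi * Complex.I * (n + 1) * w.re = ((2 * pi * (n + 1) * w.re : ℝ) : ℂ) * Complex.I by push_cast; ring,
        norm_exp_ofReal_mul_I, mul_one, norm_real, norm_of_nonneg e2]
      have h1 := lam_lin κ a h (n + 1) bomg
      have h2 := r0_sq κ hκ ((n + 1) * w.im) (by have := w.im_pos; positivity)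
      have h3 : κ ^ 2 * r0 κ (sk κ) / ((n + 1) * w.im) ^ 2 ≤ κ ^ 2 * r0 κ (sk κ) / ((n + 1) * (1/2)) ^ 2 := by
        gcongr
      have e3 : ((n + 1 : ℕ):ℝ) ^ (3/2:ℝ) = (n + 1) * √(n + 1) := by
        rw [show (3/2:ℝ) = 1 + 1/2 by norm_num, rpow_add bpos, rpow_one, ← sqrt_eq_rpow]
        push_cast; rfl
      have h4 : 0 < √((n:ℝ) + 1) := sqrt_pos.2 bpos
      calc _ ≤ (2 * ((n + 1 : ℕ):ℝ)) * ((κ ^ 2 * r0 κ (sk κ) / ((n + 1) * (1/2)) ^ 2) / √(n + 1)) := by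
            gcongr
            exact h2.trans h3
        _ = _ := by rw [e3]; push_cast; field_simp; ring
    have h8 := tsum_of_norm_bounded (hsum.hasSum.mul_left (8 * κ ^ 2 * r0 κ (sk κ))) hb
    rw [← hS] at h8
    refine h8.trans ?_
    have h9 := mul_pos (pow_pos (show (0:ℝ) < κ by linarith) 2) hr
    linarith
  refine ⟨hF, fun n hn => ?_⟩
  obtain ⟨m, rfl⟩ : ∃ m, n = m + 1 := ⟨n - 1, by omega⟩
  have h2 := lam_le_sup κ a h ((8 * S + 1) * κ ^ 2 * r0 κ (sk κ)) hF m (sk κ / (m + 1)) bpos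
  rw [show ((m:ℝ) + 1) * (sk κ / (m + 1)) = sk κ by field_simp] at h2
  have h4 : 0 < √((m:ℝ) + 1) := sqrt_pos.2 bpos
  rw [← mul_div_assoc, div_le_iff₀ h4] at h2
  push_cast
  have h9 : ‖lam κ a (m + 1)‖ * r0 κ (sk κ) ≤ ((8 * S + 1) * κ ^ 2 * √(m + 1)) * r0 κ (sk κ) := by linarith
  exact le_of_mul_le_mul_right h9 hr
theorem cs_unfold {Γ Y : Type*} [Group Γ] [Countable Γ] [MeasurableSpace Y] {μ : Measure Y} (act : Γ → Y → Y)
    (hmp : ∀ g, MeasurePreserving (act g) μ μ) (hinv : ∀ g y, act g⁻¹ (act g y) = y)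
    (hmul : ∀ g g' y, act (g * g') y = act g (act g' y)) (K : Y → ℝ)
    (hK0 : ∀ y, 0 ≤ K y) (hKm : Measurable K) (hK1 : ∀ y, HasSum (fun g => K (act g y)) 1)
    (χ : Γ → Y → ℂ) (hχ1 : ∀ g y, ‖χ g y‖ = 1) (hχ : ∀ g g' y, χ (g * g') y = χ g (act g' y) * χ g' y)
    (W : Y → ℝ) (hW0 : ∀ y, 0 < W y) (hWm : Measurable W) (hW : ∀ g y, W (act g y) = W y)
    (f G : Y → ℂ) (hf : Measurable f) (hG : Measurable G) (hGχ : ∀ g y, G (act g y) = χ g y * G y)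
    (hχm : ∀ g, Measurable (χ g)) (hfG : Integrable (fun y => f y * G y) μ)
    (P : Y → ℂ) (hP : ∀ y, P y = ∑' g, χ g y * f (act g y))
    (hQ : Integrable (fun y => (W y : ℂ) ^ 2 * starRingEnd ℂ (f y) * P y) μ)
    (hV : Integrable (fun y => K y * ‖G y‖ ^ 2 / W y ^ 2) μ) :
    ‖∫ y, f y * G y ∂μ‖ ^ 2 ≤ (∫ y, K y * ‖G y‖ ^ 2 / W y ^ 2 ∂μ) *
      ‖∫ y, (W y : ℂ) ^ 2 * starRingEnd ℂ (f y) * P y ∂μ‖ := by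
  have hPm : Measurable P := by
    rw [show P = fun y => ∑' g, χ g y * f (act g y) from funext hP]
    exact Measurable.tsum fun g => (hχm g).mul (hf.comp (hmp g).measurable)
  have hPt : ∀ g y, P (act g y) * χ g y = P y := by
    intro g y
    rw [hP, hP, ← tsum_mul_right, ← (mulRight g).tsum_eq (fun g' => χ g' y * f (act g' y))]
    refine tsum_congr fun g' => ?_
    simp only [coe_mulRight]
    rw [hχ, hmul]; ring
  have h1 : ∀ y, (K y : ℂ) * ∑' g, f (act g y) * G (act g y) = K y * (P y * G y) := by
    intro y
    rw [hP, ← tsum_mul_right]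
    congr 1
    refine tsum_congr fun g => ?_
    rw [hGχ]; ring
  have h2 : ∀ y, (K y : ℂ) * ∑' g, ((W (act g y) : ℂ) ^ 2 * starRingEnd ℂ (f (act g y)) * P (act g y)) =
      ((K y * (W y ^ 2 * ‖P y‖ ^ 2) : ℝ) : ℂ) := by
    intro y
    have : ∀ g, ((W (act g y) : ℂ) ^ 2 * starRingEnd ℂ (f (act g y)) * P (act g y)) =
        (W y : ℂ) ^ 2 * P y * starRingEnd ℂ (χ g y * f (act g y)) := by
      intro g
      have h3 : starRingEnd ℂ (χ g y) * χ g y = 1 := by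
        rw [← Complex.normSq_eq_conj_mul_self, normSq_eq_norm_sq, hχ1]; simp
      rw [hW, ← hPt g y, map_mul]
      linear_combination (-(W y : ℂ) ^ 2 * P (act g y) * starRingEnd ℂ (f (act g y))) * h3
    simp_rw [this]
    rw [tsum_mul_left, ← Complex.conj_tsum, ← hP, mul_assoc ((W y : ℂ) ^ 2), Complex.mul_conj, normSq_eq_norm_sq]
    push_cast; ring
  obtain ⟨i1, e1⟩ := unfoldU act hmp hinv K hK0 hKm hK1 (fun y => f y * G y) (hf.mul hG) hfG
  obtain ⟨i2, e2⟩ := unfoldU act hmp hinv K hK0 hKm hK1 (fun y => (W y : ℂ) ^ 2 * starRingEnd ℂ (f y) * P y)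
    (((Complex.measurable_ofReal.comp hWm).pow_const 2).mul (continuous_conj.measurable.comp hf) |>.mul hPm) hQ
  simp_rw [h1] at i1 e1
  have e1' : ∫ y, f y * G y ∂μ = ∫ y, (K y : ℂ) * (P y * G y) ∂μ := by
    rw [← e1]
  have e2' : ∫ y, (W y : ℂ) ^ 2 * starRingEnd ℂ (f y) * P y ∂μ = ((∫ y, K y * (W y ^ 2 * ‖P y‖ ^ 2) ∂μ : ℝ) : ℂ) := by
    rw [← integral_complex_ofReal]; exact e2.trans (integral_congr_ae (Filter.Eventually.of_forall h2))
  have i3 : Integrable (fun y => K y * (W y ^ 2 * ‖P y‖ ^ 2)) μ := by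
    have i2' := i2.congr (Filter.Eventually.of_forall h2)
    exact i2'.re
  rw [e1', e2']
  set A := ‖∫ y, (K y : ℂ) * (P y * G y) ∂μ‖ with hA
  set V := ∫ y, K y * ‖G y‖ ^ 2 / W y ^ 2 ∂μ with hVV
  set Q := ∫ y, K y * (W y ^ 2 * ‖P y‖ ^ 2) ∂μ with hQQ
  have hQ0 : 0 ≤ Q := integral_nonneg fun y => mul_nonneg (hK0 y) bpos
  have hA0 : 0 ≤ A := norm_nonneg _
  have hV0 : 0 ≤ V := integral_nonneg fun y => div_nonneg (mul_nonneg (hK0 y) bpos) bpos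
  have key : ∀ t : ℝ, 2 * t * A ≤ t ^ 2 * V + Q := by
    intro t
    rcases le_or_gt t 0 with ht | ht
    · nlinarith [mul_nonneg (sq_nonneg t) hV0]
    · have : A ≤ ∫ y, (t / 2) * (K y * ‖G y‖ ^ 2 / W y ^ 2) + (1 / (2 * t)) * (K y * (W y ^ 2 * ‖P y‖ ^ 2)) ∂μ := by
        refine norm_integral_le_of_norm_le ((hV.const_mul _).add (i3.const_mul _)) (Filter.Eventually.of_forall fun y => ?_)
        rw [norm_mul, norm_mul, norm_real, norm_of_nonneg (hK0 y)]
        have hw := hW0 y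
        have : ‖P y‖ * ‖G y‖ ≤ t / 2 * (‖G y‖ ^ 2 / W y ^ 2) + 1 / (2 * t) * (W y ^ 2 * ‖P y‖ ^ 2) := by
          have : t / 2 * (‖G y‖ ^ 2 / W y ^ 2) + 1 / (2 * t) * (W y ^ 2 * ‖P y‖ ^ 2) - ‖P y‖ * ‖G y‖ =
            (t * ‖G y‖ / W y - W y * ‖P y‖) ^ 2 / (2 * t) := by field_simp; ring
          have h5 : 0 ≤ (t * ‖G y‖ / W y - W y * ‖P y‖) ^ 2 / (2 * t) := by positivity
          linarith
        calc _ ≤ K y * (t / 2 * (‖G y‖ ^ 2 / W y ^ 2) + 1 / (2 * t) * (W y ^ 2 * ‖P y‖ ^ 2)) :=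
              mul_le_mul_of_nonneg_left this (hK0 y)
          _ = _ := by ring
      rw [integral_add (hV.const_mul _) (i3.const_mul _), integral_const_mul, integral_const_mul, ← hVV, ← hQQ] at this
      have h6 : 2 * t * A ≤ 2 * t * (t / 2 * V + 1 / (2 * t) * Q) := by gcongr
      refine h6.trans (le_of_eq ?_)
      field_simp
  have hd := discrim_le_zero (a := V) (b := -2 * A) (c := Q) (fun t => by nlinarith [key t])
  rw [discrim] at hd
  rw [norm_real, norm_of_nonneg hQ0]
  nlinarith
theorem lint_H (g : ℍℍ → ENNReal) (hg : Measurable g) :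
    ∫⁻ z, g z = ∫⁻ y in Ioi (0:ℝ), ofReal (1 / y ^ 2) * ∫⁻ x : ℝ, g (hpt (x, y)) := by
  have : SFinite hyν := by unfold hyν; infer_instance
  rw [hy_volume, lintegral_map hg hpt_meas, lintegral_prod_symm' (fun p => g (hpt p)) (hg.comp hpt_meas)]
  have hm : Measurable (fun y => ∫⁻ x : ℝ, g (hpt (x, y))) := Measurable.lintegral_prod_left' (hg.comp hpt_meas)
  unfold hyν
  rw [lintegral_withDensity_eq_lintegral_mul _ (by fun_prop) hm]
  rfl
theorem lint_cauchy (a b : ℝ) (ha : 0 < a) : ∫⁻ x : ℝ, ofReal (1 / ((x - b) ^ 2 + a ^ 2)) = ofReal (pi / a) := by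
  have h1 : ∀ x : ℝ, 1 / ((x - b) ^ 2 + a ^ 2) = 1 / a ^ 2 * (1 + ((x - b) / a) ^ 2)⁻¹ := by
    intro x; field_simp; ring
  have hi : Integrable (fun x : ℝ => 1 / a ^ 2 * (1 + ((x - b) / a) ^ 2)⁻¹) :=
    ((integrable_inv_one_add_sq.comp_div ha.ne').comp_sub_right b).const_mul _
  simp_rw [h1]
  rw [← ofReal_integral_eq_lintegral_ofReal hi (Filter.Eventually.of_forall fun x => by positivity)]
  congr 1
  rw [integral_const_mul, integral_sub_right_eq_self (fun x : ℝ => (1 + (x / a) ^ 2)⁻¹) b,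
    Measure.integral_comp_div (fun x : ℝ => (1 + x ^ 2)⁻¹) a, integral_univ_inv_one_add_sq, abs_of_pos ha, smul_eq_mul]
  field_simp
noncomputable def Wc (z w : ℍℍ) : ℝ := Real.cosh (dist z w)
theorem Wc_pos (z w : ℍℍ) : 0 < Wc z w := Real.cosh_pos _
theorem Wc_smul (g : SL2Z) (z w : ℍℍ) : Wc (g • z) (g • w) = Wc z w := by
  unfold Wc
  congr 1
  exact dist_smul (g : Matrix.SpecialLinearGroup (Fin 2) ℝ) z w
theorem Wc_eq (z w : ℍℍ) : Wc z w = ((z.re - w.re) ^ 2 + z.im ^ 2 + w.im ^ 2) / (2 * z.im * w.im) := by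
  unfold Wc
  rw [cosh_dist, dist_eq, ← normSq_eq_norm_sq, normSq_apply]
  have := z.im_pos
  have := w.im_pos
  simp
  field_simp
  ring
theorem Wc_meas : Measurable (fun p : ℍℍ × ℍℍ => Wc p.1 p.2) :=
  (continuous_cosh.comp continuous_dist).measurable
theorem W_int (z : ℍℍ) : ∫⁻ w, ofReal (1 / Wc z w ^ 2) ≤ ofReal (4 * pi ^ 2) := by
  have hWm : Measurable (fun w => Wc z w) := (continuous_cosh.comp (continuous_const.dist continuous_id)).measurable
  have hWm2 : Measurable (fun w => ofReal (1 / Wc z w ^ 2)) := measurable_ofReal.comp (measurable_const.div (hWm.pow_const 2))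
  rw [lint_H _ hWm2]
  have hz := z.im_pos
  have hpi := pi_pos
  calc _ ≤ ∫⁻ y in Ioi (0:ℝ), ofReal (4 * pi * z.im) * ofReal (1 / ((y - 0) ^ 2 + z.im ^ 2)) := by
        refine setLIntegral_mono (by fun_prop) fun y hy => ?_
        have hy : 0 < y := hy
        have : ∀ x : ℝ, ofReal (1 / Wc z (hpt (x, y)) ^ 2) ≤
            ofReal (4 * z.im ^ 2 * y ^ 2 / (y ^ 2 + z.im ^ 2)) * ofReal (1 / ((x - z.re) ^ 2 + z.im ^ 2)) := by
          intro x
          rw [← ENNReal.ofReal_mul bpos]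
          apply ofReal_le_ofReal
          rw [Wc_eq, hpt_re x y hy, hpt_im x y hy, div_pow, one_div_div]
          rw [div_mul_div_comm, mul_one]
          rw [div_le_div_iff₀ bpos bpos]
          have : (y ^ 2 + z.im ^ 2) * ((x - z.re) ^ 2 + z.im ^ 2) ≤ ((z.re - x) ^ 2 + z.im ^ 2 + y ^ 2) ^ 2 := by
            have e : (z.re - x) ^ 2 = (x - z.re) ^ 2 := by ring
            rw [e]
            nlinarith [sq_nonneg (x - z.re), sq_nonneg y, sq_nonneg z.im, mul_nonneg (sq_nonneg (x - z.re)) (sq_nonneg y),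
              mul_nonneg (sq_nonneg (x - z.re)) (sq_nonneg z.im), mul_nonneg (sq_nonneg y) (sq_nonneg z.im),
              sq_nonneg ((x - z.re) ^ 2), sq_nonneg (y ^ 2)]
          calc _ = 4 * z.im ^ 2 * y ^ 2 * ((y ^ 2 + z.im ^ 2) * ((x - z.re) ^ 2 + z.im ^ 2)) := by ring
            _ ≤ _ := by gcongr
        calc _ ≤ ofReal (1 / y ^ 2) * ∫⁻ x : ℝ, ofReal (4 * z.im ^ 2 * y ^ 2 / (y ^ 2 + z.im ^ 2)) * ofReal (1 / ((x - z.re) ^ 2 + z.im ^ 2)) := by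
              gcongr with x; exact this x
          _ = _ := by
              rw [lintegral_const_mul _ (by fun_prop), lint_cauchy _ _ hz, ← ENNReal.ofReal_mul bpos,
                ← ENNReal.ofReal_mul bpos, ← ENNReal.ofReal_mul bpos]
              congr 1
              field_simp
              ring
    _ ≤ ∫⁻ y, ofReal (4 * pi * z.im) * ofReal (1 / ((y - 0) ^ 2 + z.im ^ 2)) := setLIntegral_le_lintegral _ _
    _ = _ := by
        rw [lintegral_const_mul _ (by fun_prop), lint_cauchy _ _ hz, ← ENNReal.ofReal_mul bpos]
        congr 1
        field_simp
theorem lint_rpow (b : ℝ) (hb : 0 < b) : ∫⁻ y in Ioi b, ofReal (y ^ (-(3/2) : ℝ)) = ofReal (2 / √b) := by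
  rw [← ofReal_integral_eq_lintegral_ofReal (integrableOn_Ioi_rpow_of_lt bnum hb)
    ((ae_restrict_mem measurableSet_Ioi).mono fun y hy => rpow_nonneg (hb.trans hy).le _),
    integral_Ioi_rpow_of_lt bnum hb]
  congr 1
  rw [show (-(3/2) + 1 : ℝ) = -(1/2) by norm_num, rpow_neg hb.le, ← sqrt_eq_rpow]
  field_simp
theorem region_vol (c b : ℝ) (hc : 0 < c) (hb : 0 < b) :
    volume {z : ℍℍ | b ≤ z.im ∧ b * (c ^ 2 * (z.re ^ 2 + z.im ^ 2)) ≤ z.im} ≤ ofReal (4 / (c * b)) := by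
  have hS : MeasurableSet {z : ℍℍ | b ≤ z.im ∧ b * (c ^ 2 * (z.re ^ 2 + z.im ^ 2)) ≤ z.im} := by
    have h1 : Measurable UpperHalfPlane.im := continuous_im.measurable
    have h2 : Measurable UpperHalfPlane.re := continuous_re.measurable
    exact (measurableSet_le measurable_const h1).inter (measurableSet_le (by fun_prop) h1)
  rw [← lintegral_indicator_one hS, lint_H _ (measurable_one.indicator hS)]
  have hbs : 0 < √b := sqrt_pos.2 hb
  calc _ ≤ ∫⁻ y in Ioi (0:ℝ), (Set.Ici b).indicator (fun y => ofReal (2 / (c * √b)) * ofReal (y ^ (-(3/2) : ℝ))) y := by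
        refine setLIntegral_mono (Measurable.indicator (by fun_prop) measurableSet_Ici) fun y hy => ?_
        have hy : 0 < y := hy
        by_cases hyb : b ≤ y
        · rw [indicator_of_mem (by exact hyb)]
          have : ∫⁻ x : ℝ, Set.indicator {z : ℍℍ | b ≤ z.im ∧ b * (c ^ 2 * (z.re ^ 2 + z.im ^ 2)) ≤ z.im} (1 : ℍℍ → ENNReal) (hpt (x, y)) ≤
              ofReal (2 / (c * √b) * √y) := by
            calc _ ≤ ∫⁻ x : ℝ, (Set.Icc (-(√y / (c * √b))) (√y / (c * √b))).indicator 1 x := by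
                  refine lintegral_mono fun x => ?_
                  · by_cases hm : hpt (x, y) ∈ {z : ℍℍ | b ≤ z.im ∧ b * (c ^ 2 * (z.re ^ 2 + z.im ^ 2)) ≤ z.im}
                    · rw [indicator_of_mem hm, indicator_of_mem]
                      · simp
                      · have h := hm.2
                        rw [hpt_re x y hy, hpt_im x y hy] at h
                        rw [Set.mem_Icc, ← abs_le]
                        apply abs_le_of_sq_le_sq _ bpos
                        rw [div_pow, mul_pow, sq_sqrt hy.le, sq_sqrt hb.le, le_div_iff₀ bpos]
                        nlinarith [mul_nonneg (mul_nonneg hb.le (sq_nonneg c)) (sq_nonneg y)]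
                    · rw [indicator_of_notMem hm]; exact zero_le
              _ = _ := by
                  rw [lintegral_indicator_one measurableSet_Icc, volume_Icc]
                  congr 1; ring
          refine (mul_le_mul_right this _).trans ?_
          rw [← ENNReal.ofReal_mul bpos, ← ENNReal.ofReal_mul bpos]
          apply ofReal_le_ofReal
          rw [show (-(3/2) : ℝ) = 1/2 - (2:ℕ) by norm_num, Real.rpow_sub_natCast hy.ne', ← sqrt_eq_rpow]
          apply le_of_eq; ring
        · rw [indicator_of_notMem (by exact hyb)]
          have : ∀ x : ℝ, Set.indicator {z : ℍℍ | b ≤ z.im ∧ b * (c ^ 2 * (z.re ^ 2 + z.im ^ 2)) ≤ z.im} (1 : ℍℍ → ENNReal) (hpt (x, y)) = 0 := by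
            intro x
            rw [indicator_of_notMem]
            rintro ⟨h, -⟩
            rw [hpt_im x y hy] at h
            exact hyb h
          simp [this]
    _ ≤ ∫⁻ y, (Set.Ici b).indicator (fun y => ofReal (2 / (c * √b)) * ofReal (y ^ (-(3/2) : ℝ))) y := setLIntegral_le_lintegral _ _
    _ = _ := by
        rw [lintegral_indicator measurableSet_Ici, setLIntegral_congr Ioi_ae_eq_Ici.symm, lintegral_const_mul _ (by fun_prop),
          lint_rpow b hb, ← ENNReal.ofReal_mul bpos]
        congr 1
        have := mul_self_sqrt hb.le
        field_simp
        nlinarith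
theorem strip_vol (b : ℝ) (hb : 0 < b) :
    volume {z : ℍℍ | b ≤ z.im ∧ 0 ≤ z.re ∧ z.re < 1} ≤ ofReal (2 / b) := by
  have : SFinite hyν := by unfold hyν; infer_instance
  have h1 : Measurable UpperHalfPlane.im := continuous_im.measurable
  have h2 : Measurable UpperHalfPlane.re := continuous_re.measurable
  have hS : MeasurableSet {z : ℍℍ | b ≤ z.im ∧ 0 ≤ z.re ∧ z.re < 1} := 
    (measurableSet_le measurable_const h1).inter ((measurableSet_le measurable_const h2).inter (measurableSet_lt h2 measurable_const))
  rw [hy_volume, Measure.map_apply hpt_meas hS]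
  have hpos : ∀ᵐ p : ℝ × ℝ ∂(volume.prod hyν), 0 < p.2 := by
    have : ∀ᵐ y ∂hyν, 0 < y := (withDensity_absolutelyContinuous _ _) (ae_restrict_mem measurableSet_Ioi)
    exact Measure.quasiMeasurePreserving_snd.ae this
  calc _ ≤ (volume.prod hyν) (Ico (0:ℝ) 1 ×ˢ Ioi (b / 2)) := by
        refine measure_mono_ae ?_
        filter_upwards [hpos] with p hp hm
        obtain ⟨m1, m2, m3⟩ := hm
        rw [show p = (p.1, p.2) from rfl, hpt_im _ _ hp] at m1
        rw [show p = (p.1, p.2) from rfl, hpt_re _ _ hp] at m2 m3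
        exact ⟨⟨m2, m3⟩, (by show b / 2 < p.2; linarith)⟩
    _ = _ := by
        rw [Measure.prod_prod, hyν_Ioi _ bpos]
        simp
noncomputable def dn (g : SL2Z) (z : ℍℍ) : ℂ := (g 1 0 : ℤ) * (z : ℂ) + (g 1 1 : ℤ)
theorem dn_eq (g : SL2Z) (z : ℍℍ) :
    UpperHalfPlane.denom (g : Matrix.GeneralLinearGroup (Fin 2) ℝ) z = dn g z := ModularGroup.denom_apply g z
theorem dn_ne (g : SL2Z) (z : ℍℍ) : dn g z ≠ 0 := by
  rw [← dn_eq]; exact denom_ne_zero _ z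
theorem sl_coe (g : SL2Z) (z : ℍℍ) :
    ((g • z : ℍℍ) : ℂ) = ((g 0 0 : ℤ) * (z : ℂ) + (g 0 1 : ℤ)) / dn g z := by
  rw [specialLinearGroup_apply]
  simp [dn]
theorem dn_mul (g g' : SL2Z) (z : ℍℍ) :
    dn (g * g') z = dn g (g' • z) * dn g' z := by
  have h := dn_ne g' z
  have e : dn g (g' • z) = (g 1 0 : ℤ) * ((g' • z : ℍℍ) : ℂ) + (g 1 1 : ℤ) := rfl
  rw [e, sl_coe]
  field_simp
  simp only [dn, Matrix.SpecialLinearGroup.coe_mul, Matrix.mul_apply, Fin.sum_univ_two]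
  push_cast
  ring
noncomputable def chi (κ : ℕ) (g : SL2Z) (z w : ℍℍ) : ℂ :=
  (dn g z / ‖dn g z‖) ^ (2 * κ) * starRingEnd ℂ ((dn g w / ‖dn g w‖) ^ (2 * κ))
theorem chi_norm (κ : ℕ) (g : SL2Z) (z w : ℍℍ) : ‖chi κ g z w‖ = 1 := by
  have h : ∀ z, ‖dn g z / ‖dn g z‖‖ = 1 := by
    intro z
    rw [norm_div, norm_real, norm_norm, div_self (norm_ne_zero_iff.2 (dn_ne g z))]
  unfold chi
  rw [norm_mul, RCLike.norm_conj, norm_pow, norm_pow, h, h]; simp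
theorem chi_mul (κ : ℕ) (g g' : SL2Z) (z w : ℍℍ) :
    chi κ (g * g') z w = chi κ g (g' • z) (g' • w) * chi κ g' z w := by
  unfold chi
  rw [dn_mul, dn_mul, norm_mul, norm_mul]
  push_cast
  simp only [map_pow, map_div₀, map_mul, mul_div_mul_comm, mul_pow]
  ring
theorem dn_cont (g : SL2Z) : Continuous (dn g) := by
  unfold dn
  have := continuous_coe
  fun_prop
theorem chi_meas (κ : ℕ) (g : SL2Z) :
    Measurable (fun p : ℍℍ × ℍℍ => chi κ g p.1 p.2) := by
  have h : Measurable (fun z => (dn g z / ‖dn g z‖) ^ (2 * κ)) := by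
    have := (dn_cont g).measurable
    exact (this.div (Complex.measurable_ofReal.comp this.norm)).pow_const _
  exact (h.comp measurable_fst).mul (continuous_conj.measurable.comp (h.comp measurable_snd))
theorem vadd_mp (t : ℝ) : MeasurePreserving (fun z : ℍℍ => t +ᵥ z) volume volume := by
  let g : Matrix.SpecialLinearGroup (Fin 2) ℝ := ⟨!![1, t; 0, 1], by simp⟩
  have := measurePreserving_smul (g : GL (Fin 2) ℝ) (volume : Measure ℍℍ)
  convert this using 1
  funext z
  have e : (g : GL (Fin 2) ℝ) • z = g • z := rfl
  rw [e, specialLinearGroup_apply]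
  apply UpperHalfPlane.ext
  simp [coe_vadd, g, add_comm]
theorem Wc_vadd (t : ℝ) (z w : ℍℍ) : Wc (t +ᵥ z) (t +ᵥ w) = Wc z w := by
  rw [Wc_eq, Wc_eq]; simp
abbrev YY (δ : ℕ) := ZMod δ × ℍℍ × ℍℍ
noncomputable def yact (δ : ℕ) (g : SL2Z) (y : YY δ) : YY δ :=
  (((g 0 0 : ℤ) : ZMod δ) ^ 2 * y.1, g • y.2.1, g • y.2.2)
noncomputable def yμ (δ : ℕ) : Measure (YY δ) := Measure.count.prod (volume.prod volume)
theorem g0_dvd (δ q : ℕ) (hδ : δ ∣ q) (g : SL2Z) (hg : g ∈ Gamma0 q) :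
    ((g 1 0 : ℤ) : ZMod δ) = 0 := by
  rw [Gamma0_mem, intCast_zmod_eq_zero_iff_dvd] at hg
  rw [intCast_zmod_eq_zero_iff_dvd]
  exact (natCast_dvd_natCast.2 hδ).trans hg
theorem yact_mul (δ q : ℕ) (hδ : δ ∣ q) (g g' : SL2Z)
    (hg : g' ∈ Gamma0 q) (y : YY δ) : yact δ (g * g') y = yact δ g (yact δ g' y) := by
  have h := g0_dvd δ q hδ g' hg
  unfold yact
  simp only [mul_smul]
  congr 1
  simp only [Matrix.SpecialLinearGroup.coe_mul, Matrix.mul_apply, Fin.sum_univ_two]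
  push_cast
  rw [h]; ring
theorem yact_one (δ : ℕ) (y : YY δ) : yact δ 1 y = y := by
  unfold yact; simp
theorem yact_mp (δ q : ℕ) [NeZero δ] (hδ : δ ∣ q) (g : SL2Z)
    (hg : g ∈ Gamma0 q) : MeasurePreserving (yact δ g) (yμ δ) (yμ δ) := by
  have h1 : MeasurePreserving (fun j : ZMod δ => ((g 0 0 : ℤ) : ZMod δ) ^ 2 * j) Measure.count Measure.count := by
    have hu : IsUnit (((g 0 0 : ℤ) : ZMod δ) ^ 2) := by
      have hd : g 0 0 * g 1 1 - g 0 1 * g 1 0 = 1 := by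
        rw [← det_fin_two]; exact g.2
      have hd' := congrArg (Int.cast : ℤ → ZMod δ) hd
      push_cast at hd'
      rw [g0_dvd δ q hδ g hg] at hd'
      exact (IsUnit.of_mul_eq_one _ (by simpa using hd')).pow 2
    obtain ⟨u, hu⟩ := hu
    refine ⟨measurable_of_finite _, ?_⟩
    rw [← hu]
    ext s hs
    rw [Measure.map_apply (measurable_of_finite _) hs, Measure.count_apply (hs.preimage (measurable_of_finite _)), Measure.count_apply hs]
    have : (fun j : ZMod δ => (u : ZMod δ) * j) = (Units.mulLeft u) := rfl
    rw [this, Set.encard_preimage_of_bijective (Units.mulLeft u).bijective]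
  have : SFinite (Measure.count : Measure (ZMod δ)) := inferInstance
  exact h1.prod ((sl2_mp g).prod (sl2_mp g))
def PhiOK (h : ℤ) (b H : ℝ) (φ : ℍℍ → ℍℍ → ℂ) : Prop :=
  Measurable (fun p : ℍℍ × ℍℍ => φ p.1 p.2) ∧ (∀ z w, φ z w ≠ 0 → b ≤ z.im) ∧
  (∀ z w, ‖φ z w‖ ≤ H / Wc z w ^ 2) ∧
  (∀ (t : ℝ) z w, φ (t +ᵥ z) (t +ᵥ w) = exp (-(τI * h * t)) * φ z w)
noncomputable def yf (δ : ℕ) [NeZero δ] (f : ℤ) (φ : ℍℍ → ℍℍ → ℂ) (y : YY δ) : ℂ :=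
  stdAddChar (-(f : ZMod δ) * y.1) * (if 0 ≤ y.2.1.re ∧ y.2.1.re < 1 then φ y.2.1 y.2.2 else 0)
noncomputable def pr (κ δ : ℕ) [NeZero δ] (f : ℤ) (φ : ℍℍ → ℍℍ → ℂ)
    (g : SL2Z) (y : YY δ) : ℂ :=
  chi κ g y.2.1 y.2.2 * (stdAddChar (-(f : ZMod δ) * (((g 0 0 : ℤ) : ZMod δ) ^ 2 * y.1)) * φ (g • y.2.1) (g • y.2.2))
theorem T_entry (n : ℤ) (g : SL2Z) :
    (ModularGroup.T ^ n * g) 1 0 = g 1 0 ∧ (ModularGroup.T ^ n * g) 1 1 = g 1 1 ∧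
    (ModularGroup.T ^ n * g) 0 0 = g 0 0 + n * g 1 0 ∧ (ModularGroup.T ^ n * g) 0 1 = g 0 1 + n * g 1 1 := by
  refine ⟨?_, ?_, ?_, ?_⟩ <;>
  simp [Matrix.SpecialLinearGroup.coe_mul, Matrix.mul_apply, Fin.sum_univ_two, ModularGroup.coe_T_zpow]
theorem same_row (g g' : SL2Z) (h0 : g 1 0 = g' 1 0) (h1 : g 1 1 = g' 1 1) :
    ∃ n : ℤ, g' = ModularGroup.T ^ n * g := by
  have d1 : g 0 0 * g 1 1 - g 0 1 * g 1 0 = 1 := by rw [← det_fin_two]; exact g.2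
  have d2 : g' 0 0 * g' 1 1 - g' 0 1 * g' 1 0 = 1 := by rw [← det_fin_two]; exact g'.2
  rw [← h0, ← h1] at d2
  refine ⟨g' 0 1 * g 0 0 - g' 0 0 * g 0 1, ?_⟩
  obtain ⟨t1, t2, t3, t4⟩ := T_entry (g' 0 1 * g 0 0 - g' 0 0 * g 0 1) g
  ext i j
  fin_cases i <;> fin_cases j
  · show g' 0 0 = _
    refine Eq.trans ?_ t3.symm
    linear_combination (-g' 0 0) * d1 + g 0 0 * d2
  · show g' 0 1 = _
    refine Eq.trans ?_ t4.symm
    linear_combination (-g' 0 1) * d1 + g 0 1 * d2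
  · exact h0.symm.trans t1.symm
  · exact h1.symm.trans t2.symm
theorem chi_T (κ : ℕ) (n : ℤ) (g : SL2Z) (z w : ℍℍ) :
    chi κ (ModularGroup.T ^ n * g) z w = chi κ g z w := by
  obtain ⟨t1, t2, -, -⟩ := T_entry n g
  unfold chi dn
  rw [t1, t2]
theorem pr_T (κ δ q : ℕ) [NeZero δ] (hδ : δ ∣ q) (f h : ℤ) (b H : ℝ) (φ : ℍℍ → ℍℍ → ℂ) (hφ : PhiOK h b H φ)
    (n : ℤ) (g : SL2Z) (hg : g ∈ Gamma0 q) (y : YY δ) :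
    pr κ δ f φ (ModularGroup.T ^ n * g) y = pr κ δ f φ g y := by
  unfold pr
  rw [chi_T, mul_smul, mul_smul, modular_T_zpow_smul, modular_T_zpow_smul, hφ.2.2.2,
    (T_entry n g).2.2.1]
  have e : exp (-(τI * h * ((n : ℝ) : ℂ))) = 1 := by
    rw [exp_eq_one_iff]
    exact ⟨-(h * n), by push_cast; ring⟩
  rw [e, one_mul]
  congr 4
  push_cast
  rw [g0_dvd δ q hδ g hg]; simp
noncomputable def rows (q : ℕ) (C : ℤ) : Finset (ℤ × ℤ) :=
  (Icc (-C) C ×ˢ Icc (-(2 * C + 1)) (2 * C + 1)).filter (fun r => IsCoprime r.1 r.2 ∧ (q : ℤ) ∣ r.1)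
theorem rep_ex (r : ℤ × ℤ) : ∃ g : SL2Z, IsCoprime r.1 r.2 → g 1 0 = r.1 ∧ g 1 1 = r.2 := by
  by_cases h : IsCoprime r.1 r.2
  · obtain ⟨g, -, hg⟩ := ModularGroup.bottom_row_surj (R := ℤ) (show ![r.1, r.2] ∈ {cd : Fin 2 → ℤ | IsCoprime (cd 0) (cd 1)} by simpa using h)
    exact ⟨g, fun _ => ⟨by simpa using congrFun hg 0, by simpa using congrFun hg 1⟩⟩
  · exact ⟨1, fun h' => absurd h' h⟩
noncomputable def rep (r : ℤ × ℤ) : SL2Z := (rep_ex r).choose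
theorem rep_row (r : ℤ × ℤ) (hr : IsCoprime r.1 r.2) : rep r 1 0 = r.1 ∧ rep r 1 1 = r.2 := (rep_ex r).choose_spec hr
theorem rep_mem (q : ℕ) (r : ℤ × ℤ) (hr : IsCoprime r.1 r.2) (hq : (q : ℤ) ∣ r.1) : rep r ∈ Gamma0 q := by
  rw [Gamma0_mem, (rep_row r hr).1, intCast_zmod_eq_zero_iff_dvd]; exact hq
theorem T_mem (q : ℕ) (n : ℤ) (g : SL2Z) (hg : g ∈ Gamma0 q) :
    ModularGroup.T ^ n * g ∈ Gamma0 q := by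
  rw [Gamma0_mem] at *
  rw [(T_entry n g).1]; exact hg
theorem row_box (b : ℝ) (hb : 0 < b) (C : ℤ) (hC : 1 ≤ C * b) (x y : ℝ) (c d : ℤ) (hcd : IsCoprime c d) (hx : |x| ≤ 1)
    (hy : b ≤ y) (hs : b * ((c * x + d) ^ 2 + (c * y) ^ 2) ≤ y) :
    c ∈ Icc (-C) C ∧ d ∈ Icc (-(2 * C + 1)) (2 * C + 1) := by
  have hC0 : (0:ℝ) < C := by
    by_contra hh
    nlinarith [not_lt.1 hh]
  have hC1 : (0:ℤ) < C := by exact_mod_cast hC0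
  rw [mem_Icc, mem_Icc, ← abs_le, ← abs_le]
  have hy0 : 0 < y := hb.trans_le hy
  rcases eq_or_ne c 0 with rfl | hc
  · have : IsUnit d := by simpa [isCoprime_zero_left] using hcd
    rw [isUnit_iff] at this
    rcases this with rfl | rfl <;> simp <;> omega
  · have h1 : b * (c:ℝ) ^ 2 * y ≤ 1 := by
      have : (b * (c:ℝ) ^ 2 * y) * y ≤ 1 * y := by nlinarith [mul_nonneg hb.le (sq_nonneg ((c:ℝ) * x + d))]
      exact le_of_mul_le_mul_right this hy0
    have hc1 : (1:ℝ) ≤ (c:ℝ) ^ 2 := by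
      have : (1:ℤ) ≤ c ^ 2 := by have := sq_pos_of_ne_zero hc; omega
      exact_mod_cast this
    have h2 : (b * |(c:ℝ)|) ^ 2 ≤ 1 := by
      rw [mul_pow, sq_abs]
      nlinarith [mul_nonneg hb.le (sq_nonneg (c:ℝ))]
    have h3 : b * |(c:ℝ)| ≤ 1 := by
      have := abs_le_one_iff_mul_self_le_one.2 (show (b * |(c:ℝ)|) * (b * |(c:ℝ)|) ≤ 1 by nlinarith)
      exact (le_abs_self _).trans this
    have h4 : |(c:ℝ)| ≤ C := by
      have : b * |(c:ℝ)| ≤ b * C := by linarith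
      exact le_of_mul_le_mul_left this hb
    have h5 : (b * (c * x + d)) ^ 2 ≤ 1 := by
      have : b * y ≤ 1 := by nlinarith [mul_pos hb hy0]
      have h8 : b * (c * x + d) ^ 2 ≤ y := by nlinarith [mul_nonneg hb.le (sq_nonneg ((c:ℝ) * y))]
      nlinarith
    have h6 : |b * (c * x + d)| ≤ 1 := abs_le_one_iff_mul_self_le_one.2 (by nlinarith)
    rw [abs_mul, abs_of_pos hb] at h6
    have h7 : |(c:ℝ) * x + d| ≤ C := by
      have : b * |(c:ℝ) * x + d| ≤ b * C := by linarith
      exact le_of_mul_le_mul_left this hb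
    have h9 : |(c:ℝ) * x| ≤ C := by
      rw [abs_mul]; nlinarith [abs_nonneg (c:ℝ), abs_nonneg x]
    have h10 : |(d:ℝ)| ≤ 2 * C := by
      have := abs_sub ((c:ℝ) * x + d) ((c:ℝ) * x)
      rw [show (c:ℝ) * x + d - c * x = d by ring] at this
      linarith
    constructor
    · exact_mod_cast h4
    · have : |d| ≤ 2 * C := by exact_mod_cast h10
      omega
theorem sl_im (g : SL2Z) (z : ℍℍ) :
    (g • z).im * (((g 1 0 : ℤ) * z.re + (g 1 1 : ℤ)) ^ 2 + ((g 1 0 : ℤ) * z.im) ^ 2) = z.im := by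
  have h1 := im_smul_eq_div_normSq g z
  have h2 : Complex.normSq (dn g z) = ((g 1 0 : ℤ) * z.re + (g 1 1 : ℤ)) ^ 2 + ((g 1 0 : ℤ) * z.im) ^ 2 := by
    rw [normSq_apply]; simp [dn]; ring
  rw [dn_eq] at h1
  rw [h1, ← h2, div_mul_cancel₀]
  exact fun h => dn_ne g z (Complex.normSq_eq_zero.1 h)
theorem P_eq (κ δ q : ℕ) [NeZero δ] (hδ : δ ∣ q) (f h : ℤ) (b H : ℝ) (hb : 0 < b) (φ : ℍℍ → ℍℍ → ℂ) (hφ : PhiOK h b H φ)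
    (C : ℤ) (hC : 1 ≤ C * b) (y : YY δ) (h1 : b ≤ y.2.1.im) (h2 : 0 ≤ y.2.1.re) (h3 : y.2.1.re < 1) :
    ∑' g : Gamma0 q, chi κ g y.2.1 y.2.2 * yf δ f φ (yact δ g y) =
      ∑ r ∈ rows q C, pr κ δ f φ (rep r) y := by
  classical
  let i : ℤ × ℤ → SL2Z := fun r => ModularGroup.T ^ (-⌊(rep r • y.2.1).re⌋) * rep r
  have hcop : ∀ r ∈ rows q C, IsCoprime r.1 r.2 := fun r hr => (mem_filter.1 hr).2.1
  have hmem : ∀ r ∈ rows q C, i r ∈ Gamma0 q := fun r hr =>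
    T_mem q _ _ (rep_mem q r (hcop r hr) (mem_filter.1 hr).2.2)
  let i' : ℤ × ℤ → Gamma0 q := fun r => if hr : r ∈ rows q C then ⟨i r, hmem r hr⟩ else 1
  have hi' : ∀ r ∈ rows q C, ((i' r : Gamma0 q) : SL2Z) = i r := by
    intro r hr
    simp [i', hr]
  have hrow : ∀ r ∈ rows q C, i r 1 0 = r.1 ∧ i r 1 1 = r.2 := by
    intro r hr
    obtain ⟨t1, t2, -, -⟩ := T_entry (-⌊(rep r • y.2.1).re⌋) (rep r)
    obtain ⟨s1, s2⟩ := rep_row r (hcop r hr)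
    exact ⟨t1.trans s1, t2.trans s2⟩
  have hinj : Set.InjOn i' (rows q C) := by
    intro r hr s hs hrs
    have : i r = i s := by rw [← hi' r hr, ← hi' s hs, hrs]
    have e1 := hrow r hr
    rw [this, (hrow s hs).1, (hrow s hs).2] at e1
    exact Prod.ext e1.1.symm e1.2.symm
  rw [tsum_eq_sum (s := (rows q C).image i')]
  · rw [sum_image hinj]
    refine sum_congr rfl fun r hr => ?_
    rw [hi' r hr]
    have hre : (i r • y.2.1).re = fract (rep r • y.2.1).re := by
      show ((ModularGroup.T ^ (-⌊(rep r • y.2.1).re⌋) * rep r) • y.2.1).re = _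
      rw [mul_smul, modular_T_zpow_smul, vadd_re, fract]; push_cast; ring
    rw [← pr_T κ δ q hδ f h b H φ hφ (-⌊(rep r • y.2.1).re⌋) _ (rep_mem q r (hcop r hr) (mem_filter.1 hr).2.2)]
    show chi κ (i r) y.2.1 y.2.2 * (stdAddChar (-(f : ZMod δ) * ((((i r) 0 0 : ℤ) : ZMod δ) ^ 2 * y.1)) *
      (if 0 ≤ (i r • y.2.1).re ∧ (i r • y.2.1).re < 1 then φ (i r • y.2.1) (i r • y.2.2) else 0)) = pr κ δ f φ (i r) y
    rw [hre, if_pos ⟨fract_nonneg _, fract_lt_one _⟩]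
    rfl
  · intro g hg
    by_contra hne
    apply hg
    have hne2 := right_ne_zero_of_mul (right_ne_zero_of_mul hne)
    have hc1 : 0 ≤ (g.1 • y.2.1).re ∧ (g.1 • y.2.1).re < 1 := by
      by_contra hcon
      exact hne2 (if_neg hcon)
    have hc2 : φ (g.1 • y.2.1) (g.1 • y.2.2) ≠ 0 := by
      intro h0; apply hne2
      show (if 0 ≤ (g.1 • y.2.1).re ∧ (g.1 • y.2.1).re < 1 then φ (g.1 • y.2.1) (g.1 • y.2.2) else 0) = 0
      rw [if_pos hc1]; exact h0
    have him := hφ.2.1 _ _ hc2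
    have hcg : IsCoprime (g.1 1 0) (g.1 1 1) := by
      have d1 : g.1 0 0 * g.1 1 1 - g.1 0 1 * g.1 1 0 = 1 := by rw [← det_fin_two]; exact g.1.2
      exact ⟨-g.1 0 1, g.1 0 0, by linear_combination d1⟩
    have hbox := row_box b hb C hC y.2.1.re y.2.1.im (g.1 1 0) (g.1 1 1) hcg (abs_le.2 ⟨by linarith, h3.le⟩) h1 (by
      have := sl_im g.1 y.2.1
      refine le_trans ?_ this.le
      gcongr)
    have hr : (g.1 1 0, g.1 1 1) ∈ rows q C := by
      refine mem_filter.2 ⟨mem_product.2 hbox, hcg, ?_⟩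
      have := g.2
      rwa [Gamma0_mem, intCast_zmod_eq_zero_iff_dvd] at this
    refine mem_image.2 ⟨_, hr, Subtype.ext ?_⟩
    rw [hi' _ hr]
    obtain ⟨s1, s2⟩ := rep_row (g.1 1 0, g.1 1 1) hcg
    obtain ⟨n, hn⟩ := same_row (rep (g.1 1 0, g.1 1 1)) g.1 s1 s2
    have hre : (g.1 • y.2.1).re = n + (rep (g.1 1 0, g.1 1 1) • y.2.1).re := by
      conv_lhs => rw [hn, mul_smul, modular_T_zpow_smul, vadd_re]
    have hfl : n = -⌊(rep (g.1 1 0, g.1 1 1) • y.2.1).re⌋ := by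
      have : ⌊(rep (g.1 1 0, g.1 1 1) • y.2.1).re⌋ = -n := by
        rw [Int.floor_eq_iff]
        rw [hre] at hc1
        push_cast
        constructor <;> linarith [hc1.1, hc1.2]
      omega
    show ModularGroup.T ^ (-⌊(rep (g.1 1 0, g.1 1 1) • y.2.1).re⌋) * rep (g.1 1 0, g.1 1 1) = g.1
    rw [← hfl]; exact hn.symm
theorem kl_complete (n : ℕ) [NeZero n] (c : ℤ) (hc : c.natAbs = n) (κ : ZMod n → ℂ) (x : ℝ) (I : Finset ℤ)
    (hI : ∀ d : ℤ, 0 ≤ x - d / c → x - d / c < 1 → d ∈ I) :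
    ∑ d ∈ I, (if 0 ≤ x - d / c ∧ x - d / c < 1 then κ d else 0) = ∑ t, κ t := by
  classical
  have hc0 : (c : ℝ) ≠ 0 := by
    have := NeZero.ne n
    intro h
    have : c = 0 := by exact_mod_cast h
    subst this; simp at hc; omega
  rw [← sum_filter]
  refine sum_bij (fun d _ => (d : ZMod n)) (fun _ _ => mem_univ _) ?_ ?_ (fun _ _ => rfl)
  · intro d hd e he hde
    rw [mem_filter] at hd he
    have h1 : (c : ℤ) ∣ d - e := by
      rw [ZMod.intCast_eq_intCast_iff_dvd_sub, ← hc, natAbs_dvd] at hde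
      have := dvd_neg.2 hde
      simpa using this
    obtain ⟨m, hm⟩ := h1
    have h2 : (d:ℝ) / c - e / c = m := by
      rw [← sub_div, div_eq_iff hc0]; exact_mod_cast hm.trans (mul_comm _ _)
    have h3 : (m:ℝ) < 1 := by linarith [hd.2.1, he.2.2]
    have h4 : (-1:ℝ) < m := by linarith [hd.2.2, he.2.1]
    have h5 : m < 1 := by exact_mod_cast h3
    have h6 : -1 < m := by exact_mod_cast h4
    have : m = 0 := by omega
    rw [this] at hm; linarith
  · intro t _
    set m := ⌊x - (t.val : ℝ) / c⌋ with hm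
    have e : x - ((t.val + c * m : ℤ) : ℝ) / c = fract (x - (t.val : ℝ) / c) := by
      push_cast; rw [fract, ← hm]; field_simp; ring
    have a1 : 0 ≤ x - ((t.val + c * m : ℤ) : ℝ) / c := by rw [e]; exact fract_nonneg _
    have a2 : x - ((t.val + c * m : ℤ) : ℝ) / c < 1 := by rw [e]; exact fract_lt_one _
    refine ⟨t.val + c * m, mem_filter.2 ⟨hI _ a1 a2, a1, a2⟩, ?_⟩
    have : ((c:ℤ) : ZMod n) = 0 := by
      rw [intCast_zmod_eq_zero_iff_dvd, ← hc]; simp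
    push_cast
    rw [this]; simp
noncomputable def klS (n δ : ℕ) [NeZero n] (u : ℤ) (t : ZMod n) : ℂ :=
  open Classical in
  if IsUnit t then (if ((t⁻¹).cast : ZMod δ) ^ 2 = 1 then stdAddChar ((u : ZMod n) * (t⁻¹ + t)) else 0) else 0
theorem klS_sum (n δ : ℕ) [NeZero n] (u : ℤ) : ∑ t, klS n δ u t = klT n δ u := by
  classical
  unfold klS klT
  rw [← sum_filter]
  refine (sum_bij (fun (a : (ZMod n)ˣ) _ => ((a⁻¹ : (ZMod n)ˣ) : ZMod n)) ?_ ?_ ?_ ?_).symm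
  · intro a _; simp
  · intro a _ b _ hab
    exact inv_injective (Units.ext hab)
  · intro t ht
    obtain ⟨v, rfl⟩ := (mem_filter.1 ht).2
    exact ⟨v⁻¹, mem_univ _, by simp⟩
  · intro a _
    have e : ((a⁻¹ : (ZMod n)ˣ) : ZMod n)⁻¹ = a := by
      rw [← inv_coe_unit, inv_coe_unit, inv_coe_unit]; simp
    rw [e]
theorem klS_eval (n δ : ℕ) [NeZero n] (hδ : δ ∣ n) (c : ℤ) (hc : c.natAbs = n) (h a d : ℤ) (had : c ∣ a * d - 1) :
    klS n δ (-(c.sign * h)) (d : ZMod n) = if ((a : ZMod δ)) ^ 2 = 1 then exp (-(τI * h * ((a + d : ℝ) / c))) else 0 := by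
  have hn : (n:ℤ) ∣ a * d - 1 := by rw [← hc]; simpa using had
  have h1 : (d : ZMod n) * a = 1 := by
    rw [← intCast_zmod_eq_zero_iff_dvd] at hn
    push_cast at hn
    linear_combination hn
  have hu : IsUnit (d : ZMod n) := IsUnit.of_mul_eq_one _ h1
  have hinv : (d : ZMod n)⁻¹ = a := ZMod.inv_eq_of_mul_eq_one n _ _ h1
  unfold klS
  rw [if_pos hu, hinv, cast_intCast hδ]
  congr 1
  have e : ((-(c.sign * h) : ℤ) : ZMod n) * ((a : ZMod n) + d) = ((-(c.sign * h) * (a + d) : ℤ) : ZMod n) := by push_cast; ring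
  rw [e, stdAddChar_coe]
  congr 1
  have hn0 : (n : ℂ) ≠ 0 := by exact_mod_cast NeZero.ne n
  have hc2 : (c : ℂ) = c.sign * n := by
    rw [← hc]
    have := Int.sign_mul_natAbs c
    have h2 := congrArg (Int.cast : ℤ → ℂ) this.symm
    rw [h2, Int.cast_mul, cast_natCast]
  have hs : (c.sign : ℂ) * c.sign = 1 := by
    have hc0 : c ≠ 0 := by rintro rfl; have := NeZero.ne n; simp at hc; omega
    have : c.sign * c.sign = 1 := by
      rcases lt_or_gt_of_ne hc0 with h | h
      · rw [sign_eq_neg_one_of_neg h]; norm_num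
      · rw [sign_eq_one_of_pos h]; norm_num
    exact_mod_cast this
  have hs0 : (c.sign : ℂ) ≠ 0 := left_ne_zero_of_mul_eq_one hs
  push_cast
  rw [hc2]
  field_simp
  linear_combination (-((a:ℂ) + d) * h) * hs
theorem klN_neg (n δ : ℕ) (u : ℤ) : klN n δ (-u) = klN n δ u := by
  unfold klN
  split_ifs with hn
  · have : NeZero n := ⟨hn⟩
    have : @klT n δ ⟨hn⟩ (-u) = starRingEnd ℂ (@klT n δ ⟨hn⟩ u) := by
      unfold klT
      rw [map_sum]
      refine sum_congr rfl fun a _ => ?_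
      rw [apply_ite (starRingEnd ℂ), map_zero]
      congr 1
      rw [← map_neg_eq_conj]
      congr 1
      push_cast; ring
    rw [this, RCLike.norm_conj]
  · rfl
theorem klN_sign (n δ : ℕ) (c u : ℤ) (hc : c ≠ 0) : klN n δ (-(c.sign * u)) = klN n δ u := by
  rcases lt_or_gt_of_ne hc with h | h
  · rw [sign_eq_neg_one_of_neg h]; simp
  · rw [sign_eq_one_of_pos h, one_mul, klN_neg]
theorem SW_int (S : Set ℍℍ) (hS : MeasurableSet S) (v A : ℝ) (hv : 0 ≤ v) (hA : 0 ≤ A) (hSv : volume S ≤ ofReal v)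
    (F : ℍℍ × ℍℍ → ℂ) (hF : Measurable F) (hF1 : ∀ p, F p ≠ 0 → p.1 ∈ S)
    (hF2 : ∀ p, ‖F p‖ ≤ A / Wc p.1 p.2 ^ 2) :
    Integrable F (volume.prod volume) ∧ ‖∫ p, F p ∂(volume.prod volume)‖ ≤ A * (4 * pi ^ 2) * v := by
  have key : ∫⁻ p, ‖F p‖ₑ ∂(volume.prod volume) ≤ ofReal (A * (4 * pi ^ 2) * v) := by
    rw [lintegral_prod _ hF.enorm.aemeasurable]
    calc _ ≤ ∫⁻ z, S.indicator (fun _ => ofReal (A * (4 * pi ^ 2))) z := by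
          refine lintegral_mono fun z => ?_
          by_cases hz : z ∈ S
          · rw [indicator_of_mem hz]
            calc _ ≤ ∫⁻ w, ofReal A * ofReal (1 / Wc z w ^ 2) := by
                  refine lintegral_mono fun w => ?_
                  rw [← ofReal_norm, ← ENNReal.ofReal_mul hA, mul_one_div]
                  exact ofReal_le_ofReal (hF2 (z, w))
              _ ≤ _ := by
                  have hWm : Measurable (fun w => Wc z w) := (continuous_cosh.comp (continuous_const.dist continuous_id)).measurable
                  have hWm2 : Measurable (fun w => ofReal (1 / Wc z w ^ 2)) := measurable_ofReal.comp (measurable_const.div (hWm.pow_const 2))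
                  rw [lintegral_const_mul _ hWm2, ENNReal.ofReal_mul hA]
                  gcongr
                  exact W_int z
          · have : ∀ w, F (z, w) = 0 := fun w => by
              by_contra h; exact hz (hF1 _ h)
            simp [this]
      _ = ofReal (A * (4 * pi ^ 2)) * volume S := by rw [lintegral_indicator_const hS]
      _ ≤ _ := by
          rw [ENNReal.ofReal_mul (p := A * (4 * pi ^ 2)) bpos]
          gcongr
  refine ⟨⟨hF.aestronglyMeasurable, lt_of_le_of_lt key ofReal_lt_top⟩, ?_⟩
  have h1 := (enorm_integral_le_lintegral_enorm F).trans key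
  rw [← ofReal_norm] at h1
  exact (ofReal_le_ofReal_iff bpos).1 h1
theorem Y_int (δ : ℕ) [NeZero δ] (F : YY δ → ℂ) (hF : Measurable F)
    (hs : ∀ j, Integrable (fun p => F (j, p)) (volume.prod volume)) :
    Integrable F (yμ δ) ∧ ∫ y, F y ∂(yμ δ) = ∑ j, ∫ p, F (j, p) ∂(volume.prod volume) := by
  have h1 : Integrable F (yμ δ) := by
    unfold yμ
    rw [integrable_prod_iff hF.aestronglyMeasurable]
    exact ⟨Filter.Eventually.of_forall hs, Integrable.of_finite⟩
  refine ⟨h1, ?_⟩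
  unfold yμ at *
  rw [integral_prod _ h1, integral_count]
theorem yf_meas (δ : ℕ) [NeZero δ] (f : ℤ) (φ : ℍℍ → ℍℍ → ℂ)
    (hφ : Measurable (fun p : ℍℍ × ℍℍ => φ p.1 p.2)) : Measurable (yf δ f φ) := by
  have h2 : Measurable UpperHalfPlane.re := continuous_re.measurable
  unfold yf
  refine Measurable.mul ((measurable_of_finite (fun j : ZMod δ => stdAddChar (-(f : ZMod δ) * j))).comp measurable_fst) ?_
  refine Measurable.ite ?_ (hφ.comp measurable_snd) measurable_const
  have h3 : Measurable (fun y : YY δ => y.2.1.re) := h2.comp (measurable_fst.comp measurable_snd)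
  exact (measurableSet_le measurable_const h3).inter (measurableSet_lt h3 measurable_const)
theorem pr_meas (κ δ : ℕ) [NeZero δ] (f : ℤ) (φ : ℍℍ → ℍℍ → ℂ)
    (hφ : Measurable (fun p : ℍℍ × ℍℍ => φ p.1 p.2)) (g : SL2Z) :
    Measurable (pr κ δ f φ g) := by
  unfold pr
  refine ((chi_meas κ g).comp measurable_snd).mul (Measurable.mul
    ((measurable_of_finite (fun j : ZMod δ => stdAddChar (-(f : ZMod δ) * (((g 0 0 : ℤ) : ZMod δ) ^ 2 * j)))).comp measurable_fst) ?_)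
  have := (sl2_mp g).measurable
  exact hφ.comp ((this.comp (measurable_fst.comp measurable_snd)).prodMk (this.comp (measurable_snd.comp measurable_snd)))
theorem pr_norm (κ δ : ℕ) [NeZero δ] (f h : ℤ) (b H : ℝ) (φ : ℍℍ → ℍℍ → ℂ) (hφ : PhiOK h b H φ)
    (g : SL2Z) (y : YY δ) : ‖pr κ δ f φ g y‖ ≤ H / Wc y.2.1 y.2.2 ^ 2 := by
  unfold pr
  rw [norm_mul, norm_mul, chi_norm, norm_apply, one_mul, one_mul, ← Wc_smul g]
  exact hφ.2.2.1 _ _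
noncomputable def Sc (c : ℤ) (z : ℍℍ) : ℍℍ := hpt ((-1 / ((c:ℂ) ^ 2 * z)).re, (-1 / ((c:ℂ) ^ 2 * z)).im)
theorem Sc_im_pos (c : ℤ) (hc : c ≠ 0) (z : ℍℍ) :
    (-1 / ((c:ℂ) ^ 2 * z)).im = z.im / ((c:ℝ) ^ 2 * (z.re ^ 2 + z.im ^ 2)) := by
  have hz := z.im_pos
  have hc' : (c:ℝ) ≠ 0 := by exact_mod_cast hc
  have e : (-1 / ((c:ℂ) ^ 2 * z)) = ((1 / (c:ℝ) ^ 2 : ℝ) : ℂ) * (-(z:ℂ)⁻¹) := by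
    push_cast
    have : (c:ℂ) ≠ 0 := by exact_mod_cast hc
    have hz0 : (z:ℂ) ≠ 0 := UpperHalfPlane.ne_zero z
    field_simp
  rw [e, Complex.im_ofReal_mul]
  simp [normSq_apply]
  field_simp
theorem Sc_coe (c : ℤ) (hc : c ≠ 0) (z : ℍℍ) : ((Sc c z : ℍℍ) : ℂ) = -1 / ((c:ℂ) ^ 2 * z) := by
  unfold Sc
  rw [hpt_coe _ _ (by
    rw [Sc_im_pos c hc z]
    have hz := z.im_pos
    have hc' : (c:ℝ) ≠ 0 := by exact_mod_cast hc
    positivity)]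
theorem Sc_im (c : ℤ) (hc : c ≠ 0) (z : ℍℍ) : (Sc c z).im = z.im / ((c:ℝ) ^ 2 * (z.re ^ 2 + z.im ^ 2)) := by
  rw [← coe_im, Sc_coe c hc, Sc_im_pos c hc]
theorem Sc_meas (c : ℤ) : Measurable (Sc c) := by
  unfold Sc
  have h : Measurable (fun z : ℍℍ => -1 / ((c:ℂ) ^ 2 * z)) :=
    measurable_const.div (measurable_const.mul continuous_coe.measurable)
  exact hpt_meas.comp ((Complex.measurable_re.comp h).prodMk (measurable_im.comp h))
theorem sl_Sc (g : SL2Z) (c d : ℤ) (hc : c ≠ 0) (h0 : g 1 0 = c) (h1 : g 1 1 = d) (z : ℍℍ) :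
    g • z = ((g 0 0 : ℤ) / c : ℝ) +ᵥ Sc c ((d / c : ℝ) +ᵥ z) := by
  apply UpperHalfPlane.ext
  have hd1 : g 0 0 * g 1 1 - g 0 1 * g 1 0 = 1 := by rw [← det_fin_two]; exact g.2
  have hc' : (c:ℂ) ≠ 0 := by exact_mod_cast hc
  have hn := dn_ne g z
  have hd : dn g z = c * z + d := by unfold dn; rw [h0, h1]
  have hd2 := congrArg (Int.cast : ℤ → ℂ) hd1
  push_cast [h0, h1] at hd2
  rw [sl_coe, coe_vadd, Sc_coe c hc, coe_vadd]
  have hw : ((d / c : ℝ) : ℂ) + z = dn g z / c := by rw [hd]; push_cast; field_simp; ring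
  rw [hw]
  push_cast
  field_simp
  rw [hd]
  linear_combination -hd2
 
theorem dn_chi (κ : ℕ) (g : SL2Z) (c d : ℤ) (hc : c ≠ 0) (h0 : g 1 0 = c) (h1 : g 1 1 = d) (z : ℍℍ) :
    (dn g z / ‖dn g z‖) ^ (2 * κ) =
      ((((d / c : ℝ) +ᵥ z : ℍℍ) : ℂ) / ‖(((d / c : ℝ) +ᵥ z : ℍℍ) : ℂ)‖) ^ (2 * κ) := by
  have hc' : (c:ℂ) ≠ 0 := by exact_mod_cast hc
  have hd : dn g z = c * (((d / c : ℝ) +ᵥ z : ℍℍ) : ℂ) := by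
    unfold dn; rw [h0, h1, coe_vadd]; push_cast; field_simp; ring
  rw [hd, norm_mul, ofReal_mul, mul_div_mul_comm, mul_pow, pow_mul ((c:ℂ) / _)]
  have : ((c:ℂ) / ((‖(c:ℂ)‖ : ℝ) : ℂ)) ^ 2 = 1 := by
    rw [norm_intCast, div_pow, ← Complex.ofReal_pow, sq_abs]
    push_cast
    exact div_self (pow_ne_zero _ hc')
  rw [this, one_pow, one_mul]
noncomputable def psi (κ : ℕ) (c : ℤ) (φ : ℍℍ → ℍℍ → ℂ) (z w : ℍℍ) : ℂ :=
  ((z:ℂ) / ‖(z:ℂ)‖) ^ (2 * κ) * starRingEnd ℂ (((w:ℂ) / ‖(w:ℂ)‖) ^ (2 * κ)) * φ (Sc c z) (Sc c w)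
theorem psi_meas (κ : ℕ) (c : ℤ) (φ : ℍℍ → ℍℍ → ℂ)
    (hφ : Measurable (fun p : ℍℍ × ℍℍ => φ p.1 p.2)) :
    Measurable (fun p : ℍℍ × ℍℍ => psi κ c φ p.1 p.2) := by
  have h : Measurable (fun z : ℍℍ => ((z:ℂ) / ‖(z:ℂ)‖) ^ (2 * κ)) := by
    have := continuous_coe.measurable
    exact (this.div (Complex.measurable_ofReal.comp this.norm)).pow_const _
  unfold psi
  exact ((h.comp measurable_fst).mul (continuous_conj.measurable.comp (h.comp measurable_snd))).mul
    (hφ.comp (((Sc_meas c).comp measurable_fst).prodMk ((Sc_meas c).comp measurable_snd)))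
theorem pr_psi (κ δ : ℕ) [NeZero δ] (f h : ℤ) (b H : ℝ) (φ : ℍℍ → ℍℍ → ℂ) (hφ : PhiOK h b H φ)
    (g : SL2Z) (c d : ℤ) (hc : c ≠ 0) (h0 : g 1 0 = c) (h1 : g 1 1 = d) (y : YY δ) :
    pr κ δ f φ g y = stdAddChar (-(f : ZMod δ) * (((g 0 0 : ℤ) : ZMod δ) ^ 2 * y.1)) *
      exp (-(τI * h * (((g 0 0 : ℤ) / c : ℝ) : ℂ))) *
        psi κ c φ ((d / c : ℝ) +ᵥ y.2.1) ((d / c : ℝ) +ᵥ y.2.2) := by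
  unfold pr chi psi
  rw [dn_chi κ g c d hc h0 h1, dn_chi κ g c d hc h0 h1, sl_Sc g c d hc h0 h1, sl_Sc g c d hc h0 h1, hφ.2.2.2]
  ring
theorem Wc_Sc (c : ℤ) (hc : c ≠ 0) (z w : ℍℍ) : Wc (Sc c z) (Sc c w) = Wc z w := by
  unfold Wc
  have hz := z.im_pos
  have hw := w.im_pos
  have hz0 : (z:ℂ) ≠ 0 := UpperHalfPlane.ne_zero z
  have hw0 : (w:ℂ) ≠ 0 := UpperHalfPlane.ne_zero w
  have hc' : (c:ℝ) ≠ 0 := by exact_mod_cast hc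
  have hc'' : (c:ℂ) ≠ 0 := by exact_mod_cast hc
  rw [cosh_dist, cosh_dist, Sc_im c hc, Sc_im c hc, Sc_coe c hc, Sc_coe c hc, dist_eq, dist_eq]
  have e : -1 / ((c:ℂ) ^ 2 * z) - -1 / ((c:ℂ) ^ 2 * w) = (z - w) / ((c:ℂ) ^ 2 * z * w) := by field_simp; ring
  have n1 : ∀ z : ℍℍ, z.re ^ 2 + z.im ^ 2 = ‖(z:ℂ)‖ ^ 2 := by
    intro z
    rw [← normSq_eq_norm_sq, normSq_apply]; simp; ring
  have z1 : ‖(z:ℂ)‖ ≠ 0 := norm_ne_zero_iff.2 hz0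
  have w1 : ‖(w:ℂ)‖ ≠ 0 := norm_ne_zero_iff.2 hw0
  rw [e, n1, n1, norm_div, norm_mul, norm_mul, norm_pow, norm_intCast, sq_abs]
  field_simp
theorem psi_norm (κ : ℕ) (c h : ℤ) (hc : c ≠ 0) (b H : ℝ) (φ : ℍℍ → ℍℍ → ℂ) (hφ : PhiOK h b H φ)
    (z w : ℍℍ) : ‖psi κ c φ z w‖ ≤ H / Wc z w ^ 2 := by
  have h1 : ∀ z : ℍℍ, ‖(z:ℂ) / ((‖(z:ℂ)‖ : ℝ) : ℂ)‖ = 1 := by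
    intro z
    rw [norm_div, norm_real, norm_norm, div_self (norm_ne_zero_iff.2 (UpperHalfPlane.ne_zero z))]
  unfold psi
  rw [norm_mul, norm_mul, RCLike.norm_conj, norm_pow, norm_pow, h1, h1, one_pow, one_mul, one_mul, ← Wc_Sc c hc]
  exact hφ.2.2.1 _ _
noncomputable def Rr (κ δ : ℕ) [NeZero δ] (f : ℤ) (φ : ℍℍ → ℍℍ → ℂ)
    (g : SL2Z) (y : YY δ) : ℂ :=
  (Wc y.2.1 y.2.2 : ℂ) ^ 2 * starRingEnd ℂ (yf δ f φ y) * pr κ δ f φ g y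
noncomputable def Uc (κ : ℕ) (c : ℤ) (φ : ℍℍ → ℍℍ → ℂ) (p : ℍℍ × ℍℍ) : ℂ :=
  (Wc p.1 p.2 : ℂ) ^ 2 * starRingEnd ℂ (φ p.1 p.2) * psi κ c φ p.1 p.2
theorem yf_norm (δ : ℕ) [NeZero δ] (f h : ℤ) (b H : ℝ) (hH : 0 ≤ H) (φ : ℍℍ → ℍℍ → ℂ) (hφ : PhiOK h b H φ) (y : YY δ) :
    ‖yf δ f φ y‖ ≤ H / Wc y.2.1 y.2.2 ^ 2 := by
  unfold yf
  rw [norm_mul, norm_apply, one_mul]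
  split_ifs
  · exact hφ.2.2.1 _ _
  · rw [norm_zero]; positivity
theorem yf_supp (δ : ℕ) [NeZero δ] (f h : ℤ) (b H : ℝ) (φ : ℍℍ → ℍℍ → ℂ) (hφ : PhiOK h b H φ) (y : YY δ)
    (hy : yf δ f φ y ≠ 0) : b ≤ y.2.1.im ∧ 0 ≤ y.2.1.re ∧ y.2.1.re < 1 := by
  unfold yf at hy
  split_ifs at hy with h1
  · exact ⟨hφ.2.1 _ _ (right_ne_zero_of_mul hy), h1.1, h1.2⟩
  · simp at hy
theorem WW_le (W A B H : ℝ) (hW : 0 < W) (hA : A ≤ H / W ^ 2) (hB : B ≤ H / W ^ 2) (hA0 : 0 ≤ A) (hB0 : 0 ≤ B) : W ^ 2 * A * B ≤ H ^ 2 / W ^ 2 := by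
  rw [le_div_iff₀ bpos] at *
  nlinarith [mul_le_mul hA hB bpos (by nlinarith [mul_nonneg hA0 (sq_nonneg W)])]
theorem Wc_meas2 : Measurable (fun p : ℍℍ × ℍℍ => (Wc p.1 p.2 : ℂ) ^ 2) := by
  have : Measurable (fun p : ℍℍ × ℍℍ => Wc p.1 p.2) :=
    (continuous_cosh.comp (continuous_fst.dist continuous_snd)).measurable
  exact (Complex.measurable_ofReal.comp this).pow_const 2
theorem strip_meas (b : ℝ) : MeasurableSet {z : ℍℍ | b ≤ z.im ∧ 0 ≤ z.re ∧ z.re < 1} := by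
  have h1 : Measurable UpperHalfPlane.re := continuous_re.measurable
  have h2 : Measurable UpperHalfPlane.im := continuous_im.measurable
  exact (measurableSet_le measurable_const h2).inter ((measurableSet_le measurable_const h1).inter (measurableSet_lt h1 measurable_const))
theorem Rr_meas (κ δ : ℕ) [NeZero δ] (f : ℤ) (φ : ℍℍ → ℍℍ → ℂ)
    (hφ : Measurable (fun p : ℍℍ × ℍℍ => φ p.1 p.2)) (g : SL2Z) :
    Measurable (Rr κ δ f φ g) := by
  unfold Rr
  exact ((Wc_meas2.comp measurable_snd).mul (continuous_conj.measurable.comp (yf_meas δ f φ hφ))).mul (pr_meas κ δ f φ hφ g)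
theorem Rr_norm (κ δ : ℕ) [NeZero δ] (f h : ℤ) (b H : ℝ) (hH : 0 ≤ H) (φ : ℍℍ → ℍℍ → ℂ) (hφ : PhiOK h b H φ)
    (g : SL2Z) (y : YY δ) : ‖Rr κ δ f φ g y‖ ≤ H ^ 2 / Wc y.2.1 y.2.2 ^ 2 := by
  unfold Rr
  rw [norm_mul, norm_mul, RCLike.norm_conj, norm_pow, norm_real, norm_of_nonneg (Wc_pos _ _).le]
  exact WW_le _ _ _ _ (Wc_pos _ _) (yf_norm δ f h b H hH φ hφ y) (pr_norm κ δ f h b H φ hφ g y) (norm_nonneg _) (norm_nonneg _)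
theorem Rr_int (κ δ : ℕ) [NeZero δ] (f h : ℤ) (b H : ℝ) (hb : 0 < b) (hH : 0 ≤ H) (φ : ℍℍ → ℍℍ → ℂ) (hφ : PhiOK h b H φ)
    (g : SL2Z) : Integrable (Rr κ δ f φ g) (yμ δ) ∧
      (∫ y, Rr κ δ f φ g y ∂(yμ δ) = ∑ j, ∫ p, Rr κ δ f φ g (j, p) ∂(volume.prod volume)) ∧
      ‖∫ y, Rr κ δ f φ g y ∂(yμ δ)‖ ≤ δ * H ^ 2 * (8 * pi ^ 2 / b) := by
  have hm := Rr_meas κ δ f φ hφ.1 g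
  have h1 : ∀ j : ZMod δ, _ := fun j => SW_int {z : ℍℍ | b ≤ z.im ∧ 0 ≤ z.re ∧ z.re < 1} (strip_meas b) (2 / b) (H ^ 2)
    bpos bpos (strip_vol b hb) (fun p => Rr κ δ f φ g (j, p)) (hm.comp measurable_prodMk_left)
    (fun p hp => yf_supp δ f h b H φ hφ (j, p) (by
      intro h0; apply hp; unfold Rr; rw [h0]; simp)) (fun p => Rr_norm κ δ f h b H hH φ hφ g (j, p))
  obtain ⟨a1, a2⟩ := Y_int δ (Rr κ δ f φ g) hm (fun j => (h1 j).1)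
  refine ⟨a1, a2, ?_⟩
  rw [a2]
  refine (norm_sum_le _ _).trans ((sum_le_sum fun j _ => (h1 j).2).trans ?_)
  rw [sum_const, card_univ, ZMod.card, nsmul_eq_mul]
  apply le_of_eq
  field_simp
  ring
theorem Uc_region (κ : ℕ) (c h : ℤ) (hc : c ≠ 0) (b H : ℝ) (hb : 0 < b) (φ : ℍℍ → ℍℍ → ℂ) (hφ : PhiOK h b H φ) :
    Measurable (Uc κ c φ) ∧ (∀ p, ‖Uc κ c φ p‖ ≤ H ^ 2 / Wc p.1 p.2 ^ 2) ∧
    (∀ p, Uc κ c φ p ≠ 0 → p.1 ∈ {z : ℍℍ | b ≤ z.im ∧ b * (|(c:ℝ)| ^ 2 * (z.re ^ 2 + z.im ^ 2)) ≤ z.im}) ∧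
    Integrable (Uc κ c φ) (volume.prod volume) ∧ ‖∫ p, Uc κ c φ p ∂(volume.prod volume)‖ ≤ H ^ 2 * (4 * pi ^ 2) * (4 / (|(c:ℝ)| * b)) := by
  have hc' : 0 < |(c:ℝ)| := abs_pos.2 (by exact_mod_cast hc)
  have hm : Measurable (Uc κ c φ) := by
    unfold Uc
    exact (Wc_meas2.mul (continuous_conj.measurable.comp hφ.1)).mul (psi_meas κ c φ hφ.1)
  have hn : ∀ p, ‖Uc κ c φ p‖ ≤ H ^ 2 / Wc p.1 p.2 ^ 2 := by
    intro p
    unfold Uc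
    rw [norm_mul, norm_mul, RCLike.norm_conj, norm_pow, norm_real, norm_of_nonneg (Wc_pos _ _).le]
    exact WW_le _ _ _ _ (Wc_pos _ _) (hφ.2.2.1 _ _) (psi_norm κ c h hc b H φ hφ _ _) (norm_nonneg _) (norm_nonneg _)
  have hs : (∀ p, Uc κ c φ p ≠ 0 → p.1 ∈ {z : ℍℍ | b ≤ z.im ∧ b * (|(c:ℝ)| ^ 2 * (z.re ^ 2 + z.im ^ 2)) ≤ z.im}) := by
    intro p hp
    unfold Uc psi at hp
    have h1 : φ p.1 p.2 ≠ 0 := by rintro h0; apply hp; rw [h0]; simp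
    have h2 : φ (Sc c p.1) (Sc c p.2) ≠ 0 := right_ne_zero_of_mul (right_ne_zero_of_mul hp)
    refine ⟨hφ.2.1 _ _ h1, ?_⟩
    have h3 := hφ.2.1 _ _ h2
    have := p.1.im_pos
    rw [Sc_im c hc, le_div_iff₀ (by rw [← sq_abs]; positivity)] at h3
    rw [sq_abs]; exact h3
  have hS : MeasurableSet {z : ℍℍ | b ≤ z.im ∧ b * (|(c:ℝ)| ^ 2 * (z.re ^ 2 + z.im ^ 2)) ≤ z.im} := by
    have h1 : Measurable UpperHalfPlane.re := continuous_re.measurable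
    have h2 : Measurable UpperHalfPlane.im := continuous_im.measurable
    exact (measurableSet_le measurable_const h2).inter (measurableSet_le
      (((((h1.pow_const 2).add (h2.pow_const 2)).const_mul _)).const_mul _) h2)
  exact ⟨hm, hn, hs, SW_int _ hS _ _ bpos bpos (region_vol _ b hc' hb) _ hm hs hn⟩
theorem Rr_shift (κ δ : ℕ) [NeZero δ] (f h : ℤ) (b H : ℝ) (φ : ℍℍ → ℍℍ → ℂ) (hφ : PhiOK h b H φ)
    (g : SL2Z) (c d : ℤ) (hc : c ≠ 0) (h0 : g 1 0 = c) (h1 : g 1 1 = d) (y : YY δ) :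
    Rr κ δ f φ g y = stdAddChar (y.1 * ((f : ZMod δ) * (1 - ((g 0 0 : ℤ) : ZMod δ) ^ 2))) *
      exp (-(τI * h * (((g 0 0 : ℤ) + d : ℝ) / c))) *
      (fun p : ℍℍ × ℍℍ => if 0 ≤ p.1.re - d / c ∧ p.1.re - d / c < 1 then Uc κ c φ p else 0)
        ((d / c : ℝ) +ᵥ y.2.1, (d / c : ℝ) +ᵥ y.2.2) := by
  have hc' : (c:ℂ) ≠ 0 := by exact_mod_cast hc
  unfold Rr
  rw [pr_psi κ δ f h b H φ hφ g c d hc h0 h1]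
  unfold yf Uc
  have e1 : ((d / c : ℝ) +ᵥ y.2.1 : ℍℍ).re - d / c = y.2.1.re := by rw [vadd_re]; ring
  simp only [e1]
  split_ifs with hh
  · rw [hφ.2.2.2 (d / c : ℝ), Wc_vadd, map_mul (starRingEnd ℂ), map_mul (starRingEnd ℂ), ← Complex.exp_conj, ← map_neg_eq_conj]
    have s1 : stdAddChar (y.1 * ((f : ZMod δ) * (1 - ((g 0 0 : ℤ) : ZMod δ) ^ 2))) =
      stdAddChar (-(-(f : ZMod δ) * y.1)) * stdAddChar (-(f : ZMod δ) * (((g 0 0 : ℤ) : ZMod δ) ^ 2 * y.1)) := by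
      rw [← map_add_eq_mul]; congr 1; ring
    have s2 : exp (-(τI * h * (((g 0 0 : ℤ) + d : ℝ) / c))) * exp ((starRingEnd ℂ) (-(τI * h * ((d / c : ℝ) : ℂ)))) =
       exp (-(τI * h * (((g 0 0 : ℤ) / c : ℝ) : ℂ))) := by
      rw [← exp_add]
      congr 1
      simp only [map_neg, map_mul, Complex.conj_I, conj_ofReal, map_ofNat, map_intCast]
      push_cast
      field_simp
      ring
    rw [s1, ← s2]
    ring
  · simp
theorem Rr_eval (κ δ : ℕ) [NeZero δ] (f h : ℤ) (hf : IsUnit (f : ZMod δ)) (b H : ℝ) (hb : 0 < b) (hH : 0 ≤ H) (φ : ℍℍ → ℍℍ → ℂ) (hφ : PhiOK h b H φ)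
    (n : ℕ) [NeZero n] (hδ : δ ∣ n)
    (g : SL2Z) (c d : ℤ) (hc : c.natAbs = n) (h0 : g 1 0 = c) (h1 : g 1 1 = d) :
    ∫ y, Rr κ δ f φ g y ∂(yμ δ) = δ * klS n δ (-(c.sign * h)) (d : ZMod n) *
      ∫ p : ℍℍ × ℍℍ, (if 0 ≤ p.1.re - d / c ∧ p.1.re - d / c < 1 then Uc κ c φ p else 0) ∂(volume.prod volume) := by
  have hc0 : c ≠ 0 := by rintro rfl; exact NeZero.ne n (by simpa using hc.symm)
  rw [(Rr_int κ δ f h b H hb hH φ hφ g).2.1]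
  set V : ℍℍ × ℍℍ → ℂ := fun p => if 0 ≤ p.1.re - d / c ∧ p.1.re - d / c < 1 then Uc κ c φ p else 0 with hV
  have hmp := (vadd_mp (d / c : ℝ)).prod (vadd_mp (d / c : ℝ))
  have hVm : Measurable V := by
    have h3 : Measurable (fun p : ℍℍ × ℍℍ => p.1.re - d / c) :=
      (continuous_re.measurable.comp measurable_fst).sub_const _
    exact Measurable.ite ((measurableSet_le measurable_const h3).inter (measurableSet_lt h3 measurable_const)) (Uc_region κ c h hc0 b H hb φ hφ).1 measurable_const
  have hVs : ∫ p : ℍℍ × ℍℍ, V ((d / c : ℝ) +ᵥ p.1, (d / c : ℝ) +ᵥ p.2) ∂(volume.prod volume) = ∫ p, V p ∂(volume.prod volume) := by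
    conv_rhs => rw [← hmp.map_eq]
    rw [integral_map hmp.measurable.aemeasurable hVm.aestronglyMeasurable]
    rfl
  have e : ∀ j : ZMod δ, ∫ p, Rr κ δ f φ g (j, p) ∂(volume.prod volume) =
      stdAddChar (j * ((f : ZMod δ) * (1 - ((g 0 0 : ℤ) : ZMod δ) ^ 2))) *
      (exp (-(τI * h * (((g 0 0 : ℤ) + d : ℝ) / c))) * ∫ p, V p ∂(volume.prod volume)) := by
    intro j
    rw [← hVs, ← mul_assoc, ← integral_const_mul]
    refine integral_congr_ae (Filter.Eventually.of_forall fun p => ?_)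
    exact Rr_shift κ δ f h b H φ hφ g c d hc0 h0 h1 (j, p)
  have hd1 : g 0 0 * g 1 1 - g 0 1 * g 1 0 = 1 := by rw [← det_fin_two]; exact g.2
  rw [sum_congr rfl fun j _ => e j, ← sum_mul, sum_mulShift _ (isPrimitive_stdAddChar δ),
    klS_eval n δ hδ c hc h (g 0 0) d ⟨g 0 1, by rw [h0, h1] at hd1; linarith⟩]
  have iff1 : (f : ZMod δ) * (1 - ((g 0 0 : ℤ) : ZMod δ) ^ 2) = 0 ↔ (((g 0 0 : ℤ) : ZMod δ)) ^ 2 = 1 := by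
    rw [hf.mul_right_eq_zero, sub_eq_zero, eq_comm]
  simp only [iff1]
  split_ifs <;> simp [ZMod.card] <;> ring
theorem Qc_bound (κ δ : ℕ) [NeZero δ] (f h : ℤ) (hf : IsUnit (f : ZMod δ)) (b H : ℝ) (hb : 0 < b) (hH : 0 ≤ H) (φ : ℍℍ → ℍℍ → ℂ) (hφ : PhiOK h b H φ)
    (C : ℤ) (hC : 1 ≤ C * b) (c : ℤ) (hc0 : c ≠ 0) (hδ : (δ : ℤ) ∣ c) (hcC : |c| ≤ C) :
    ‖∑ d ∈ (Icc (-(2 * C + 1)) (2 * C + 1)).filter (fun d => IsCoprime c d), ∫ y, Rr κ δ f φ (rep (c, d)) y ∂(yμ δ)‖ ≤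
      δ * H ^ 2 * (16 * pi ^ 2 / b) * (klN c.natAbs δ h / c.natAbs) := by
  classical
  have hn : NeZero c.natAbs := ⟨by simpa using hc0⟩
  have hδ' : δ ∣ c.natAbs := natCast_dvd.1 hδ
  have hc' : 0 < |(c:ℝ)| := abs_pos.2 (by exact_mod_cast hc0)
  have hc1 : 1 ≤ |(c:ℝ)| := by exact_mod_cast one_le_abs hc0
  have hC' : |(c:ℝ)| ≤ C := by exact_mod_cast hcC
  obtain ⟨um, un, us, ui, ub⟩ := Uc_region κ c h hc0 b H hb φ hφ
  set S := klS c.natAbs δ (-(c.sign * h)) with hS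
  have e1 : ∀ d ∈ (Icc (-(2 * C + 1)) (2 * C + 1)).filter (fun d => IsCoprime c d), ∫ y, Rr κ δ f φ (rep (c, d)) y ∂(yμ δ) =
      δ * ∫ p : ℍℍ × ℍℍ, (if 0 ≤ p.1.re - d / c ∧ p.1.re - d / c < 1 then S (d : ZMod c.natAbs) else 0) * Uc κ c φ p ∂(volume.prod volume) := by
    intro d hd
    have hr := rep_row (c, d) (mem_filter.1 hd).2
    rw [Rr_eval κ δ f h hf b H hb hH φ hφ c.natAbs hδ' (rep (c, d)) c d rfl hr.1 hr.2, mul_assoc, ← integral_const_mul]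
    congr 2
    ext p
    split_ifs <;> simp [hS]
  have e2 : ∀ d ∈ (Icc (-(2 * C + 1)) (2 * C + 1)), Integrable (fun p : ℍℍ × ℍℍ => 
     (if 0 ≤ p.1.re - d / c ∧ p.1.re - d / c < 1 then S (d : ZMod c.natAbs) else 0) * Uc κ c φ p) (volume.prod volume) := by
    intro d _
    refine ui.bdd_mul (c := ‖S (d : ZMod c.natAbs)‖) ?_ (Filter.Eventually.of_forall fun p => ?_)
    · have h3 : Measurable (fun p : ℍℍ × ℍℍ => p.1.re - d / c) :=
        (continuous_re.measurable.comp measurable_fst).sub_const _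
      exact (Measurable.ite ((measurableSet_le measurable_const h3).inter (measurableSet_lt h3 measurable_const)) measurable_const measurable_const).aestronglyMeasurable
    · split_ifs
      · exact le_rfl
      · simp
  rw [sum_congr rfl e1, ← mul_sum, Finset.sum_filter_of_ne]
  · rw [← integral_finsetSum _ e2]
    have e3 : ∀ p : ℍℍ × ℍℍ, ∑ d ∈ (Icc (-(2 * C + 1)) (2 * C + 1)),
       (if 0 ≤ p.1.re - d / c ∧ p.1.re - d / c < 1 then S (d : ZMod c.natAbs) else 0) * Uc κ c φ p = klT c.natAbs δ (-(c.sign * h)) * Uc κ c φ p := by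
      intro p
      by_cases hp : Uc κ c φ p = 0
      · simp [hp]
      rw [← sum_mul, kl_complete c.natAbs c rfl S p.1.re, klS_sum]
      intro d hd1 hd2
      obtain ⟨r1, r2⟩ := us p hp
      have hx : |p.1.re| * |(c:ℝ)| ≤ C := by
        have hy := p.1.im_pos
        have t1 : b * (|(c:ℝ)| ^ 2 * p.1.im ^ 2) ≤ p.1.im := le_trans (by gcongr; nlinarith [sq_nonneg p.1.re]) r2
        have t2 : b * |(c:ℝ)| ^ 2 * p.1.im ≤ 1 := by
          by_contra hh
          push Not at hh
          nlinarith
        have t3 : b * (|(c:ℝ)| ^ 2 * p.1.re ^ 2) ≤ p.1.im := le_trans (by gcongr; nlinarith [sq_nonneg p.1.im]) r2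
        have t4 : (b * (|p.1.re| * |(c:ℝ)|)) ^ 2 ≤ 1 := by
          calc _ = b * (b * (|(c:ℝ)| ^ 2 * p.1.re ^ 2)) := by rw [← sq_abs p.1.re]; ring
            _ ≤ b * p.1.im := by gcongr
            _ ≤ b * |(c:ℝ)| ^ 2 * p.1.im := by
              rw [mul_right_comm]
              exact le_mul_of_one_le_right bpos (by nlinarith)
            _ ≤ 1 := t2
        have t5 : b * (|p.1.re| * |(c:ℝ)|) ≤ 1 := by
          by_contra hh
          push Not at hh
          nlinarith
        have : b * (|p.1.re| * |(c:ℝ)|) ≤ b * C := by linarith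
        exact le_of_mul_le_mul_left this hb
      have hd3 : |(d:ℝ)| ≤ 2 * C := by
        have : (d:ℝ) = c * p.1.re - c * (p.1.re - d / c) := by
          have : (c:ℝ) ≠ 0 := by exact_mod_cast hc0
          field_simp
          ring
        rw [this]
        refine (abs_sub _ _).trans ?_
        rw [abs_mul, abs_mul, abs_of_nonneg hd1]
        nlinarith
      have hd4 : |d| ≤ 2 * C := by exact_mod_cast hd3
      rw [abs_le] at hd4
      rw [mem_Icc]; omega
    simp only [e3]
    rw [integral_const_mul, norm_mul, norm_mul]
    have : ‖klT c.natAbs δ (-(c.sign * h))‖ = klN c.natAbs δ h := by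
      rw [← klN_sign _ _ c h hc0]; unfold klN; rw [dif_pos (NeZero.ne c.natAbs)]
    rw [this]
    have hk0 : 0 ≤ klN c.natAbs δ h := by rw [← this]; exact norm_nonneg _
    have e5 : ((c.natAbs : ℕ) : ℝ) = |(c:ℝ)| := by rw [cast_natAbs]; push_cast; rfl
    calc _ ≤ (δ:ℝ) * (klN c.natAbs δ h * (H ^ 2 * (4 * pi ^ 2) * (4 / (|(c:ℝ)| * b)))) := by
          rw [Complex.norm_natCast]
          gcongr
      _ = _ := by rw [e5]; field_simp; ring
  · intro d _ hd
    by_contra hcop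
    apply hd
    have : S (d : ZMod c.natAbs) = 0 := by
      rw [hS]; unfold klS
      rw [if_neg]
      intro hu
      apply hcop
      have := (coe_int_isUnit_iff_isCoprime d c.natAbs).1 hu
      rw [isCoprime_iff_gcd_eq_one] at this ⊢
      have e : ((c.natAbs : ℕ) : ℤ).natAbs = c.natAbs := natAbs_natCast _
      unfold Int.gcd at *
      rw [e] at this
      exact this
    simp [this]
theorem sum_pm (q C : ℕ) (F : ℕ → ℝ) (hF : ∀ n, 0 ≤ F n) :
    ∑ c ∈ (Icc (-(C:ℤ)) C).filter (fun c : ℤ => c ≠ 0 ∧ (q:ℤ) ∣ c), F c.natAbs ≤ 2 * ∑ c ∈ (Icc 1 C).filter (q ∣ ·), F c := by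
  classical
  have h1 : (Icc (-(C:ℤ)) C).filter (fun c : ℤ => c ≠ 0 ∧ (q:ℤ) ∣ c) ⊆
      ((Icc 1 C).filter (q ∣ ·)).image (fun n : ℕ => (n:ℤ)) ∪ ((Icc 1 C).filter (q ∣ ·)).image (fun n : ℕ => -(n:ℤ)) := by
    intro c hc
    simp only [mem_filter, mem_Icc, Finset.mem_union, mem_image] at hc ⊢
    have hd : q ∣ c.natAbs := natCast_dvd.1 hc.2.2
    rcases lt_or_gt_of_ne hc.2.1 with h | h
    · exact Or.inr ⟨c.natAbs, ⟨by omega, hd⟩, by omega⟩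
    · exact Or.inl ⟨c.natAbs, ⟨by omega, hd⟩, by omega⟩
  refine (sum_le_sum_of_subset_of_nonneg h1 fun _ _ _ => hF _).trans ?_
  have h2 := Finset.sum_union_inter (s₁ := ((Icc 1 C).filter (q ∣ ·)).image (fun n : ℕ => (n:ℤ)))
    (s₂ := ((Icc 1 C).filter (q ∣ ·)).image (fun n : ℕ => -(n:ℤ))) (f := fun c : ℤ => F c.natAbs)
  refine (le_add_of_nonneg_right (sum_nonneg fun _ _ => hF _)).trans (h2.le.trans ?_)
  rw [two_mul]
  gcongr
  · rw [sum_image (by intro a _ b _ h; simpa using h)]; simp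
  · rw [sum_image (by intro a _ b _ h; simpa using h)]; simp
theorem Q_bound (κ δ q : ℕ) [NeZero δ] (hδ : δ ∣ q) (f h : ℤ) (hf : IsUnit (f : ZMod δ)) (b H : ℝ) (hb : 0 < b) (hH : 0 ≤ H) (φ : ℍℍ → ℍℍ → ℂ) (hφ : PhiOK h b H φ)
    (C : ℕ) (hC : 1 ≤ C * b) :
    Integrable (fun y : YY δ => (Wc y.2.1 y.2.2 : ℂ) ^ 2 * starRingEnd ℂ (yf δ f φ y) * ∑' g : Gamma0 q, chi κ g y.2.1 y.2.2 * yf δ f φ (yact δ g y)) (yμ δ) ∧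
    ‖∫ y, (Wc y.2.1 y.2.2 : ℂ) ^ 2 * starRingEnd ℂ (yf δ f φ y) * ∑' g : Gamma0 q, chi κ g y.2.1 y.2.2 * yf δ f φ (yact δ g y) ∂(yμ δ)‖ ≤
      δ * H ^ 2 * (16 * pi ^ 2 / b) * (1 + 2 * ∑ c ∈ (Icc 1 C).filter (q ∣ ·), klN c δ h / c) := by
  classical
  have e1 : (fun y : YY δ => (Wc y.2.1 y.2.2 : ℂ) ^ 2 * starRingEnd ℂ (yf δ f φ y) * ∑' g : Gamma0 q, chi κ g y.2.1 y.2.2 * yf δ f φ (yact δ g y)) =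
      fun y => ∑ r ∈ rows q C, Rr κ δ f φ (rep r) y := by
    funext y
    unfold Rr
    rw [← mul_sum]
    by_cases hy : yf δ f φ y = 0
    · rw [hy]; simp
    · obtain ⟨a1, a2, a3⟩ := yf_supp δ f h b H φ hφ y hy
      rw [P_eq κ δ q hδ f h b H hb φ hφ C (by exact_mod_cast hC) y a1 a2 a3]
  rw [e1]
  have hi := fun r : ℤ × ℤ => Rr_int κ δ f h b H hb hH φ hφ (rep r)
  refine ⟨integrable_finsetSum _ fun r _ => (hi r).1, ?_⟩
  rw [integral_finsetSum _ fun r _ => (hi r).1]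
  set J : ℤ × ℤ → ℂ := fun r => ∫ y, Rr κ δ f φ (rep r) y ∂(yμ δ) with hJ
  have e2 : ∑ r ∈ rows q C, J r = ∑ c ∈ (Icc (-(C:ℤ)) C).filter (fun c : ℤ => (q:ℤ) ∣ c),
      ∑ d ∈ (Icc (-(2 * (C:ℤ) + 1)) (2 * C + 1)).filter (fun d => IsCoprime c d), J (c, d) := by
    unfold rows
    rw [sum_filter, Finset.sum_product, sum_filter]
    refine sum_congr rfl fun c _ => ?_
    rw [sum_filter]
    split_ifs with hq
    · refine sum_congr rfl fun d _ => ?_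
      simp [hq]
    · refine sum_eq_zero fun d _ => ?_
      simp [hq]
  have e3 : (Icc (-(C:ℤ)) C).filter (fun c : ℤ => (q:ℤ) ∣ c) = insert 0 ((Icc (-(C:ℤ)) C).filter (fun c : ℤ => c ≠ 0 ∧ (q:ℤ) ∣ c)) := by
    ext c
    simp only [mem_filter, Finset.mem_insert, mem_Icc]
    by_cases hc : c = 0
    · subst hc; simp
    · simp [hc]
  rw [e2, e3, Finset.sum_insert (by simp)]
  have t0 : ‖∑ d ∈ (Icc (-(2 * (C:ℤ) + 1)) (2 * C + 1)).filter (fun d => IsCoprime 0 d), J (0, d)‖ ≤ δ * H ^ 2 * (16 * pi ^ 2 / b) := by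
    refine (norm_sum_le _ _).trans ?_
    have hsub : (Icc (-(2 * (C:ℤ) + 1)) (2 * C + 1)).filter (fun d => IsCoprime 0 d) ⊆ {1, -1} := by
      intro d hd
      have := (mem_filter.1 hd).2
      rw [isCoprime_zero_left, isUnit_iff] at this
      simpa using this
    refine (sum_le_sum_of_subset_of_nonneg hsub fun _ _ _ => norm_nonneg _).trans ?_
    rw [Finset.sum_pair bnum]
    refine (add_le_add (hi _).2.2 (hi _).2.2).trans (le_of_eq ?_)
    ring
  have t1 : ‖∑ c ∈ (Icc (-(C:ℤ)) C).filter (fun c : ℤ => c ≠ 0 ∧ (q:ℤ) ∣ c),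
      ∑ d ∈ (Icc (-(2 * (C:ℤ) + 1)) (2 * C + 1)).filter (fun d => IsCoprime c d), J (c, d)‖ ≤ δ * H ^ 2 * (16 * pi ^ 2 / b) * (2 * ∑ c ∈ (Icc 1 C).filter (q ∣ ·), klN c δ h / c) := by
    refine (norm_sum_le _ _).trans ?_
    have hk : ∀ n : ℕ, 0 ≤ klN n δ h / n := fun n => by unfold klN; split_ifs <;> positivity
    calc _ ≤ ∑ c ∈ (Icc (-(C:ℤ)) C).filter (fun c : ℤ => c ≠ 0 ∧ (q:ℤ) ∣ c), δ * H ^ 2 * (16 * pi ^ 2 / b) * (klN c.natAbs δ h / c.natAbs) := by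
          refine sum_le_sum fun c hc => ?_
          simp only [mem_filter, mem_Icc] at hc
          exact Qc_bound κ δ f h hf b H hb hH φ hφ C (by exact_mod_cast hC) c hc.2.1 ((natCast_dvd_natCast.2 hδ).trans hc.2.2) (abs_le.2 hc.1)
      _ ≤ _ := by
          rw [← mul_sum]
          gcongr
          exact sum_pm q C (fun n => klN n δ h / n) hk
  refine (norm_add_le _ _).trans ((add_le_add t0 t1).trans (le_of_eq ?_))
  ring
theorem KW_int (δ : ℕ) [NeZero δ] (K : ℍℍ → ℝ) (hK0 : ∀ z, 0 ≤ K z) (hKm : Measurable K) (v A : ℝ) (hv : 0 ≤ v) (hA : 0 ≤ A)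
    (hKv : ∫⁻ z, ofReal (K z) ≤ ofReal v)
    (F : YY δ → ℝ) (hF : Measurable F) (hF0 : ∀ y, 0 ≤ F y) (hF2 : ∀ y, F y ≤ A * K y.2.1 * (1 / Wc y.2.1 y.2.2 ^ 2)) :
    Integrable F (yμ δ) ∧ ∫ y, F y ∂(yμ δ) ≤ δ * A * (4 * pi ^ 2) * v := by
  have key : ∫⁻ y, ofReal (F y) ∂(yμ δ) ≤ ofReal (δ * A * (4 * pi ^ 2) * v) := by
    have hm : Measurable (fun y => ofReal (F y)) := measurable_ofReal.comp hF
    unfold yμ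
    rw [lintegral_prod _ hm.aemeasurable, lintegral_count]
    have hj : ∀ j : ZMod δ, ∫⁻ p, ofReal (F (j, p)) ∂(volume.prod volume) ≤ ofReal (A * (4 * pi ^ 2) * v) := by
      intro j
      have hm2 : Measurable (fun p => ofReal (F (j, p))) := hm.comp measurable_prodMk_left
      rw [lintegral_prod _ hm2.aemeasurable]
      calc _ ≤ ∫⁻ z : ℍℍ, ofReal (A * (4 * pi ^ 2)) * ofReal (K z) := by
            refine lintegral_mono fun z => ?_
            calc _ ≤ ∫⁻ w, ofReal (A * K z) * ofReal (1 / Wc z w ^ 2) := by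
                  refine lintegral_mono fun w => ?_
                  rw [← ENNReal.ofReal_mul (mul_nonneg hA (hK0 z))]
                  exact ofReal_le_ofReal (hF2 (j, z, w))
              _ ≤ _ := by
                  have hWm : Measurable (fun w => Wc z w) := (continuous_cosh.comp (continuous_const.dist continuous_id)).measurable
                  have hWm2 : Measurable (fun w => ofReal (1 / Wc z w ^ 2)) := measurable_ofReal.comp (measurable_const.div (hWm.pow_const 2))
                  rw [lintegral_const_mul _ hWm2, ENNReal.ofReal_mul hA, ENNReal.ofReal_mul hA, mul_right_comm]
                  gcongr
                  exact W_int z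
        _ ≤ _ := by
            rw [lintegral_const_mul (ofReal (A * (4 * pi ^ 2))) (show Measurable (fun z => ofReal (K z)) from measurable_ofReal.comp hKm), ENNReal.ofReal_mul (p := A * (4 * pi ^ 2)) bpos]
            gcongr
    rw [tsum_fintype]
    refine (sum_le_sum fun j _ => hj j).trans ?_
    rw [sum_const, card_univ, ZMod.card, nsmul_eq_mul]
    rw [show (δ:ℝ) * A * (4 * pi ^ 2) * v = δ * (A * (4 * pi ^ 2) * v) by ring, ENNReal.ofReal_mul (p := (δ:ℝ)) bpos, ofReal_natCast]
  have hi : Integrable F (yμ δ) := by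
    refine ⟨hF.aestronglyMeasurable, lt_of_le_of_lt ?_ (lt_of_le_of_lt key ofReal_lt_top)⟩
    refine lintegral_mono fun y => ?_
    rw [← ofReal_norm, norm_of_nonneg (hF0 y)]
  refine ⟨hi, ?_⟩
  rw [← ofReal_integral_eq_lintegral_ofReal hi (Filter.Eventually.of_forall hF0)] at key
  exact (ofReal_le_ofReal_iff bpos).1 key
theorem geo (κ δ q : ℕ) [NeZero δ] (hδ : δ ∣ q) (hq : q ≠ 0) (f h : ℤ) (hf : IsUnit (f : ZMod δ)) (b H : ℝ) (hb : 0 < b) (hH : 0 ≤ H) (φ : ℍℍ → ℍℍ → ℂ) (hφ : PhiOK h b H φ)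
    (C : ℕ) (hC : 1 ≤ C * b) (G : YY δ → ℂ) (hG : Measurable G) (B : ℝ) (hB : 0 ≤ B) (hGB : ∀ y, ‖G y‖ ≤ B)
    (hGt : ∀ g ∈ Gamma0 q, ∀ y, G (yact δ g y) = chi κ g y.2.1 y.2.2 * G y) :
    Integrable (fun y => yf δ f φ y * G y) (yμ δ) ∧
    ‖∫ y, yf δ f φ y * G y ∂(yμ δ)‖ ^ 2 ≤ (δ * B ^ 2 * (4 * pi ^ 2) * (2 * (q * q.divisors.card))) *
      (δ * H ^ 2 * (16 * pi ^ 2 / b) * (1 + 2 * ∑ c ∈ (Icc 1 C).filter (q ∣ ·), klN c δ h / c)) := by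
  have : NeZero q := ⟨hq⟩
  obtain ⟨K, hK0, hKm, hK1, hKi⟩ := kq_exists (Gamma0 q)
  have hKi' : ∫⁻ z, ofReal (K z) ≤ ofReal (2 * (q * q.divisors.card)) := by
    refine hKi.trans ?_
    have := gamma0_index q hq
    rw [show ((2:ℝ) * (q * q.divisors.card)) = ((2 * (q * q.divisors.card) : ℕ) : ℝ) by push_cast; ring, ofReal_natCast]
    exact_mod_cast Nat.mul_le_mul_left 2 this
  have hWm : Measurable (fun y : YY δ => Wc y.2.1 y.2.2) := Wc_meas.comp measurable_snd
  have hfm := yf_meas δ f φ hφ.1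
  obtain ⟨V1, V2⟩ := KW_int δ K hK0 hKm (2 * (q * q.divisors.card)) (B ^ 2) bpos bpos hKi'
    (fun y => K y.2.1 * ‖G y‖ ^ 2 / Wc y.2.1 y.2.2 ^ 2)
    (((hKm.comp (measurable_fst.comp measurable_snd)).mul (hG.norm.pow_const 2)).div (hWm.pow_const 2))
    (fun y => by have := hK0 y.2.1; positivity)
    (fun y => by
      rw [mul_one_div, mul_comm (B ^ 2)]
      have := hK0 y.2.1
      have := hGB y
      gcongr)
  obtain ⟨Q1, Q2⟩ := Q_bound κ δ q hδ f h hf b H hb hH φ hφ C hC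
  have hfG : Integrable (fun y => yf δ f φ y * G y) (yμ δ) := by
    refine (Y_int δ _ (hfm.mul hG) fun j => ?_).1
    refine (SW_int {z : ℍℍ | b ≤ z.im ∧ 0 ≤ z.re ∧ z.re < 1} (strip_meas b) (2 / b) (H * B)
      bpos bpos (strip_vol b hb) (fun p => yf δ f φ (j, p) * G (j, p)) ((hfm.mul hG).comp measurable_prodMk_left)
      (fun p hp => yf_supp δ f h b H φ hφ (j, p) (left_ne_zero_of_mul hp)) (fun p => ?_)).1
    rw [norm_mul, mul_div_right_comm]
    exact mul_le_mul (yf_norm δ f h b H hH φ hφ (j, p)) (hGB _) (norm_nonneg _) bpos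
  refine ⟨hfG, ?_⟩
  refine (cs_unfold (Γ := Gamma0 q) (fun g => yact δ (g : SL2Z)) (fun g => yact_mp δ q hδ g g.2)
    (fun g y => by
      rw [← yact_mul δ q hδ _ _ g.2]
      have : ((g⁻¹ : Gamma0 q) : SL2Z) * g = 1 := by simp
      rw [this, yact_one])
    (fun g g' y => by rw [← yact_mul δ q hδ _ _ g'.2]; rfl)
    (fun y => K y.2.1) (fun y => hK0 _) (hKm.comp (measurable_fst.comp measurable_snd)) (fun y => hK1 y.2.1)
    (fun g y => chi κ g y.2.1 y.2.2) (fun g y => chi_norm κ _ _ _) (fun g g' y => chi_mul κ _ _ _ _)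
    (fun y => Wc y.2.1 y.2.2) (fun y => Wc_pos _ _) hWm (fun g y => Wc_smul _ _ _) _ G hfm hG (fun g y => hGt g g.2 y)
    (fun g => (chi_meas κ g).comp measurable_snd) hfG _ (fun y => rfl) Q1 V1).trans ?_
  exact mul_le_mul V2 Q2 (norm_nonneg _) bpos
theorem fo_mob (κ : ℕ) (a : ℕ → ℂ) (h : IsNormalizedHeckeEigenform (2 * κ) a) (A B C D : ℤ) (hdet : A * D - B * C = 1) (w w' : ℍℍ)
    (hw : (w' : ℂ) * (C * w + D) = A * w + B) :
    Fo κ a w' = (((C:ℂ) * w + D) / ‖(C:ℂ) * w + D‖) ^ (2 * κ) * Fo κ a w := by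
  let g : SL2Z := ⟨!![A, B; C, D], by rw [Matrix.det_fin_two_of]; exact hdet⟩
  have e : dn g w = C * w + D := rfl
  have hne := dn_ne g w
  have e2 : w' = g • w := by
    apply UpperHalfPlane.ext
    rw [sl_coe, e, eq_div_iff (by rw [← e]; exact hne), hw]
    rfl
  rw [e2, fo_slash κ a h, dn_eq, e]
noncomputable def Gf (κ : ℕ) (a : ℕ → ℂ) (δ c1 c2 μ3 μ4 : ℕ) (y : YY δ) : ℂ :=
  Fo κ a (hpt (c1 * μ4 * y.2.1.re + c1 * y.1.val / δ, c1 * μ4 * y.2.1.im)) *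
    Fo κ a (hpt (-(c2 * μ3 * y.2.2.re), c2 * μ3 * y.2.2.im))
theorem Gf_trans (κ : ℕ) (a : ℕ → ℂ) (h : IsNormalizedHeckeEigenform (2 * κ) a) (δ c1 c2 μ3 μ4 : ℕ) [NeZero δ] (h1 : 0 < c1) (h2 : 0 < c2) (h3 : 0 < μ3) (h4 : 0 < μ4)
    (g : SL2Z) (hg : g ∈ Gamma0 (δ ^ 2 * μ3 * μ4 * c1 * c2)) (y : YY δ) :
    Gf κ a δ c1 c2 μ3 μ4 (yact δ g y) = chi κ g y.2.1 y.2.2 * Gf κ a δ c1 c2 μ3 μ4 y := by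
  have hδ : (δ:ℂ) ≠ 0 := by exact_mod_cast NeZero.ne δ
  have hdet : g 0 0 * g 1 1 - g 0 1 * g 1 0 = 1 := by rw [← det_fin_two]; exact g.2
  have hcd := g0_dvd δ _ (by exact ⟨δ * μ3 * μ4 * c1 * c2, by ring⟩) g hg
  rw [Gamma0_mem, intCast_zmod_eq_zero_iff_dvd] at hg
  obtain ⟨t, ht⟩ := hg
  push_cast at ht
  set A := g 0 0 with hA
  set B := g 0 1 with hB
  set D := g 1 1 with hD
  set j : ℤ := (y.1.val : ℤ) with hj
  set j' : ℤ := (((((A : ℤ) : ZMod δ)) ^ 2 * y.1).val : ℤ) with hj'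
  have hu : (δ:ℤ) ∣ j' * D - A * j := by
    rw [← intCast_zmod_eq_zero_iff_dvd, hj, hj']
    push_cast
    rw [natCast_zmod_val, natCast_zmod_val]
    have := congrArg (Int.cast : ℤ → ZMod δ) hdet
    push_cast at this
    rw [hcd] at this
    linear_combination (A : ZMod δ) * y.1 * this
  obtain ⟨u, hu⟩ := hu
  have m1 : (0:ℝ) < c1 * μ4 := by positivity
  have m2 : (0:ℝ) < c2 * μ3 := by positivity
  have i1 := y.2.1.im_pos
  have i2 := y.2.2.im_pos
  have i1' := (g • y.2.1).im_pos
  have i2' := (g • y.2.2).im_pos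
  have hre : ∀ z : ℍℍ, (z:ℂ) = z.re + z.im * Complex.I := fun z => (re_add_im (z:ℂ)).symm
  have eA : ∀ (z : ℍℍ) (x : ℤ), (((hpt (c1 * μ4 * z.re + c1 * x / δ, c1 * μ4 * z.im)) : ℍℍ) : ℂ) = c1 * μ4 * z + c1 * x / δ := by
    intro z x
    rw [hpt_coe _ _ (by have := z.im_pos; positivity), hre z]
    apply Complex.ext <;> simp [hδ, Complex.div_re, Complex.div_im, normSq_apply] <;> field_simp
  have eB : ∀ (z : ℍℍ), (((hpt (-(c2 * μ3 * z.re), c2 * μ3 * z.im)) : ℍℍ) : ℂ) = -(c2 * μ3 * (starRingEnd ℂ z)) := by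
    intro z
    rw [hpt_coe _ _ (by have := z.im_pos; positivity)]
    apply Complex.ext <;> simp
  have hdetC := congrArg (Int.cast : ℤ → ℂ) hdet
  have htC := congrArg (Int.cast : ℤ → ℂ) ht
  have huC := congrArg (Int.cast : ℤ → ℂ) hu
  push_cast at hdetC htC huC
  have edn : ∀ z : ℍℍ, dn g z = (g 1 0 : ℤ) * z + D := fun z => rfl
  have esm : ∀ z : ℍℍ, ((g • z : ℍℍ) : ℂ) * ((g 1 0 : ℤ) * z + D) = A * z + B := by
    intro z
    rw [sl_coe, edn, div_mul_cancel₀ _ (by rw [← edn]; exact dn_ne g z)]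
  have hw1 := eA y.2.1 j
  have hw1' := eA (g • y.2.1) j'
  have hw2 := eB y.2.2
  have hw2' := eB (g • y.2.2)
  set w1 := hpt (c1 * μ4 * y.2.1.re + c1 * j / δ, c1 * μ4 * y.2.1.im) with hw1d
  set w1' := hpt (c1 * μ4 * (g • y.2.1).re + c1 * j' / δ, c1 * μ4 * (g • y.2.1).im) with hw1d'
  set w2 := hpt (-(c2 * μ3 * y.2.2.re), c2 * μ3 * y.2.2.im)
  set w2' := hpt (-(c2 * μ3 * (g • y.2.2).re), c2 * μ3 * (g • y.2.2).im)
  have E : Gf κ a δ c1 c2 μ3 μ4 (yact δ g y) = Fo κ a w1' * Fo κ a w2' := by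
    unfold Gf yact
    rw [hw1d', hj']; rfl
  have E' : Gf κ a δ c1 c2 μ3 μ4 y = Fo κ a w1 * Fo κ a w2 := by
    unfold Gf
    rw [hw1d, hj]; rfl
  have den1 : (((δ ^ 2 * μ3 * c2 * t : ℤ) : ℂ) * w1 + ((D - j * δ * μ3 * c1 * c2 * t : ℤ) : ℂ)) = dn g y.2.1 := by
    rw [edn, hw1, htC]; push_cast; field_simp; ring
  have den2 : (((-(δ ^ 2 * μ4 * c1 * t) : ℤ) : ℂ) * w2 + ((D : ℤ) : ℂ)) = starRingEnd ℂ (dn g y.2.2) := by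
    rw [edn, hw2, map_add, map_mul, map_intCast, map_intCast, htC]; push_cast; ring
  have f1 := fo_mob κ a h (A + j' * δ * μ3 * c1 * c2 * t) (c1 * u - c1 ^ 2 * c2 * μ3 * t * j * j' + c1 * μ4 * B)
    (δ ^ 2 * μ3 * c2 * t) (D - j * δ * μ3 * c1 * c2 * t) (by
      linear_combination hdet + (δ * μ3 * c1 * c2 * t) * hu + B * ht) w1 w1' (by
      rw [den1, edn, hw1', add_mul, mul_assoc, esm, hw1]
      push_cast
      rw [htC]
      field_simp
      linear_combination (c1:ℂ) * huC)
  have f2 := fo_mob κ a h A (-(c2 * μ3 * B)) (-(δ ^ 2 * μ4 * c1 * t)) D (by linear_combination hdet + B * ht) w2 w2' (by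
      rw [den2, hw2', hw2, edn]
      have := congrArg (starRingEnd ℂ) (esm y.2.2)
      rw [map_mul, map_add (starRingEnd ℂ) (_ * _) (B : ℂ), map_mul _ (A:ℂ)] at this
      simp only [map_intCast] at this
      push_cast
      linear_combination (-(c2:ℂ) * μ3) * this)
  rw [E, E', f1, f2, den1, den2, Complex.norm_conj]
  unfold chi
  simp only [map_pow, map_div₀, conj_ofReal]
  ring
theorem Gf_meas (κ : ℕ) (a : ℕ → ℂ) (h : IsNormalizedHeckeEigenform (2 * κ) a) (δ c1 c2 μ3 μ4 : ℕ) [NeZero δ] : Measurable (Gf κ a δ c1 c2 μ3 μ4) := by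
  have hF := (fo_cont κ a h).measurable
  have h1 : Measurable UpperHalfPlane.re := continuous_re.measurable
  have h2 : Measurable UpperHalfPlane.im := continuous_im.measurable
  have p1 : Measurable (fun y : YY δ => y.2.1) := measurable_fst.comp measurable_snd
  have p2 : Measurable (fun y : YY δ => y.2.2) := measurable_snd.comp measurable_snd
  have hj : Measurable (fun y : YY δ => (c1 * y.1.val / δ : ℝ)) := (measurable_of_finite (fun j : ZMod δ => (c1 * j.val / δ : ℝ))).comp measurable_fst
  unfold Gf
  exact (hF.comp (hpt_meas.comp ((((h1.comp p1).const_mul _).add hj).prodMk ((h2.comp p1).const_mul _)))).mul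
    (hF.comp (hpt_meas.comp ((((h1.comp p2).const_mul _).neg).prodMk ((h2.comp p2).const_mul _))))
def Dn (A τ : ℝ) (F : ℝ → ℂ) : Prop :=
  ContDiff ℝ 4 F ∧ ∀ ν : ℕ, ν ≤ 4 → ∀ v, ‖iteratedDeriv ν F v‖ ≤ A * τ ^ ν
theorem dnb_nonneg {A τ : ℝ} {F : ℝ → ℂ} (h : Dn A τ F) : 0 ≤ A := by
  have := (norm_nonneg _).trans (h.2 0 bnum 0)
  simpa using this
theorem dnb_mono {A τ τ' : ℝ} {F : ℝ → ℂ} (h : Dn A τ F) (h0 : 0 ≤ τ) (hτ : τ ≤ τ') : Dn A τ' F :=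
  ⟨h.1, fun ν hν v => (h.2 ν hν v).trans (mul_le_mul_of_nonneg_left (pow_le_pow_left₀ h0 hτ ν) (dnb_nonneg h))⟩
theorem dnb_mul {A A' τ : ℝ} {F G : ℝ → ℂ} (hτ : 0 ≤ τ) (h : Dn A τ F) (h' : Dn A' τ G) : Dn (16 * A * A') τ (fun v => F v * G v) := by
  have hA := dnb_nonneg h
  have hA' := dnb_nonneg h'
  refine ⟨h.1.mul h'.1, fun ν hν v => ?_⟩
  have c4 : ((ν : ℕ) : WithTop ℕ∞) ≤ 4 := by exact_mod_cast hν
  have e := iteratedDeriv_mul (n := ν) (x := v) (h.1.of_le c4).contDiffAt (h'.1.of_le c4).contDiffAt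
  have e2 : iteratedDeriv ν (fun v => F v * G v) v = _ := e
  rw [e2]
  calc _ ≤ ∑ i ∈ range (ν + 1), (ν.choose i : ℝ) * (A * A' * τ ^ ν) := by
        refine (norm_sum_le _ _).trans (sum_le_sum fun i hi => ?_)
        have hi' : i ≤ ν := by have := mem_range.1 hi; omega
        rw [norm_mul, norm_mul, Complex.norm_natCast, mul_assoc]
        refine mul_le_mul_of_nonneg_left ?_ bpos
        calc _ ≤ (A * τ ^ i) * (A' * τ ^ (ν - i)) :=
              mul_le_mul (h.2 i bomg v) (h'.2 _ bomg v) (norm_nonneg _) bpos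
          _ = A * A' * (τ ^ i * τ ^ (ν - i)) := by ring
          _ = _ := by rw [← pow_add, Nat.add_sub_cancel' hi']
    _ = 2 ^ ν * (A * A' * τ ^ ν) := by
        rw [← sum_mul]
        congr 1
        exact_mod_cast Nat.sum_range_choose ν
    _ ≤ 2 ^ 4 * (A * A' * τ ^ ν) := by
        refine mul_le_mul_of_nonneg_right ?_ bpos
        exact pow_le_pow_right₀ bnum hν
    _ = _ := by ring
theorem dnb_aff {A τ : ℝ} {F : ℝ → ℂ} (c x : ℝ) (h : Dn A τ F) : Dn A (τ * |c|) (fun v => F (c * v + x)) := by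
  have hc : ContDiff ℝ 4 (fun v => F (v + x)) := h.1.comp (contDiff_id.add contDiff_const)
  refine ⟨h.1.comp ((contDiff_const.mul contDiff_id).add contDiff_const), fun ν hν v => ?_⟩
  have c4 : ((ν : ℕ) : WithTop ℕ∞) ≤ 4 := by exact_mod_cast hν
  have e := congrFun (iteratedDeriv_comp_const_smul (n := ν) (hc.of_le c4) c) v
  rw [e, iteratedDeriv_comp_add_const, norm_smul, norm_pow, norm_eq_abs, mul_pow]
  have := h.2 ν hν (c * v + x)
  calc _ ≤ |c| ^ ν * (A * τ ^ ν) := mul_le_mul_of_nonneg_left this bpos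
    _ = _ := by ring
noncomputable def bb (u : ℝ) : ℝ := (⟨1/4, 1/2, by norm_num, by norm_num⟩ : ContDiffBump (0:ℝ)) u
theorem bb_nonneg (u : ℝ) : 0 ≤ bb u := ContDiffBump.nonneg _
theorem bb_le (u : ℝ) : bb u ≤ 1 := ContDiffBump.le_one _
theorem bb_one (u : ℝ) (hu : |u| ≤ 1/4) : bb u = 1 := by
  refine ContDiffBump.one_of_mem_closedBall _ ?_
  rw [mem_closedBall_zero_iff]; exact hu
theorem bb_supp (u : ℝ) (hu : bb u ≠ 0) : |u| ≤ 1/2 := by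
  by_contra hc
  refine hu (ContDiffBump.zero_of_le_dist _ ?_)
  rw [dist_zero_right, norm_eq_abs]
  exact (not_le.1 hc).le
theorem bb_smooth : ContDiff ℝ 4 bb := ContDiffBump.contDiff _
theorem bb_dn : ∃ C : ℝ, 1 ≤ C ∧ Dn C 1 (fun u => (bb u : ℂ)) := by
  have hs : ContDiff ℝ 4 (fun u => (bb u : ℂ)) := Complex.ofRealCLM.contDiff.comp bb_smooth
  have hcs : HasCompactSupport (fun u => (bb u : ℂ)) := by
    refine HasCompactSupport.intro (isCompact_Icc (a := (-1/2:ℝ)) (b := 1/2)) fun x hx => ?_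
    by_contra hne
    have := abs_le.1 (bb_supp x (by intro h0; exact hne (by simp [h0])))
    exact hx ⟨by linarith [this.1], this.2⟩
  have hb : ∀ ν : ℕ, ∃ C, ν ≤ 4 → ∀ x, ‖iteratedDeriv ν (fun u => (bb u : ℂ)) x‖ ≤ C := by
    intro ν
    by_cases hν : ν ≤ 4
    · have hc : Continuous (iteratedFDeriv ℝ ν (fun u => (bb u : ℂ))) := hs.continuous_iteratedFDeriv (by exact_mod_cast hν)
      obtain ⟨C, hC⟩ := (hcs.iteratedFDeriv ν).exists_bound_of_continuous hc
      exact ⟨C, fun _ x => by rw [← norm_iteratedFDeriv_eq_norm_iteratedDeriv]; exact hC x⟩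
    · exact ⟨0, fun h => absurd h hν⟩
  choose C hC using hb
  refine ⟨1 + ∑ ν ∈ range 5, |C ν|, by linarith [sum_nonneg (fun i (_ : i ∈ range 5) => abs_nonneg (C i))], hs, fun ν hν v => ?_⟩
  rw [one_pow, mul_one]
  have h1 := hC ν hν v
  have h2 := single_le_sum (f := fun i => |C i|) (fun i _ => abs_nonneg (C i)) (mem_range.2 (show ν < 5 by omega))
  have h3 := le_abs_self (C ν)
  linarith
open MeasureTheory FourierTransform in
theorem ft_decay (A τ p ℓ : ℝ) (R : ℝ → ℂ) (h : Dn A τ R) (hℓ : 0 ≤ ℓ) (hs : ∀ v, R v ≠ 0 → p ≤ v ∧ v ≤ p + ℓ) :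
    Integrable R ∧ (∀ t, ‖𝓕⁻ R t‖ ≤ A * ℓ) ∧ (∀ t, t ^ 4 * ‖𝓕⁻ R t‖ ≤ A * τ ^ 4 * ℓ) := by
  have hA := dnb_nonneg h
  have hts : tsupport R ⊆ Set.Icc p (p + ℓ) := closure_minimal (fun v hv => hs v hv) isClosed_Icc
  have hsup : ∀ ν : ℕ, ∀ v, v ∉ Set.Icc p (p + ℓ) → iteratedDeriv ν R v = 0 := by
    intro ν v hv
    by_contra hne
    have : v ∈ Function.support (iteratedFDeriv ℝ ν R) := by
      rw [Function.mem_support]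
      intro h0
      have := norm_iteratedFDeriv_eq_norm_iteratedDeriv (𝕜 := ℝ) (f := R) (n := ν) (x := v)
      rw [h0, norm_zero] at this
      exact hne (norm_eq_zero.1 this.symm)
    exact hv (hts (support_iteratedFDeriv_subset ν this))
  have hint : ∀ ν : ℕ, ν ≤ 4 → Integrable (iteratedDeriv ν R) := by
    intro ν hν
    have hc : Continuous (iteratedDeriv ν R) := h.1.continuous_iteratedDeriv ν (by exact_mod_cast hν)
    exact hc.integrable_of_hasCompactSupport (HasCompactSupport.intro isCompact_Icc (hsup ν))
  have hbd : ∀ ν : ℕ, ν ≤ 4 → ∀ t, ‖𝓕 (iteratedDeriv ν R) t‖ ≤ A * τ ^ ν * ℓ := by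
    intro ν hν t
    refine (VectorFourier.norm_fourierIntegral_le_integral_norm _ _ _ _ _).trans ?_
    calc ∫ v, ‖iteratedDeriv ν R v‖ = ∫ v in Set.Icc p (p + ℓ), ‖iteratedDeriv ν R v‖ := by
          rw [setIntegral_eq_integral_of_forall_compl_eq_zero]
          intro v hv; rw [hsup ν v hv, norm_zero]
      _ ≤ ∫ v in Set.Icc p (p + ℓ), A * τ ^ ν := by
          refine setIntegral_mono_on (hint ν hν).norm.integrableOn (integrableOn_const (by simp)) measurableSet_Icc fun v _ => h.2 ν hν v
      _ = _ := by
          simp [hℓ]; ring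
  have i0 : Integrable R := by simpa using hint 0 bnum
  refine ⟨i0, fun t => ?_, fun t => ?_⟩
  · rw [fourierInv_eq_fourier_neg]
    simpa using hbd 0 bnum (-t)
  · rw [fourierInv_eq_fourier_neg]
    have e := congrFun (Real.fourier_iteratedDeriv (N := 4) (n := 4) (f := R) (by exact_mod_cast h.1) (fun n hn => hint n (by exact_mod_cast hn)) bnum) (-t)
    have h4 := hbd 4 le_rfl (-t)
    rw [e, norm_smul, norm_pow] at h4
    refine le_trans (mul_le_mul_of_nonneg_right ?_ (norm_nonneg _)) h4
    have : ‖(τI * ((-t : ℝ) : ℂ))‖ = 2 * pi * |t| := by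
      simp [abs_of_pos pi_pos]
    rw [this, mul_pow]
    have : |t| ^ 4 = t ^ 4 := by rw [← abs_pow, abs_of_nonneg bpos]
    rw [this]
    have hp : 1 ≤ (2 * pi) ^ 4 := one_le_pow₀ (by linarith [pi_gt_three])
    nlinarith [show 0 ≤ t ^ 4 by positivity]
open MeasureTheory FourierTransform in
theorem ft_inv (A τ p ℓ : ℝ) (R : ℝ → ℂ) (h : Dn A τ R) (hℓ : 0 ≤ ℓ) (hs : ∀ v, R v ≠ 0 → p ≤ v ∧ v ≤ p + ℓ) :
    Integrable (𝓕⁻ R) ∧ ∀ v : ℝ, ∫ t : ℝ, 𝓕⁻ R t * exp (-(τI * v * t)) = R v := by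
  obtain ⟨hR, h1, h2⟩ := ft_decay A τ p ℓ R h hℓ hs
  have hc : Continuous (𝓕⁻ R) := by
    have e : 𝓕⁻ R = fun t => 𝓕 R (-t) := by ext t; exact fourierInv_eq_fourier_neg R t
    rw [e]
    have : Continuous (𝓕 R) := VectorFourier.fourierIntegral_continuous Real.continuous_fourierChar (by exact continuous_inner) hR
    exact this.comp continuous_neg
  have hi : Integrable (𝓕⁻ R) := by
    refine Integrable.mono' (integrable_inv_one_add_sq.const_mul (2 * (A * ℓ) + A * τ ^ 4 * ℓ)) hc.aestronglyMeasurable (Filter.Eventually.of_forall fun t => ?_)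
    rw [← div_eq_mul_inv, le_div_iff₀ bpos]
    have a1 := h1 t
    have a2 := h2 t
    have : t ^ 2 ≤ 1 + t ^ 4 := by nlinarith [sq_nonneg (t ^ 2 - 1)]
    nlinarith [norm_nonneg (𝓕⁻ R t)]
  refine ⟨hi, fun v => ?_⟩
  have hF : Integrable (𝓕 R) := by
    have e : 𝓕 R = fun t => 𝓕⁻ R (-t) := by ext t; rw [fourierInv_eq_fourier_neg, neg_neg]
    rw [e]; exact hi.comp_neg
  have := congrFun (h.1.continuous.fourier_fourierInv_eq hR hF) v
  rw [← this, fourier_real_eq_integral_exp_smul]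
  refine integral_congr_ae (Filter.Eventually.of_forall fun t => ?_)
  simp only [smul_eq_mul]
  rw [mul_comm]
  congr 2
  push_cast; ring
noncomputable def Rw (w : ℝ → ℂ) (h : ℤ) (s y1 y2 v : ℝ) : ℂ := w v * (bb (y1 * v + (y1 * h - s)) : ℂ) * (bb (y2 * v + (-s)) : ℂ)
theorem Rw_dn (C Cw θ yu : ℝ) (w : ℝ → ℂ) (h : ℤ) (s y1 y2 : ℝ) (hC : Dn C 1 (fun u => (bb u : ℂ))) (hw : Dn Cw θ w) (hθ : 0 ≤ θ)
    (h1 : 0 < y1) (h1' : y1 ≤ yu) (h2 : 0 < y2) (h2' : y2 ≤ yu) : Dn (256 * Cw * C ^ 2) (θ + yu) (Rw w h s y1 y2) := by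
  have a1 := dnb_mono (dnb_aff y1 (y1 * h - s) hC) bpos (show 1 * |y1| ≤ θ + yu by rw [abs_of_pos h1]; linarith)
  have a2 := dnb_mono (dnb_aff y2 (-s) hC) bpos (show 1 * |y2| ≤ θ + yu by rw [abs_of_pos h2]; linarith)
  have a0 := dnb_mono hw hθ (show θ ≤ θ + yu by linarith)
  have := dnb_mul blin (dnb_mul blin a0 a1) a2
  have e : 16 * (16 * Cw * C) * C = 256 * Cw * C ^ 2 := by ring
  rw [e] at this
  exact this
theorem Rw_supp (w : ℝ → ℂ) (h : ℤ) (s y1 y2 yl : ℝ) (hl : 0 < yl) (h2 : yl ≤ y2) (v : ℝ) (hv : Rw w h s y1 y2 v ≠ 0) :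
    (s - 1/2) / y2 ≤ v ∧ v ≤ (s - 1/2) / y2 + 1 / yl := by
  have hb : bb (y2 * v + (-s)) ≠ 0 := by
    intro h0; apply hv; unfold Rw; rw [h0]; simp
  have := abs_le.1 (bb_supp _ hb)
  have hy : 0 < y2 := by linarith
  refine ⟨?_, ?_⟩
  · rw [div_le_iff₀ hy]; linarith [this.1]
  · have : v ≤ (s - 1/2) / y2 + 1 / y2 := by
      rw [← add_div, le_div_iff₀ hy]; linarith [this.2]
    have h3 : 1 / y2 ≤ 1 / yl := one_div_le_one_div_of_le hl h2
    linarith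
open FourierTransform in
noncomputable def ph (w : ℝ → ℂ) (h : ℤ) (s yl yu : ℝ) (z1 z2 : ℍℍ) : ℂ :=
  if (yl ≤ z1.im ∧ z1.im ≤ yu) ∧ (yl ≤ z2.im ∧ z2.im ≤ yu) then
    exp (-(τI * h * z1.re)) * (√(z1.im * z2.im) : ℝ) * 𝓕⁻ (Rw w h s z1.im z2.im) (z2.re - z1.re) else 0
open MeasureTheory FourierTransform in
theorem ph_meas (w : ℝ → ℂ) (hw : Continuous w) (h : ℤ) (s yl yu : ℝ) :
    Measurable (fun p : ℍℍ × ℍℍ => ph w h s yl yu p.1 p.2) := by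
  have i1 : Continuous (fun p : ℍℍ × ℍℍ => p.1.im) := continuous_im.comp continuous_fst
  have i2 : Continuous (fun p : ℍℍ × ℍℍ => p.2.im) := continuous_im.comp continuous_snd
  have r1 : Continuous (fun p : ℍℍ × ℍℍ => p.1.re) := continuous_re.comp continuous_fst
  have r2 : Continuous (fun p : ℍℍ × ℍℍ => p.2.re) := continuous_re.comp continuous_snd
  have hbb : Continuous bb := bb_smooth.continuous
  unfold ph
  refine Measurable.ite ?_ ?_ measurable_const
  · exact ((measurableSet_le measurable_const i1.measurable).inter (measurableSet_le i1.measurable measurable_const)).inter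
      ((measurableSet_le measurable_const i2.measurable).inter (measurableSet_le i2.measurable measurable_const))
  refine Measurable.mul ?_ ?_
  · refine Continuous.measurable ?_
    refine Continuous.mul (continuous_exp.comp (Continuous.neg (continuous_const.mul (continuous_ofReal.comp r1)))) ?_
    exact continuous_ofReal.comp (Real.continuous_sqrt.comp (i1.mul i2))
  · simp_rw [fourierInv_eq_fourier_neg, fourier_real_eq_integral_exp_smul]
    refine StronglyMeasurable.measurable ?_
    have hc : Continuous (fun q : (ℍℍ × ℍℍ) × ℝ =>
        exp (((-2 * pi * q.2 * -(q.1.2.re - q.1.1.re) : ℝ) : ℂ) * Complex.I) • Rw w h s q.1.1.im q.1.2.im q.2) := by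
      have i1' := i1.comp (continuous_fst (X := ℍℍ × ℍℍ) (Y := ℝ))
      have i2' := i2.comp (continuous_fst (X := ℍℍ × ℍℍ) (Y := ℝ))
      have r1' := r1.comp (continuous_fst (X := ℍℍ × ℍℍ) (Y := ℝ))
      have r2' := r2.comp (continuous_fst (X := ℍℍ × ℍℍ) (Y := ℝ))
      have s1 := continuous_snd (X := ℍℍ × ℍℍ) (Y := ℝ)
      unfold Rw
      refine Continuous.smul (continuous_exp.comp (Continuous.mul (continuous_ofReal.comp ?_) continuous_const)) ?_
      · exact (continuous_const.mul s1).mul (r2'.sub r1').neg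
      · refine Continuous.mul (Continuous.mul (hw.comp s1) (continuous_ofReal.comp (hbb.comp ?_))) (continuous_ofReal.comp (hbb.comp ?_))
        · exact (i1'.mul s1).add ((i1'.mul continuous_const).sub continuous_const)
        · exact (i2'.mul s1).add continuous_const
    exact hc.stronglyMeasurable.integral_prod_right
theorem ph_ok (C Cw θ yl yu : ℝ) (w : ℝ → ℂ) (h : ℤ) (s : ℝ) (hC : Dn C 1 (fun u => (bb u : ℂ))) (hw : Dn Cw θ w) (hθ : 0 ≤ θ)
    (hl : 0 < yl) (hlu : yl ≤ yu) :
    PhiOK h yl (yu * (256 * Cw * C ^ 2) * ((θ + yu) ^ 4 + 4 * yu ^ 4) / (2 * yl ^ 5)) (ph w h s yl yu) := by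
  have hCw := dnb_nonneg hw
  have hC0 := dnb_nonneg hC
  have hu0 : 0 < yu := by linarith
  refine ⟨ph_meas w hw.1.continuous h s yl yu, fun z w' hne => ?_, fun z w' => ?_, fun t z w' => ?_⟩
  · by_contra hc
    exact hne (by unfold ph; rw [if_neg]; tauto)
  · have hW := Wc_pos z w'
    rw [le_div_iff₀ bpos]
    unfold ph
    split_ifs with hi
    swap
    · rw [norm_zero, zero_mul]; positivity
    obtain ⟨⟨a1, a2⟩, a3, a4⟩ := hi
    have p1 : 0 < z.im := z.im_pos
    have p2 : 0 < w'.im := w'.im_pos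
    obtain ⟨-, b1, b2⟩ := ft_decay _ _ ((s - 1/2) / w'.im) (1 / yl) _ (Rw_dn C Cw θ yu w h s z.im w'.im hC hw hθ p1 a2 p2 a4) bpos
      (Rw_supp w h s z.im w'.im yl hl a3)
    set t := w'.re - z.re with ht
    have hb1 := b1 t
    have hb2 := b2 t
    set ρ := ‖FourierTransformInv.fourierInv (Rw w h s z.im w'.im) t‖ with hρ
    set A := 256 * Cw * C ^ 2 with hA
    have hA0 : 0 ≤ A := by positivity
    have hρ0 : 0 ≤ ρ := norm_nonneg _
    have e1 : ‖exp (-(τI * h * z.re))‖ = 1 := by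
      rw [norm_exp]; simp
    have e2 : ‖((√(z.im * w'.im) : ℝ) : ℂ)‖ ≤ yu := by
      rw [norm_real, norm_of_nonneg bpos]
      rw [sqrt_le_left blin]
      nlinarith
    rw [norm_mul, norm_mul, e1, one_mul]
    have hW2 : Wc z w' ^ 2 ≤ (t ^ 4 + 4 * yu ^ 4) / (2 * yl ^ 4) := by
      have : Wc z w' ≤ (t ^ 2 + 2 * yu ^ 2) / (2 * yl ^ 2) := by
        rw [Wc_eq]
        have : (z.re - w'.re) ^ 2 = t ^ 2 := by rw [ht]; ring
        rw [this]
        refine div_le_div₀ bpos (by nlinarith) bpos (by nlinarith)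
      calc Wc z w' ^ 2 ≤ ((t ^ 2 + 2 * yu ^ 2) / (2 * yl ^ 2)) ^ 2 := by gcongr
        _ = (t ^ 2 + 2 * yu ^ 2) ^ 2 / (4 * yl ^ 4) := by rw [div_pow]; ring
        _ ≤ (2 * (t ^ 4 + 4 * yu ^ 4)) / (4 * yl ^ 4) := by
            gcongr
            nlinarith [sq_nonneg (t ^ 2 - 2 * yu ^ 2)]
        _ = _ := by field_simp; ring
    calc _ ≤ yu * ρ * ((t ^ 4 + 4 * yu ^ 4) / (2 * yl ^ 4)) := by gcongr
      _ = yu * (t ^ 4 * ρ + 4 * yu ^ 4 * ρ) / (2 * yl ^ 4) := by ring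
      _ ≤ yu * (A * (θ + yu) ^ 4 * (1 / yl) + 4 * yu ^ 4 * (A * (1 / yl))) / (2 * yl ^ 4) := by gcongr
      _ = _ := by field_simp
  · unfold ph
    simp only [UpperHalfPlane.vadd_im, vadd_re]
    split_ifs
    · have : t + w'.re - (t + z.re) = w'.re - z.re := by ring
      rw [this, ← mul_assoc, ← mul_assoc, ← exp_add]
      congr 3
      push_cast; ring_nf
    · simp
theorem nexp (c x : ℝ) : ‖exp (τI * c * x)‖ = 1 := by
  rw [norm_exp]; simp
theorem x2_int (B : ℕ → ℂ) (c : ℕ → ℝ) (hB : Summable (fun n => ‖B n‖)) (F2 : ℝ → ℂ)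
    (hF2 : ∀ x : ℝ, HasSum (fun n => B n * exp (τI * (-c n : ℝ) * x)) (F2 x))
    (ρ : ℝ → ℂ) (hρ : Integrable ρ) (R : ℝ → ℂ) (hR : ∀ v : ℝ, ∫ t : ℝ, ρ t * exp (-(τI * v * t)) = R v)
    (N0 : ℕ) (hN : ∀ m, N0 ≤ m → R (c m) = 0) (x1 : ℝ) :
    ∫ x2, ρ (x2 - x1) * F2 x2 = ∑ m ∈ range N0, B m * R (c m) * exp (τI * (-c m : ℝ) * x1) := by
  have e1 : ∫ x2, ρ (x2 - x1) * F2 x2 = ∫ t, ρ t * F2 (t + x1) := by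
    rw [← integral_sub_right_eq_self (fun t => ρ t * F2 (t + x1)) x1]
    simp
  rw [e1]
  have hn : ∀ m t, ‖ρ t * (B m * exp (τI * (-c m : ℝ) * (t + x1 : ℝ)))‖ = ‖ρ t‖ * ‖B m‖ := by
    intro m t; rw [norm_mul, norm_mul, nexp, mul_one]
  have hi : ∀ m, Integrable (fun t : ℝ => ρ t * (B m * exp (τI * (-c m : ℝ) * (t + x1 : ℝ)))) := by
    intro m
    refine hρ.mul_bdd (c := ‖B m‖) ?_ (Filter.Eventually.of_forall fun t => ?_)
    · refine Continuous.aestronglyMeasurable ?_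
      fun_prop
    · rw [norm_mul, nexp, mul_one]
  have hs := hasSum_integral_of_summable_integral_norm hi (by
    simp_rw [hn, integral_mul_const]; exact hB.mul_left _)
  have e2 : ∀ t : ℝ, ∑' m, ρ t * (B m * exp (τI * (-c m : ℝ) * (t + x1 : ℝ))) = ρ t * F2 (t + x1) := by
    intro t
    rw [tsum_mul_left, (hF2 (t + x1)).tsum_eq]
  simp_rw [e2] at hs
  have e3 : ∀ m, ∫ t : ℝ, ρ t * (B m * exp (τI * (-c m : ℝ) * (t + x1 : ℝ))) =
      B m * R (c m) * exp (τI * (-c m : ℝ) * x1) := by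
    intro m
    have r : B m * R (c m) * exp (τI * (-c m : ℝ) * x1) =
        (B m * exp (τI * (-c m : ℝ) * x1)) * R (c m) := by ring
    rw [r, ← hR (c m), ← integral_const_mul]
    refine integral_congr_ae (Filter.Eventually.of_forall fun t => ?_)
    simp only
    have : exp (τI * (-c m : ℝ) * (t + x1 : ℝ)) =
      exp (τI * (-c m : ℝ) * x1) * exp (-(τI * c m * t)) := by
      rw [← exp_add]; congr 1; push_cast; ring
    rw [this]; ring
  simp_rw [e3] at hs
  rw [← hs.tsum_eq]
  exact tsum_eq_sum fun m hm => by
    rw [hN m (by simpa using hm)]; simp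
theorem x1_int (A : ℕ → ℂ) (c : ℕ → ℤ) (hA : Summable (fun n => ‖A n‖)) (F1 : ℝ → ℂ)
    (hF1 : ∀ x : ℝ, HasSum (fun n => A n * exp (τI * (c n : ℝ) * x)) (F1 x)) (h c' : ℤ) :
    HasSum (fun n => if c n = c' + h then A n else 0)
    (∫ x in Ico (0:ℝ) 1, exp (-(τI * h * x)) * F1 x * exp (τI * (-(c' : ℝ) : ℝ) * x))
      ∧ IntegrableOn (fun x : ℝ => exp (-(τI * h * x)) * F1 x * exp (τI * (-(c' : ℝ) : ℝ) * x)) (Ico (0:ℝ) 1) := by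
  have hn : ∀ m (x : ℝ), ‖A m * exp (τI * ((c m - c' - h : ℤ) : ℝ) * x)‖ = ‖A m‖ := by
    intro m t; rw [norm_mul, nexp, mul_one]
  have hi : ∀ m, IntegrableOn (fun x : ℝ => A m * exp (τI * ((c m - c' - h : ℤ) : ℝ) * x)) (Ico (0:ℝ) 1) := by
    intro m
    refine (Continuous.integrableOn_Icc (a := (0:ℝ)) (b := 1) (by fun_prop)).mono_set Ico_subset_Icc_self
  have hs := hasSum_integral_of_summable_integral_norm (μ := volume.restrict (Ico (0:ℝ) 1)) hi (by
    simp_rw [hn]; simpa using hA)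
  have e2 : ∀ x : ℝ, ∑' m, A m * exp (τI * ((c m - c' - h : ℤ) : ℝ) * x) =
      exp (-(τI * h * x)) * F1 x * exp (τI * (-(c' : ℝ) : ℝ) * x) := by
    intro x
    rw [mul_right_comm (exp (-(τI * h * x))), ← exp_add, ← (hF1 x).tsum_eq, ← tsum_mul_left]
    refine tsum_congr fun m => ?_
    rw [mul_left_comm, ← exp_add]
    congr 2
    push_cast; ring
  have e3 : ∀ m, ∫ x in Ico (0:ℝ) 1, A m * exp (τI * ((c m - c' - h : ℤ) : ℝ) * x) = if c m = c' + h then A m else 0 := by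
    intro m
    rw [integral_const_mul]
    have := e_int (c m - c' - h)
    push_cast at this ⊢
    rw [this]
    by_cases hc : c m = c' + h
    · rw [if_pos hc, if_pos bomg, mul_one]
    · rw [if_neg hc, if_neg bomg, mul_zero]
  simp_rw [e2, e3] at hs
  refine ⟨hs, ?_⟩
  have hcont : Continuous F1 := by
    have : F1 = fun x : ℝ => ∑' n, A n * exp (τI * (c n : ℝ) * x) := by
      ext x; exact (hF1 x).tsum_eq.symm
    rw [this]
    refine continuous_tsum (fun n => by fun_prop) hA fun n x => ?_
    rw [norm_mul, nexp, mul_one]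
  exact (Continuous.integrableOn_Icc (a := (0:ℝ)) (b := 1) (by fun_prop)).mono_set Ico_subset_Icc_self
theorem x_int (A B : ℕ → ℂ) (c1 c2 : ℕ → ℤ) (hA : Summable (fun n => ‖A n‖)) (hB : Summable (fun n => ‖B n‖)) (F1 F2 : ℝ → ℂ)
    (hF1 : ∀ x : ℝ, HasSum (fun n => A n * exp (τI * (c1 n : ℝ) * x)) (F1 x))
    (hF2 : ∀ x : ℝ, HasSum (fun n => B n * exp (τI * (-(c2 n : ℝ) : ℝ) * x)) (F2 x)) (h : ℤ)
    (ρ : ℝ → ℂ) (hρ : Integrable ρ) (R : ℝ → ℂ) (hR : ∀ v : ℝ, ∫ t : ℝ, ρ t * exp (-(τI * v * t)) = R v)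
    (N0 : ℕ) (hN : ∀ m, N0 ≤ m → R (c2 m) = 0) (hN' : ∀ n m, N0 ≤ n → c1 n = c2 m + h → R (c2 m) = 0) :
    ∫ x1 in Ico (0:ℝ) 1, ∫ x2, exp (-(τI * h * x1)) * F1 x1 * (ρ (x2 - x1) * F2 x2) =
      ∑ n ∈ range N0, ∑ m ∈ range N0, if c1 n = c2 m + h then A n * B m * R (c2 m) else 0 := by
  simp_rw [integral_const_mul, x2_int B (fun n => (c2 n : ℝ)) hB F2 hF2 ρ hρ R hR N0 hN, mul_sum]
  have e : ∀ (x : ℝ) m, exp (-(τI * h * x)) * F1 x * (B m * R (c2 m) * exp (τI * (-(c2 m : ℝ) : ℝ) * x)) =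
    (B m * R (c2 m)) * (exp (-(τI * h * x)) * F1 x * exp (τI * (-(c2 m : ℝ) : ℝ) * x)) := by
    intro x m; ring
  simp_rw [e]
  rw [integral_finsetSum _ fun m _ => ((x1_int A c1 hA F1 hF1 h (c2 m)).2).const_mul _, sum_comm]
  refine sum_congr rfl fun m _ => ?_
  rw [integral_const_mul, ← (x1_int A c1 hA F1 hF1 h (c2 m)).1.tsum_eq, ← tsum_mul_left]
  rw [tsum_eq_sum (s := range N0)]
  · refine sum_congr rfl fun n _ => ?_
    split_ifs <;> ring
  · intro n hn
    by_cases hc : c1 n = c2 m + h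
    · rw [hN' n m (by simpa using hn) hc]; simp
    · rw [if_neg hc, mul_zero]
noncomputable def Nk (κ : ℕ) : ℝ := ∫ y, √y * r0 κ y * bb (y + (-sk κ)) ∂hyν
theorem hyν_integral (g : ℝ → ℝ) : ∫ y, g y ∂hyν = ∫ y in Ioi (0:ℝ), 1 / y ^ 2 * g y := by
  unfold hyν
  rw [integral_withDensity_eq_integral_toReal_smul (by fun_prop) (by simp)]
  refine integral_congr_ae (Filter.Eventually.of_forall fun y => ?_)
  simp only [smul_eq_mul]
  rw [toReal_ofReal bpos]
theorem y_int (κ : ℕ) (ℓ : ℝ) (hℓ : 0 < ℓ) : ∫ y, √y * r0 κ (ℓ * y) * bb (ℓ * y + (-sk κ)) ∂hyν = √ℓ * Nk κ := by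
  unfold Nk
  rw [hyν_integral, hyν_integral]
  have := integral_comp_mul_left_Ioi (fun y => 1 / y ^ 2 * (√y * r0 κ y * bb (y + (-sk κ)))) 0 hℓ
  rw [mul_zero, smul_eq_mul] at this
  have h2 : ∫ y in Ioi (0:ℝ), 1 / y ^ 2 * (√y * r0 κ y * bb (y + (-sk κ))) =
      ℓ * ∫ y in Ioi (0:ℝ), 1 / (ℓ * y) ^ 2 * (√(ℓ * y) * r0 κ (ℓ * y) * bb (ℓ * y + (-sk κ))) := by
    rw [this]; field_simp
  rw [h2, ← mul_assoc, ← integral_const_mul]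
  refine setIntegral_congr_fun measurableSet_Ioi fun y hy => ?_
  have hy : 0 < y := hy
  rw [sqrt_mul hℓ.le]
  have e : √ℓ * √ℓ = ℓ := mul_self_sqrt hℓ.le
  field_simp
  rw [sq_sqrt hℓ.le]
  ring
theorem r0_near (κ : ℕ) (hκ : 6 ≤ κ) (u : ℝ) (h1 : sk κ - 1/4 ≤ u) (h2 : u ≤ sk κ + 1/4) : Real.exp (-1) * r0 κ (sk κ) ≤ r0 κ u := by
  have hk : (6:ℝ) ≤ κ := by exact_mod_cast hκ
  have hp := pi_gt_three
  have hp2 := pi_lt_d2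
  have hs : 2 * pi * sk κ = κ := by unfold sk; field_simp
  have hs0 : 0.95 < sk κ := by nlinarith
  set s := sk κ with hsd
  set x := (u - s) / s with hx
  have hs1 : 0 < s := by linarith
  have hxs : s * x = u - s := by rw [hx]; field_simp
  have hx1 : |s * x| ≤ 1/4 := by rw [hxs, abs_le]; constructor <;> linarith
  have hx2 : -(1/2) ≤ x := by have := (abs_le.1 hx1).1; nlinarith
  have hu : u = s * (1 + x) := by linarith
  have hlog : x - 2 * x ^ 2 ≤ log (1 + x) := by
    refine le_trans ?_ (Real.one_sub_inv_le_log_of_pos blin)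
    have h0 : (0:ℝ) < 1 + x := by linarith
    rw [show 1 - (1 + x)⁻¹ = x / (1 + x) by field_simp; ring, le_div_iff₀ h0]
    nlinarith [sq_nonneg x, mul_nonneg (sq_nonneg x) (show 0 ≤ 1 + 2 * x by linarith)]
  have hkx : κ * (2 * x ^ 2) ≤ 1 := by
    have : (s * x) ^ 2 ≤ 1/16 := by rw [← sq_abs]; nlinarith [abs_nonneg (s * x)]
    have h4 : κ * (2 * x ^ 2) * s = 4 * pi * (s * x) ^ 2 := by rw [← hs]; ring
    by_contra hc
    push Not at hc
    nlinarith
  unfold r0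
  rw [hu, mul_pow]
  have e1 : (1 + x) ^ κ = Real.exp (κ * log (1 + x)) := by
    rw [← Real.log_pow, Real.exp_log (by apply pow_pos; linarith)]
  rw [e1]
  calc _ = s ^ κ * Real.exp (-1 - 2 * pi * s) := by rw [sub_eq_add_neg, Real.exp_add]; ring
    _ ≤ s ^ κ * Real.exp (κ * log (1 + x) - 2 * pi * (s * (1 + x))) := by
        refine mul_le_mul_of_nonneg_left (Real.exp_le_exp.2 ?_) bpos
        have : 2 * pi * (s * (1 + x)) = κ + κ * x := by rw [← hs]; ring
        rw [this, hs]
        have := mul_le_mul_of_nonneg_left hlog (show (0:ℝ) ≤ κ by linarith)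
        nlinarith
    _ = _ := by rw [sub_eq_add_neg, Real.exp_add]; ring
theorem Nk_lb (κ : ℕ) (hκ : 6 ≤ κ) : r0 κ (sk κ) ≤ 48 * κ ^ 2 * Nk κ := by
  have hk : (6:ℝ) ≤ κ := by exact_mod_cast hκ
  have hp := pi_gt_three
  have hp2 := pi_lt_d2
  have hs : 2 * pi * sk κ = κ := by unfold sk; field_simp
  have hs0 : 0.95 < sk κ := by nlinarith
  have hsk : sk κ ≤ κ / 6 := by nlinarith
  unfold Nk
  rw [hyν_integral]
  set s := sk κ with hsd
  have hr0 : ∀ u, 0 ≤ u → 0 ≤ r0 κ u := fun u hu => by unfold r0; positivity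
  have hr0c : Continuous (r0 κ) := by unfold r0; fun_prop
  have hbc : Continuous bb := bb_smooth.continuous
  set g := fun y : ℝ => 1 / y ^ 2 * (√y * r0 κ y * bb (y + (-s))) with hg
  have g0 : ∀ y, 0 ≤ y → 0 ≤ g y := fun y hy => by
    have := bb_nonneg (y + (-s)); have := hr0 y hy
    simp only [hg]; positivity
  have gi : IntegrableOn g (Ioi 0) := by
    have hco : ContinuousOn g (Set.Icc (s - 1/2) (s + 1/2)) := by
      refine ContinuousOn.mul (continuousOn_const.div (by fun_prop) fun y hy => ?_) (by fun_prop)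
      have : 0 < y := by linarith [hy.1]
      positivity
    refine IntegrableOn.mono_set ?_ (Set.subset_univ _)
    rw [integrableOn_univ]
    refine (integrableOn_iff_integrable_of_support_subset ?_).1 (hco.integrableOn_Icc)
    intro y hy
    have hb : bb (y + (-s)) ≠ 0 := fun h0 => hy (by simp [hg, h0])
    have := abs_le.1 (bb_supp _ hb)
    exact ⟨by linarith [this.1], by linarith [this.2]⟩
  have hsub : Set.Icc (s - 1/4) (s + 1/4) ⊆ Ioi (0:ℝ) := fun y hy => by
    have := hy.1; show 0 < y; linarith
  have step1 : ∫ y in Set.Icc (s - 1/4) (s + 1/4), g y ≤ ∫ y in Ioi 0, g y :=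
    setIntegral_mono_set gi ((ae_restrict_iff' measurableSet_Ioi).2 (Filter.Eventually.of_forall fun y hy => g0 y (le_of_lt hy))) hsub.eventuallyLE
  have step2 : ∫ y in Set.Icc (s - 1/4) (s + 1/4), (1 / (8 * s ^ 2) * (Real.exp (-1) * r0 κ s)) ≤ ∫ y in Set.Icc (s - 1/4) (s + 1/4), g y := by
    refine setIntegral_mono_on (integrableOn_const (by simp)) (gi.mono_set hsub) measurableSet_Icc fun y hy => ?_
    have y0 : 0.7 ≤ y := by linarith [hy.1]
    have y1 : y ≤ 2 * s := by linarith [hy.2]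
    have hb : bb (y + (-s)) = 1 := bb_one _ (by rw [abs_le]; constructor <;> linarith [hy.1, hy.2])
    have hn := r0_near κ hκ y hy.1 hy.2
    simp only [hg]
    rw [hb, mul_one, ← mul_assoc (1 / y ^ 2)]
    refine mul_le_mul ?_ hn (by have := hr0 s blin; positivity) bpos
    have hsq : 1/2 ≤ √y := le_sqrt_of_sq_le blin
    rw [div_mul_eq_mul_div, one_mul, div_le_div_iff₀ bpos bpos]
    nlinarith [sq_nonneg s, sq_nonneg y]
  rw [setIntegral_const, smul_eq_mul] at step2
  have hv : volume.real (Set.Icc (s - 1/4) (s + 1/4)) = 1/2 := by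
    rw [Measure.real, volume_Icc, toReal_ofReal blin]; ring
  rw [hv] at step2
  have h3 := step2.trans step1
  have he : 1/3 ≤ Real.exp (-1) := by
    rw [Real.exp_neg, one_div]
    exact inv_anti₀ (Real.exp_pos _) (by linarith [Real.exp_one_lt_d9])
  have hr := hr0 s blin
  have h4 : r0 κ s ≤ 48 * s ^ 2 * (1 / 2 * (1 / (8 * s ^ 2) * (Real.exp (-1) * r0 κ s))) := by
    have hs1 : 0 < s := by linarith
    field_simp
    nlinarith
  refine h4.trans ?_
  have hI : 0 ≤ ∫ y in Ioi 0, g y := setIntegral_nonneg measurableSet_Ioi fun y hy => g0 y (le_of_lt hy)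
  refine mul_le_mul ?_ h3 ?_ bpos
  · have : s ≤ κ := by linarith
    gcongr
  · positivity
theorem hyν_pos : ∀ᵐ y ∂hyν, 0 < y := by
  unfold hyν
  refine (withDensity_absolutelyContinuous _ _).ae_le ?_
  exact ae_restrict_mem measurableSet_Ioi
theorem swap4 (μ ν : Measure ℝ) [SFinite μ] [SFinite ν] :
    MeasurePreserving (fun q : (ℝ × ℝ) × (ℝ × ℝ) => ((q.2.1, q.1.1), (q.2.2, q.1.2))) ((ν.prod ν).prod (μ.prod μ)) ((μ.prod ν).prod (μ.prod ν)) := by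
  have hm : Measurable (fun q : (ℝ × ℝ) × (ℝ × ℝ) => ((q.2.1, q.1.1), (q.2.2, q.1.2))) := by fun_prop
  have a1 := measurePreserving_prodAssoc ν ν (μ.prod μ)
  have a2 : MeasurePreserving (Prod.swap : ℝ × (ℝ × ℝ) → (ℝ × ℝ) × ℝ) (ν.prod (μ.prod μ)) ((μ.prod μ).prod ν) := Measure.measurePreserving_swap
  have a3 := measurePreserving_prodAssoc μ μ ν
  have a4 := (MeasurePreserving.id ν).prod (a3.comp a2)
  have a5 := (measurePreserving_prodAssoc ν μ (μ.prod ν)).symm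
  have a6 : MeasurePreserving (Prod.swap : ℝ × ℝ → ℝ × ℝ) (ν.prod μ) (μ.prod ν) := Measure.measurePreserving_swap
  have a7 := a6.prod (MeasurePreserving.id (μ.prod ν))
  exact a7.comp (a5.comp (a4.comp a1))
theorem HH_int (F : ℍℍ × ℍℍ → ℂ) (hF : Measurable F) (hi : Integrable F (volume.prod volume)) (V : ℝ × ℝ → ℂ)
    (hV : ∀ y1 y2 : ℝ, 0 < y1 → 0 < y2 → ∫ x1 : ℝ, ∫ x2 : ℝ, F (hpt (x1, y1), hpt (x2, y2)) = V (y1, y2)) :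
    ∫ p, F p ∂(volume.prod volume) = ∫ q, V q ∂(hyν.prod hyν) := by
  have : SFinite hyν := by unfold hyν; infer_instance
  rw [hy_volume, Measure.map_prod_map _ _ hpt_meas hpt_meas] at hi ⊢
  have hm : Measurable (Prod.map hpt hpt) := hpt_meas.prodMap hpt_meas
  rw [integral_map hm.aemeasurable hF.aestronglyMeasurable]
  rw [integrable_map_measure hF.aestronglyMeasurable hm.aemeasurable] at hi
  have sw := swap4 (volume : Measure ℝ) hyν
  have hG : Measurable (fun q => F (Prod.map hpt hpt q)) := hF.comp hm
  have e1 : ∫ q, F (Prod.map hpt hpt q) ∂((volume.prod hyν).prod (volume.prod hyν)) =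
      ∫ q : (ℝ × ℝ) × (ℝ × ℝ), F (hpt (q.2.1, q.1.1), hpt (q.2.2, q.1.2)) ∂((hyν.prod hyν).prod (volume.prod volume)) := by
    rw [← sw.map_eq, integral_map sw.measurable.aemeasurable hG.aestronglyMeasurable]
    rfl
  have hi2 : Integrable (fun q : (ℝ × ℝ) × (ℝ × ℝ) => F (hpt (q.2.1, q.1.1), hpt (q.2.2, q.1.2))) ((hyν.prod hyν).prod (volume.prod volume)) := by
    have hi : Integrable (fun q => F (Prod.map hpt hpt q)) ((volume.prod hyν).prod (volume.prod hyν)) := hi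
    rw [← sw.map_eq, integrable_map_measure hG.aestronglyMeasurable sw.measurable.aemeasurable] at hi
    exact hi
  rw [e1, integral_prod _ hi2]
  refine integral_congr_ae ?_
  have hy := hyν_pos
  have hpos : ∀ᵐ q ∂(hyν.prod hyν), 0 < q.1 ∧ 0 < q.2 := by
    have h1 : ∀ᵐ q ∂(hyν.prod hyν), 0 < q.1 := Measure.quasiMeasurePreserving_fst.ae hy
    have h2 : ∀ᵐ q ∂(hyν.prod hyν), 0 < q.2 := Measure.quasiMeasurePreserving_snd.ae hy
    exact h1.and h2
  filter_upwards [hi2.prod_right_ae, hpos] with q hq hq2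
  rw [integral_prod _ hq]
  exact hV q.1 q.2 hq2.1 hq2.2
theorem V_int (κ : ℕ) (ℓ s yl yu : ℝ) (hl : 0 < yl) :
    Integrable (fun y => (Set.Icc yl yu).indicator (fun y => √y * r0 κ (ℓ * y) * bb (ℓ * y + (-s))) y) hyν := by
  rw [integrable_indicator_iff measurableSet_Icc]
  have hr0c : Continuous (r0 κ) := by unfold r0; fun_prop
  have hbc : Continuous bb := bb_smooth.continuous
  have hc : Continuous (fun y => √y * r0 κ (ℓ * y) * bb (ℓ * y + (-s))) := by fun_prop
  obtain ⟨M, hM⟩ := isCompact_Icc.exists_bound_of_continuousOn (s := Set.Icc yl yu) hc.continuousOn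
  refine Measure.integrableOn_of_bounded (M := M) ?_ hc.aestronglyMeasurable ((ae_restrict_iff' measurableSet_Icc).2 (Filter.Eventually.of_forall hM))
  have : hyν (Set.Icc yl yu) ≤ hyν (Ioi (yl / 2)) := measure_mono fun y hy => by
    have := hy.1; show yl / 2 < y; linarith
  rw [hyν_Ioi _ blin] at this
  exact ne_top_of_le_ne_top ENNReal.ofReal_ne_top this
noncomputable def Vf (κ : ℕ) (yl yu ℓ y : ℝ) : ℝ := (Set.Icc yl yu).indicator (fun y => √y * r0 κ (ℓ * y) * bb (ℓ * y + (-sk κ))) y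
theorem fo_exp (κ : ℕ) (a : ℕ → ℂ) (h : IsNormalizedHeckeEigenform (2 * κ) a) (x y : ℝ) (hy : 0 < y) :
    HasSum (fun n : ℕ => lam κ a (n+1) * ((r0 κ ((n+1) * y) / √(n+1) : ℝ) : ℂ) * exp (τI * (n+1) * x)) (Fo κ a (hpt (x, y))) := by
  have := fo_fourier κ a h (hpt (x, y))
  rw [hpt_re x y hy, hpt_im x y hy] at this
  exact this
theorem fo_sum2 (κ : ℕ) (a : ℕ → ℂ) (h : IsNormalizedHeckeEigenform (2 * κ) a) (y : ℝ) (hy : 0 < y) (u : ℕ → ℂ) (hu : ∀ n, ‖u n‖ = 1) :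
    Summable (fun n : ℕ => ‖lam κ a (n+1) * ((r0 κ ((n+1) * y) / √(n+1) : ℝ) : ℂ) * u n‖) := by
  refine (fo_summable κ a h y hy).congr fun n => ?_
  rw [norm_mul, norm_mul, hu, mul_one, norm_real, norm_of_nonneg]
  unfold r0
  positivity
theorem std_exp (δ : ℕ) [NeZero δ] (j : ZMod δ) (c : ℕ) :
    exp (τI * ((c : ℝ) * (j.val : ℝ) / (δ : ℝ) : ℝ)) = stdAddChar ((c : ZMod δ) * j) := by
  have := stdAddChar_coe (N := δ) ((c * j.val : ℕ) : ℤ)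
  push_cast at this
  rw [natCast_zmod_val] at this
  rw [this]
  congr 1
  push_cast
  ring
noncomputable def cA (κ : ℕ) (a : ℕ → ℂ) (δ c1 μ4 : ℕ) [NeZero δ] (j : ZMod δ) (y1 : ℝ) (n : ℕ) : ℂ :=
  lam κ a (n+1) * ((r0 κ ((n+1) * (c1 * μ4 * y1)) / √(n+1) : ℝ) : ℂ) * stdAddChar (((c1 * (n + 1) : ℕ) : ZMod δ) * j)
noncomputable def cB (κ : ℕ) (a : ℕ → ℂ) (c2 μ3 : ℕ) (y2 : ℝ) (n : ℕ) : ℂ :=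
  lam κ a (n+1) * ((r0 κ ((n+1) * (c2 * μ3 * y2)) / √(n+1) : ℝ) : ℂ) * 1
noncomputable def fA (κ : ℕ) (a : ℕ → ℂ) (δ c1 μ4 : ℕ) (j : ZMod δ) (y1 x : ℝ) : ℂ :=
  Fo κ a (hpt (c1 * μ4 * x + c1 * j.val / δ, c1 * μ4 * y1))
noncomputable def fB (κ : ℕ) (a : ℕ → ℂ) (c2 μ3 : ℕ) (y2 x : ℝ) : ℂ :=
  Fo κ a (hpt (-(c2 * μ3 * x), c2 * μ3 * y2))
theorem fA_sum (κ : ℕ) (a : ℕ → ℂ) (ha : IsNormalizedHeckeEigenform (2 * κ) a) (δ c1 μ4 : ℕ) [NeZero δ] (h1 : 0 < c1) (h4 : 0 < μ4) (j : ZMod δ) (y1 x : ℝ) (hy : 0 < y1) :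
    HasSum (fun n => cA κ a δ c1 μ4 j y1 n * exp (τI * ((PN c1 μ4 n : ℤ) : ℝ) * x)) (fA κ a δ c1 μ4 j y1 x) := by
  have p1 : (0:ℝ) < c1 * μ4 * y1 := by positivity
  refine (fo_exp κ a ha (c1 * μ4 * x + c1 * j.val / δ) _ p1).congr_fun ?_
  intro n
  unfold cA
  rw [← std_exp, mul_assoc _ (exp _) (exp _), ← exp_add]
  congr 2
  push_cast; ring
theorem fB_sum (κ : ℕ) (a : ℕ → ℂ) (ha : IsNormalizedHeckeEigenform (2 * κ) a) (c2 μ3 : ℕ) (h2 : 0 < c2) (h3 : 0 < μ3) (y2 x : ℝ) (hy : 0 < y2) :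
    HasSum (fun n => cB κ a c2 μ3 y2 n * exp (τI * (-((PN c2 μ3 n : ℤ) : ℝ) : ℝ) * x)) (fB κ a c2 μ3 y2 x) := by
  have p1 : (0:ℝ) < c2 * μ3 * y2 := by positivity
  refine (fo_exp κ a ha (-(c2 * μ3 * x)) _ p1).congr_fun ?_
  intro n
  unfold cB
  rw [mul_one]
  congr 2
  push_cast; ring
theorem sl_big (κ N0 c m : ℕ) (yl y : ℝ) (hl : 0 < yl) (hN0 : (sk κ + 1/2) / yl ≤ N0) (hc : 0 < c) (hm : N0 ≤ m) (hy : yl ≤ y) :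
    bb (y * ((c * (m + 1) : ℕ) : ℝ) + (-sk κ)) = 0 := by
  by_contra hne
  have h5 := (abs_le.1 (bb_supp _ hne)).2
  have h6 : (sk κ + 1/2) < yl * (m + 1) := by
    rw [div_le_iff₀ hl] at hN0
    have : (N0:ℝ) ≤ m := by exact_mod_cast hm
    nlinarith
  have h7 : (m:ℝ) + 1 ≤ ((c * (m + 1) : ℕ) : ℝ) := by
    exact_mod_cast le_mul_of_pos_left (m+1) hc
  have hy0 : 0 ≤ y := by linarith
  have : yl * (m + 1) ≤ y * ((c * (m + 1) : ℕ) : ℝ) := by gcongr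
  linarith
theorem sl_e0 (κ : ℕ) (a : ℕ → ℂ) (δ c1 c2 μ3 μ4 : ℕ) [NeZero δ] (f h : ℤ) (w : ℝ → ℂ) (yl yu : ℝ) (j : ZMod δ) (y1 y2 : ℝ) (hy1 : 0 < y1) (hy2 : 0 < y2)
    (hr : (yl ≤ y1 ∧ y1 ≤ yu) ∧ (yl ≤ y2 ∧ y2 ≤ yu)) (x1 x2 : ℝ) :
    yf δ f (ph w h (sk κ) yl yu) (j, hpt (x1, y1), hpt (x2, y2)) * Gf κ a δ c1 c2 μ3 μ4 (j, hpt (x1, y1), hpt (x2, y2)) =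
      (stdAddChar (-(f : ZMod δ) * j) * (√(y1 * y2) : ℝ)) * (Ico (0:ℝ) 1).indicator (fun x1 : ℝ =>
        exp (-(τI * h * x1)) * fA κ a δ c1 μ4 j y1 x1 * (FourierTransformInv.fourierInv (Rw w h (sk κ) y1 y2) (x2 - x1) * fB κ a c2 μ3 y2 x2)) x1 := by
  unfold yf ph Gf fA fB
  simp only [hpt_im _ _ hy1, hpt_im _ _ hy2, hpt_re _ _ hy1, hpt_re _ _ hy2]
  rw [if_pos hr]
  by_cases hx : 0 ≤ x1 ∧ x1 < 1
  · rw [if_pos hx, indicator_of_mem (show x1 ∈ Ico (0:ℝ) 1 from hx)]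
    ring
  · rw [if_neg hx, indicator_of_notMem (show x1 ∉ Ico (0:ℝ) 1 from hx)]
    ring
theorem sl_zero (κ : ℕ) (δ : ℕ) (f h : ℤ) (w : ℝ → ℂ) (yl yu : ℝ) (j : ZMod δ) [NeZero δ] (y1 y2 : ℝ) (hy1 : 0 < y1) (hy2 : 0 < y2)
    (hr : ¬ ((yl ≤ y1 ∧ y1 ≤ yu) ∧ (yl ≤ y2 ∧ y2 ≤ yu))) :
    (∀ x1 x2 : ℝ, yf δ f (ph w h (sk κ) yl yu) (j, hpt (x1, y1), hpt (x2, y2)) = 0) ∧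
    ∀ ℓ ℓ' : ℝ, Vf κ yl yu ℓ y1 * Vf κ yl yu ℓ' y2 = 0 := by
  constructor
  · intro x1 x2
    unfold yf ph
    simp only [hpt_im _ _ hy1, hpt_im _ _ hy2, if_neg hr]
    simp
  · intro ℓ ℓ'
    unfold Vf
    by_cases hr1 : y1 ∈ Set.Icc yl yu
    · have hr2 : y2 ∉ Set.Icc yl yu := fun h2 => hr ⟨hr1, h2⟩
      rw [indicator_of_notMem hr2, mul_zero]
    · rw [indicator_of_notMem hr1, zero_mul]
theorem sl_alg (κ : ℕ) (a : ℕ → ℂ) (δ c1 c2 μ3 μ4 : ℕ) [NeZero δ] (f h : ℤ) (w : ℝ → ℂ) (yl yu : ℝ) (j : ZMod δ) (y1 y2 : ℝ) (hy1 : 0 < y1)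
    (hr : (yl ≤ y1 ∧ y1 ≤ yu) ∧ (yl ≤ y2 ∧ y2 ≤ yu)) (n m : ℕ)
    (arg : y1 * (PN c2 μ3 m : ℝ) + (y1 * h - sk κ) = y1 * (PN c1 μ4 n : ℝ) + (-sk κ)) :
    (stdAddChar (-(f : ZMod δ) * j) * (√(y1 * y2) : ℝ)) * (cA κ a δ c1 μ4 j y1 n * cB κ a c2 μ3 y2 m * Rw w h (sk κ) y1 y2 ((PN c2 μ3 m : ℤ) : ℝ)) =
    stdAddChar ((((c1 * (n + 1) : ℕ) : ZMod δ) - (f : ZMod δ)) * j) * (lam κ a (n + 1) * lam κ a (m + 1) * w (PN c2 μ3 m : ℝ) / ((√(n + 1) * √(m + 1) : ℝ) : ℂ)) *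
        ((Vf κ yl yu (PN c1 μ4 n : ℝ) y1 * Vf κ yl yu (PN c2 μ3 m : ℝ) y2 : ℝ) : ℂ) := by
  unfold Rw Vf cA cB
  rw [cast_natCast, arg, indicator_of_mem (show y1 ∈ Set.Icc yl yu from hr.1), indicator_of_mem (show y2 ∈ Set.Icc yl yu from hr.2)]
  have e : (((c1 * (n + 1) : ℕ) : ZMod δ) - (f : ZMod δ)) * j = -(f : ZMod δ) * j + ((c1 * (n + 1) : ℕ) : ZMod δ) * j := by ring
  rw [e, map_add_eq_mul, sqrt_mul hy1.le]
  have q1 : ((n:ℝ)+1) * (c1 * μ4 * y1) = (PN c1 μ4 n : ℝ) * y1 := by push_cast; ring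
  have q2 : ((m:ℝ)+1) * (c2 * μ3 * y2) = (PN c2 μ3 m : ℝ) * y2 := by push_cast; ring
  rw [q1, q2, mul_comm y1 (PN c1 μ4 n : ℝ), mul_comm y2 (PN c2 μ3 m : ℝ)]
  simp only [ofReal_mul, Complex.ofReal_div]
  generalize ((√((n:ℝ)+1) : ℝ) : ℂ) = s1
  generalize ((√((m:ℝ)+1) : ℝ) : ℂ) = s2
  simp only [div_eq_mul_inv, mul_inv]
  ring
theorem slice (κ : ℕ) (a : ℕ → ℂ) (ha : IsNormalizedHeckeEigenform (2 * κ) a) (δ c1 c2 μ3 μ4 : ℕ) [NeZero δ] (h1 : 0 < c1) (h2 : 0 < c2) (h3 : 0 < μ3) (h4 : 0 < μ4)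
    (f h : ℤ) (w : ℝ → ℂ) (C Cw θ yl yu : ℝ) (hC : Dn C 1 (fun u => (bb u : ℂ))) (hw : Dn Cw θ w) (hθ : 0 ≤ θ) (hl : 0 < yl)
    (N0 : ℕ) (hN0 : (sk κ + 1/2) / yl ≤ N0) (j : ZMod δ) (y1 y2 : ℝ) (hy1 : 0 < y1) (hy2 : 0 < y2) :
    ∫ x1 : ℝ, ∫ x2 : ℝ, yf δ f (ph w h (sk κ) yl yu) (j, hpt (x1, y1), hpt (x2, y2)) * Gf κ a δ c1 c2 μ3 μ4 (j, hpt (x1, y1), hpt (x2, y2)) =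
    ∑ n ∈ range N0, ∑ m ∈ range N0, if (PN c1 μ4 n : ℤ) = (PN c2 μ3 m : ℤ) + h then
      stdAddChar ((((c1 * (n + 1) : ℕ) : ZMod δ) - (f : ZMod δ)) * j) * (lam κ a (n + 1) * lam κ a (m + 1) * w (PN c2 μ3 m : ℝ) / ((√(n + 1) * √(m + 1) : ℝ) : ℂ)) *
        ((Vf κ yl yu (PN c1 μ4 n : ℝ) y1 * Vf κ yl yu (PN c2 μ3 m : ℝ) y2 : ℝ) : ℂ) else 0 := by
  by_cases hr : (yl ≤ y1 ∧ y1 ≤ yu) ∧ (yl ≤ y2 ∧ y2 ≤ yu)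
  swap
  · obtain ⟨z1, z2⟩ := sl_zero κ δ f h w yl yu j y1 y2 hy1 hy2 hr
    simp [z1, z2]
  have hr' := hr
  obtain ⟨⟨a1, a2⟩, a3, a4⟩ := hr'
  obtain ⟨hρ, hR⟩ := ft_inv _ _ ((sk κ - 1/2) / y2) (1 / yl) _ (Rw_dn C Cw θ yu w h (sk κ) y1 y2 hC hw hθ hy1 a2 hy2 a4) bpos
      (Rw_supp w h (sk κ) y1 y2 yl hl a3)
  have hN : ∀ m, N0 ≤ m → Rw w h (sk κ) y1 y2 ((PN c2 μ3 m : ℤ) : ℝ) = 0 := by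
    intro m hm
    have := sl_big κ N0 (c2 * μ3) m yl y2 hl hN0 bpos hm a3
    unfold Rw
    rw [cast_natCast, this, ofReal_zero, mul_zero]
  have arg : ∀ n m, (PN c1 μ4 n : ℤ) = (PN c2 μ3 m : ℤ) + h →
      y1 * (PN c2 μ3 m : ℝ) + (y1 * h - sk κ) = y1 * (PN c1 μ4 n : ℝ) + (-sk κ) := by
    intro n m he
    have : ((PN c1 μ4 n : ℝ)) = (PN c2 μ3 m : ℝ) + h := by exact_mod_cast congrArg (Int.cast : ℤ → ℝ) he
    rw [this]; ring
  have hN' : ∀ n m, N0 ≤ n → (PN c1 μ4 n : ℤ) = (PN c2 μ3 m : ℤ) + h → Rw w h (sk κ) y1 y2 ((PN c2 μ3 m : ℤ) : ℝ) = 0 := by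
    intro n m hn he
    have := sl_big κ N0 (c1 * μ4) n yl y1 hl hN0 bpos hn a1
    unfold Rw
    rw [cast_natCast, arg n m he, this, ofReal_zero, mul_zero, zero_mul]
  have key := x_int (cA κ a δ c1 μ4 j y1) (cB κ a c2 μ3 y2) (fun n => (PN c1 μ4 n : ℤ)) (fun n => (PN c2 μ3 n : ℤ))
    (fo_sum2 κ a ha _ bpos _ (fun n => norm_apply _ _)) (fo_sum2 κ a ha _ bpos _ (fun n => norm_one))
    _ _ (fun x => fA_sum κ a ha δ c1 μ4 h1 h4 j y1 x hy1) (fun x => fB_sum κ a ha c2 μ3 h2 h3 y2 x hy2) h _ hρ _ hR N0 hN hN'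
  simp_rw [sl_e0 κ a δ c1 c2 μ3 μ4 f h w yl yu j y1 y2 hy1 hy2 hr, integral_const_mul]
  have e1 : ∀ x1 : ℝ, (∫ x2, (Ico (0:ℝ) 1).indicator (fun x1 : ℝ => exp (-(τI * h * x1)) * fA κ a δ c1 μ4 j y1 x1 * (FourierTransformInv.fourierInv (Rw w h (sk κ) y1 y2) (x2 - x1) * fB κ a c2 μ3 y2 x2)) x1) =
     (Ico (0:ℝ) 1).indicator (fun x1 => ∫ x2, exp (-(τI * h * x1)) * fA κ a δ c1 μ4 j y1 x1 * (FourierTransformInv.fourierInv (Rw w h (sk κ) y1 y2) (x2 - x1) * fB κ a c2 μ3 y2 x2)) x1 := by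
    intro x1
    by_cases hx : x1 ∈ Ico (0:ℝ) 1
    · simp only [indicator_of_mem hx]
    · simp only [indicator_of_notMem hx, integral_zero]
  rw [funext e1, integral_indicator measurableSet_Ico, key, mul_sum]
  refine sum_congr rfl fun n _ => ?_
  rw [mul_sum]
  refine sum_congr rfl fun m _ => ?_
  by_cases he : (PN c1 μ4 n : ℤ) = (PN c2 μ3 m : ℤ) + h
  · rw [if_pos he, if_pos he, sl_alg κ a δ c1 c2 μ3 μ4 f h w yl yu j y1 y2 hy1 hr n m (arg n m he)]
  · rw [if_neg he, if_neg he, mul_zero]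
theorem Vf_int (κ : ℕ) (L ℓ : ℝ) (hL : 0 < L) (hs : 1/2 < sk κ) (h1 : L ≤ ℓ) (h2 : ℓ ≤ 4 * L) :
    ∫ y, Vf κ ((sk κ - 1/2) / (4 * L)) ((sk κ + 1/2) / L) ℓ y ∂hyν = √ℓ * Nk κ := by
  rw [← y_int κ ℓ blin]
  refine integral_congr_ae (hyν_pos.mono fun y hy => ?_)
  have hy : 0 < y := hy
  show Vf _ _ _ _ _ = _
  unfold Vf
  by_cases hm : y ∈ Set.Icc ((sk κ - 1/2) / (4 * L)) ((sk κ + 1/2) / L)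
  · rw [indicator_of_mem hm]
  · rw [indicator_of_notMem hm]
    have : bb (ℓ * y + (-sk κ)) = 0 := by
      by_contra hne
      obtain ⟨h5, h6⟩ := abs_le.1 (bb_supp _ hne)
      refine hm ⟨?_, ?_⟩
      · rw [div_le_iff₀ bpos]; nlinarith
      · rw [le_div_iff₀ hL]; nlinarith
    simp only [this, mul_zero]
theorem main_id (κ : ℕ) (a : ℕ → ℂ) (ha : IsNormalizedHeckeEigenform (2 * κ) a) (δ c1 c2 μ3 μ4 : ℕ) [NeZero δ] (h1 : 0 < c1) (h2 : 0 < c2) (h3 : 0 < μ3) (h4 : 0 < μ4)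
    (f h : ℤ) (w : ℝ → ℂ) (C Cw θ L yl yu : ℝ) (hC : Dn C 1 (fun u => (bb u : ℂ))) (hw : Dn Cw θ w) (hθ : 0 ≤ θ) (hL : 0 < L) (hs : 1/2 < sk κ)
    (hyl : yl = (sk κ - 1/2) / (4 * L)) (hyu : yu = (sk κ + 1/2) / L)
    (N0 : ℕ) (hN0 : (sk κ + 1/2) / yl ≤ N0)
    (hsup : ∀ n m : ℕ, (PN c1 μ4 n : ℤ) = (PN c2 μ3 m : ℤ) + h → (δ : ℤ) ∣ ((c1 * (n + 1) : ℕ) : ℤ) - f → w (PN c2 μ3 m : ℝ) ≠ 0 →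
      (L ≤ (PN c1 μ4 n : ℝ) ∧ (PN c1 μ4 n : ℝ) ≤ 4 * L) ∧ (L ≤ (PN c2 μ3 m : ℝ) ∧ (PN c2 μ3 m : ℝ) ≤ 4 * L))
    (hi : Integrable (fun y => yf δ f (ph w h (sk κ) yl yu) y * Gf κ a δ c1 c2 μ3 μ4 y) (yμ δ)) :
    ∫ y, yf δ f (ph w h (sk κ) yl yu) y * Gf κ a δ c1 c2 μ3 μ4 y ∂(yμ δ) =
      ((δ * Nk κ ^ 2 * (√(c1 * μ4) * √(c2 * μ3)) : ℝ) : ℂ) *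
      ∑ n ∈ range N0, ∑ m ∈ range N0, if (PN c1 μ4 n : ℤ) = (PN c2 μ3 m : ℤ) + h ∧ (δ : ℤ) ∣ ((c1 * (n + 1) : ℕ) : ℤ) - f then
        lam κ a (n + 1) * lam κ a (m + 1) * w (PN c2 μ3 m : ℝ) else 0 := by
  have hl : 0 < yl := by rw [hyl]; exact div_pos blin bpos
  have hSF : SFinite hyν := by unfold hyν; infer_instance
  have hVi : ∀ ℓ, Integrable (fun y => ((Vf κ yl yu ℓ y : ℝ) : ℂ)) hyν := fun ℓ => (V_int κ ℓ (sk κ) yl yu hl).ofReal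
  have hmeas : Measurable (fun y => yf δ f (ph w h (sk κ) yl yu) y * Gf κ a δ c1 c2 μ3 μ4 y) :=
    (yf_meas δ f _ (ph_meas w hw.1.continuous h (sk κ) yl yu)).mul (Gf_meas κ a ha δ c1 c2 μ3 μ4)
  have hsl : ∀ j, Integrable (fun p => yf δ f (ph w h (sk κ) yl yu) (j, p) * Gf κ a δ c1 c2 μ3 μ4 (j, p)) (volume.prod volume) := by
    have := hi
    unfold yμ at this
    have := this.prod_right_ae
    rwa [Measure.ae_count_iff] at this
  rw [(Y_int δ _ hmeas hsl).2]
  have hj : ∀ j, ∫ p, yf δ f (ph w h (sk κ) yl yu) (j, p) * Gf κ a δ c1 c2 μ3 μ4 (j, p) ∂(volume.prod volume) =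
      ∑ n ∈ range N0, ∑ m ∈ range N0, if (PN c1 μ4 n : ℤ) = (PN c2 μ3 m : ℤ) + h then
      stdAddChar ((((c1 * (n + 1) : ℕ) : ZMod δ) - (f : ZMod δ)) * j) * (lam κ a (n + 1) * lam κ a (m + 1) * w (PN c2 μ3 m : ℝ) / ((√(n + 1) * √(m + 1) : ℝ) : ℂ)) *
        ((∫ y, ((Vf κ yl yu (PN c1 μ4 n : ℝ) y : ℝ) : ℂ) ∂hyν) * ∫ y, ((Vf κ yl yu (PN c2 μ3 m : ℝ) y : ℝ) : ℂ) ∂hyν) else 0 := by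
    intro j
    have hmj : Measurable (fun p => yf δ f (ph w h (sk κ) yl yu) (j, p) * Gf κ a δ c1 c2 μ3 μ4 (j, p)) := hmeas.comp measurable_prodMk_left
    rw [HH_int _ hmj (hsl j) (fun q => ∑ n ∈ range N0, ∑ m ∈ range N0, if (PN c1 μ4 n : ℤ) = (PN c2 μ3 m : ℤ) + h then
      stdAddChar ((((c1 * (n + 1) : ℕ) : ZMod δ) - (f : ZMod δ)) * j) * (lam κ a (n + 1) * lam κ a (m + 1) * w (PN c2 μ3 m : ℝ) / ((√(n + 1) * √(m + 1) : ℝ) : ℂ)) *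
        ((Vf κ yl yu (PN c1 μ4 n : ℝ) q.1 * Vf κ yl yu (PN c2 μ3 m : ℝ) q.2 : ℝ) : ℂ) else 0)
        (fun y1 y2 hy1 hy2 => slice κ a ha δ c1 c2 μ3 μ4 h1 h2 h3 h4 f h w C Cw θ yl yu hC hw hθ hl N0 hN0 j y1 y2 hy1 hy2)]
    have hI : ∀ n m : ℕ, Integrable (fun q : ℝ × ℝ => if (PN c1 μ4 n : ℤ) = (PN c2 μ3 m : ℤ) + h then
      stdAddChar ((((c1 * (n + 1) : ℕ) : ZMod δ) - (f : ZMod δ)) * j) * (lam κ a (n + 1) * lam κ a (m + 1) * w (PN c2 μ3 m : ℝ) / ((√(n + 1) * √(m + 1) : ℝ) : ℂ)) *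
        ((Vf κ yl yu (PN c1 μ4 n : ℝ) q.1 * Vf κ yl yu (PN c2 μ3 m : ℝ) q.2 : ℝ) : ℂ) else 0) (hyν.prod hyν) := by
      intro n m
      split_ifs
      · simp only [ofReal_mul]
        exact ((hVi _).mul_prod (hVi _)).const_mul _
      · exact integrable_zero _ _ _
    rw [integral_finsetSum _ fun n _ => integrable_finsetSum _ fun m _ => hI n m]
    refine sum_congr rfl fun n _ => ?_
    rw [integral_finsetSum _ fun m _ => hI n m]
    refine sum_congr rfl fun m _ => ?_
    split_ifs
    · rw [integral_const_mul, ← integral_prod_mul]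
      simp only [ofReal_mul]
    · simp
  rw [sum_congr rfl fun j _ => hj j, sum_comm, mul_sum]
  refine sum_congr rfl fun n _ => ?_
  rw [sum_comm, mul_sum]
  refine sum_congr rfl fun m _ => ?_
  by_cases he : (PN c1 μ4 n : ℤ) = (PN c2 μ3 m : ℤ) + h
  swap
  · rw [if_neg (fun hh => he hh.1), mul_zero]
    exact sum_eq_zero fun j _ => if_neg he
  simp only [he, if_true, true_and]
  simp only [mul_assoc (stdAddChar _ : ℂ)]
  rw [← sum_mul]
  have hsum : ∑ j : ZMod δ, stdAddChar ((((c1 * (n + 1) : ℕ) : ZMod δ) - (f : ZMod δ)) * j) = if (δ : ℤ) ∣ ((c1 * (n + 1) : ℕ) : ℤ) - f then (δ:ℂ) else 0 := by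
    have := sum_mulShift (((c1 * (n + 1) : ℕ) : ZMod δ) - (f : ZMod δ)) (isPrimitive_stdAddChar δ)
    simp_rw [mul_comm] at this ⊢
    rw [this]
    have hiff : (((c1 * (n + 1) : ℕ) : ZMod δ) - (f : ZMod δ) = 0) ↔ (δ : ℤ) ∣ ((c1 * (n + 1) : ℕ) : ℤ) - f := by
      rw [← intCast_zmod_eq_zero_iff_dvd]
      simp only [Int.cast_sub, cast_natCast]
    by_cases hd : (δ : ℤ) ∣ ((c1 * (n + 1) : ℕ) : ℤ) - f
    · rw [if_pos hd, if_pos (hiff.2 hd), ZMod.card]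
    · rw [if_neg hd, if_neg (fun hh => hd (hiff.1 hh)), Nat.cast_zero]
  rw [hsum]
  by_cases hd : (δ : ℤ) ∣ ((c1 * (n + 1) : ℕ) : ℤ) - f
  swap
  · rw [if_neg hd, if_neg hd, zero_mul, mul_zero]
  rw [if_pos hd, if_pos hd]
  by_cases hw0 : w (PN c2 μ3 m : ℝ) = 0
  · rw [hw0]; simp
  obtain ⟨⟨b1, b2⟩, b3, b4⟩ := hsup n m he hd hw0
  rw [integral_complex_ofReal, integral_complex_ofReal, hyl, hyu, Vf_int κ L _ hL hs b1 b2, Vf_int κ L _ hL hs b3 b4]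
  have e1 : √((PN c1 μ4 n : ℝ)) = √(c1 * μ4) * √(n+1) := by
    rw [← sqrt_mul bpos]; push_cast; rfl
  have e2 : √((PN c2 μ3 m : ℝ)) = √(c2 * μ3) * √(m+1) := by
    rw [← sqrt_mul bpos]; push_cast; rfl
  rw [e1, e2]
  have s1 : ((√((n:ℝ)+1) : ℝ) : ℂ) ≠ 0 := by exact_mod_cast (sqrt_pos.2 bpos).ne'
  have s2 : ((√((m:ℝ)+1) : ℝ) : ℂ) ≠ 0 := by exact_mod_cast (sqrt_pos.2 bpos).ne'
  push_cast
  field_simp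
theorem sk_lb (κ : ℕ) (hκ : 6 ≤ κ) : 19/20 ≤ sk κ := by
  unfold sk
  rw [le_div_iff₀ bpos]
  have : (6:ℝ) ≤ κ := by exact_mod_cast hκ
  have := pi_lt_d2
  nlinarith
noncomputable def TT (κ : ℕ) (a : ℕ → ℂ) (δ c1 c2 μ3 μ4 : ℕ) (f h : ℤ) (w : ℝ → ℂ) (N0 : ℕ) : ℂ :=
  ∑ n ∈ range N0, ∑ m ∈ range N0, if (PN c1 μ4 n : ℤ) = (PN c2 μ3 m : ℤ) + h ∧ (δ : ℤ) ∣ ((c1 * (n + 1) : ℕ) : ℤ) - f then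
        lam κ a (n + 1) * lam κ a (m + 1) * w (PN c2 μ3 m : ℝ) else 0
theorem H_bd (C Cw θ L s yl yu : ℝ) (hCw : 0 ≤ Cw) (hθ : 0 ≤ θ) (hL : 0 < L) (hs : 19/20 ≤ s) (hyl : yl = (s - 1/2) / (4 * L)) (hyu : yu = (s + 1/2) / L) :
    0 < yl ∧ yl ≤ yu ∧ 1 ≤ 9 * L * yl ∧ yu * (256 * Cw * C ^ 2) * ((θ + yu) ^ 4 + 4 * yu ^ 4) / (2 * yl ^ 5) ≤ (2 ^ 30 * C ^ 2) * Cw * (1 + θ * L) ^ 4 := by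
  have hl : 0 < yl := by rw [hyl]; exact div_pos blin bpos
  have h1 : yl * (4 * L) = s - 1/2 := by rw [hyl]; field_simp
  have h2 : yu * L = s + 1/2 := by rw [hyu]; field_simp
  have h3 : yl ≤ yu := by
    by_contra hh; push Not at hh
    nlinarith
  have h4 : yu ≤ 16 * yl := by
    by_contra hh; push Not at hh
    nlinarith
  have h5 : 1 ≤ 9 * L * yl := by nlinarith
  refine ⟨hl, h3, h5, ?_⟩
  rw [div_le_iff₀ bpos]
  have h6 : θ + yu ≤ 16 * yl * (1 + θ * L) := by
    have : θ ≤ θ * (9 * L * yl) := le_mul_of_one_le_right hθ h5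
    have : 0 ≤ θ * L * yl := by positivity
    nlinarith
  have h7 : (θ + yu)^4 ≤ (16 * yl * (1 + θ * L))^4 := by
    have : 0 ≤ θ + yu := by linarith
    gcongr
  have h8 : yu^4 ≤ (16 * yl * (1 + θ * L))^4 := by
    have : 0 ≤ yu := by linarith
    have : yu ≤ 16 * yl * (1 + θ * L) := by linarith
    gcongr
  calc yu * (256 * Cw * C ^ 2) * ((θ + yu) ^ 4 + 4 * yu ^ 4) ≤ (16 * yl) * (256 * Cw * C ^ 2) * ((16 * yl * (1 + θ * L))^4 + 4 * (16 * yl * (1 + θ * L))^4) := by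
        have : 0 ≤ yu := by linarith
        gcongr
    _ = (20480 * 16^4) * (Cw * C ^ 2 * yl ^ 5 * (1 + θ * L)^4) := by ring
    _ ≤ (2 ^ 31) * (Cw * C ^ 2 * yl ^ 5 * (1 + θ * L)^4) := by gcongr; norm_num
    _ = _ := by ring
theorem core : ∃ K0 : ℝ, 1 ≤ K0 ∧ ∀ (κ : ℕ) (a : ℕ → ℂ), IsNormalizedHeckeEigenform (2 * κ) a → ∀ (δ c1 c2 μ3 μ4 : ℕ), 0 < δ → 0 < c1 → 0 < c2 → 0 < μ3 → 0 < μ4 →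
    ∀ (f h : ℤ), IsCoprime f (δ : ℤ) → ∀ (w : ℝ → ℂ) (Cw θ L : ℝ), Dn Cw θ w → 0 ≤ θ → 0 < L → ∀ (N0 Cn : ℕ), 9 * L ≤ Cn → 9 * L * (sk κ + 1/2) ≤ N0 →
    (∀ n m : ℕ, (PN c1 μ4 n : ℤ) = (PN c2 μ3 m : ℤ) + h → (δ : ℤ) ∣ ((c1 * (n + 1) : ℕ) : ℤ) - f → w (PN c2 μ3 m : ℝ) ≠ 0 →
      (L ≤ (PN c1 μ4 n : ℝ) ∧ (PN c1 μ4 n : ℝ) ≤ 4 * L) ∧ (L ≤ (PN c2 μ3 m : ℝ) ∧ (PN c2 μ3 m : ℝ) ≤ 4 * L)) →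
    ‖TT κ a δ c1 c2 μ3 μ4 f h w N0‖ ^ 2 ≤ K0 * Cw ^ 2 * κ ^ 16 * (1 + θ * L) ^ 8 * δ ^ 2 * (δ ^ 2 * μ3 * μ4 * c1 * c2).divisors.card * L *
      (1 + 2 * ∑ c ∈ (Icc 1 Cn).filter (δ ^ 2 * μ3 * μ4 * c1 * c2 ∣ ·), klN c δ h / c) := by
  obtain ⟨Cf, hCf, hfo⟩ := fo_bound
  obtain ⟨C, hC1, hC⟩ := bb_dn
  have hπ1 : (1:ℝ) ≤ pi := by linarith [pi_gt_three]
  refine ⟨((Cf ^ 2 * 48 ^ 2) ^ 2 * (2 ^ 30 * C ^ 2) ^ 2 * (128 * pi ^ 4 * 9)), ?_, ?_⟩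
  · have a1 : 1 ≤ Cf ^ 2 := one_le_pow₀ hCf
    have a2 : 1 ≤ C ^ 2 := one_le_pow₀ hC1
    have a3 : 1 ≤ pi ^ 4 := one_le_pow₀ hπ1
    refine one_le_mul_of_one_le_of_one_le (one_le_mul_of_one_le_of_one_le (one_le_pow₀ ?_) (one_le_pow₀ ?_)) ?_ <;> nlinarith
  intro κ a ha δ c1 c2 μ3 μ4 hδ h1 h2 h3 h4 f h hf w Cw θ L hw hθ hL N0 Cn hCn hN0 hsup
  have : NeZero δ := ⟨hδ.ne'⟩
  have hκ : 6 ≤ κ := by have := ha.2.1; omega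
  have hCw := dnb_nonneg hw
  obtain ⟨hl, hlu, hL9, hH⟩ := H_bd C Cw θ L (sk κ) _ _ hCw hθ hL (sk_lb κ hκ) rfl rfl
  set yl := (sk κ - 1/2) / (4 * L) with hyl
  set yu := (sk κ + 1/2) / L with hyu
  set q := δ ^ 2 * μ3 * μ4 * c1 * c2 with hq
  have hq0 : 0 < q := by positivity
  have hsk := sk_lb κ hκ
  have hNk := Nk_lb κ hκ
  have hr0 : 0 < r0 κ (sk κ) := by
    have : 0 < sk κ := by linarith
    unfold r0; positivity
  have hNp : 0 < Nk κ := by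
    by_contra hh; push Not at hh
    exact absurd (hNk.trans (mul_nonpos_of_nonneg_of_nonpos bpos hh)) (not_le.2 hr0)
  have hB : ∀ y, ‖Gf κ a δ c1 c2 μ3 μ4 y‖ ≤ (Cf * κ ^ 2 * r0 κ (sk κ)) ^ 2 := by
    intro y
    unfold Gf
    rw [norm_mul, sq]
    have := (hfo κ a ha).1
    gcongr
    · exact this _
    · exact this _
  obtain ⟨hi, hg⟩ := geo κ δ q (Dvd.intro (δ * μ3 * μ4 * c1 * c2) (by rw [hq]; ring)) hq0.ne' f h ((coe_int_isUnit_iff_isCoprime f δ).2 hf.symm) yl _ hl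
    (by have : 0 ≤ yu := hl.le.trans hlu
        positivity) _ (ph_ok C Cw θ yl yu w h (sk κ) hC hw hθ hl hlu) Cn (hL9.trans (mul_le_mul_of_nonneg_right hCn hl.le)) (Gf κ a δ c1 c2 μ3 μ4) (Gf_meas κ a ha δ c1 c2 μ3 μ4) _ bpos hB
    (fun g hg y => Gf_trans κ a ha δ c1 c2 μ3 μ4 h1 h2 h3 h4 g hg y)
  have hid := main_id κ a ha δ c1 c2 μ3 μ4 h1 h2 h3 h4 f h w C Cw θ L yl yu hC hw hθ hL blin rfl rfl N0
    (by rw [div_le_iff₀ hl]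
        have : (sk κ + 1/2) ≤ (sk κ + 1/2) * (9 * L * yl) := le_mul_of_one_le_right blin hL9
        refine this.trans (le_trans (le_of_eq ?_) (mul_le_mul_of_nonneg_right hN0 hl.le))
        ring) hsup hi
  rw [hid] at hg
  change ‖_ * TT κ a δ c1 c2 μ3 μ4 f h w N0‖ ^ 2 ≤ _ at hg
  set S := 1 + 2 * ∑ c ∈ (Icc 1 Cn).filter (q ∣ ·), klN c δ h / c with hS
  have hS0 : 0 ≤ S := by
    have : 0 ≤ ∑ c ∈ (Icc 1 Cn).filter (q ∣ ·), klN c δ h / c := sum_nonneg fun c _ => by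
      refine div_nonneg ?_ bpos
      unfold klN
      split_ifs <;> positivity
    positivity
  rw [norm_mul, mul_pow, norm_real, norm_eq_abs, sq_abs] at hg
  have e1 : (δ * Nk κ ^ 2 * (√(c1 * μ4) * √(c2 * μ3)) : ℝ) ^ 2 = q * Nk κ ^ 4 := by
    have : (√(c1 * μ4) * √(c2 * μ3) : ℝ) ^ 2 = c1 * μ4 * (c2 * μ3) := by
      rw [mul_pow, sq_sqrt bpos, sq_sqrt bpos]
    rw [mul_pow, this, hq]; push_cast; ring
  rw [e1] at hg
  have hpos : 0 < (q:ℝ) * Nk κ ^ 4 := by positivity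
  refine le_of_mul_le_mul_left (hg.trans ?_) hpos
  have hb : 1 / yl ≤ 9 * L := by rw [div_le_iff₀ hl]; exact hL9
  have hBB : (Cf * κ ^ 2 * r0 κ (sk κ)) ^ 2 ≤ (Cf ^ 2 * 48 ^ 2) * κ ^ 8 * Nk κ ^ 2 := by
    calc (Cf * κ ^ 2 * r0 κ (sk κ)) ^ 2 ≤ (Cf * κ ^ 2 * (48 * κ ^ 2 * Nk κ)) ^ 2 := by gcongr
      _ = _ := by ring
  have hyu0 : 0 ≤ yu := hl.le.trans hlu
  calc _ = δ ^ 2 * ((Cf * κ ^ 2 * r0 κ (sk κ)) ^ 2) ^ 2 * (128 * pi ^ 4) * (q * q.divisors.card) * (yu * (256 * Cw * C ^ 2) * ((θ + yu) ^ 4 + 4 * yu ^ 4) / (2 * yl ^ 5)) ^ 2 * (1 / yl) * S := by ring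
    _ ≤ δ ^ 2 * ((Cf ^ 2 * 48 ^ 2) * κ ^ 8 * Nk κ ^ 2) ^ 2 * (128 * pi ^ 4) * (q * q.divisors.card) * ((2 ^ 30 * C ^ 2) * Cw * (1 + θ * L) ^ 4) ^ 2 * (9 * L) * S := by
        gcongr
    _ = _ := by push_cast; ring
theorem kl_alg (U T t1 t2 t3 lg δ w μ G Cn L : ℝ) (hU : 1 ≤ U) (hT : T ≤ U) (h10 : 0 ≤ t1) (h1 : t1 ≤ U) (h20 : 0 ≤ t2) (h2 : t2 ≤ U) (h30 : 0 ≤ t3) (h3 : t3 ≤ U)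
    (hl0 : 0 ≤ lg) (hl : lg ≤ U) (hδ : 0 < δ) (hw : δ ^ 2 ≤ w) (hμ : 0 < μ) (hL : 0 ≤ L) (hCn : Cn ≤ 13 * L) :
    T * t1 / δ * (2 * √Cn / (w * μ)) * (√w * √G) * t2 * (t3 * lg) ^ 2 ≤ U ^ 7 * (8 * √L * √G / (δ ^ 2 * μ)) := by
  have hw0 : 0 < w := lt_of_lt_of_le bpos hw
  have hsw : δ ≤ √w := le_sqrt_of_sq_le hw
  have hsc : √Cn ≤ 4 * √L := by
    rw [show (4:ℝ) * √L = √(16 * L) by rw [sqrt_mul bnum, show (16:ℝ) = 4 ^ 2 by norm_num, sqrt_sq bnum]]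
    exact sqrt_le_sqrt blin
  have e : √w / w = 1 / √w := Real.sqrt_div_self'
  calc _ = (T * t1 * t2 * (t3 * lg) ^ 2) * (2 * √Cn * √G / (δ * μ) * (√w / w)) := by field_simp
    _ = (T * t1 * t2 * (t3 * lg) ^ 2) * (2 * √Cn * √G / (δ * μ * √w)) := by rw [e]; field_simp
    _ ≤ (U * U * U * (U * U) ^ 2) * (2 * (4 * √L) * √G / (δ * μ * δ)) := by gcongr
    _ = _ := by ring
theorem TT_bd : ∃ K0 : ℝ, 1 ≤ K0 ∧ ∀ (κ : ℕ) (a : ℕ → ℂ), IsNormalizedHeckeEigenform (2 * κ) a → ∀ (δ c1 c2 μ3 μ4 : ℕ), 0 < δ → 0 < c1 → 0 < c2 → 0 < μ3 → 0 < μ4 →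
    ∀ (f h : ℤ), IsCoprime f (δ : ℤ) → h ≠ 0 → Squarefree δ → Squarefree (μ3 * μ4) → (δ ^ 2 * c1 * c2).Coprime (μ3 * μ4) →
    ∀ (w : ℝ → ℂ) (Cw θ L : ℝ), Dn Cw θ w → 0 ≤ θ → 0 < L → ∀ (N0 : ℕ), 9 * L * (sk κ + 1/2) ≤ N0 →
    (∀ n m : ℕ, (PN c1 μ4 n : ℤ) = (PN c2 μ3 m : ℤ) + h → (δ : ℤ) ∣ ((c1 * (n + 1) : ℕ) : ℤ) - f → w (PN c2 μ3 m : ℝ) ≠ 0 →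
      (L ≤ (PN c1 μ4 n : ℝ) ∧ (PN c1 μ4 n : ℝ) ≤ 4 * L) ∧ (L ≤ (PN c2 μ3 m : ℝ) ∧ (PN c2 μ3 m : ℝ) ≤ 4 * L)) →
    ∀ U : ℝ, 1 ≤ U → (∀ c : ℕ, c ≠ 0 → (c:ℝ) ≤ 13 * L → (c.divisors.card : ℝ) ≤ U) → (δ.divisors.card : ℝ) ≤ U → ((2 * h.natAbs * δ).divisors.card : ℝ) ≤ U →
      ((δ ^ 2 * μ3 * μ4 * c1 * c2).divisors.card : ℝ) ≤ U → (∀ c : ℕ, c ≠ 0 → (c:ℝ) ≤ 13 * L → 1 + log c ≤ U) →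
    ‖TT κ a δ c1 c2 μ3 μ4 f h w N0‖ ^ 2 ≤ K0 * Cw ^ 2 * κ ^ 16 * (1 + θ * L) ^ 8 * U ^ 8 * (δ ^ 2 * L + L * √L * √(Nat.gcd (μ3 * μ4) (2 * h.natAbs * δ)) / (μ3 * μ4)) := by
  obtain ⟨K0, hK0, hcore⟩ := core
  refine ⟨16 * K0, by linarith, ?_⟩
  intro κ a ha δ c1 c2 μ3 μ4 hδ h1 h2 h3 h4 f h hf hh hsδ hsμ hcop w Cw θ L hw hθ hL N0 hN0 hsup U hU hT hτδ hτh hτq hlog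
  have hrhs : 0 ≤ K0 * Cw ^ 2 * κ ^ 16 * (1 + θ * L) ^ 8 := by positivity
  by_cases hL4 : L < 1/4
  · have : TT κ a δ c1 c2 μ3 μ4 f h w N0 = 0 := by
      unfold TT
      refine sum_eq_zero fun n _ => sum_eq_zero fun m _ => ?_
      split_ifs with hc
      · by_cases hw0 : w (PN c2 μ3 m : ℝ) = 0
        · rw [hw0, mul_zero]
        · exfalso
          have := (hsup n m hc.1 hc.2 hw0).2.2
          have h5 : (1:ℝ) ≤ (PN c2 μ3 m : ℝ) := by exact_mod_cast one_le_iff_ne_zero.2 bpos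
          linarith
      · rfl
    rw [this, norm_zero, zero_pow bnum]
    positivity
  push Not at hL4
  set Cn := ⌈9 * L⌉₊ with hCn
  have hCn1 : 9 * L ≤ Cn := Nat.le_ceil _
  have hCn2 : (Cn:ℝ) ≤ 13 * L := by
    have := Nat.ceil_lt_add_one (show 0 ≤ 9 * L by positivity)
    linarith
  have hCn0 : Cn ≠ 0 := by rw [hCn]; exact (Nat.ceil_pos.2 bpos).ne'
  have hc := hcore κ a ha δ c1 c2 μ3 μ4 hδ h1 h2 h3 h4 f h hf w Cw θ L hw hθ hL N0 Cn hCn1 hN0 hsup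
  have hq : δ ^ 2 * μ3 * μ4 * c1 * c2 = (δ ^ 2 * c1 * c2) * (μ3 * μ4) := by ring
  rw [hq] at hc hτq
  have hkl := kl_sum (δ ^ 2 * c1 * c2) (μ3 * μ4) δ Cn h U hcop hsμ bpos hsδ (Dvd.intro (δ * c1 * c2) (by ring)) hh
    (fun c hc => by
      rw [mem_Icc] at hc
      refine hT c bomg (le_trans ?_ hCn2)
      exact_mod_cast hc.2)
  have hcc : (1:ℝ) ≤ c1 * c2 := by exact_mod_cast one_le_iff_ne_zero.2 bpos
  rw [cast_mul (δ ^ 2 * c1 * c2) (μ3 * μ4)] at hkl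
  have hl0 : 0 ≤ 1 + log Cn := by
    have := Real.log_nonneg (show (1:ℝ) ≤ Cn by exact_mod_cast one_le_iff_ne_zero.2 hCn0)
    linarith
  have hS := hkl.trans (kl_alg U U _ _ _ _ δ ((δ ^ 2 * c1 * c2 : ℕ) : ℝ) ((μ3 * μ4 : ℕ) : ℝ) _ Cn L hU le_rfl bpos hτδ bpos hτh bpos hτq
    hl0 (hlog Cn hCn0 hCn2) bpos (by
      push_cast
      have : (0:ℝ) ≤ (δ:ℝ)^2 := by positivity
      nlinarith) bpos hL.le hCn2)
  set Sg := ∑ c ∈ (Icc 1 Cn).filter ((δ ^ 2 * c1 * c2) * (μ3 * μ4) ∣ ·), klN c δ h / c with hSg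
  set G := √(Nat.gcd (μ3 * μ4) (2 * h.natAbs * δ) : ℝ) with hG
  have hU8 : U ^ 7 * U = U ^ 8 := by ring
  have hU1 : U ≤ U ^ 8 := le_self_pow₀ hU bnum
  have hδ' : (0:ℝ) < δ := by positivity
  have hμ' : (0:ℝ) < ((μ3 * μ4 : ℕ) : ℝ) := by positivity
  calc _ ≤ _ := hc
    _ = (K0 * Cw ^ 2 * κ ^ 16 * (1 + θ * L) ^ 8) * (δ ^ 2 * (((δ ^ 2 * c1 * c2) * (μ3 * μ4)).divisors.card * (L * (1 + 2 * Sg)))) := by ring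
    _ ≤ (K0 * Cw ^ 2 * κ ^ 16 * (1 + θ * L) ^ 8) * (δ ^ 2 * (((δ ^ 2 * c1 * c2) * (μ3 * μ4)).divisors.card * (L * (1 + 2 * (U ^ 7 * (8 * √L * G / (δ ^ 2 * ((μ3 * μ4 : ℕ) : ℝ)))))))) := by gcongr
    _ ≤ (K0 * Cw ^ 2 * κ ^ 16 * (1 + θ * L) ^ 8) * (δ ^ 2 * (U * (L * (1 + 2 * (U ^ 7 * (8 * √L * G / (δ ^ 2 * ((μ3 * μ4 : ℕ) : ℝ)))))))) := by gcongr
    _ = (K0 * Cw ^ 2 * κ ^ 16 * (1 + θ * L) ^ 8) * (U * (δ ^ 2 * L) + 16 * U ^ 8 * (L * √L * G / ((μ3 * μ4 : ℕ) : ℝ))) := by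
        congr 1; rw [← hU8]; field_simp; ring
    _ ≤ (K0 * Cw ^ 2 * κ ^ 16 * (1 + θ * L) ^ 8) * ((16 * U ^ 8) * (δ ^ 2 * L) + 16 * U ^ 8 * (L * √L * G / ((μ3 * μ4 : ℕ) : ℝ))) := by
        gcongr
        linarith
    _ = _ := by push_cast; ring
theorem hecke_inv (κ : ℕ) (a : ℕ → ℂ) (h : IsNormalizedHeckeEigenform (2 * κ) a) (e l : ℕ) (he : 0 < e) (hl : 0 < l) :
    lam κ a (e * l) = ∑ c ∈ e.divisors, if c ∣ l then (moebius c : ℂ) * lam κ a (e / c) * lam κ a (l / c) else 0 := by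
  obtain ⟨g, e', l', hg, hcop, hee, hll⟩ := exists_coprime' (gcd_pos_of_pos_left l he)
  have hgcd : Nat.gcd e l = g := by rw [hee, hll, gcd_mul_right, hcop, one_mul]
  have he' : 0 < e' := Nat.pos_of_ne_zero (by rintro rfl; simp at hee; omega)
  have hl' : 0 < l' := Nat.pos_of_ne_zero (by rintro rfl; simp at hll; omega)
  have key := (ArithmeticFunction.sum_eq_iff_sum_mul_moebius_eq (f := fun n => lam κ a (e' * l' * n ^ 2)) (g := fun n => lam κ a (e' * n) * lam κ a (l' * n))).1 (by
    intro n hn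
    rw [lam_hecke κ a h _ _ (Nat.mul_pos he' hn) (Nat.mul_pos hl' hn), gcd_mul_right, hcop, one_mul, ← Nat.sum_div_divisors]
    refine sum_congr rfl fun d hd => ?_
    obtain ⟨t, rfl⟩ := dvd_of_mem_divisors hd
    have hd0 : 0 < d := pos_of_mem_divisors hd
    rw [Nat.mul_div_cancel_left _ hd0]
    congr 1
    symm
    apply Nat.div_eq_of_eq_mul_left bpos
    ring) g hg
  have e0 : e * l = e' * l' * g ^ 2 := by rw [hee, hll]; ring
  rw [e0, ← key, Nat.sum_divisorsAntidiagonal (f := fun c d => (moebius c : ℂ) * (lam κ a (e' * d) * lam κ a (l' * d))), ← sum_filter]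
  have hset : e.divisors.filter (· ∣ l) = g.divisors := by
    ext c
    simp only [mem_filter, mem_divisors, ← hgcd, Nat.dvd_gcd_iff]
    have : e.gcd l ≠ 0 := (gcd_pos_of_pos_left l he).ne'
    constructor
    · rintro ⟨⟨h1, _⟩, h2⟩; exact ⟨⟨h1, h2⟩, this⟩
    · rintro ⟨⟨h1, h2⟩, _⟩; exact ⟨⟨h1, he.ne'⟩, h2⟩
  rw [hset]
  refine sum_congr rfl fun c hc => ?_
  have hcg := dvd_of_mem_divisors hc
  rw [hee, hll, Nat.mul_div_assoc _ hcg, Nat.mul_div_assoc _ hcg]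
  ring
noncomputable def wt (g : ℝ → ℂ) (δ μ3 : ℕ) (m4 f1 : ℤ) (v : ℝ) : ℂ := g ((1 / (μ3 * m4 * δ)) * v + (-(f1 / (m4 * δ))))
theorem pair_n (δ c1 c2 μ3 μ4 l1 l2 : ℕ) (m3 m4 f1 h : ℤ) (hδ : 0 < δ) (h3 : 0 < μ3) (hm4 : m4 ≠ 0) (hs : (μ4 : ℤ) * m3 = m4 * μ3) (hμ3 : μ3 = m3.natAbs)
    (hc : μ3.Coprime μ4) (hcδ : IsCoprime (δ : ℤ) m3) (hh : h = f1 * (μ4 - μ3)) (g : ℝ → ℂ)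
    (e1 : ((c1 * μ4 * l1 : ℕ) : ℤ) = ((c2 * μ3 * l2 : ℕ) : ℤ) + h) (e2 : (δ : ℤ) ∣ ((c1 * l1 : ℕ) : ℤ) - f1) :
    ∃ n : ℤ, ((c1 * l1 : ℕ) : ℤ) = δ * m3 * n + f1 ∧ ((c2 * l2 : ℕ) : ℤ) = δ * m4 * n + f1 ∧ wt g δ μ3 m4 f1 ((c2 * μ3 * l2 : ℕ) : ℝ) = g n := by
  have h5 : (μ4 : ℤ) * (((c1 * l1 : ℕ) : ℤ) - f1) = μ3 * (((c2 * l2 : ℕ) : ℤ) - f1) := by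
    push_cast at e1 ⊢; rw [hh] at e1; linear_combination e1
  have h6 : m3 ∣ ((c1 * l1 : ℕ) : ℤ) - f1 := by
    rw [← natAbs_dvd, ← hμ3]
    exact (isCoprime_iff_coprime.2 hc).dvd_of_dvd_mul_left (Dvd.intro _ h5.symm)
  obtain ⟨n, hn⟩ := hcδ.mul_dvd e2 h6
  have h7 : ((c2 * l2 : ℕ) : ℤ) - f1 = δ * m4 * n := by
    have : (μ3 : ℤ) ≠ 0 := by exact_mod_cast h3.ne'
    refine mul_left_cancel₀ this ?_
    rw [← h5, hn]
    linear_combination (δ * n) * hs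
  refine ⟨n, by linarith, by linarith, ?_⟩
  unfold wt
  congr 1
  have h8 : ((c2 * l2 : ℕ) : ℝ) = δ * m4 * n + f1 := by
    have : ((c2 * l2 : ℕ) : ℤ) = δ * m4 * n + f1 := by linarith
    exact_mod_cast congrArg (Int.cast : ℤ → ℝ) this
  have h9 : ((c2 * μ3 * l2 : ℕ) : ℝ) = μ3 * (δ * m4 * n + f1) := by rw [← h8]; push_cast; ring
  rw [h9]
  have : (m4 : ℝ) ≠ 0 := by exact_mod_cast hm4
  field_simp
  ring
theorem TT_eq (κ : ℕ) (a : ℕ → ℂ) (δ c1 c2 μ3 μ4 : ℕ) (m3 m4 f1 h : ℤ) (hδ : 0 < δ) (hc1 : 0 < c1) (hc2 : 0 < c2) (h3 : 0 < μ3) (hm4 : m4 ≠ 0) (hs : (μ4 : ℤ) * m3 = m4 * μ3) (hμ3 : μ3 = m3.natAbs)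
    (hc : μ3.Coprime μ4) (hcδ : IsCoprime (δ : ℤ) m3) (hh : h = f1 * (μ4 - μ3)) (g : ℝ → ℂ) (N N0 : ℕ)
    (hg : ∀ x, g x ≠ 0 → 0 < x ∧ x < N)
    (hp : ∀ n : ℕ, g n ≠ 0 → (0 < δ * m3 * n + f1 ∧ δ * m3 * n + f1 ≤ N0) ∧ (0 < δ * m4 * n + f1 ∧ δ * m4 * n + f1 ≤ N0)) :
    ∑ n ∈ range N, (if (c1 : ℤ) ∣ δ * m3 * n + f1 ∧ (c2 : ℤ) ∣ δ * m4 * n + f1 then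
      lam κ a ((δ * m3 * n + f1) / c1).toNat * lam κ a ((δ * m4 * n + f1) / c2).toNat * g n else 0) = TT κ a δ c1 c2 μ3 μ4 f1 h (wt g δ μ3 m4 f1) N0 := by
  unfold TT
  rw [← Finset.sum_product']
  have hm3 : m3 ≠ 0 := by rintro rfl; simp at hμ3; omega
  have hδ' : (δ : ℤ) ≠ 0 := by exact_mod_cast hδ.ne'
  have hdat : ∀ n : ℕ, (c1 : ℤ) ∣ δ * m3 * n + f1 ∧ (c2 : ℤ) ∣ δ * m4 * n + f1 → g n ≠ 0 → ∃ l1 l2 : ℕ, δ * m3 * n + f1 = ((c1 * (l1 + 1) : ℕ) : ℤ) ∧ δ * m4 * n + f1 = ((c2 * (l2 + 1) : ℕ) : ℤ) ∧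
      ((δ * m3 * n + f1) / c1).toNat = l1 + 1 ∧ ((δ * m4 * n + f1) / c2).toNat = l2 + 1 ∧ l1 < N0 ∧ l2 < N0 := by
    have aux : ∀ (c : ℕ) (x : ℤ), 0 < c → (c : ℤ) ∣ x → 0 < x → x ≤ N0 → ∃ l : ℕ, x = ((c * (l + 1) : ℕ) : ℤ) ∧ (x / c).toNat = l + 1 ∧ l < N0 := by
      rintro c x hc0 ⟨t, rfl⟩ h1 h2
      have hc' : (0:ℤ) < c := by exact_mod_cast hc0
      have ht : 0 < t := pos_of_mul_pos_right h1 hc'.le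
      refine ⟨t.toNat - 1, ?_, ?_, ?_⟩
      · have : ((t.toNat - 1 + 1 : ℕ) : ℤ) = t := by omega
        rw [cast_mul, this]
      · rw [mul_ediv_cancel_left _ hc'.ne']; omega
      · have : t ≤ c * t := le_mul_of_one_le_left ht.le hc'
        omega
    intro n hd hgn
    obtain ⟨⟨p1, p2⟩, p3, p4⟩ := hp n hgn
    obtain ⟨l1, b1, b2, b3⟩ := aux c1 _ hc1 hd.1 p1 p2
    obtain ⟨l2, b4, b5, b6⟩ := aux c2 _ hc2 hd.2 p3 p4
    exact ⟨l1, l2, b1, b4, b2, b5, b3, b6⟩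
  have hcond : ∀ (n : ℤ) (l1 l2 : ℕ), δ * m3 * n + f1 = ((c1 * (l1 + 1) : ℕ) : ℤ) → δ * m4 * n + f1 = ((c2 * (l2 + 1) : ℕ) : ℤ) →
      (PN c1 μ4 l1 : ℤ) = (PN c2 μ3 l2 : ℤ) + h ∧ (δ : ℤ) ∣ ((c1 * (l1 + 1) : ℕ) : ℤ) - f1 := by
    intro n l1 l2 b1 b2
    constructor
    · push_cast at b1 b2 ⊢
      rw [hh]
      linear_combination (-(μ4:ℤ)) * b1 + (μ3:ℤ) * b2 + δ * n * hs
    · rw [← b1]; exact ⟨m3 * n, by ring⟩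
  refine Finset.sum_bij_ne_zero (fun n _ _ => (((δ * m3 * n + f1) / c1).toNat - 1, ((δ * m4 * n + f1) / c2).toNat - 1)) ?_ ?_ ?_ ?_
  · intro n _ hne
    split_ifs at hne with hd
    · obtain ⟨l1, l2, _, _, b3, b4, b5, b6⟩ := hdat n hd (right_ne_zero_of_mul hne)
      simp only [b3, b4, mem_product, mem_range]
      exact ⟨by omega, by omega⟩
    · exact absurd rfl hne
  · intro n _ hne n' _ hne' heq
    split_ifs at hne with hd
    · split_ifs at hne' with hd'
      · obtain ⟨l1, l2, b1, _, b3, _⟩ := hdat n hd (right_ne_zero_of_mul hne)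
        obtain ⟨l1', l2', b1', _, b3', _⟩ := hdat n' hd' (right_ne_zero_of_mul hne')
        have heq1 := (Prod.mk.inj heq).1
        rw [b3, b3'] at heq1
        have : l1 = l1' := by omega
        rw [this, ← b1'] at b1
        have h2 : (δ * m3) * (n : ℤ) = (δ * m3) * (n' : ℤ) := by linarith
        exact_mod_cast mul_left_cancel₀ (mul_ne_zero hδ' hm3) h2
      · exact absurd rfl hne'
    · exact absurd rfl hne
  · rintro ⟨l1, l2⟩ _ hne
    simp only at hne
    split_ifs at hne with hd
    · obtain ⟨n, b1, b2, b3⟩ := pair_n δ c1 c2 μ3 μ4 (l1+1) (l2+1) m3 m4 f1 h hδ h3 hm4 hs hμ3 hc hcδ hh g hd.1 hd.2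
      have hgn : g n ≠ 0 := by rw [← b3]; exact right_ne_zero_of_mul hne
      obtain ⟨g1, g2⟩ := hg _ hgn
      have n0 : 0 < n := by exact_mod_cast g1
      obtain ⟨n, rfl⟩ := eq_ofNat_of_zero_le n0.le
      rw [cast_natCast] at hgn g2 b3
      have hd1 : (c1 : ℤ) ∣ δ * m3 * n + f1 ∧ (c2 : ℤ) ∣ δ * m4 * n + f1 := ⟨by rw [← b1]; push_cast; exact Dvd.intro _ rfl, by rw [← b2]; push_cast; exact Dvd.intro _ rfl⟩
      have q1 : ((δ * m3 * n + f1) / c1).toNat = l1 + 1 := by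
        rw [← b1, cast_mul, mul_ediv_cancel_left _ (by exact_mod_cast hc1.ne')]; rfl
      have q2 : ((δ * m4 * n + f1) / c2).toNat = l2 + 1 := by
        rw [← b2, cast_mul, mul_ediv_cancel_left _ (by exact_mod_cast hc2.ne')]; rfl
      refine ⟨n, mem_range.2 (by exact_mod_cast g2), ?_, ?_⟩
      · rw [if_pos hd1, q1, q2, ← b3]; exact hne
      · rw [q1, q2]; rfl
    · exact absurd rfl hne
  · intro n _ hne
    split_ifs at hne with hd
    · have hgn := right_ne_zero_of_mul hne
      obtain ⟨l1, l2, b1, b2, b3, b4, b5, b6⟩ := hdat n hd hgn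
      have hcd := hcond n l1 l2 b1 b2
      obtain ⟨n', d1, d2, d3⟩ := pair_n δ c1 c2 μ3 μ4 (l1+1) (l2+1) m3 m4 f1 h hδ h3 hm4 hs hμ3 hc hcδ hh g hcd.1 hcd.2
      have hnn : (n:ℤ) = n' := by
        have h2 : (δ * m3) * (n : ℤ) = (δ * m3) * n' := by linarith
        exact mul_left_cancel₀ (mul_ne_zero hδ' hm3) h2
      rw [if_pos hd]
      simp only [b3, b4, Nat.add_sub_cancel]
      rw [if_pos hcd, d3, ← hnn, cast_natCast]
    · exact absurd rfl hne
theorem expand (κ : ℕ) (a : ℕ → ℂ) (h : IsNormalizedHeckeEigenform (2 * κ) a) (e δ : ℕ) (he : 0 < e)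
    (m3 m4 f1 : ℤ) (g : ℝ → ℂ) (N : ℕ)
    (hp : ∀ n : ℕ, g n ≠ 0 → 0 < δ * m3 * n + f1 ∧ 0 < δ * m4 * n + f1) :
    ∑ n ∈ range N, heckeLambda (2 * κ) a (e * (δ * m3 * n + f1)) * heckeLambda (2 * κ) a (e * (δ * m4 * n + f1)) * g (n : ℝ)
    = ∑ c1 ∈ e.divisors, ∑ c2 ∈ e.divisors,
        ((moebius c1 : ℂ) * lam κ a (e / c1)) * ((moebius c2 : ℂ) * lam κ a (e / c2)) *
        ∑ n ∈ range N, (if (c1 : ℤ) ∣ δ * m3 * n + f1 ∧ (c2 : ℤ) ∣ δ * m4 * n + f1 then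
          lam κ a ((δ * m3 * n + f1) / c1).toNat * lam κ a ((δ * m4 * n + f1) / c2).toNat * g n else 0) := by
  have e1 : ∀ c1 ∈ e.divisors, (∑ c2 ∈ e.divisors,
        ((moebius c1 : ℂ) * lam κ a (e / c1)) * ((moebius c2 : ℂ) * lam κ a (e / c2)) *
        ∑ n ∈ range N, (if (c1 : ℤ) ∣ δ * m3 * n + f1 ∧ (c2 : ℤ) ∣ δ * m4 * n + f1 then
          lam κ a ((δ * m3 * n + f1) / c1).toNat * lam κ a ((δ * m4 * n + f1) / c2).toNat * g n else 0))
      = ∑ n ∈ range N, ∑ c2 ∈ e.divisors,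
        ((moebius c1 : ℂ) * lam κ a (e / c1)) * ((moebius c2 : ℂ) * lam κ a (e / c2)) *
        (if (c1 : ℤ) ∣ δ * m3 * n + f1 ∧ (c2 : ℤ) ∣ δ * m4 * n + f1 then
          lam κ a ((δ * m3 * n + f1) / c1).toNat * lam κ a ((δ * m4 * n + f1) / c2).toNat * g n else 0) := by
    intro c1 _
    rw [sum_comm]
    simp_rw [mul_sum]
  rw [sum_congr rfl e1, sum_comm]
  refine sum_congr rfl fun n _ => ?_
  by_cases hg : g (n : ℝ) = 0
  · simp [hg]
  obtain ⟨h1, h2⟩ := hp n hg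
  obtain ⟨l1, hl1⟩ := eq_ofNat_of_zero_le h1.le
  obtain ⟨l2, hl2⟩ := eq_ofNat_of_zero_le h2.le
  rw [hl1, hl2]
  rw [hl1] at h1
  rw [hl2] at h2
  have q1 : heckeLambda (2 * κ) a ((e : ℤ) * (l1 : ℤ)) = lam κ a (e * l1) := by
    unfold lam; push_cast; rfl
  have q2 : heckeLambda (2 * κ) a ((e : ℤ) * (l2 : ℤ)) = lam κ a (e * l2) := by
    unfold lam; push_cast; rfl
  rw [q1, q2, hecke_inv κ a h e l1 he bomg, hecke_inv κ a h e l2 he bomg, sum_mul_sum, sum_mul]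
  refine sum_congr rfl fun c1 _ => ?_
  rw [sum_mul]
  refine sum_congr rfl fun c2 _ => ?_
  simp only [natCast_dvd_natCast, ← Int.natCast_div, toNat_natCast]
  by_cases a1 : c1 ∣ l1
  · by_cases a2 : c2 ∣ l2
    · rw [if_pos a1, if_pos a2, if_pos ⟨a1, a2⟩]; ring
    · rw [if_neg a2, if_neg (show ¬ (c1 ∣ l1 ∧ c2 ∣ l2) from fun hh => a2 hh.2)]; ring
  · rw [if_neg a1, if_neg (show ¬ (c1 ∣ l1 ∧ c2 ∣ l2) from fun hh => a1 hh.1)]; ring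
theorem expand_bd (C : ℝ) (hC : 1 ≤ C) (κ : ℕ) (a : ℕ → ℂ) (hl : ∀ n, 1 ≤ n → ‖lam κ a n‖ ≤ C * κ ^ 2 * √n)
    (e : ℕ) (he : 0 < e) (T : ℕ → ℕ → ℂ) (B U : ℝ) (hB : 0 ≤ B) (hU : (e.divisors.card : ℝ) ≤ U)
    (hT : ∀ c1 ∈ e.divisors, ∀ c2 ∈ e.divisors, ‖T c1 c2‖ ≤ B) :
    ‖∑ c1 ∈ e.divisors, ∑ c2 ∈ e.divisors,
        ((moebius c1 : ℂ) * lam κ a (e / c1)) * ((moebius c2 : ℂ) * lam κ a (e / c2)) * T c1 c2‖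
      ≤ U ^ 2 * (C ^ 2 * κ ^ 4 * e * B) := by
  have h1 : ∀ c ∈ e.divisors, ‖(moebius c : ℂ) * lam κ a (e / c)‖ ≤ C * κ ^ 2 * √e := by
    intro c hc
    rw [norm_mul]
    have m1 : ‖(moebius c : ℂ)‖ ≤ 1 := by
      rw [norm_intCast]
      have := ArithmeticFunction.abs_moebius_le_one (n := c)
      exact_mod_cast this
    have hle := Nat.div_le_self e c
    have h2 : ‖lam κ a (e / c)‖ ≤ C * κ ^ 2 * √e := by
      refine (hl _ (Nat.div_pos (divisor_le hc) (pos_of_mem_divisors hc))).trans ?_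
      have : √((e / c : ℕ) : ℝ) ≤ √(e : ℝ) := sqrt_le_sqrt (by exact_mod_cast hle)
      exact mul_le_mul_of_nonneg_left this bpos
    calc _ ≤ 1 * (C * κ ^ 2 * √e) := mul_le_mul m1 h2 (norm_nonneg _) zero_le_one
      _ = _ := one_mul _
  have h2 : ∀ c1 ∈ e.divisors, ∀ c2 ∈ e.divisors, ‖((moebius c1 : ℂ) * lam κ a (e / c1)) * ((moebius c2 : ℂ) * lam κ a (e / c2)) * T c1 c2‖ ≤ C ^ 2 * κ ^ 4 * e * B := by
    intro c1 hc1 c2 hc2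
    rw [norm_mul, norm_mul]
    have : C ^ 2 * κ ^ 4 * e * B = (C * κ ^ 2 * √e) * (C * κ ^ 2 * √e) * B := by
      have := mul_self_sqrt (cast_nonneg (α := ℝ) e)
      linear_combination -C ^ 2 * κ ^ 4 * B * this
    rw [this]
    refine mul_le_mul (mul_le_mul (h1 _ hc1) (h1 _ hc2) (norm_nonneg _) bpos) (hT _ hc1 _ hc2) (norm_nonneg _) bpos
  have h3 : ∀ c1 ∈ e.divisors, ‖∑ c2 ∈ e.divisors, ((moebius c1 : ℂ) * lam κ a (e / c1)) * ((moebius c2 : ℂ) * lam κ a (e / c2)) * T c1 c2‖ ≤ e.divisors.card * (C ^ 2 * κ ^ 4 * e * B) := by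
    intro c1 hc1
    refine (norm_sum_le_of_le _ (h2 c1 hc1)).trans ?_
    rw [sum_const, nsmul_eq_mul]
  refine (norm_sum_le_of_le _ h3).trans ?_
  rw [sum_const, nsmul_eq_mul, ← mul_assoc, ← sq]
  refine mul_le_mul_of_nonneg_right ?_ bpos
  exact pow_le_pow_left₀ (cast_nonneg _) hU 2
theorem arith_data (m1 m2 f m3 m4 : ℤ) (d : ℕ) (h1 : m1 ≠ 0) (_h2 : m2 ≠ 0) (h12 : m1 ≠ m2) (s1 : Squarefree m1) (s2 : Squarefree m2)
    (hsg : (0 < m1 ∧ 0 < m2) ∨ (m1 < 0 ∧ m2 < 0)) (hf : f ≠ 0) (hd : d = Int.gcd m1 m2) (e3 : m1 = d * m3) (e4 : m2 = d * m4) :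
    ∃ (e δ : ℕ) (f1 : ℤ), 0 < e ∧ 0 < δ ∧ d = e * δ ∧ f = e * f1 ∧ f1 ≠ 0 ∧ IsCoprime f1 (δ : ℤ) ∧ Squarefree d ∧ Squarefree δ ∧
      0 < m3.natAbs ∧ 0 < m4.natAbs ∧ Squarefree (m3.natAbs * m4.natAbs) ∧ d.Coprime (m3.natAbs * m4.natAbs) ∧
      m3.natAbs.Coprime m4.natAbs ∧ (m4.natAbs : ℤ) * m3 = m4 * (m3.natAbs : ℤ) ∧ m3.natAbs ≠ m4.natAbs := by
  have d0 : 0 < d := by rw [hd]; exact gcd_pos_of_ne_zero_left _ h1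
  have dz : (0 : ℤ) < d := by exact_mod_cast d0
  have n1 : m1.natAbs = d * m3.natAbs := by rw [e3, natAbs_mul, natAbs_natCast]
  have n2 : m2.natAbs = d * m4.natAbs := by rw [e4, natAbs_mul, natAbs_natCast]
  have q1 := squarefree_natAbs.2 s1
  have q2 := squarefree_natAbs.2 s2
  rw [n1, squarefree_mul_iff] at q1
  rw [n2, squarefree_mul_iff] at q2
  have c34 : m3.natAbs.Coprime m4.natAbs := by
    have : d = d * Nat.gcd m3.natAbs m4.natAbs := by
      conv_lhs => rw [hd, gcd_def, n1, n2, Nat.gcd_mul_left]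
    exact (Nat.eq_of_mul_eq_mul_left d0 (by rw [mul_one]; exact this)).symm
  have hpos : (0 < m3 ∧ 0 < m4) ∨ (m3 < 0 ∧ m4 < 0) := by
    rcases hsg with ⟨a, b⟩ | ⟨a, b⟩
    · rw [e3] at a; rw [e4] at b
      exact Or.inl ⟨pos_of_mul_pos_right a dz.le, pos_of_mul_pos_right b dz.le⟩
    · rw [e3] at a; rw [e4] at b
      exact Or.inr ⟨by by_contra hc; push Not at hc; exact absurd (mul_nonneg dz.le hc) (not_le.2 a), by by_contra hc; push Not at hc; exact absurd (mul_nonneg dz.le hc) (not_le.2 b)⟩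
  obtain ⟨e, δ, φ, he, hcop, hde, hfe⟩ := exists_coprime' (m := d) (n := f.natAbs) (gcd_pos_of_pos_left _ d0)
  have hef : (e : ℤ) ∣ f := by rw [natCast_dvd, hfe]; exact Dvd.intro_left _ rfl
  obtain ⟨f1, hf1⟩ := hef
  have hφ : f1.natAbs = φ := by
    have : e * f1.natAbs = e * φ := by
      rw [mul_comm e φ, ← hfe, hf1, natAbs_mul, natAbs_natCast]
    exact Nat.eq_of_mul_eq_mul_left he this
  refine ⟨e, δ, f1, he, ?_, by rw [hde, mul_comm], hf1, ?_, ?_, q1.2.1, ?_, ?_, ?_, ?_, ?_, c34, ?_, ?_⟩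
  · rcases Nat.eq_zero_or_pos δ with h | h
    · rw [h] at hde; omega
    · exact h
  · rintro rfl; simp at hf1; exact hf hf1
  · rw [isCoprime_iff_gcd_eq_one, gcd_def, hφ, natAbs_natCast]; exact hcop.symm
  · exact q1.2.1.squarefree_of_dvd (by rw [hde]; exact Dvd.intro _ rfl)
  · omega
  · omega
  · exact (squarefree_mul_iff).2 ⟨c34, q1.2.2, q2.2.2⟩
  · exact Nat.Coprime.mul_right q1.1 q2.1
  · rcases hpos with ⟨a, b⟩ | ⟨a, b⟩
    · rw [natCast_natAbs, natCast_natAbs, abs_of_pos a, abs_of_pos b]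
    · rw [natCast_natAbs, natCast_natAbs, abs_of_neg a, abs_of_neg b]; ring
  · intro hh
    apply h12
    rw [e3, e4]
    congr 1
    omega
theorem gcd_bd (μ3 μ4 δ : ℕ) (f1 h : ℤ) (hh : h = f1 * ((μ4 : ℤ) - μ3)) (hμ : 0 < μ3 * μ4) (hf : f1 ≠ 0) (c34 : μ3.Coprime μ4) (cδ : δ.Coprime (μ3 * μ4)) :
    Nat.gcd (μ3 * μ4) (2 * h.natAbs * δ) ≤ 2 * Nat.gcd (μ3 * μ4) f1.natAbs := by
  have ct : (((μ4 : ℤ) - μ3).natAbs).Coprime (μ3 * μ4) := by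
    refine Nat.Coprime.mul_right ?_ ?_
    · show Int.gcd ((μ4 : ℤ) - μ3) (μ3 : ℤ) = 1
      rw [← isCoprime_iff_gcd_eq_one]
      have : IsCoprime (μ4 : ℤ) (μ3 : ℤ) := (isCoprime_iff_coprime.2 c34.symm)
      have h2 := this.add_mul_right_left (-1)
      rwa [show (μ4 : ℤ) + (-1) * μ3 = μ4 - μ3 by ring] at h2
    · show Int.gcd ((μ4 : ℤ) - μ3) (μ4 : ℤ) = 1
      rw [← isCoprime_iff_gcd_eq_one]
      have : IsCoprime (μ3 : ℤ) (μ4 : ℤ) := (isCoprime_iff_coprime.2 c34)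
      have h2 := (this.neg_left).add_mul_right_left 1
      rwa [show -(μ3 : ℤ) + 1 * μ4 = μ4 - μ3 by ring] at h2
  rw [Nat.Coprime.gcd_mul_right_cancel_right _ cδ, hh, natAbs_mul, ← mul_assoc, Nat.Coprime.gcd_mul_right_cancel_right _ ct]
  refine (le_of_dvd ?_ (Nat.gcd_mul_right_dvd_mul_gcd _ _ _)).trans ?_
  · exact Nat.mul_pos (gcd_pos_of_pos_left _ hμ) (gcd_pos_of_pos_left _ hμ)
  · exact Nat.mul_le_mul_right _ (le_of_dvd bnum (Nat.gcd_dvd_right _ _))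
theorem d_dvd_D (n d : ℕ) (hn : n ≠ 0) (hd : d ∣ n) (sd : Squarefree d) : d ∣ ∏ p ∈ n.primeFactors.filter (fun p : ℕ => p ∣ d), p ^ (n.factorization p) := by
  conv_lhs => rw [← prod_primeFactors_of_squarefree sd]
  have hs : d.primeFactors ⊆ n.primeFactors.filter (fun p : ℕ => p ∣ d) := by
    intro p hp
    rw [mem_filter]
    exact ⟨primeFactors_mono hd hn hp, dvd_of_mem_primeFactors hp⟩
  refine (Finset.prod_dvd_prod_of_dvd _ (fun p => p ^ (n.factorization p)) ?_).trans (Finset.prod_dvd_prod_of_subset _ _ _ hs)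
  intro p hp
  refine dvd_pow_self p ?_
  have h1 := primeFactors_mono hd hn hp
  have h2 := (prime_of_mem_primeFactors h1).factorization_pos_of_dvd hn (dvd_of_mem_primeFactors h1)
  omega
theorem gcd_final (f m3 m4 f1 : ℤ) (e D : ℕ) (hf : f ≠ 0) (hfe : f = e * f1) (heD : e ∣ D) :
    e * Nat.gcd (m3.natAbs * m4.natAbs) f1.natAbs ≤ Int.gcd f ((D : ℤ) * m3 * m4) := by
  refine le_of_dvd (gcd_pos_of_ne_zero_left _ hf) ?_
  rw [gcd_def, hfe]
  refine Nat.dvd_gcd ?_ ?_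
  · rw [natAbs_mul, natAbs_natCast]
    exact mul_dvd_mul_left _ (Nat.gcd_dvd_right _ _)
  · rw [mul_assoc, natAbs_mul, natAbs_mul, natAbs_natCast]
    exact mul_dvd_mul heD (Nat.gcd_dvd_left _ _)
theorem U_lem (ε : ℝ) (hε : 0 < ε) : ∃ K : ℝ, 1 ≤ K ∧ ∀ P : ℝ, 1 ≤ P → 1 ≤ K * P ^ (ε / 6) ∧ ∀ c : ℕ, c ≠ 0 → (c : ℝ) ≤ P ^ 4 →
    (c.divisors.card : ℝ) ≤ K * P ^ (ε / 6) ∧ 1 + log c ≤ K * P ^ (ε / 6) := by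
  obtain ⟨K, hK, h⟩ := dv_bound (ε / 24) bpos
  have hη : 0 < ε / 24 := by positivity
  refine ⟨K + 1 + 1 / (ε / 24), by have : 0 < 1 / (ε / 24) := by positivity
                                   linarith, fun P hP => ?_⟩
  have hP1 : 1 ≤ P ^ (ε / 6) := Real.one_le_rpow hP bpos
  have hi : 0 < 1 / (ε / 24) := by positivity
  refine ⟨?_, fun c hc hcP => ?_⟩
  · nlinarith
  have hcp : (c : ℝ) ^ (ε / 24) ≤ P ^ (ε / 6) := by
    calc _ ≤ (P ^ 4) ^ (ε / 24) := rpow_le_rpow (cast_nonneg _) hcP hη.le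
      _ = P ^ (ε / 6) := by
        rw [← rpow_natCast, ← rpow_mul blin]; congr 1; push_cast; ring
  constructor
  · refine (h c hc).trans ?_
    calc _ ≤ K * P ^ (ε / 6) := mul_le_mul_of_nonneg_left hcp blin
      _ ≤ _ := mul_le_mul_of_nonneg_right blin blin
  · have := Real.log_le_rpow_div (cast_nonneg (α := ℝ) c) hη
    have h2 : (c : ℝ) ^ (ε / 24) / (ε / 24) ≤ 1 / (ε / 24) * P ^ (ε / 6) := by
      rw [div_eq_mul_one_div, mul_comm]; exact mul_le_mul_of_nonneg_left hcp hi.le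
    nlinarith
theorem claimA (Y M D d e δ Ξ L : ℝ) (hd : d = e * δ) (hL : L = M * Ξ / (d * e)) (he : 1 ≤ e) (hδ : 0 < δ) (hD : d ≤ D)
    (hΞ : 0 < Ξ) (hY : Ξ ≤ 100 * Y) (hM : 1 ≤ M) :
    e * √(δ ^ 2 * L) ≤ 10 * (Y ^ ((1 : ℝ) / 2) * M ^ ((1 : ℝ) / 2) * D * d ^ (-(1 : ℝ) / 2)) := by
  have hd0 : 0 < d := by rw [hd]; positivity
  have hY0 : 0 < Y := by linarith
  have hD0 : 0 < D := by linarith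
  have hL0 : 0 < L := by rw [hL]; positivity
  refine le_of_sq_le_sq ?_ bpos
  have e1 : (Y ^ ((1 : ℝ) / 2)) ^ 2 = Y := by rw [← sqrt_eq_rpow, sq_sqrt hY0.le]
  have e2 : (M ^ ((1 : ℝ) / 2)) ^ 2 = M := by rw [← sqrt_eq_rpow, sq_sqrt blin]
  have e3 : (d ^ (-(1 : ℝ) / 2)) ^ 2 = d⁻¹ := by
    rw [← rpow_natCast, ← rpow_mul hd0.le, ← rpow_neg_one]; congr 1; norm_num
  have l1 : (e * √(δ ^ 2 * L)) ^ 2 = d * M * Ξ / e := by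
    rw [mul_pow, sq_sqrt bpos, hL, hd]; field_simp
  have l2 : (10 * (Y ^ ((1 : ℝ) / 2) * M ^ ((1 : ℝ) / 2) * D * d ^ (-(1 : ℝ) / 2))) ^ 2 = 100 * Y * M * D ^ 2 / d := by
    rw [mul_pow, mul_pow, mul_pow, mul_pow, e1, e2, e3]; ring
  rw [l1, l2]
  calc d * M * Ξ / e ≤ d * M * Ξ := div_le_self bpos he
    _ ≤ d * M * (100 * Y) := by gcongr
    _ = 100 * Y * M * d ^ 2 / d := by field_simp
    _ ≤ _ := by gcongr
theorem claimB (Y M D d e Ξ L G Γ μ : ℝ) (hL : L = M * Ξ / (d * e)) (he : 1 ≤ e) (hd : 0 < d) (hD : d ≤ D)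
    (hΞ : 0 < Ξ) (hY : Ξ ≤ 100 * Y) (hM : 1 ≤ M) (hG : 0 ≤ G) (hΓ : e * G ≤ 2 * Γ) (hμ : M ^ 2 ≤ d ^ 2 * μ) :
    e * √(L * √L * √G / μ) ≤ 100 * (Y ^ ((3 : ℝ) / 4) * D ^ ((1 : ℝ) / 4) * Γ ^ ((1 : ℝ) / 4) * M ^ (-(1 : ℝ) / 4)) := by
  have hY0 : 0 < Y := by linarith
  have hD0 : 0 < D := by linarith
  have hM0 : 0 < M := by linarith
  have hL0 : 0 < L := by rw [hL]; positivity
  have hΓ0 : 0 ≤ Γ := by have : 0 ≤ e * G := by positivity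
                         linarith
  have hμ0 : 0 < μ := by
    have : 0 < d ^ 2 * μ := lt_of_lt_of_le bpos hμ
    exact pos_of_mul_pos_right this bpos
  refine le_of_pow_le_pow_left₀ (n := 4) bnum bpos ?_
  have r : ∀ x : ℝ, 0 ≤ x → (x ^ ((1 : ℝ) / 4)) ^ 4 = x := by
    intro x hx
    rw [← rpow_natCast, ← rpow_mul hx]; norm_num
  have e1 : (Y ^ ((3 : ℝ) / 4)) ^ 4 = Y ^ 3 := by
    rw [← rpow_natCast, ← rpow_mul hY0.le, ← rpow_natCast]; congr 1; norm_num
  have e3 : (M ^ (-(1 : ℝ) / 4)) ^ 4 = M⁻¹ := by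
    rw [← rpow_natCast, ← rpow_mul hM0.le, ← rpow_neg_one]; congr 1; norm_num
  have l2 : (100 * (Y ^ ((3 : ℝ) / 4) * D ^ ((1 : ℝ) / 4) * Γ ^ ((1 : ℝ) / 4) * M ^ (-(1 : ℝ) / 4))) ^ 4 = 10 ^ 8 * Y ^ 3 * D * Γ / M := by
    rw [mul_pow, mul_pow, mul_pow, mul_pow, e1, e3, r D hD0.le, r Γ hΓ0]; ring
  have l1 : (e * √(L * √L * √G / μ)) ^ 4 = e ^ 4 * L ^ 3 * G / μ ^ 2 := by
    rw [mul_pow, show (√(L * √L * √G / μ)) ^ 4 = ((√(L * √L * √G / μ)) ^ 2) ^ 2 by ring, sq_sqrt bpos,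
      div_pow, mul_pow, mul_pow, sq_sqrt hL0.le, sq_sqrt hG]; ring
  rw [l1, l2]
  calc e ^ 4 * L ^ 3 * G / μ ^ 2 = (e * G) * M ^ 3 * Ξ ^ 3 * d / (d ^ 2 * μ) ^ 2 := by rw [hL]; field_simp
    _ ≤ (e * G) * M ^ 3 * Ξ ^ 3 * d / (M ^ 2) ^ 2 := by gcongr
    _ = (e * G) * Ξ ^ 3 * d / M := by field_simp
    _ ≤ (2 * Γ) * (100 * Y) ^ 3 * D / M := by gcongr
    _ = 2 * 10 ^ 6 * (Y ^ 3 * D * Γ / M) := by ring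
    _ ≤ 10 ^ 8 * (Y ^ 3 * D * Γ / M) := by
      refine mul_le_mul_of_nonneg_right bnum bpos
    _ = _ := by ring
theorem finalK (k κ E : ℝ) (hk : k = 2 * κ) (hk1 : 12 ≤ k) (hE : k ≤ E) : κ ^ 4 * (κ ^ 8 * (101 * E) ^ 4) ≤ 101 ^ 4 * (k ^ ((23 : ℝ) / 2) * E ^ 8) := by
  have h1 : k ^ (12 : ℕ) ≤ k ^ ((23 : ℝ) / 2) * k := by
    calc k ^ (12 : ℕ) = k ^ (12 : ℝ) := by rw [← rpow_natCast]; norm_num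
      _ ≤ k ^ ((23 : ℝ) / 2 + 1) := Real.rpow_le_rpow_of_exponent_le blin bnum
      _ = _ := by rw [rpow_add blin, rpow_one]
  have hE1 : 1 ≤ E := by linarith
  have hp : 0 ≤ k ^ ((23 : ℝ) / 2) := rpow_nonneg blin _
  calc κ ^ 4 * (κ ^ 8 * (101 * E) ^ 4) = κ ^ 12 * (101 ^ 4 * E ^ 4) := by ring
    _ ≤ k ^ 12 * (101 ^ 4 * E ^ 4) := by
      refine mul_le_mul_of_nonneg_right (pow_le_pow_left₀ blin blin 12) bpos
    _ ≤ (k ^ ((23 : ℝ) / 2) * k) * (101 ^ 4 * E ^ 4) := mul_le_mul_of_nonneg_right h1 bpos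
    _ ≤ (k ^ ((23 : ℝ) / 2) * E) * (101 ^ 4 * E ^ 4) := by
      refine mul_le_mul_of_nonneg_right (mul_le_mul_of_nonneg_left hE hp) bpos
    _ = 101 ^ 4 * (k ^ ((23 : ℝ) / 2) * E ^ 5) := by ring
    _ ≤ _ := by
      have : E ^ 5 ≤ E ^ 8 := pow_le_pow_right₀ hE1 bnum
      gcongr
theorem Dn_g (κ : ℕ → ℝ) (X Z : ℝ) (hX : 1 ≤ X) (hZ : 1 ≤ Z) (g : ℝ → ℂ) (hg : ContDiff ℝ (⊤ : ℕ∞) g)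
    (hb : ∀ ν : ℕ, ∀ x : ℝ, ‖iteratedDeriv ν g x‖ ≤ κ ν * (X / Z) ^ (-(ν : ℝ))) :
    Dn (1 + ∑ ν ∈ range 5, |κ ν|) (Z / X) g := by
  refine ⟨by exact_mod_cast (contDiff_infty.1 hg) 4, fun ν hν v => (hb ν v).trans ?_⟩
  have e : (X / Z) ^ (-(ν : ℝ)) = (Z / X) ^ ν := by
    rw [rpow_neg bpos, rpow_natCast, ← inv_pow, inv_div]
  rw [e]
  refine mul_le_mul_of_nonneg_right ?_ bpos
  have := single_le_sum (f := fun ν => |κ ν|) (fun i _ => abs_nonneg _) (mem_range.2 (show ν < 5 by omega))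
  have h2 := le_abs_self (κ ν)
  linarith
theorem hsup_lem (δ e d c1 c2 : ℕ) (m3 m4 f1 h : ℤ) (M Ξ L X : ℝ) (hδ : 0 < δ) (he : 0 < e) (hde : d = e * δ)
    (h3 : 0 < m3.natAbs) (h4 : 0 < m4.natAbs)
    (hs : (m4.natAbs : ℤ) * m3 = m4 * (m3.natAbs : ℤ)) (c34 : m3.natAbs.Coprime m4.natAbs) (hcδ : IsCoprime (δ : ℤ) m3)
    (hh : h = f1 * ((m4.natAbs : ℤ) - m3.natAbs)) (hM : 1 ≤ M) (hX : 1 ≤ X) (hΞ : 0 < Ξ) (hL : L = M * Ξ / (d * e))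
    (a1 : M ≤ d * (m3.natAbs : ℝ)) (a2 : d * (m3.natAbs : ℝ) ≤ 2 * M) (a3 : M ≤ d * (m4.natAbs : ℝ)) (a4 : d * (m4.natAbs : ℝ) ≤ 2 * M)
    (g : ℝ → ℂ) (hg : ∀ x, g x ≠ 0 → X ≤ x ∧ x ≤ 2 * X)
    (hz : ∀ n : ℕ, g n ≠ 0 → (Ξ ≤ e * ((δ * m3 * n + f1 : ℤ) : ℝ) ∧ e * ((δ * m3 * n + f1 : ℤ) : ℝ) ≤ 2 * Ξ) ∧
      (Ξ ≤ e * ((δ * m4 * n + f1 : ℤ) : ℝ) ∧ e * ((δ * m4 * n + f1 : ℤ) : ℝ) ≤ 2 * Ξ)) :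
    ∀ n m : ℕ, ((c1 * m4.natAbs * (n + 1) : ℕ) : ℤ) = ((c2 * m3.natAbs * (m + 1) : ℕ) : ℤ) + h → (δ : ℤ) ∣ ((c1 * (n + 1) : ℕ) : ℤ) - f1 →
      wt g δ m3.natAbs m4 f1 ((c2 * m3.natAbs * (m + 1) : ℕ) : ℝ) ≠ 0 →
      (L ≤ ((c1 * m4.natAbs * (n + 1) : ℕ) : ℝ) ∧ ((c1 * m4.natAbs * (n + 1) : ℕ) : ℝ) ≤ 4 * L) ∧
      (L ≤ ((c2 * m3.natAbs * (m + 1) : ℕ) : ℝ) ∧ ((c2 * m3.natAbs * (m + 1) : ℕ) : ℝ) ≤ 4 * L) := by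
  intro n m e1 e2 hw
  obtain ⟨z, z1, z2, z3⟩ := pair_n δ c1 c2 m3.natAbs m4.natAbs (n + 1) (m + 1) m3 m4 f1 h hδ h3 bomg hs rfl c34 hcδ hh g e1 e2
  rw [z3] at hw
  have hz0 : 0 ≤ z := by
    have := (hg _ hw).1
    have h0 : (0 : ℝ) ≤ (z : ℝ) := by linarith
    exact_mod_cast h0
  obtain ⟨N, rfl⟩ := eq_ofNat_of_zero_le hz0
  obtain ⟨⟨b1, b2⟩, b3, b4⟩ := hz N (by simpa using hw)
  rw [← z1] at b1 b2
  rw [← z2] at b3 b4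
  have he' : (0 : ℝ) < e := by exact_mod_cast he
  have hd' : (0 : ℝ) < d := by rw [hde]; exact_mod_cast Nat.mul_pos he hδ
  have gen : ∀ μ q : ℕ, M ≤ d * (μ : ℝ) → d * (μ : ℝ) ≤ 2 * M → Ξ ≤ e * (q : ℝ) → e * (q : ℝ) ≤ 2 * Ξ → L ≤ (μ * q : ℕ) ∧ ((μ * q : ℕ) : ℝ) ≤ 4 * L := by
    intro μ q i1 i2 i3 i4
    push_cast
    rw [hL, div_le_iff₀ bpos]
    refine ⟨?_, ?_⟩
    · calc M * Ξ ≤ (d * (μ : ℝ)) * (e * (q : ℝ)) := mul_le_mul i1 i3 hΞ.le bpos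
        _ = _ := by ring
    · rw [← mul_div_assoc, le_div_iff₀ bpos]
      calc _ = (d * (μ : ℝ)) * (e * (q : ℝ)) := by ring
        _ ≤ (2 * M) * (2 * Ξ) := mul_le_mul i2 i4 bpos bpos
        _ = _ := by ring
  rw [cast_natCast] at b1 b2 b3 b4
  have r1 := gen m4.natAbs (c1 * (n + 1)) a3 a4 b1 b2
  have r2 := gen m3.natAbs (c2 * (m + 1)) a1 a2 b3 b4
  rw [show c1 * m4.natAbs * (n + 1) = m4.natAbs * (c1 * (n + 1)) by ring, show c2 * m3.natAbs * (m + 1) = m3.natAbs * (c2 * (m + 1)) by ring]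
  exact ⟨r1, r2⟩
theorem sqrt_split (K0 A x θ U y1 y2 t : ℝ) (hK : 1 ≤ K0) (hA : 0 ≤ A) (hx : 0 ≤ x) (hθ : 0 ≤ θ) (hU : 0 ≤ U) (h1 : 0 ≤ y1) (h2 : 0 ≤ y2)
    (h : t ^ 2 ≤ K0 * A ^ 2 * x ^ 16 * θ ^ 8 * U ^ 8 * (y1 + y2)) : t ≤ K0 * A * x ^ 8 * θ ^ 4 * U ^ 4 * (√y1 + √y2) := by
  refine le_of_sq_le_sq (h.trans ?_) bpos
  have : y1 + y2 ≤ (√y1 + √y2) ^ 2 := by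
    have s1 := sq_sqrt h1
    have s2 := sq_sqrt h2
    have : 0 ≤ √y1 * √y2 := by positivity
    nlinarith
  have hK2 : K0 ≤ K0 ^ 2 := by nlinarith
  calc _ ≤ K0 ^ 2 * A ^ 2 * x ^ 16 * θ ^ 8 * U ^ 8 * (√y1 + √y2) ^ 2 := by
        refine mul_le_mul ?_ this bpos bpos
        have : 0 ≤ A ^ 2 * x ^ 16 * θ ^ 8 * U ^ 8 := by positivity
        calc _ = K0 * (A ^ 2 * x ^ 16 * θ ^ 8 * U ^ 8) := by ring
          _ ≤ K0 ^ 2 * (A ^ 2 * x ^ 16 * θ ^ 8 * U ^ 8) := mul_le_mul_of_nonneg_right hK2 this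
          _ = _ := by ring
    _ = _ := by ring
theorem P_bds (M X Z k F Ξ P : ℝ) (hM : 1 ≤ M) (hX : 1 ≤ X) (hZ : 1 ≤ Z) (hk : 12 ≤ k) (hF : 1 ≤ F) (hΞ : Ξ ≤ 100 * (M * X + F)) (hP : P = F * X * M * Z * k) :
    1 ≤ P ∧ 4 * F * M ≤ P ^ 4 ∧ 4 * M ^ 2 ≤ P ^ 4 ∧ 13 * (M * Ξ) ≤ P ^ 4 := by
  have b1 : 1 ≤ F * X := one_le_mul_of_one_le_of_one_le hF hX
  have b2 : 12 * (F * X * M) ≤ P := by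
    rw [hP]
    have h0 : 0 ≤ F * X * M := by positivity
    calc 12 * (F * X * M) = F * X * M * 1 * 12 := by ring
      _ ≤ F * X * M * Z * k := by gcongr
  have b3 : 1 ≤ F * X * M := one_le_mul_of_one_le_of_one_le b1 hM
  have h1 : 1 ≤ P := by linarith
  set Q := F * X * M with hQ
  have p4 : 12 ^ 4 * Q ^ 4 ≤ P ^ 4 := by
    rw [← mul_pow]; exact pow_le_pow_left₀ blin b2 4
  have q2 : Q ^ 2 ≤ Q ^ 4 := pow_le_pow_right₀ b3 bnum
  have q1 : Q ≤ Q ^ 4 := le_self_pow₀ b3 bnum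
  have q0 : 0 ≤ Q ^ 4 := by positivity
  have s1 : F * M ≤ Q := by
    rw [hQ]; calc F * M = F * 1 * M := by ring
      _ ≤ _ := by gcongr
  have s2 : M ^ 2 ≤ Q ^ 2 := by
    refine pow_le_pow_left₀ blin ?_ 2
    rw [hQ]; exact le_mul_of_one_le_left blin b1
  have s3 : M * Ξ ≤ 200 * Q ^ 2 := by
    have i1 : M * X ≤ Q := by
      rw [hQ]; calc M * X = 1 * X * M := by ring
        _ ≤ _ := by gcongr
    have i2 : F ≤ Q := by
      rw [hQ, mul_assoc]; exact le_mul_of_one_le_right blin (one_le_mul_of_one_le_of_one_le hX hM)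
    have i3 : M ≤ Q := by rw [hQ]; exact le_mul_of_one_le_left blin b1
    calc M * Ξ ≤ Q * (100 * (Q + Q)) := by
          refine (mul_le_mul_of_nonneg_left hΞ blin).trans ?_
          gcongr
      _ = _ := by ring
  refine ⟨h1, ?_, ?_, ?_⟩
  · linarith
  · linarith
  · linarith
theorem theta_bd (M X Z F Ξ E k d e δ μ3 μ4 L : ℝ) (hM : 1 ≤ M) (hX : 1 ≤ X) (hZ : 1 ≤ Z) (hF : 0 ≤ F) (hk : 1 ≤ k)
    (hΞ : 0 < Ξ) (hΞ2 : Ξ ≤ 100 * (M * X + F)) (hE : E = k + Z * (1 + F / (M * X))) (hd : d = e * δ) (he : 0 < e) (hδ : 0 < δ) (h3 : 0 < μ3) (h4 : 0 < μ4)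
    (hL : L = M * Ξ / (d * e)) (a1 : M ≤ d * μ3) (a3 : M ≤ d * μ4) : 1 + Z / X * (1 / (μ3 * μ4 * δ)) * L ≤ 101 * E := by
  have hd0 : 0 < d := by rw [hd]; positivity
  have h2 : M ^ 2 ≤ (d * μ3) * (d * μ4) := by rw [sq]; exact mul_le_mul a1 a3 blin bpos
  have e1 : Z / X * (1 / (μ3 * μ4 * δ)) * L = Z * M * Ξ / (X * ((d * μ3) * (d * μ4))) := by
    rw [hL, hd]; field_simp
  have e2 : Z / X * (1 / (μ3 * μ4 * δ)) * L ≤ 100 * (Z * (1 + F / (M * X))) := by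
    rw [e1]
    calc _ ≤ Z * M * (100 * (M * X + F)) / (X * M ^ 2) := by gcongr
      _ = _ := by field_simp
  have : 0 ≤ Z * (1 + F / (M * X)) := by positivity
  rw [hE]; linarith
theorem final_alg (U C0 K0 Cg K1 Pe x T T' E e t1 t2 R1 R2 kp : ℝ) (hK0 : 0 ≤ K0) (hUP : U ^ 6 = K1 ^ 6 * Pe) (hR1 : 0 ≤ R1) (hR2 : 0 ≤ R2)
    (hCg : 0 ≤ Cg) (hT : 0 ≤ T) (hx : 0 ≤ x) (hth : T ≤ T') (fK : x ^ 4 * (x ^ 8 * T') ≤ 101 ^ 4 * (kp * E ^ 8)) (hst : e * (t1 + t2) ≤ 100 * (R1 + R2)) :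
    U ^ 2 * (C0 ^ 2 * x ^ 4 * e * (K0 * Cg * x ^ 8 * T * U ^ 4 * (t1 + t2))) ≤
      (C0 ^ 2 * K0 * Cg * K1 ^ 6 * 101 ^ 4 * 100) * Pe * kp * E ^ 8 * (R1 + R2) := by
  have hU : 0 ≤ U ^ 6 := by positivity
  calc U ^ 2 * (C0 ^ 2 * x ^ 4 * e * (K0 * Cg * x ^ 8 * T * U ^ 4 * (t1 + t2)))
      = (C0 ^ 2 * K0 * Cg * U ^ 6) * (x ^ 4 * (x ^ 8 * T)) * (e * (t1 + t2)) := by ring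
    _ ≤ (C0 ^ 2 * K0 * Cg * U ^ 6) * (x ^ 4 * (x ^ 8 * T)) * (100 * (R1 + R2)) :=
      mul_le_mul_of_nonneg_left hst bpos
    _ ≤ (C0 ^ 2 * K0 * Cg * U ^ 6) * (101 ^ 4 * (kp * E ^ 8)) * (100 * (R1 + R2)) := by
      refine mul_le_mul_of_nonneg_right (mul_le_mul_of_nonneg_left (le_trans ?_ fK) bpos) bpos
      gcongr
    _ = _ := by rw [hUP]; ring

set_option maxHeartbeats 1000000 in
/-- **Shifted convolution of two Hecke eigenvalues with long shifts** (Theorem 2.6,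
level 1). -/
theorem shifted_convolution_two_eigenvalues :
    ∀ ε : ℝ, 0 < ε → ∀ κ : ℕ → ℝ, ∃ K : ℝ,
      ∀ (k : ℕ) (a : ℕ → ℂ), IsNormalizedHeckeEigenform k a →
        ∀ (M X Z Ξ : ℝ) (m₁ m₂ f : ℤ) (d Dd : ℕ) (m₃ m₄ : ℤ) (g : ℝ → ℂ),
          1 ≤ M → m₁ ≠ 0 → m₂ ≠ 0 → m₁ ≠ m₂ →
          Squarefree m₁ → Squarefree m₂ →
          ((0 < m₁ ∧ 0 < m₂) ∨ (m₁ < 0 ∧ m₂ < 0)) →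
          M ≤ |(m₁ : ℝ)| → |(m₁ : ℝ)| ≤ 2 * M →
          M ≤ |(m₂ : ℝ)| → |(m₂ : ℝ)| ≤ 2 * M →
          f ≠ 0 → ¬(m₁ < 0 ∧ m₂ < 0 ∧ f < 0) →
          d = Int.gcd m₁ m₂ → m₁ = (d : ℤ) * m₃ → m₂ = (d : ℤ) * m₄ →
          Dd = ∏ p ∈ (m₁ - m₂).natAbs.primeFactors.filter (fun p : ℕ => p ∣ d),
            p ^ ((m₁ - m₂).natAbs.factorization p) →
          1 ≤ X → 1 ≤ Z →
          ContDiff ℝ (⊤ : ℕ∞) g →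
          (∀ x : ℝ, g x ≠ 0 → X ≤ x ∧ x ≤ 2 * X) →
          (∀ ν : ℕ, ∀ x : ℝ, ‖iteratedDeriv ν g x‖ ≤ κ ν * (X / Z) ^ (-(ν : ℝ))) →
          M * X / (100 * Z) ≤ Ξ → Ξ ≤ 100 * (M * X + |(f : ℝ)|) →
          (∀ n : ℕ, ¬((Ξ ≤ ((m₁ * n + f : ℤ) : ℝ) ∧ ((m₁ * n + f : ℤ) : ℝ) ≤ 2 * Ξ) ∧
              (Ξ ≤ ((m₂ * n + f : ℤ) : ℝ) ∧ ((m₂ * n + f : ℤ) : ℝ) ≤ 2 * Ξ)) →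
            g (n : ℝ) = 0) →
          ‖∑' n : ℕ, heckeLambda k a (m₁ * n + f) * heckeLambda k a (m₂ * n + f) *
              g (n : ℝ)‖ ≤
            K * (|(f : ℝ)| * X * M * Z * k) ^ ε * (k : ℝ) ^ ((23 : ℝ) / 2) *
              ((k : ℝ) + Z * (1 + |(f : ℝ)| / (M * X))) ^ (8 : ℕ) *
              ((M * X + |(f : ℝ)|) ^ ((1 : ℝ) / 2) * M ^ ((1 : ℝ) / 2) * (Dd : ℝ) *
                  (d : ℝ) ^ (-(1 : ℝ) / 2) +
                (M * X + |(f : ℝ)|) ^ ((3 : ℝ) / 4) * (Dd : ℝ) ^ ((1 : ℝ) / 4) *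
                  (Int.gcd f ((Dd : ℤ) * m₃ * m₄) : ℝ) ^ ((1 : ℝ) / 4) *
                  M ^ (-(1 : ℝ) / 4)) := by
  intro ε hε κκ
  obtain ⟨K0, hK0, hTT⟩ := TT_bd
  obtain ⟨C0, hC0, hfo⟩ := fo_bound
  obtain ⟨K1, hK1, hU⟩ := U_lem ε hε
  refine ⟨C0 ^ 2 * K0 * (1 + ∑ ν ∈ Finset.range 5, |κκ ν|) * K1 ^ 6 * 101 ^ 4 * 100, ?_⟩
  intro k a ha M X Z Ξ m₁ m₂ f d Dd m₃ m₄ g hM h1 h2 h12 s1 s2 hsg A1 A2 A3 A4 hf _ hd e3 e4 hD hX hZ hgs hg hgd hΞ1 hΞ2 hgz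
  obtain ⟨κ, hκ⟩ := ha.1
  obtain rfl : k = 2 * κ := by omega
  replace hTT := hTT κ a ha
  have hlam := (hfo κ a ha).2
  obtain ⟨e, δ, f1, he, hδ, hde, hfe, hf1, cf, sd, sδ, p3, p4, s34, cd, c34, hs, hne⟩ := arith_data m₁ m₂ f m₃ m₄ d h1 h2 h12 s1 s2 hsg hf hd e3 e4
  have hΞ : 0 < Ξ := lt_of_lt_of_le bpos hΞ1
  have he' : (1 : ℝ) ≤ e := by exact_mod_cast he
  have hδ' : (1 : ℝ) ≤ δ := by exact_mod_cast hδ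
  have hdR : (d : ℝ) = e * δ := by exact_mod_cast hde
  have hd1 : (1 : ℝ) ≤ d := by rw [hdR]; exact one_le_mul_of_one_le_of_one_le he' hδ'
  have d0 : d ≠ 0 := by rintro rfl; norm_num at hd1
  have n3 : (1 : ℝ) ≤ (m₃.natAbs : ℝ) := by exact_mod_cast p3
  have n4 : (1 : ℝ) ≤ (m₄.natAbs : ℝ) := by exact_mod_cast p4
  have hF : (1 : ℝ) ≤ |(f : ℝ)| := by
    have : 1 ≤ |f| := one_le_abs hf
    exact_mod_cast this
  have ab1 : |(m₁ : ℝ)| = d * (m₃.natAbs : ℝ) := by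
    rw [e3, Int.cast_mul, abs_mul, cast_natCast, abs_cast, cast_natAbs, cast_abs]

  have ab2 : |(m₂ : ℝ)| = d * (m₄.natAbs : ℝ) := by
    rw [e4, Int.cast_mul, abs_mul, cast_natCast, abs_cast, cast_natAbs, cast_abs]
  rw [ab1] at A1 A2
  rw [ab2] at A3 A4
  have dM : (d : ℝ) ≤ 2 * M := (le_mul_of_one_le_right blin n3).trans A2
  have hk12 : (12 : ℝ) ≤ ((2 * κ : ℕ) : ℝ) := by exact_mod_cast ha.2.1
  have hκ1 : (1 : ℝ) ≤ (κ : ℝ) := by push_cast at hk12; linarith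
  set P : ℝ := |(f : ℝ)| * X * M * Z * ((2 * κ : ℕ) : ℝ) with hP
  obtain ⟨P1, P2, P3, P4⟩ := P_bds M X Z ((2 * κ : ℕ) : ℝ) |(f : ℝ)| Ξ P hM hX hZ hk12 hF hΞ2 hP
  obtain ⟨U1, U2⟩ := hU P P1
  set U : ℝ := K1 * P ^ (ε / 6) with hUd
  set h : ℤ := f1 * ((m₄.natAbs : ℤ) - m₃.natAbs) with hh
  have h0 : h ≠ 0 := mul_ne_zero hf1 bomg
  set L : ℝ := M * Ξ / (d * e) with hL
  have L0 : 0 < L := by positivity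
  have LM : L ≤ M * Ξ := div_le_self bpos (one_le_mul_of_one_le_of_one_le hd1 he')
  set E : ℝ := ((2 * κ : ℕ) : ℝ) + Z * (1 + |(f : ℝ)| / (M * X)) with hE
  have hEk : ((2 * κ : ℕ) : ℝ) ≤ E := by rw [hE]; exact le_add_of_nonneg_right bpos
  set Cg : ℝ := 1 + ∑ ν ∈ range 5, |κκ ν| with hCg
  have hCg0 : 0 ≤ Cg := by positivity
  have hDg := Dn_g κκ X Z hX hZ g hgs hgd
  have hn0 : (m₁ - m₂).natAbs ≠ 0 := by omega
  have hdn : d ∣ (m₁ - m₂).natAbs := by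
    rw [e3, e4, ← mul_sub, natAbs_mul, natAbs_natCast]; exact Dvd.intro _ rfl
  have hdD : d ∣ Dd := by rw [hD]; exact d_dvd_D _ d hn0 hdn sd
  have hD0 : 0 < Dd := by
    rw [hD]; refine Finset.prod_pos fun p hp => ?_
    exact pow_pos (Nat.pos_of_mem_primeFactors (mem_filter.1 hp).1) _
  have hdDR : (d : ℝ) ≤ Dd := by exact_mod_cast le_of_dvd hD0 hdD
  have cδ : δ.Coprime (m₃.natAbs * m₄.natAbs) := Nat.Coprime.coprime_dvd_left (by rw [hde]; exact Dvd.intro_left _ rfl) cd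
  have ce : e.Coprime (m₃.natAbs * m₄.natAbs) := Nat.Coprime.coprime_dvd_left (by rw [hde]; exact Dvd.intro _ rfl) cd
  have cδ3 : IsCoprime (δ : ℤ) m₃ := by
    rw [isCoprime_iff_gcd_eq_one, gcd_def, natAbs_natCast]
    exact Nat.Coprime.coprime_dvd_right (Dvd.intro _ rfl) cδ
  set G : ℕ := Nat.gcd (m₃.natAbs * m₄.natAbs) (2 * h.natAbs * δ) with hG
  set Γ : ℕ := Int.gcd f ((Dd : ℤ) * m₃ * m₄) with hΓ
  have hGΓ : (e : ℝ) * G ≤ 2 * Γ := by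
    have g1 := gcd_bd m₃.natAbs m₄.natAbs δ f1 h hh (Nat.mul_pos p3 p4) hf1 c34 cδ
    have g2 := gcd_final f m₃ m₄ f1 e Dd hf hfe ((Dvd.intro _ hde.symm).trans hdD)
    have : e * G ≤ 2 * Γ := by
      calc e * G ≤ e * (2 * Nat.gcd (m₃.natAbs * m₄.natAbs) f1.natAbs) := Nat.mul_le_mul_left _ g1
        _ = 2 * (e * Nat.gcd (m₃.natAbs * m₄.natAbs) f1.natAbs) := by ring
        _ ≤ _ := Nat.mul_le_mul_left _ g2
    exact_mod_cast this
  have r1 : ∀ n : ℕ, m₁ * n + f = e * (δ * m₃ * n + f1) := by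
    intro n; rw [e3, hfe, hde]; push_cast; ring
  have r2 : ∀ n : ℕ, m₂ * n + f = e * (δ * m₄ * n + f1) := by
    intro n; rw [e4, hfe, hde]; push_cast; ring
  have hz : ∀ n : ℕ, g n ≠ 0 → (Ξ ≤ e * ((δ * m₃ * n + f1 : ℤ) : ℝ) ∧ e * ((δ * m₃ * n + f1 : ℤ) : ℝ) ≤ 2 * Ξ) ∧
      (Ξ ≤ e * ((δ * m₄ * n + f1 : ℤ) : ℝ) ∧ e * ((δ * m₄ * n + f1 : ℤ) : ℝ) ≤ 2 * Ξ) := by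
    intro n hgn
    by_contra hc
    apply hgn
    apply hgz n
    rw [r1, r2, Int.cast_mul, Int.cast_mul, cast_natCast]
    exact hc
  obtain ⟨N0, hN0⟩ := exists_nat_ge (2 * Ξ + 9 * L * (sk κ + 1 / 2))
  have hsk : 0 ≤ sk κ := by unfold sk; positivity
  have hN1 : 2 * Ξ ≤ N0 := le_trans (le_add_of_nonneg_right bpos) hN0
  have hN2 : 9 * L * (sk κ + 1 / 2) ≤ N0 := le_trans (le_add_of_nonneg_left bpos) hN0
  have hz1 : ∀ q : ℤ, Ξ ≤ e * (q : ℝ) → e * (q : ℝ) ≤ 2 * Ξ → 0 < q ∧ q ≤ N0 := by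
    intro q i1 i2
    have i3 : (0 : ℝ) < q := pos_of_mul_pos_right (lt_of_lt_of_le hΞ i1) blin
    refine ⟨by exact_mod_cast i3, ?_⟩
    have : (q : ℝ) ≤ N0 := (le_mul_of_one_le_left i3.le he').trans (i2.trans hN1)
    exact_mod_cast this
  have hp : ∀ n : ℕ, g n ≠ 0 → (0 < δ * m₃ * n + f1 ∧ δ * m₃ * n + f1 ≤ N0) ∧ (0 < δ * m₄ * n + f1 ∧ δ * m₄ * n + f1 ≤ N0) := by
    intro n hgn
    obtain ⟨⟨i1, i2⟩, i3, i4⟩ := hz n hgn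
    exact ⟨hz1 _ i1 i2, hz1 _ i3 i4⟩
  obtain ⟨N, hN⟩ := exists_nat_gt (2 * X)
  have hgN : ∀ x, g x ≠ 0 → 0 < x ∧ x < N := by
    intro x hx
    have := hg x hx
    exact ⟨by linarith, by linarith⟩
  have hsum : ∑' n : ℕ, heckeLambda (2 * κ) a (m₁ * n + f) * heckeLambda (2 * κ) a (m₂ * n + f) * g (n : ℝ)
      = ∑ c1 ∈ e.divisors, ∑ c2 ∈ e.divisors,
        ((moebius c1 : ℂ) * lam κ a (e / c1)) * ((moebius c2 : ℂ) * lam κ a (e / c2)) *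
          TT κ a δ c1 c2 m₃.natAbs m₄.natAbs f1 h (wt g δ m₃.natAbs m₄ f1) N0 := by
    rw [tsum_eq_sum (s := range N)]
    · simp_rw [r1, r2]
      rw [expand κ a ha e δ he m₃ m₄ f1 g N (fun n hn => ⟨(hp n hn).1.1, (hp n hn).2.1⟩)]
      refine sum_congr rfl fun c1 hc1 => sum_congr rfl fun c2 hc2 => ?_
      rw [TT_eq κ a δ c1 c2 m₃.natAbs m₄.natAbs m₃ m₄ f1 h hδ (pos_of_mem_divisors hc1) (pos_of_mem_divisors hc2) p3 bomg hs rfl c34 cδ3 hh g N N0 hgN hp]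
    · intro n hn
      have : g (n : ℝ) = 0 := by
        by_contra hc
        have := (hgN _ hc).2
        exact hn (mem_range.2 (by exact_mod_cast this))
      rw [this, mul_zero]
  rw [hsum]
  set θ : ℝ := Z / X * |1 / ((m₃.natAbs : ℝ) * m₄ * δ)| with hθ
  have hDw : Dn Cg θ (wt g δ m₃.natAbs m₄ f1) := dnb_aff _ _ hDg
  have hθ0 : 0 ≤ θ := by positivity
  have hθE : 1 + θ * L ≤ 101 * E := by
    have := theta_bd M X Z |(f : ℝ)| Ξ E ((2 * κ : ℕ) : ℝ) d e δ m₃.natAbs m₄.natAbs L hM hX hZ blin blin hΞ hΞ2 hE hdR blin blin blin blin hL A1 A3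
    have e0 : |1 / ((m₃.natAbs : ℝ) * m₄ * δ)| = 1 / ((m₃.natAbs : ℝ) * m₄.natAbs * δ) := by
      rw [abs_div, abs_one, abs_mul, abs_mul, abs_cast, abs_cast, cast_natAbs m₄, cast_abs]
    rw [hθ, e0]; exact this
  have hbT : ∀ c1 ∈ e.divisors, ∀ c2 ∈ e.divisors, ‖TT κ a δ c1 c2 m₃.natAbs m₄.natAbs f1 h (wt g δ m₃.natAbs m₄ f1) N0‖ ≤
      K0 * Cg * (κ : ℝ) ^ 8 * (1 + θ * L) ^ 4 * U ^ 4 * (√((δ : ℝ) ^ 2 * L) + √(L * √L * √(G : ℝ) / (m₃.natAbs * m₄.natAbs))) := by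
    intro c1 hc1 c2 hc2
    have hc10 := pos_of_mem_divisors hc1
    have hc20 := pos_of_mem_divisors hc2
    have hc1d := dvd_of_mem_divisors hc1
    have hc2d := dvd_of_mem_divisors hc2
    have l13 : ∀ c : ℕ, (c : ℝ) ≤ 13 * L → (c : ℝ) ≤ P ^ 4 := fun c hc => by linarith
    have hδe : (δ : ℝ) ≤ d := by rw [hdR]; exact le_mul_of_one_le_left blin he'
    have hMM : M ≤ M ^ 2 := le_self_pow₀ hM bnum
    refine sqrt_split _ _ _ _ _ _ _ _ hK0 hCg0 bpos bpos blin bpos bpos ?_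
    refine hTT δ c1 c2 m₃.natAbs m₄.natAbs hδ hc10 hc20 p3 p4 f1 h cf h0 sδ s34 ?_ _ Cg θ L hDw hθ0 L0 N0 hN2 ?_ U U1 ?_ ?_ ?_ ?_ ?_
    · exact Nat.Coprime.mul_left (Nat.Coprime.mul_left (cδ.pow_left 2) (Nat.Coprime.coprime_dvd_left hc1d ce)) (Nat.Coprime.coprime_dvd_left hc2d ce)
    · exact hsup_lem δ e d c1 c2 m₃ m₄ f1 h M Ξ L X hδ he hde p3 p4 hs c34 cδ3 hh hM hX hΞ hL A1 A2 A3 A4 g hg hz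
    · exact fun c hc hcl => (U2 c hc (l13 c hcl)).1
    · exact (U2 δ hδ.ne' blin).1
    · refine (U2 _ (by have := Int.natAbs_ne_zero.2 h0; positivity) ?_).1
      have b1 : (h.natAbs : ℝ) = |(f1 : ℝ)| * |(m₄.natAbs : ℝ) - m₃.natAbs| := by
        rw [cast_natAbs, cast_abs, hh, Int.cast_mul, Int.cast_sub, cast_natCast, cast_natCast, abs_mul]
      have b2 : |(f : ℝ)| = e * |(f1 : ℝ)| := by rw [hfe]; push_cast; rw [abs_mul, abs_cast]
      have b3 : d * |(m₄.natAbs : ℝ) - m₃.natAbs| ≤ 2 * M := by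
        have : d * |(m₄.natAbs : ℝ) - m₃.natAbs| = |d * (m₄.natAbs : ℝ) - d * m₃.natAbs| := by
          rw [← mul_sub, abs_mul, abs_cast]
        rw [this, abs_le]; constructor <;> linarith
      rw [cast_mul, cast_mul, Nat.cast_ofNat, b1]
      have f1n : 0 ≤ |(f1 : ℝ)| := abs_nonneg _
      calc 2 * (|(f1 : ℝ)| * |(m₄.natAbs : ℝ) - m₃.natAbs|) * δ = 2 * |(f1 : ℝ)| * (δ * |(m₄.natAbs : ℝ) - m₃.natAbs|) := by ring
        _ ≤ 2 * |(f : ℝ)| * (d * |(m₄.natAbs : ℝ) - m₃.natAbs|) := by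
          have : |(f1 : ℝ)| ≤ |(f : ℝ)| := by rw [b2]; exact le_mul_of_one_le_left f1n he'
          gcongr
        _ ≤ 2 * |(f : ℝ)| * (2 * M) := by gcongr
        _ = 4 * |(f : ℝ)| * M := by ring
        _ ≤ _ := P2
    · refine (U2 _ bpos ?_).1
      have i1 : (c1 : ℝ) ≤ e := by exact_mod_cast le_of_dvd he hc1d
      have i2 : (c2 : ℝ) ≤ e := by exact_mod_cast le_of_dvd he hc2d
      simp only [cast_mul, Nat.cast_pow]
      calc (δ : ℝ) ^ 2 * m₃.natAbs * m₄.natAbs * c1 * c2 ≤ (δ : ℝ) ^ 2 * m₃.natAbs * m₄.natAbs * e * e := by gcongr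
        _ = (d * (m₃.natAbs : ℝ)) * (d * m₄.natAbs) := by rw [hdR]; ring
        _ ≤ (2 * M) * (2 * M) := by gcongr
        _ = 4 * M ^ 2 := by ring
        _ ≤ _ := P3
    · exact fun c hc hcl => (U2 c hc (l13 c hcl)).2
  have hUe : (e.divisors.card : ℝ) ≤ U := by
    refine (U2 e he.ne' ?_).1
    have hed : (e : ℝ) ≤ d := by rw [hdR]; exact le_mul_of_one_le_right blin hδ'
    have hMM : M ≤ M ^ 2 := le_self_pow₀ hM bnum
    linarith
  refine (expand_bd C0 hC0 κ a hlam e he _ _ U bpos hUe hbT).trans ?_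
  have cA := claimA (M * X + |(f : ℝ)|) M Dd d e δ Ξ L hdR hL he' blin hdDR hΞ hΞ2 hM
  have cB := claimB (M * X + |(f : ℝ)|) M Dd d e Ξ L G Γ (m₃.natAbs * m₄.natAbs) hL he' blin hdDR hΞ hΞ2 hM (cast_nonneg _) hGΓ
    (by calc M ^ 2 = M * M := sq M
          _ ≤ (d * (m₃.natAbs : ℝ)) * (d * m₄.natAbs) := mul_le_mul A1 A3 blin bpos
          _ = _ := by ring)
  have fK := finalK ((2 * κ : ℕ) : ℝ) κ E (by push_cast; ring) hk12 hEk
  set R1 : ℝ := (M * X + |(f : ℝ)|) ^ ((1 : ℝ) / 2) * M ^ ((1 : ℝ) / 2) * (Dd : ℝ) * (d : ℝ) ^ (-(1 : ℝ) / 2) with hR1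
  set R2 : ℝ := (M * X + |(f : ℝ)|) ^ ((3 : ℝ) / 4) * (Dd : ℝ) ^ ((1 : ℝ) / 4) * (Γ : ℝ) ^ ((1 : ℝ) / 4) * M ^ (-(1 : ℝ) / 4) with hR2
  have R10 : 0 ≤ R1 := by positivity
  have R20 : 0 ≤ R2 := by positivity
  set t1 := √((δ : ℝ) ^ 2 * L) with ht1
  set t2 := √(L * √L * √(G : ℝ) / (m₃.natAbs * m₄.natAbs)) with ht2
  have hUP : U ^ 6 = K1 ^ 6 * P ^ ε := by
    rw [hUd, mul_pow]; congr 1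
    rw [← rpow_natCast, ← rpow_mul blin]; congr 1; push_cast; ring
  have hth : (1 + θ * L) ^ 4 ≤ (101 * E) ^ 4 := pow_le_pow_left₀ bpos hθE 4
  have hst : e * (t1 + t2) ≤ 100 * (R1 + R2) := by rw [mul_add]; linarith
  exact final_alg U C0 K0 Cg K1 (P ^ ε) κ _ _ E e t1 t2 R1 R2 _ (zero_le_one.trans hK0) hUP R10 R20 hCg0 bpos bpos hth fK hst
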